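/- Let g be a Riemannian metric on T². Then g is flat if and only if no axis c: ℝ → ℝ² on the universal covering intersects any of its translates τc transversally (τ a nontrivial translation element). -/

import Mathlib

open Filter Topology Set
open scoped ENNReal

noncomputable section

/-- The Euclidean norm of a point of `ℝ × ℝ` (the universal covering of `T²`). -/
def norm2 (p : ℝ × ℝ) : ℝ := Real.sqrt (p.1 ^ 2 + p.2 ^ 2)

/-- The translation vector of the covering transformation `τ_{(m,n)}` of `T² = ℝ²/ℤ²`. -/
def lat (k : ℤ × ℤ) : ℝ × ℝ := ((k.1 : ℝ), (k.2 : ℝ))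

/-- The transl of a curve in `ℝ²` by the covering transformation `τ_k`. -/
def transl (k : ℤ × ℤ) (c : ℝ → ℝ × ℝ) : ℝ → ℝ × ℝ := fun t => c t + lat k

/-- The asymptotic direction `δ(τ_k)` of the axes of the translation element `τ_k`. -/
def latDir (k : ℤ × ℤ) : ℝ × ℝ := (norm2 (lat k))⁻¹ • lat k

/-- A smooth Riemannian metric on the torus `T² = ℝ²/ℤ²`, described through its lift to the
universal covering `ℝ²`: a smooth family of positive definite symmetric bilinear forms on the
tangent spaces of `ℝ²`, invariant under the deck transformation group `ℤ²`. -/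
structure TorusMetric where
  g : (ℝ × ℝ) → (ℝ × ℝ) → (ℝ × ℝ) → ℝ
  smooth : ContDiff ℝ (⊤ : ℕ∞) fun p : (ℝ × ℝ) × (ℝ × ℝ) × (ℝ × ℝ) => g p.1 p.2.1 p.2.2
  symm : ∀ x v w, g x v w = g x w v
  linear : ∀ x w, IsLinearMap ℝ fun v => g x v w
  posdef : ∀ x v, v ≠ 0 → 0 < g x v v
  periodic : ∀ (k : ℤ × ℤ) (x v w : ℝ × ℝ), g (x + lat k) v w = g x v w

namespace TorusMetric

/-- The Riemannian length of the curve `c` between the parameters `a` and `b`. -/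
def length (M : TorusMetric) (c : ℝ → ℝ × ℝ) (a b : ℝ) : ℝ :=
  ∫ t in a..b, Real.sqrt (M.g (c t) (deriv c t) (deriv c t))

/-- The Riemannian distance on the universal covering `ℝ²` (hence also on `T²`). -/
def dist (M : TorusMetric) (x y : ℝ × ℝ) : ℝ :=
  sInf {L | ∃ c : ℝ → ℝ × ℝ, ContDiff ℝ 1 c ∧ c 0 = x ∧ c 1 = y ∧ L = M.length c 0 1}

/-- A (complete, unit speed) geodesic of the lifted metric on the universal covering `ℝ²`:
a smooth curve with constant unit speed which is locally length minimizing. -/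
def IsGeodesic (M : TorusMetric) (c : ℝ → ℝ × ℝ) : Prop :=
  ContDiff ℝ (⊤ : ℕ∞) c ∧ (∀ t, M.g (c t) (deriv c t) (deriv c t) = 1) ∧
    ∀ t : ℝ, ∃ ε > 0, ∀ s₁ s₂, t - ε ≤ s₁ → s₁ ≤ s₂ → s₂ ≤ t + ε →
      M.dist (c s₁) (c s₂) = M.length c s₁ s₂

end TorusMetric

/-- The distance between two points of the unit tangent bundle `ST²` of the torus; points of
`ST²` are represented by points of the tangent bundle `ℝ² × ℝ²` of the universal covering
(the deck transformations act trivially on the vector component). -/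
def phaseDist (p q : (ℝ × ℝ) × (ℝ × ℝ)) : ℝ :=
  sInf {r : ℝ | ∃ k : ℤ × ℤ, r = norm2 (p.1 - (q.1 + lat k)) + norm2 (p.2 - q.2)}

/-- A `(φ,ε)`-separated set with respect to time `T` for the geodesic flow `φ` of `M` on
`ST²`: a finite family of geodesics (each geodesic `c` representing the phase point
`(c 0, ċ 0) ∈ ST²`, of which `t ↦ (c t, ċ t)` is the flow orbit) such that any two distinct
members satisfy `max_{0 ≤ t ≤ T} d(φᵗ v, φᵗ w) > ε`. -/
def IsSeparated (M : TorusMetric) (ε T : ℝ) (F : Finset (ℝ → ℝ × ℝ)) : Prop :=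
  (∀ c ∈ F, M.IsGeodesic c) ∧
    ∀ c₁ ∈ F, ∀ c₂ ∈ F, c₁ ≠ c₂ →
      ∃ t ∈ Set.Icc (0 : ℝ) T, ε < phaseDist (c₁ t, deriv c₁ t) (c₂ t, deriv c₂ t)

/-- `r_T(φ, ε)`: the maximal cardinality of `(φ,ε)`-separated sets with respect to `T`. -/
def sepCount (M : TorusMetric) (ε T : ℝ) : ℝ≥0∞ :=
  ⨆ (F : Finset (ℝ → ℝ × ℝ)) (_ : IsSeparated M ε T F), (F.card : ℝ≥0∞)

/-- Extended real logarithm of an extended nonnegative real. -/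
def elog (x : ℝ≥0∞) : EReal :=
  if x = 0 then ⊥ else if x = ⊤ then ⊤ else ((Real.log x.toReal : ℝ) : EReal)

/-- Bowen's topological entropy `h_top(g)` of the geodesic flow of `g` on `ST²`:
`lim_{ε → 0} limsup_{T → ∞} (1/T) log r_T(φ,ε)`; since `r_T(φ,ε)` is monotone in `ε`,
the limit `ε → 0` is realized as the supremum over `ε > 0`. -/
def topEnt (M : TorusMetric) : EReal :=
  ⨆ (ε : ℝ) (_ : 0 < ε),
    Filter.limsup (fun T : ℝ => ((T⁻¹ : ℝ) : EReal) * elog (sepCount M ε T)) Filter.atTop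

/-- The forward ray `c⁺` of `c` is escaping: `‖c(t)‖ → ∞` as `t → ∞`. -/
def EscapesForward (c : ℝ → ℝ × ℝ) : Prop :=
  Filter.Tendsto (fun t => norm2 (c t)) Filter.atTop Filter.atTop

/-- The backward ray `c⁻` of `c` is escaping: `‖c(-t)‖ → ∞` as `t → ∞`. -/
def EscapesBackward (c : ℝ → ℝ × ℝ) : Prop :=
  Filter.Tendsto (fun t => norm2 (c (-t))) Filter.atTop Filter.atTop

/-- `z ∈ S¹` is the asymptotic direction `δ(c⁺) = lim_{t → ∞} c(t)/‖c(t)‖` of the forward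
ray of `c`. -/
def HasDirection (c : ℝ → ℝ × ℝ) (z : ℝ × ℝ) : Prop :=
  norm2 z = 1 ∧ Filter.Tendsto (fun t => (norm2 (c t))⁻¹ • c t) Filter.atTop (nhds z)

/-- The canonical projection `π : S¹ → P¹(ℝ) ≅ ℝ ∪ {∞}`, sending `(x, y)` to `y/x` if
`x ≠ 0` and to `∞` otherwise; `ℝ ∪ {∞}` is the one-point compactification of `ℝ`. -/
def projPt (z : ℝ × ℝ) : OnePoint ℝ :=
  if z.1 = 0 then OnePoint.infty else ((z.2 / z.1 : ℝ) : OnePoint ℝ)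

/-- `crossDet v w ≠ 0` expresses transversality of two directions in `ℝ²`. -/
def crossDet (v w : ℝ × ℝ) : ℝ := v.1 * w.2 - v.2 * w.1

/-- The set of points at which the curve `c₁` (restricted to parameters in `D₁`) and the
curve `c₂` (restricted to parameters in `D₂`) intersect transversally. -/
def transInter (c₁ c₂ : ℝ → ℝ × ℝ) (D₁ D₂ : Set ℝ) : Set (ℝ × ℝ) :=
  {x | ∃ s ∈ D₁, ∃ t ∈ D₂, c₁ s = x ∧ c₂ t = x ∧ crossDet (deriv c₁ s) (deriv c₂ t) ≠ 0}

/-- The geodesic `c` is an axis of the (nontrivial) translation element `τ_k`: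
`τ_k c(t) = c(t + ℓ)` for some `ℓ` and all `t`. -/
def IsAxisOf (M : TorusMetric) (c : ℝ → ℝ × ℝ) (k : ℤ × ℤ) : Prop :=
  M.IsGeodesic c ∧ k ≠ 0 ∧ ∃ ℓ : ℝ, ∀ t, c (t + ℓ) = c t + lat k

/-- The geodesic `c` is an axis of some nontrivial translation element. -/
def IsAxis (M : TorusMetric) (c : ℝ → ℝ × ℝ) : Prop := ∃ k : ℤ × ℤ, IsAxisOf M c k

/-- The curve `c` is minimal: each of its segments minimizes the Riemannian length between
its endpoints. -/
def IsMinimal (M : TorusMetric) (c : ℝ → ℝ × ℝ) : Prop :=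
  ∀ s t : ℝ, s ≤ t → M.dist (c s) (c t) = M.length c s t

/-- Equivalence of translation elements: `τ₁^a = τ₂^b` for some nonzero integers `a, b`. -/
def TransEquiv (k₁ k₂ : ℤ × ℤ) : Prop := ∃ a b : ℤ, a ≠ 0 ∧ b ≠ 0 ∧ a • k₁ = b • k₂

/-- A translation element is primitive if it is not a nontrivial power of another
translation element. -/
def IsPrimitive (k : ℤ × ℤ) : Prop := k ≠ 0 ∧ ∀ (j : ℤ × ℤ) (n : ℤ), k = n • j → IsUnit n

/-- The metric `g` on `T²` is flat, i.e. its Gaussian curvature vanishes identically;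
equivalently (by the theorems of Myers–Steenrod and Cartan–Hadamard), the universal covering
`ℝ²` with the induced Riemannian distance is isometric to the Euclidean plane. -/
def IsFlat (M : TorusMetric) : Prop :=
  ∃ F : (ℝ × ℝ) ≃ (ℝ × ℝ), ∀ x y, M.dist x y = norm2 (F x - F y)

/-- The plane. -/
abbrev Pl := ℝ × ℝ

lemma lat_add (k l : ℤ × ℤ) : lat (k + l) = lat k + lat l := by
  simp [lat]

lemma lat_neg (k : ℤ × ℤ) : lat (-k) = -lat k := by
  simp [lat]

lemma lat_zero : lat 0 = 0 := by
  simp [lat]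

lemma lat_sub (k l : ℤ × ℤ) : lat (k - l) = lat k - lat l := by
  simp [lat]

lemma lat_zsmul (n : ℤ) (k : ℤ × ℤ) : lat (n • k) = (n : ℝ) • lat k := by
  simp [lat]

lemma lat_inj {k l : ℤ × ℤ} (h : lat k = lat l) : k = l := by
  simp only [lat, Prod.mk.injEq, Int.cast_inj] at h
  exact Prod.ext h.1 h.2

lemma exists_lat_near (x : Pl) : ∃ k : ℤ × ℤ, x - lat k ∈ Icc (0 : Pl) 1 := by
  refine ⟨(⌊x.1⌋, ⌊x.2⌋), ⟨⟨?_, ?_⟩, ⟨?_, ?_⟩⟩⟩ <;> simp [lat] <;>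
    first | exact Int.floor_le _ | exact (Int.fract_lt_one _).le

lemma norm_le_of_mem_Icc {x : Pl} (h : x ∈ Icc (0 : Pl) 1) : ‖x‖ ≤ 1 := by
  obtain ⟨⟨h1, h2⟩, ⟨h3, h4⟩⟩ := h
  simp only [Prod.fst_zero, Prod.snd_zero, Prod.fst_one, Prod.snd_one] at h1 h2 h3 h4
  rw [Prod.norm_def]
  simp [abs_le]
  refine ⟨⟨?_, h3⟩, ?_, h4⟩ <;> linarith

lemma periodic_bounded {F : Type*} [NormedAddCommGroup F] {f : Pl → F} (hf : Continuous f)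
    (hp : ∀ k x, f (x + lat k) = f x) : ∃ C, 0 ≤ C ∧ ∀ x, ‖f x‖ ≤ C := by
  obtain ⟨C, hC⟩ := (isCompact_Icc (a := (0 : Pl)) (b := 1)).exists_bound_of_continuousOn
    hf.continuousOn
  refine ⟨max C 0, le_max_right _ _, fun x => ?_⟩
  obtain ⟨k, hk⟩ := exists_lat_near x
  have := hC _ hk
  rw [← hp k (x - lat k), sub_add_cancel] at this
  exact this.trans (le_max_left _ _)

lemma periodic_lipschitz {F : Type*} [NormedAddCommGroup F] [NormedSpace ℝ F] {f : Pl → F}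
    (hf : ContDiff ℝ 1 f)
    (hp : ∀ k x, f (x + lat k) = f x) :
    ∃ C, 0 ≤ C ∧ (∀ x, ‖f x‖ ≤ C) ∧ ∀ x y, ‖f x - f y‖ ≤ C * ‖x - y‖ := by
  obtain ⟨C, hC0, hC⟩ := periodic_bounded hf.continuous hp
  obtain ⟨D, hD0, hD⟩ := periodic_bounded (hf.continuous_fderiv one_ne_zero) (fun k x => by
    rw [← fderiv_comp_add_right]; simp_rw [hp])
  refine ⟨C + D, by positivity, fun x => (hC x).trans (by linarith), fun x y => ?_⟩
  have := convex_univ.norm_image_sub_le_of_norm_fderiv_le (𝕜 := ℝ) (f := f)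
    (fun x _ => hf.differentiable one_ne_zero x) (fun x _ => hD x) (mem_univ y) (mem_univ x)
  nlinarith [norm_nonneg (x - y)]

namespace TorusMetric

/-- Coefficient `g₁₁`. -/
def cA (M : TorusMetric) (x : Pl) : ℝ := M.g x (1, 0) (1, 0)
/-- Coefficient `g₁₂`. -/
def cB (M : TorusMetric) (x : Pl) : ℝ := M.g x (1, 0) (0, 1)
/-- Coefficient `g₂₂`. -/
def cC (M : TorusMetric) (x : Pl) : ℝ := M.g x (0, 1) (0, 1)

section Coefficients
variable (M : TorusMetric)

lemma g_eq (x v w : Pl) : M.g x v w =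
    M.cA x * (v.1 * w.1) + M.cB x * (v.1 * w.2 + v.2 * w.1) + M.cC x * (v.2 * w.2) := by
  have key : ∀ v w : Pl, M.g x v w = v.1 * M.g x (1, 0) w + v.2 * M.g x (0, 1) w := by
    intro v w
    have h := M.linear x w
    conv_lhs => rw [show v = v.1 • ((1, 0) : Pl) + v.2 • ((0, 1) : Pl) by ext <;> simp]
    rw [h.map_add, h.map_smul, h.map_smul]
    rfl
  rw [key, M.symm x _ w, M.symm x _ w, key w, key w, M.symm x (0, 1) (1, 0), cA, cB, cC]
  ring

lemma contDiff_g {n : ℕ∞} {v w : Pl} : ContDiff ℝ n fun x => M.g x v w := by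
  have h : ContDiff ℝ n fun x : Pl => (x, v, w) := contDiff_id.prodMk contDiff_const
  exact (M.smooth.of_le (WithTop.coe_le_coe.2 le_top)).comp h

lemma contDiff_cA {n : ℕ∞} : ContDiff ℝ n M.cA := M.contDiff_g
lemma contDiff_cB {n : ℕ∞} : ContDiff ℝ n M.cB := M.contDiff_g
lemma contDiff_cC {n : ℕ∞} : ContDiff ℝ n M.cC := M.contDiff_g

lemma cA_per (k : ℤ × ℤ) (x : Pl) : M.cA (x + lat k) = M.cA x := M.periodic _ _ _ _
lemma cB_per (k : ℤ × ℤ) (x : Pl) : M.cB (x + lat k) = M.cB x := M.periodic _ _ _ _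
lemma cC_per (k : ℤ × ℤ) (x : Pl) : M.cC (x + lat k) = M.cC x := M.periodic _ _ _ _

lemma cA_pos (x : Pl) : 0 < M.cA x := M.posdef _ _ (by simp)
/-- The determinant of the metric. -/
def dt (x : Pl) : ℝ := M.cA x * M.cC x - M.cB x ^ 2

lemma dt_pos (x : Pl) : 0 < M.dt x := by
  have h := M.posdef x (-M.cB x, M.cA x) (by simp [(M.cA_pos x).ne'])
  rw [g_eq] at h
  have h1 := M.cA_pos x
  have : 0 < M.cA x * M.dt x := by simp only at h; unfold dt; linarith
  exact (mul_pos_iff_of_pos_left h1).1 this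

lemma dt_per (k : ℤ × ℤ) (x : Pl) : M.dt (x + lat k) = M.dt x := by
  simp [dt, cA_per, cB_per, cC_per]

lemma contDiff_dt {n : ℕ∞} : ContDiff ℝ n M.dt :=
  (M.contDiff_cA.mul M.contDiff_cC).sub (M.contDiff_cB.pow 2)

/-- The norm of a tangent vector. -/
def nrm (x v : Pl) : ℝ := Real.sqrt (M.g x v v)

lemma g_nonneg (x v : Pl) : 0 ≤ M.g x v v := by
  rcases eq_or_ne v 0 with rfl | h
  · simp [g_eq]
  · exact (M.posdef x v h).le

lemma nrm_nonneg (x v : Pl) : 0 ≤ M.nrm x v := Real.sqrt_nonneg _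

lemma nrm_sq (x v : Pl) : M.nrm x v ^ 2 = M.g x v v := Real.sq_sqrt (M.g_nonneg x v)

lemma g_smul_self (x v : Pl) (r : ℝ) : M.g x (r • v) (r • v) = r ^ 2 * M.g x v v := by
  simp [g_eq]; ring

lemma nrm_smul (x v : Pl) (r : ℝ) : M.nrm x (r • v) = |r| * M.nrm x v := by
  rw [nrm, g_smul_self, Real.sqrt_mul (sq_nonneg r), Real.sqrt_sq_eq_abs, nrm]

lemma nrm_per (k : ℤ × ℤ) (x v : Pl) : M.nrm (x + lat k) v = M.nrm x v := by
  simp [nrm, M.periodic]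

lemma g_lagrange (x v w : Pl) : M.g x v v * M.g x w w - M.g x v w ^ 2 =
    M.dt x * (v.1 * w.2 - v.2 * w.1) ^ 2 := by
  simp only [g_eq, dt]; ring

lemma g_le_nrm (x v w : Pl) : |M.g x v w| ≤ M.nrm x v * M.nrm x w := by
  apply abs_le_of_sq_le_sq _ (mul_nonneg (M.nrm_nonneg _ _) (M.nrm_nonneg _ _))
  rw [mul_pow, nrm_sq, nrm_sq]
  nlinarith [M.g_lagrange x v w, mul_nonneg (M.dt_pos x).le (sq_nonneg (v.1 * w.2 - v.2 * w.1))]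

lemma nrm_add_le (x v w : Pl) : M.nrm x (v + w) ≤ M.nrm x v + M.nrm x w := by
  apply abs_le_of_sq_le_sq' _ (add_nonneg (M.nrm_nonneg _ _) (M.nrm_nonneg _ _)) |>.2
  have h := (abs_le.1 (M.g_le_nrm x v w)).2
  have e : M.g x (v + w) (v + w) = M.g x v v + 2 * M.g x v w + M.g x w w := by
    simp [g_eq]; ring
  rw [nrm_sq, e, ← nrm_sq, ← nrm_sq]; nlinarith

lemma abs_fst_le (v : Pl) : |v.1| ≤ ‖v‖ := norm_fst_le v
lemma abs_snd_le (v : Pl) : |v.2| ≤ ‖v‖ := norm_snd_le v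

lemma form_bound {a b c L : ℝ} (ha : |a| ≤ L) (hb : |b| ≤ L) (hc : |c| ≤ L) (v w : Pl) :
    |a * (v.1 * w.1) + b * (v.1 * w.2 + v.2 * w.1) + c * (v.2 * w.2)| ≤ 4 * L * ‖v‖ * ‖w‖ := by
  have hL : 0 ≤ L := (abs_nonneg _).trans ha
  have key : ∀ {d p q : ℝ}, |d| ≤ L → |p| ≤ ‖v‖ → |q| ≤ ‖w‖ → |d * (p * q)| ≤ L * (‖v‖ * ‖w‖) := by
    intro d p q h1 h2 h3
    rw [abs_mul, abs_mul]
    gcongr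
  have h1 := abs_le.1 (key ha (abs_fst_le v) (abs_fst_le w))
  have h2 := abs_le.1 (key hb (abs_fst_le v) (abs_snd_le w))
  have h3 := abs_le.1 (key hb (abs_snd_le v) (abs_fst_le w))
  have h4 := abs_le.1 (key hc (abs_snd_le v) (abs_snd_le w))
  rw [abs_le]
  constructor <;> nlinarith

lemma exists_const : ∃ K : ℝ, 1 ≤ K ∧ (∀ x v, ‖v‖ ≤ K * M.nrm x v) ∧ (∀ x v, M.nrm x v ≤ K * ‖v‖) ∧
    (∀ x v w, |M.g x v w| ≤ K * ‖v‖ * ‖w‖) ∧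
    (∀ x y v, |M.nrm x v - M.nrm y v| ≤ K * ‖x - y‖ * ‖v‖) := by
  obtain ⟨A, hA0, hA, hA'⟩ := periodic_lipschitz (M.contDiff_cA (n := 1)) M.cA_per
  obtain ⟨B, hB0, hB, hB'⟩ := periodic_lipschitz (M.contDiff_cB (n := 1)) M.cB_per
  obtain ⟨C, hC0, hC, hC'⟩ := periodic_lipschitz (M.contDiff_cC (n := 1)) M.cC_per
  obtain ⟨D, hD0, hD⟩ := periodic_bounded (f := fun x => (M.dt x)⁻¹)
    ((M.contDiff_dt (n := 1)).continuous.inv₀ fun x => (M.dt_pos x).ne')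
    (fun k x => by rw [dt_per])
  simp only [Real.norm_eq_abs] at *
  set L := A + B + C
  have hL : 0 ≤ L := by positivity
  have b1 : ∀ x v w, |M.g x v w| ≤ 4 * L * ‖v‖ * ‖w‖ := fun x v w => by
    rw [g_eq]
    exact form_bound ((hA x).trans (by simp only [L]; linarith))
      ((hB x).trans (by simp only [L]; linarith)) ((hC x).trans (by simp only [L]; linarith)) v w
  have b2 : ∀ x y v w, |M.g x v w - M.g y v w| ≤ 4 * L * ‖x - y‖ * ‖v‖ * ‖w‖ := fun x y v w => by
    have := form_bound (L := L * ‖x - y‖) ((hA' x y).trans (by gcongr; simp only [L]; linarith))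
      ((hB' x y).trans (by gcongr; simp only [L]; linarith))
      ((hC' x y).trans (by gcongr; simp only [L]; linarith)) v w
    rw [g_eq, g_eq]
    convert this using 2 <;> ring
  have b3 : ∀ x v, ‖v‖ ^ 2 ≤ (L * D) * M.g x v v := by
    intro x v
    have hd := M.dt_pos x
    have hinv : 1 ≤ D * M.dt x := by
      have := (abs_le.1 (hD x)).2
      rwa [inv_le_iff_one_le_mul₀ hd] at this
    have e1 : M.cA x * M.g x v v = (M.cA x * v.1 + M.cB x * v.2) ^ 2 + M.dt x * v.2 ^ 2 := by
      rw [g_eq, dt]; ring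
    have e2 : M.cC x * M.g x v v = (M.cC x * v.2 + M.cB x * v.1) ^ 2 + M.dt x * v.1 ^ 2 := by
      rw [g_eq, dt]; ring
    have hA1 : M.cA x ≤ L := (le_abs_self _).trans ((hA x).trans (by simp only [L]; linarith))
    have hC1 : M.cC x ≤ L := (le_abs_self _).trans ((hC x).trans (by simp only [L]; linarith))
    have hg := M.g_nonneg x v
    have key : ∀ {e p q t : ℝ}, e * M.g x v v = q ^ 2 + M.dt x * p ^ 2 → e ≤ L →
        p ^ 2 ≤ L * D * M.g x v v := by
      intro e p q t h1 h2
      have h3 : M.dt x * p ^ 2 ≤ L * M.g x v v := by nlinarith [sq_nonneg q]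
      calc p ^ 2 ≤ (D * M.dt x) * p ^ 2 := by nlinarith [sq_nonneg p]
        _ = D * (M.dt x * p ^ 2) := by ring
        _ ≤ D * (L * M.g x v v) := by gcongr
        _ = _ := by ring
    rcases le_total ‖v.1‖ ‖v.2‖ with h | h
    · rw [Prod.norm_def, max_eq_right h, Real.norm_eq_abs, sq_abs]
      exact key (t := 0) e1 hA1
    · rw [Prod.norm_def, max_eq_left h, Real.norm_eq_abs, sq_abs]
      exact key (t := 0) e2 hC1
  have c1 : ∀ x v, ‖v‖ ≤ (1 + L * D) * M.nrm x v := fun x v => by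
    apply abs_le_of_sq_le_sq' _ (mul_nonneg (by positivity) (M.nrm_nonneg _ _)) |>.2
    rw [mul_pow, nrm_sq]
    have := mul_nonneg hL hD0
    nlinarith [b3 x v, M.g_nonneg x v, mul_nonneg this (M.g_nonneg x v)]
  have c2 : ∀ x v, M.nrm x v ≤ (1 + 4 * L) * ‖v‖ := fun x v => by
    apply abs_le_of_sq_le_sq' _ (by positivity) |>.2
    rw [mul_pow, nrm_sq]
    have := (abs_le.1 (b1 x v v)).2
    nlinarith [sq_nonneg ‖v‖, mul_nonneg hL (sq_nonneg ‖v‖)]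
  have c3 : ∀ x y v, |M.nrm x v - M.nrm y v| ≤ (4 * L * (1 + L * D)) * ‖x - y‖ * ‖v‖ := by
    intro x y v
    have h1 := b2 x y v v
    rw [← nrm_sq, ← nrm_sq, sq_sub_sq, abs_mul,
      abs_of_nonneg (add_nonneg (M.nrm_nonneg x v) (M.nrm_nonneg y v))] at h1
    rcases eq_or_ne v 0 with rfl | hv
    · simp [nrm, g_eq]
    have hv' := norm_pos_iff.2 hv
    have h2 : ‖v‖ * |M.nrm x v - M.nrm y v| ≤
        (1 + L * D) * ((M.nrm x v + M.nrm y v) * |M.nrm x v - M.nrm y v|) := by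
      have := c1 x v
      have h3 : ‖v‖ ≤ (1 + L * D) * (M.nrm x v + M.nrm y v) := by
        have h4 := mul_nonneg (a := 1 + L * D) (by positivity) (M.nrm_nonneg y v)
        nlinarith
      nlinarith [abs_nonneg (M.nrm x v - M.nrm y v)]
    have h3 : ‖v‖ * |M.nrm x v - M.nrm y v| ≤ ‖v‖ * (4 * L * (1 + L * D) * ‖x - y‖ * ‖v‖) := by
      refine h2.trans ?_
      have : (0 : ℝ) ≤ 1 + L * D := by positivity
      calc _ ≤ (1 + L * D) * (4 * L * ‖x - y‖ * ‖v‖ * ‖v‖) := by gcongr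
        _ = _ := by ring
    exact le_of_mul_le_mul_left h3 hv'
  have hLD := mul_nonneg hL hD0
  have hLLD := mul_nonneg hL hLD
  refine ⟨1 + 4 * L + L * D + 4 * L * (1 + L * D), by nlinarith, fun x v => (c1 x v).trans ?_,
    fun x v => (c2 x v).trans ?_, fun x v w => (b1 x v w).trans ?_,
    fun x y v => (c3 x y v).trans ?_⟩
  · exact mul_le_mul_of_nonneg_right (by nlinarith) (M.nrm_nonneg _ _)
  all_goals repeat refine mul_le_mul_of_nonneg_right ?_ (norm_nonneg _)
  all_goals nlinarith

/-- A constant controlling the metric. -/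
def K : ℝ := M.exists_const.choose

lemma one_le_K : 1 ≤ M.K := M.exists_const.choose_spec.1
lemma K_pos : 0 < M.K := one_pos.trans_le M.one_le_K
lemma norm_le_nrm (x v : Pl) : ‖v‖ ≤ M.K * M.nrm x v := M.exists_const.choose_spec.2.1 x v
lemma nrm_le_norm (x v : Pl) : M.nrm x v ≤ M.K * ‖v‖ := M.exists_const.choose_spec.2.2.1 x v
lemma abs_g_le (x v w : Pl) : |M.g x v w| ≤ M.K * ‖v‖ * ‖w‖ :=
  M.exists_const.choose_spec.2.2.2.1 x v w
lemma abs_nrm_sub_le (x y v : Pl) : |M.nrm x v - M.nrm y v| ≤ M.K * ‖x - y‖ * ‖v‖ :=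
  M.exists_const.choose_spec.2.2.2.2 x y v

end Coefficients
end TorusMetric

namespace TorusMetric
variable (M : TorusMetric)

/-- The speed of a curve. -/
def spd (c : ℝ → Pl) (t : ℝ) : ℝ := M.nrm (c t) (deriv c t)

lemma length_eq (c : ℝ → Pl) (a b : ℝ) : M.length c a b = ∫ t in a..b, M.spd c t := rfl

lemma continuous_g {X : Type*} [TopologicalSpace X] {f u v : X → Pl} (hf : Continuous f)
    (hu : Continuous u) (hv : Continuous v) : Continuous fun t => M.g (f t) (u t) (v t) :=
  M.smooth.continuous.comp (hf.prodMk (hu.prodMk hv))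

lemma continuous_nrm {X : Type*} [TopologicalSpace X] {f u : X → Pl} (hf : Continuous f)
    (hu : Continuous u) : Continuous fun t => M.nrm (f t) (u t) :=
  Real.continuous_sqrt.comp (M.continuous_g hf hu hu)

variable {M}

lemma continuous_spd {c : ℝ → Pl} (hc : ContDiff ℝ 1 c) : Continuous (M.spd c) :=
  M.continuous_nrm hc.continuous (hc.continuous_deriv le_rfl)

lemma spd_nonneg (c : ℝ → Pl) (t : ℝ) : 0 ≤ M.spd c t := M.nrm_nonneg _ _

lemma length_nonneg (c : ℝ → Pl) {a b : ℝ} (h : a ≤ b) : 0 ≤ M.length c a b :=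
  intervalIntegral.integral_nonneg h fun t _ => M.spd_nonneg c t

lemma length_add {c : ℝ → Pl} (hc : ContDiff ℝ 1 c) (a b e : ℝ) :
    M.length c a b + M.length c b e = M.length c a e :=
  intervalIntegral.integral_add_adjacent_intervals
    ((continuous_spd hc).intervalIntegrable _ _) ((continuous_spd hc).intervalIntegrable _ _)

lemma spd_comp {c : ℝ → Pl} (hc : ContDiff ℝ 1 c) {f : ℝ → ℝ} {t f' : ℝ}
    (hf : HasDerivAt f f' t) : M.spd (c ∘ f) t = |f'| * M.spd c (f t) := by
  have h := ((hc.differentiable one_ne_zero (f t)).hasDerivAt.scomp t hf).deriv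
  rw [spd, h, nrm_smul]; rfl

lemma length_comp {c : ℝ → Pl} (hc : ContDiff ℝ 1 c) {f : ℝ → ℝ} (hf : ContDiff ℝ 1 f)
    (hm : Monotone f) (a b : ℝ) : M.length (c ∘ f) a b = M.length c (f a) (f b) := by
  have hd : ∀ t, HasDerivAt f (deriv f t) t := fun t =>
    (hf.differentiable one_ne_zero t).hasDerivAt
  rw [length_eq, length_eq, ← intervalIntegral.integral_comp_mul_deriv (fun t _ => hd t)
    (hf.continuous_deriv le_rfl).continuousOn (continuous_spd hc)]
  refine intervalIntegral.integral_congr fun t _ => ?_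
  simp only [Function.comp]
  rw [spd_comp hc (hd t), abs_of_nonneg hm.deriv_nonneg, mul_comm]

lemma norm_sub_le_length {c : ℝ → Pl} (hc : ContDiff ℝ 1 c) {a b : ℝ} (h : a ≤ b) :
    ‖c b - c a‖ ≤ M.K * M.length c a b := by
  have e : ∫ t in a..b, deriv c t = c b - c a :=
    intervalIntegral.integral_deriv_eq_sub (fun t _ => hc.differentiable one_ne_zero t)
      ((hc.continuous_deriv le_rfl).intervalIntegrable _ _)
  rw [← e, length_eq, ← intervalIntegral.integral_const_mul]
  refine (intervalIntegral.norm_integral_le_integral_norm h).trans ?_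
  exact intervalIntegral.integral_mono_on h
    ((hc.continuous_deriv le_rfl).norm.intervalIntegrable _ _)
    ((continuous_spd hc).const_mul _ |>.intervalIntegrable _ _) fun t _ => M.norm_le_nrm _ _

/-- The straight line. -/
def lin (x y : Pl) (t : ℝ) : Pl := x + t • (y - x)

lemma contDiff_lin (x y : Pl) {n : ℕ∞} : ContDiff ℝ n (lin x y) :=
  contDiff_const.add (contDiff_id.smul contDiff_const)

lemma hasDerivAt_lin (x y : Pl) (t : ℝ) : HasDerivAt (lin x y) (y - x) t := by
  have h := ((hasDerivAt_id t).smul_const (y - x)).const_add x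
  rw [one_smul] at h
  exact h

lemma lin_zero (x y : Pl) : lin x y 0 = x := by simp [lin]
lemma lin_one (x y : Pl) : lin x y 1 = y := by simp [lin]

lemma bddBelow_lengths (x y : Pl) : BddBelow {L | ∃ c : ℝ → Pl, ContDiff ℝ 1 c ∧
    c 0 = x ∧ c 1 = y ∧ L = M.length c 0 1} :=
  ⟨0, by rintro L ⟨c, -, -, -, rfl⟩; exact length_nonneg c zero_le_one⟩

lemma lengths_nonempty (x y : Pl) : {L | ∃ c : ℝ → Pl, ContDiff ℝ 1 c ∧
    c 0 = x ∧ c 1 = y ∧ L = M.length c 0 1}.Nonempty :=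
  ⟨_, lin x y, contDiff_lin x y (n := 1), lin_zero x y, lin_one x y, rfl⟩

lemma dist_le_length {c : ℝ → Pl} (hc : ContDiff ℝ 1 c) {a b : ℝ} (h : a ≤ b) :
    M.dist (c a) (c b) ≤ M.length c a b := by
  have hf : ContDiff ℝ 1 fun t : ℝ => a + (b - a) * t := by fun_prop
  refine csInf_le (bddBelow_lengths _ _) ⟨c ∘ fun t => a + (b - a) * t, hc.comp hf, by simp, by simp, ?_⟩
  rw [length_comp hc hf]
  · simp
  · intro s t hst
    have : 0 ≤ b - a := by linarith
    simp only; gcongr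

variable (M)

lemma exists_near (x y : Pl) {e : ℝ} (he : 0 < e) : ∃ c : ℝ → Pl, ContDiff ℝ 1 c ∧
    c 0 = x ∧ c 1 = y ∧ M.length c 0 1 < M.dist x y + e := by
  obtain ⟨L, ⟨c, h1, h2, h3, rfl⟩, h⟩ := exists_lt_of_csInf_lt (lengths_nonempty (M := M) x y)
    (show sInf _ < M.dist x y + e from lt_add_of_pos_right _ he)
  exact ⟨c, h1, h2, h3, h⟩

lemma dist_nonneg (x y : Pl) : 0 ≤ M.dist x y :=
  le_csInf (lengths_nonempty x y) (by rintro L ⟨c, -, -, -, rfl⟩; exact length_nonneg c zero_le_one)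

lemma norm_sub_le_dist (x y : Pl) : ‖x - y‖ ≤ M.K * M.dist x y := by
  rw [norm_sub_rev, ← div_le_iff₀' M.K_pos]
  refine le_csInf (lengths_nonempty x y) ?_
  rintro L ⟨c, h, rfl, rfl, rfl⟩
  rw [div_le_iff₀' M.K_pos]
  exact norm_sub_le_length h zero_le_one

lemma dist_le_norm_sub (x y : Pl) : M.dist x y ≤ M.K * ‖x - y‖ := by
  have h := dist_le_length (M := M) (contDiff_lin x y (n := 1)) zero_le_one
  rw [lin_zero, lin_one] at h
  refine h.trans ?_
  have : ∀ t ∈ Icc (0 : ℝ) 1, M.spd (lin x y) t ≤ M.K * ‖x - y‖ := fun t _ => by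
    rw [spd, (hasDerivAt_lin x y t).deriv, norm_sub_rev]
    exact M.nrm_le_norm _ _
  have := intervalIntegral.integral_mono_on (μ := MeasureTheory.volume) (zero_le_one (α := ℝ))
    ((continuous_spd (M := M) (contDiff_lin x y (n := 1))).intervalIntegrable 0 1)
    ((continuous_const (y := M.K * ‖x - y‖)).intervalIntegrable _ _) this
  simpa [length_eq] using this

lemma dist_self (x : Pl) : M.dist x x = 0 :=
  le_antisymm (by simpa using M.dist_le_norm_sub x x) (M.dist_nonneg _ _)

lemma eq_of_dist_le {x y : Pl} (h : M.dist x y ≤ 0) : x = y := by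
  have := M.norm_sub_le_dist x y
  rw [le_antisymm h (M.dist_nonneg _ _)] at this
  simpa [sub_eq_zero] using this

lemma dist_symm_le (x y : Pl) : M.dist y x ≤ M.dist x y := by
  refine le_csInf (lengths_nonempty x y) ?_
  rintro L ⟨c, h, rfl, rfl, rfl⟩
  have hf : ContDiff ℝ 1 fun t : ℝ => 1 - t := by fun_prop
  refine csInf_le (bddBelow_lengths _ _) ⟨c ∘ fun t => 1 - t, h.comp hf, by simp, by simp, ?_⟩
  have : ∀ t, M.spd (c ∘ fun t => 1 - t) t = M.spd c (1 - t) := fun t => by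
    rw [spd_comp h (f := fun t => 1 - t) ((hasDerivAt_id' t).const_sub 1)]; simp
  rw [length_eq, length_eq]
  simp_rw [this]
  rw [intervalIntegral.integral_comp_sub_left]; simp

lemma dist_comm (x y : Pl) : M.dist x y = M.dist y x :=
  le_antisymm (M.dist_symm_le _ _) (M.dist_symm_le _ _)

lemma length_congr {c e : ℝ → Pl} {a b : ℝ} (hab : a ≤ b) (h : ∀ t ∈ Ioo a b, c t = e t) :
    M.length c a b = M.length e a b := by
  rw [length_eq, length_eq, intervalIntegral.integral_of_le hab, intervalIntegral.integral_of_le hab,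
    MeasureTheory.integral_Ioc_eq_integral_Ioo, MeasureTheory.integral_Ioc_eq_integral_Ioo]
  refine MeasureTheory.setIntegral_congr_fun measurableSet_Ioo fun t ht => ?_
  have hev : c =ᶠ[𝓝 t] e := by
    filter_upwards [isOpen_Ioo.mem_nhds ht] with s hs using h s hs
  simp only [spd]
  rw [h t ht, hev.deriv_eq]

lemma dist_triangle (x y z : Pl) : M.dist x z ≤ M.dist x y + M.dist y z := by
  refine le_of_forall_pos_lt_add fun e he => ?_
  obtain ⟨c, c1, c2, c3, c4⟩ := M.exists_near x y (half_pos he)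
  obtain ⟨u, u1, u2, u3, u4⟩ := M.exists_near y z (half_pos he)
  let S := Real.smoothTransition
  have hS : ContDiff ℝ 1 S := Real.smoothTransition.contDiff
  have hf : ContDiff ℝ 1 fun t : ℝ => S (2 * t) := hS.comp (by fun_prop)
  have hk : ContDiff ℝ 1 fun t : ℝ => S (2 * t - 1) := hS.comp (by fun_prop)
  have mf : Monotone fun t : ℝ => S (2 * t) := fun s t h =>
    Real.smoothTransition.monotone (by linarith)
  have mk : Monotone fun t : ℝ => S (2 * t - 1) := fun s t h =>
    Real.smoothTransition.monotone (by linarith)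
  let w : ℝ → Pl := fun t => (c ∘ fun t => S (2 * t)) t + (u ∘ fun t => S (2 * t - 1)) t - y
  have hw : ContDiff ℝ 1 w := ((c1.comp hf).add (u1.comp hk)).sub contDiff_const
  have S0 : ∀ {r}, r ≤ 0 → S r = 0 := fun h => Real.smoothTransition.zero_of_nonpos h
  have S1 : ∀ {r}, 1 ≤ r → S r = 1 := fun h => Real.smoothTransition.one_of_one_le h
  have h := dist_le_length (M := M) hw zero_le_one
  rw [← length_add hw 0 (1 / 2) 1, M.length_congr (e := c ∘ fun t => S (2 * t)) (by norm_num),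
    M.length_congr (c := w) (e := u ∘ fun t => S (2 * t - 1)) (by norm_num), length_comp c1 hf mf,
    length_comp u1 hk mk] at h
  · have e0 : w 0 = x := by simp [w, S0, u2, c2]
    have e1 : w 1 = z := by
      simp only [w, Function.comp]
      rw [S1 (by norm_num), S1 (by norm_num), c3, u3]; simp
    have f0 : S (2 * 0) = 0 := S0 (by norm_num)
    have f1 : S (2 * (1 / 2)) = 1 := S1 (by norm_num)
    have f2 : S (2 * (1 / 2) - 1) = 0 := S0 (by norm_num)
    have f3 : S (2 * 1 - 1) = 1 := S1 (by norm_num)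
    rw [e0, e1, f0, f1, f2, f3] at h
    linarith
  · intro t ht
    simp only [w, Function.comp]
    rw [S1 (by linarith [ht.1]), c3]; simp
  · intro t ht
    simp only [w, Function.comp]
    rw [S0 (r := 2 * t - 1) (by linarith [ht.2]), u2]; simp

lemma dist_translate (k : ℤ × ℤ) (x y : Pl) : M.dist (x + lat k) (y + lat k) = M.dist x y := by
  have key : ∀ (k : ℤ × ℤ) (x y : Pl), M.dist (x + lat k) (y + lat k) ≤ M.dist x y := by
    intro k x y
    refine le_csInf (lengths_nonempty x y) ?_
    rintro L ⟨c, h, rfl, rfl, rfl⟩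
    refine csInf_le (bddBelow_lengths _ _) ⟨fun t => c t + lat k, h.add contDiff_const, rfl, rfl, ?_⟩
    rw [length_eq, length_eq]
    congr 1; ext t
    rw [spd, spd, deriv_add_const, nrm_per]
  refine le_antisymm (key k x y) ?_
  have := key (-k) (x + lat k) (y + lat k)
  simpa [lat_neg] using this

lemma abs_dist_sub_le (x y z : Pl) : |M.dist x z - M.dist y z| ≤ M.dist x y := by
  rw [abs_le]
  constructor
  · linarith [M.dist_triangle y x z, M.dist_comm x y]
  · linarith [M.dist_triangle x y z]

lemma continuous_dist : Continuous fun p : Pl × Pl => M.dist p.1 p.2 := by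
  rw [Metric.continuous_iff]
  intro p e he
  refine ⟨e / (2 * M.K + 1), by have := M.K_pos; positivity, fun q hq => ?_⟩
  have h0 := M.K_pos
  rw [lt_div_iff₀ (by positivity)] at hq
  have h1 := M.abs_dist_sub_le q.1 p.1 q.2
  have h2 := M.abs_dist_sub_le q.2 p.2 p.1
  have h3 := M.dist_le_norm_sub q.1 p.1
  have h4 := M.dist_le_norm_sub q.2 p.2
  have h5 : ‖q.1 - p.1‖ ≤ Dist.dist q p := by rw [dist_eq_norm]; exact norm_fst_le (q - p)
  have h6 : ‖q.2 - p.2‖ ≤ Dist.dist q p := by rw [dist_eq_norm]; exact norm_snd_le (q - p)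
  rw [Real.dist_eq]
  rw [M.dist_comm q.2 p.1, M.dist_comm p.2 p.1] at h2
  have h7 : |M.dist q.1 q.2 - M.dist p.1 p.2| ≤ |M.dist q.1 q.2 - M.dist p.1 q.2| +
    |M.dist p.1 q.2 - M.dist p.1 p.2| := abs_sub_le _ _ _
  have h8 : M.K * ‖q.1 - p.1‖ ≤ M.K * Dist.dist q p := by gcongr
  have h9 : M.K * ‖q.2 - p.2‖ ≤ M.K * Dist.dist q p := by gcongr
  have h10 : 0 ≤ Dist.dist q p := _root_.dist_nonneg
  nlinarith

lemma tendsto_dist {X : Type*} {l : Filter X} {f u : X → Pl} {a b : Pl} (hf : Tendsto f l (𝓝 a))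
    (hu : Tendsto u l (𝓝 b)) : Tendsto (fun t => M.dist (f t) (u t)) l (𝓝 (M.dist a b)) :=
  Tendsto.comp (g := fun p : Pl × Pl => M.dist p.1 p.2) (f := fun t => (f t, u t))
    (M.continuous_dist.tendsto (a, b)) (hf.prodMk_nhds hu)

end TorusMetric

/-- A fixed nonprincipal ultrafilter on `ℕ`. -/
def Ult : Ultrafilter ℕ := hyperfilter ℕ

lemma ult_le : (Ult : Filter ℕ) ≤ atTop := Nat.hyperfilter_le_atTop

lemma exists_ulim {ι E : Type*} [NormedAddCommGroup E] [ProperSpace E] {U : Ultrafilter ι}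
    {u : ι → E} {C : ℝ} (h : ∀ᶠ n in (U : Filter ι), ‖u n‖ ≤ C) : ∃ x, Tendsto u U (𝓝 x) := by
  obtain ⟨x, -, hx⟩ := (isCompact_closedBall (0 : E) C).ultrafilter_le_nhds (U.map u)
    (by
      rw [le_principal_iff, Ultrafilter.coe_map, mem_map]
      exact mem_of_superset (show {n | ‖u n‖ ≤ C} ∈ (U : Filter ι) from h)
        fun n (hn : ‖u n‖ ≤ C) => by simpa using hn)
  exact ⟨x, hx⟩

lemma exists_ulim_fun {X E : Type*} [NormedAddCommGroup E] [ProperSpace E] {u : ℕ → X → E}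
    (h : ∀ x, ∃ C : ℝ, ∀ᶠ n in (Ult : Filter ℕ), ‖u n x‖ ≤ C) :
    ∃ f : X → E, ∀ x, Tendsto (fun n => u n x) Ult (𝓝 (f x)) := by
  choose C hC using h
  choose f hf using fun x => exists_ulim (hC x)
  exact ⟨f, hf⟩

/-- Projection to the interval `[a, b]`. -/
def clamp (a b s : ℝ) : ℝ := max a (min b s)

lemma clamp_mem {a b : ℝ} (h : a ≤ b) (s : ℝ) : clamp a b s ∈ Icc a b :=
  ⟨le_max_left _ _, max_le h (min_le_left _ _)⟩

lemma clamp_eq {a b s : ℝ} (h : s ∈ Icc a b) : clamp a b s = s := by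
  rw [clamp, min_eq_right h.2, max_eq_right h.1]

lemma clamp_lip (a b s t : ℝ) : |clamp a b s - clamp a b t| ≤ |s - t| := by
  have h1 := abs_max_sub_max_le_max a (min b s) a (min b t)
  have h2 := abs_min_sub_min_le_max b s b t
  simp only [sub_self, abs_zero, abs_nonneg, sup_of_le_right] at h1 h2
  exact h1.trans h2

lemma continuous_clamp (a b : ℝ) : Continuous (clamp a b) := by unfold clamp; fun_prop

namespace TorusMetric
variable (M : TorusMetric)

/-- `P` is `ℓ`-Lipschitz with respect to the Riemannian distance. -/
def Lip (P : ℝ → Pl) (ℓ : ℝ) : Prop := ∀ s t, M.dist (P s) (P t) ≤ ℓ * |s - t|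

/-- `c` is distance realizing on `I`. -/
def IsSeg (c : ℝ → Pl) (I : Set ℝ) : Prop := ∀ s ∈ I, ∀ t ∈ I, M.dist (c s) (c t) = |s - t|

variable {M}

lemma Lip.norm_sub_le {P : ℝ → Pl} {ℓ : ℝ} (h : M.Lip P ℓ) (s t : ℝ) :
    ‖P s - P t‖ ≤ M.K * (ℓ * |s - t|) :=
  (M.norm_sub_le_dist _ _).trans (mul_le_mul_of_nonneg_left (h s t) M.K_pos.le)

lemma Lip.nonneg {P : ℝ → Pl} {ℓ : ℝ} (h : M.Lip P ℓ) : 0 ≤ ℓ := by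
  simpa using (M.dist_nonneg _ _).trans (h 1 0)

lemma Lip.continuous {P : ℝ → Pl} {ℓ : ℝ} (h : M.Lip P ℓ) : Continuous P := by
  refine LipschitzWith.continuous (K := (M.K * ℓ).toNNReal) (LipschitzWith.of_dist_le_mul ?_)
  intro s t
  rw [Real.coe_toNNReal _ (mul_nonneg M.K_pos.le h.nonneg), dist_eq_norm, Real.dist_eq, mul_assoc]
  exact h.norm_sub_le s t

lemma Lip.comp_add {P : ℝ → Pl} {ℓ : ℝ} (h : M.Lip P ℓ) (a : ℝ) : M.Lip (fun t => P (t + a)) ℓ :=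
  fun s t => by simpa using h (s + a) (t + a)

lemma IsSeg.mono {c : ℝ → Pl} {I J : Set ℝ} (h : M.IsSeg c I) (hJ : J ⊆ I) : M.IsSeg c J :=
  fun s hs t ht => h s (hJ hs) t (hJ ht)

lemma IsSeg.comp_add {c : ℝ → Pl} {I : Set ℝ} (h : M.IsSeg c I) (a : ℝ) :
    M.IsSeg (fun t => c (t + a)) {t | t + a ∈ I} := fun s hs t ht => by
  rw [h _ hs _ ht]; congr 1; ring

lemma IsSeg.of_le {c : ℝ → Pl} {a b : ℝ} (hab : a ≤ b)
    (h : ∀ s ∈ Icc a b, ∀ t ∈ Icc a b, M.dist (c s) (c t) ≤ |s - t|)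
    (h' : b - a ≤ M.dist (c a) (c b)) : M.IsSeg c (Icc a b) := by
  have key : ∀ s ∈ Icc a b, ∀ t ∈ Icc a b, s ≤ t → t - s ≤ M.dist (c s) (c t) := by
    intro s hs t ht hst
    have h1 := h a ⟨le_rfl, hab⟩ s hs
    have h2 := h t ht b ⟨hab, le_rfl⟩
    rw [abs_of_nonpos (by linarith [hs.1])] at h1
    rw [abs_of_nonpos (by linarith [ht.2])] at h2
    linarith [M.dist_triangle (c a) (c s) (c b), M.dist_triangle (c s) (c t) (c b)]
  intro s hs t ht
  refine le_antisymm (h s hs t ht) ?_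
  rcases le_total s t with hst | hst
  · rw [abs_of_nonpos (by linarith)]; linarith [key s hs t ht hst]
  · rw [abs_of_nonneg (by linarith), M.dist_comm]; exact key t ht s hs hst

variable (M)

lemma exists_near_param (x y : Pl) {e : ℝ} (he : 0 < e) : ∃ p : ℝ → Pl, p 0 = x ∧ p 1 = y ∧
    ∀ s ∈ Icc (0 : ℝ) 1, ∀ t ∈ Icc (0 : ℝ) 1,
      M.dist (p s) (p t) ≤ (M.dist x y + e) * |s - t| := by
  obtain ⟨c, c1, c2, c3, c4⟩ := M.exists_near x y he
  set ℓ := M.length c 0 1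
  have hℓ : 0 ≤ ℓ := length_nonneg c zero_le_one
  have hcont : ContinuousOn (fun t => M.length c 0 t) (Icc 0 1) :=
    (intervalIntegral.continuous_primitive
      (fun a b => (continuous_spd c1).intervalIntegrable a b) 0).continuousOn
  have hsub : ∀ s ∈ Icc (0 : ℝ) 1, ∃ t ∈ Icc (0 : ℝ) 1, M.length c 0 t = ℓ * s := by
    intro s hs
    have := intermediate_value_Icc zero_le_one hcont
    obtain ⟨t, ht, e⟩ := this (show ℓ * s ∈ Icc (M.length c 0 0) (M.length c 0 1) by
      rw [length_eq, intervalIntegral.integral_same]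
      exact ⟨mul_nonneg hℓ hs.1, mul_le_of_le_one_right hℓ hs.2⟩)
    exact ⟨t, ht, e⟩
  have hd : ∀ a b, M.dist (c a) (c b) ≤ |M.length c 0 a - M.length c 0 b| := by
    intro a b
    rw [← length_add c1 0 a b]
    rcases le_total a b with h | h
    · have h1 := dist_le_length (M := M) c1 h
      rw [abs_sub_comm]
      exact h1.trans ((le_abs_self _).trans_eq' (by ring))
    · have h1 := dist_le_length (M := M) c1 h
      have h2 := length_add (M := M) c1 a b a
      rw [length_eq M c a a, intervalIntegral.integral_same] at h2
      rw [M.dist_comm]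
      exact h1.trans ((le_abs_self _).trans_eq' (by linarith))
  choose! τ hτ hτ' using hsub
  refine ⟨fun s => if s = 0 then x else if s = 1 then y else c (τ s), by simp, by simp, ?_⟩
  have hp : ∀ s ∈ Icc (0 : ℝ) 1, ∃ r, (if s = 0 then x else if s = 1 then y else c (τ s)) = c r ∧
      M.length c 0 r = ℓ * s := by
    intro s hs
    split_ifs with h1 h2
    · exact ⟨0, c2.symm, by simp [h1, length_eq]⟩
    · exact ⟨1, c3.symm, by simp [h2, ℓ]⟩
    · exact ⟨τ s, rfl, hτ' s hs⟩
  intro s hs t ht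
  obtain ⟨r, e1, e2⟩ := hp s hs
  obtain ⟨r', e3, e4⟩ := hp t ht
  simp only [e1, e3]
  refine (hd _ _).trans ?_
  rw [e2, e4, ← mul_sub, abs_mul, abs_of_nonneg hℓ]
  gcongr

/-- Any two points are joined by a minimizing segment. -/
lemma exists_seg (x y : Pl) : ∃ σ : ℝ → Pl, σ 0 = x ∧ σ (M.dist x y) = y ∧ M.Lip σ 1 ∧
    M.IsSeg σ (Icc 0 (M.dist x y)) := by
  rcases (M.dist_nonneg x y).eq_or_lt with h0 | h0
  · refine ⟨fun _ => x, rfl, M.eq_of_dist_le h0.ge, fun s t => ?_, fun s hs t ht => ?_⟩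
    · rw [M.dist_self]; positivity
    · rw [← h0, Icc_self] at hs ht
      rw [M.dist_self, hs, ht]; simp
  set D := M.dist x y
  choose p p0 p1 hp using fun n : ℕ => M.exists_near_param x y
    (show (0 : ℝ) < 1 / ((n : ℝ) + 1) by positivity)
  have hlim : Tendsto (fun n : ℕ => D + 1 / ((n : ℝ) + 1)) Ult (𝓝 D) := by
    simpa using (tendsto_const_nhds (x := D)).add (tendsto_one_div_add_atTop_nhds_zero_nat.mono_left
      ult_le)
  set cl : ℝ → ℝ := clamp 0 1
  have hcl : ∀ s, cl s ∈ Icc (0 : ℝ) 1 := clamp_mem zero_le_one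
  have hcl' : ∀ s ∈ Icc (0 : ℝ) 1, cl s = s := fun s hs => clamp_eq hs
  have clLip : ∀ s t, |cl s - cl t| ≤ |s - t| := clamp_lip 0 1
  obtain ⟨q, hq⟩ := exists_ulim_fun (u := fun n s => p n (cl s)) (fun s => by
    refine ⟨‖x‖ + M.K * (D + 1), Eventually.of_forall fun n => ?_⟩
    have h1 := hp n 0 (by simp) (cl s) (hcl s)
    rw [p0] at h1
    have h2 := M.norm_sub_le_dist x (p n (cl s))
    have h3 : M.dist x (p n (cl s)) ≤ D + 1 := by
      refine h1.trans ?_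
      have : (1 : ℝ) / ((n : ℝ) + 1) ≤ 1 := by
        rw [div_le_one (by positivity)]; linarith [n.cast_nonneg (α := ℝ)]
      have h4 : |0 - cl s| ≤ 1 := by
        rw [zero_sub, abs_neg, abs_of_nonneg (hcl s).1]; exact (hcl s).2
      have h5 : 0 ≤ |0 - cl s| := abs_nonneg _
      have h6 : (0 : ℝ) < 1 / ((n : ℝ) + 1) := by positivity
      nlinarith
    have h4 := norm_sub_norm_le (p n (cl s)) x
    rw [norm_sub_rev] at h4
    nlinarith [M.K_pos])
  have hq1 : ∀ s t, M.dist (q s) (q t) ≤ D * |s - t| := fun s t => by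
    refine le_of_tendsto_of_tendsto (M.tendsto_dist (hq s) (hq t)) (hlim.mul_const |s - t|)
      (Eventually.of_forall fun n => (hp n _ (hcl s) _ (hcl t)).trans ?_)
    exact mul_le_mul_of_nonneg_left (clLip s t) (add_nonneg h0.le (by positivity))
  have q0 : q 0 = x := by
    have := hq 0
    simp only [hcl' 0 (by simp), p0] at this
    exact tendsto_nhds_unique this tendsto_const_nhds
  have q1 : q 1 = y := by
    have := hq 1
    simp only [hcl' 1 (by simp), p1] at this
    exact tendsto_nhds_unique this tendsto_const_nhds
  have hL : M.Lip (fun t => q (t / D)) 1 := fun s t => by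
    refine (hq1 _ _).trans_eq ?_
    rw [← sub_div, abs_div, abs_of_pos h0]; field_simp
  refine ⟨fun t => q (t / D), by simp [q0], by simp [h0.ne', q1], hL, ?_⟩
  refine IsSeg.of_le h0.le (fun s _ t _ => by simpa using hL s t) ?_
  simp only [zero_div, q0, div_self h0.ne', q1, sub_zero]
  exact le_rfl

end TorusMetric

namespace TorusMetric
variable (M : TorusMetric)

lemma g_sub_self (x v w : Pl) : M.g x (v - w) (v - w) =
    2 * M.g x v v + 2 * M.g x w w - M.g x (v + w) (v + w) := by
  simp [g_eq]; ring

lemma nrm_le_integral (z : Pl) {c : ℝ → Pl} (hc : ContDiff ℝ 1 c) :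
    M.nrm z (c 1 - c 0) ≤ ∫ t in (0 : ℝ)..1, M.nrm z (deriv c t) := by
  set u := c 1 - c 0
  have hc' := hc.continuous_deriv le_rfl
  have hd : ∀ t, HasDerivAt (fun t => M.g z (c t) u) (M.g z (deriv c t) u) t := fun t => by
    have h := (hc.differentiable one_ne_zero t).hasDerivAt
    have h1 : HasDerivAt (fun t => (c t).1) (deriv c t).1 t := h.fst
    have h2 : HasDerivAt (fun t => (c t).2) (deriv c t).2 t := h.snd
    simp only [g_eq]
    exact (((h1.mul_const _).const_mul _).add (((h1.mul_const _).add (h2.mul_const _)).const_mul _)).add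
      ((h2.mul_const _).const_mul _)
  have e : ∫ t in (0 : ℝ)..1, M.g z (deriv c t) u = M.g z u u := by
    rw [intervalIntegral.integral_eq_sub_of_hasDerivAt (fun t _ => hd t)
      ((M.continuous_g continuous_const hc' continuous_const).intervalIntegrable _ _)]
    simp [g_eq, u]; ring
  have h : ∫ t in (0 : ℝ)..1, M.g z (deriv c t) u ≤
      ∫ t in (0 : ℝ)..1, M.nrm z (deriv c t) * M.nrm z u :=
    intervalIntegral.integral_mono_on zero_le_one
      ((M.continuous_g continuous_const hc' continuous_const).intervalIntegrable _ _)
      (((M.continuous_nrm continuous_const hc').mul continuous_const).intervalIntegrable _ _)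
      fun t _ => (le_abs_self _).trans (M.g_le_nrm _ _ _)
  rw [e, ← nrm_sq, intervalIntegral.integral_mul_const] at h
  rcases (M.nrm_nonneg z u).eq_or_lt with h0 | h0
  · rw [← h0]; exact intervalIntegral.integral_nonneg zero_le_one fun t _ => M.nrm_nonneg _ _
  · nlinarith

/-- First-order comparison of the distance with a fixed tangent norm. -/
lemma abs_nrm_sub_dist_le (x y z : Pl) :
    |M.nrm z (y - x) - M.dist x y| ≤ M.K ^ 3 * (‖x - z‖ + M.dist x y) * M.dist x y := by
  have hK := M.one_le_K
  have hd := M.dist_nonneg x y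
  have hK0 := M.K_pos
  have hr := norm_nonneg (x - z)
  have hK2 : M.K ^ 2 ≤ M.K ^ 3 := pow_le_pow_right₀ hK (by norm_num)
  have hfin : M.K * (‖x - z‖ + M.K * M.dist x y) * (M.K * M.dist x y) ≤
      M.K ^ 3 * (‖x - z‖ + M.dist x y) * M.dist x y := by
    have : M.K ^ 2 * (‖x - z‖ * M.dist x y) ≤ M.K ^ 3 * (‖x - z‖ * M.dist x y) := by gcongr
    nlinarith
  rw [abs_le]
  constructor
  · have hl := contDiff_lin x y (n := 1)
    have h := dist_le_length (M := M) hl zero_le_one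
    rw [lin_zero, lin_one] at h
    have hb : ∀ t ∈ Icc (0 : ℝ) 1, M.spd (lin x y) t ≤
        M.nrm z (y - x) + M.K * (‖x - z‖ + M.K * M.dist x y) * (M.K * M.dist x y) := by
      intro t ht
      rw [spd, (hasDerivAt_lin x y t).deriv]
      have h1 := (abs_le.1 (M.abs_nrm_sub_le (lin x y t) z (y - x))).2
      have h2 : ‖y - x‖ ≤ M.K * M.dist x y := by rw [norm_sub_rev]; exact M.norm_sub_le_dist x y
      have h3 : ‖lin x y t - z‖ ≤ ‖x - z‖ + M.K * M.dist x y := by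
        have : lin x y t - z = (x - z) + t • (y - x) := by simp only [lin]; abel
        rw [this]
        refine (norm_add_le _ _).trans ?_
        rw [norm_smul, Real.norm_eq_abs, abs_of_nonneg ht.1]
        nlinarith [ht.2, norm_nonneg (y - x)]
      have : M.K * ‖lin x y t - z‖ * ‖y - x‖ ≤
        M.K * (‖x - z‖ + M.K * M.dist x y) * (M.K * M.dist x y) := by gcongr
      linarith
    have := intervalIntegral.integral_mono_on (μ := MeasureTheory.volume) zero_le_one
      ((continuous_spd (M := M) hl).intervalIntegrable 0 1)
      ((continuous_const (y := M.nrm z (y - x) +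
        M.K * (‖x - z‖ + M.K * M.dist x y) * (M.K * M.dist x y))).intervalIntegrable _ _) hb
    rw [← length_eq] at this
    simp only [intervalIntegral.integral_const, sub_zero, one_smul] at this
    linarith
  · have key : ∀ e > 0, M.nrm z (y - x) ≤ (M.dist x y + e) +
        M.K * (‖x - z‖ + M.K * (M.dist x y + e)) * (M.K * (M.dist x y + e)) := by
      intro e he
      obtain ⟨c, c1, c2, c3, c4⟩ := M.exists_near x y he
      have h := M.nrm_le_integral z c1
      rw [c2, c3] at h
      set ℓ := M.dist x y + e
      have hℓ : 0 < ℓ := by positivity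
      have hb : ∀ t ∈ Icc (0 : ℝ) 1, M.nrm z (deriv c t) ≤
          (1 + M.K * (‖x - z‖ + M.K * ℓ) * M.K) * M.spd c t := by
        intro t ht
        have h1 := (abs_le.1 (M.abs_nrm_sub_le (c t) z (deriv c t))).1
        have h2 : ‖deriv c t‖ ≤ M.K * M.spd c t := M.norm_le_nrm _ _
        have h3 : ‖c t - z‖ ≤ ‖x - z‖ + M.K * ℓ := by
          have h5 := norm_sub_le_length (M := M) c1 ht.1
          have h6 := length_add (M := M) c1 0 t 1
          have h7 := length_nonneg (M := M) c ht.2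
          rw [c2] at h5
          have h8 : c t - z = (x - z) + (c t - x) := by abel
          rw [h8]
          refine (norm_add_le _ _).trans ?_
          have : M.K * M.length c 0 t ≤ M.K * ℓ := by gcongr; linarith
          linarith
        have : M.K * ‖c t - z‖ * ‖deriv c t‖ ≤
          M.K * (‖x - z‖ + M.K * ℓ) * (M.K * M.spd c t) := by gcongr
        change -_ ≤ M.spd c t - _ at h1
        nlinarith
      have := intervalIntegral.integral_mono_on (μ := MeasureTheory.volume) zero_le_one
        ((M.continuous_nrm (continuous_const (y := z)) (c1.continuous_deriv le_rfl)).intervalIntegrable 0 1)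
        ((continuous_spd (M := M) c1).const_mul (1 + M.K * (‖x - z‖ + M.K * ℓ) * M.K)
          |>.intervalIntegrable _ _) hb
      rw [intervalIntegral.integral_const_mul, ← length_eq] at this
      have h9 : (1 + M.K * (‖x - z‖ + M.K * ℓ) * M.K) * M.length c 0 1 ≤
        (1 + M.K * (‖x - z‖ + M.K * ℓ) * M.K) * ℓ := by gcongr
      nlinarith
    have hlim : Tendsto (fun e => (M.dist x y + e) +
        M.K * (‖x - z‖ + M.K * (M.dist x y + e)) * (M.K * (M.dist x y + e))) (𝓝[>] 0)
        (𝓝 ((M.dist x y + 0) +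
        M.K * (‖x - z‖ + M.K * (M.dist x y + 0)) * (M.K * (M.dist x y + 0)))) := by
      apply Tendsto.mono_left _ nhdsWithin_le_nhds
      apply Continuous.tendsto
      fun_prop
    have := ge_of_tendsto hlim (by filter_upwards [self_mem_nhdsWithin] with e he using key e he)
    simp only [add_zero] at this
    linarith

lemma second_diff_le {c : ℝ → Pl} {t h : ℝ} (h0 : 0 < h) (hh : 6 * M.K ^ 4 * h ≤ 1)
    (hc : M.IsSeg c (Icc (t - h) (t + h))) :
    ‖c (t + h) - (2 : ℝ) • c t + c (t - h)‖ ^ 2 ≤ (96 * M.K ^ 6) * h ^ 3 := by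
  have hK := M.one_le_K
  have hK0 := M.K_pos
  have m0 : t ∈ Icc (t - h) (t + h) := ⟨by linarith, by linarith⟩
  have m1 : t - h ∈ Icc (t - h) (t + h) := ⟨by linarith, by linarith⟩
  have m2 : t + h ∈ Icc (t - h) (t + h) := ⟨by linarith, by linarith⟩
  have d1 : M.dist (c (t - h)) (c t) = h := by
    rw [hc _ m1 _ m0, abs_of_nonpos (by linarith)]; ring
  have d2 : M.dist (c t) (c (t + h)) = h := by
    rw [hc _ m0 _ m2, abs_of_nonpos (by linarith)]; ring
  have d3 : M.dist (c (t - h)) (c (t + h)) = 2 * h := by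
    rw [hc _ m1 _ m2, abs_of_nonpos (by linarith)]; ring
  set u := c t - c (t - h)
  set v := c (t + h) - c t
  have e1 := (abs_le.1 (M.abs_nrm_sub_dist_le (c (t - h)) (c t) (c t))).2
  have e2 := (abs_le.1 (M.abs_nrm_sub_dist_le (c t) (c (t + h)) (c t))).2
  have e3 := (abs_le.1 (M.abs_nrm_sub_dist_le (c (t - h)) (c (t + h)) (c t))).1
  have n1 : ‖c (t - h) - c t‖ ≤ M.K * h := (M.norm_sub_le_dist _ _).trans_eq (by rw [d1])
  rw [d1] at e1
  rw [d2, sub_self, norm_zero] at e2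
  rw [d3, show c (t + h) - c (t - h) = v + u by simp [u, v]] at e3
  have hp1 : M.K ^ 3 * (‖c (t - h) - c t‖ + h) * h ≤ 2 * M.K ^ 4 * h * h := by
    have : M.K ^ 3 * (‖c (t - h) - c t‖ + h) ≤ M.K ^ 3 * (M.K * h + M.K * h) := by
      gcongr; nlinarith
    nlinarith
  have hp2 : M.K ^ 3 * (0 + h) * h ≤ 2 * M.K ^ 4 * h * h := by
    have : M.K ^ 3 ≤ M.K ^ 4 := pow_le_pow_right₀ hK (by norm_num)
    have : M.K ^ 3 * (h * h) ≤ M.K ^ 4 * (h * h) := by gcongr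
    nlinarith [show 0 < M.K ^ 4 * (h * h) by positivity]
  have hp3 : M.K ^ 3 * (‖c (t - h) - c t‖ + 2 * h) * (2 * h) ≤ 6 * M.K ^ 4 * h * (2 * h) * (1 / 2) := by
    have : M.K ^ 3 * (‖c (t - h) - c t‖ + 2 * h) ≤ M.K ^ 3 * (M.K * h + 2 * (M.K * h)) := by
      gcongr; nlinarith
    nlinarith
  set δ := 6 * M.K ^ 4 * h
  have hδ : 0 < δ := by positivity
  have f1 : M.nrm (c t) u ≤ h * (1 + δ) := by
    have : M.nrm (c t) u - h ≤ 2 * M.K ^ 4 * h * h := e1.trans hp1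
    nlinarith
  have f2 : M.nrm (c t) v ≤ h * (1 + δ) := by
    have : M.nrm (c t) v - h ≤ 2 * M.K ^ 4 * h * h := e2.trans hp2
    nlinarith
  have f3 : 2 * h * (1 - δ) ≤ M.nrm (c t) (v + u) := by nlinarith
  have g1 := M.g_sub_self (c t) v u
  rw [← nrm_sq, ← nrm_sq, ← nrm_sq, ← nrm_sq] at g1
  have q1 : M.nrm (c t) u ^ 2 ≤ (h * (1 + δ)) ^ 2 := pow_le_pow_left₀ (M.nrm_nonneg _ _) f1 2
  have q2 : M.nrm (c t) v ^ 2 ≤ (h * (1 + δ)) ^ 2 := pow_le_pow_left₀ (M.nrm_nonneg _ _) f2 2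
  have q3 : (2 * h * (1 - δ)) ^ 2 ≤ M.nrm (c t) (v + u) ^ 2 :=
    pow_le_pow_left₀ (mul_nonneg (by linarith) (by linarith)) f3 2
  have q4 : M.nrm (c t) (v - u) ^ 2 ≤ 16 * h ^ 2 * δ := by nlinarith
  have e : c (t + h) - (2 : ℝ) • c t + c (t - h) = v - u := by simp only [u, v]; module
  rw [e]
  calc ‖v - u‖ ^ 2 ≤ (M.K * M.nrm (c t) (v - u)) ^ 2 :=
        pow_le_pow_left₀ (norm_nonneg _) (M.norm_le_nrm _ _) 2
    _ = M.K ^ 2 * M.nrm (c t) (v - u) ^ 2 := by ring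
    _ ≤ M.K ^ 2 * (16 * h ^ 2 * δ) := by gcongr
    _ = _ := by simp only [δ]; ring

end TorusMetric

section SecondDifferences

/-- A continuous curve whose second differences are `O(h ^ (3/2))` is continuously
differentiable. -/
lemma differentiable_of_second_diff {E : Type*} [NormedAddCommGroup E] [NormedSpace ℝ E]
    [CompleteSpace E] {c : ℝ → E} (hc : Continuous c) {a b C h₀ : ℝ} (hC : 0 ≤ C) (h₀p : 0 < h₀)
    (H : ∀ t h, 0 < h → h ≤ h₀ → a < t - h → t + h < b →
      ‖c (t + h) - (2 : ℝ) • c t + c (t - h)‖ ^ 2 ≤ C * h ^ 3) {t₀ : ℝ} (ht₀ : t₀ ∈ Ioo a b) :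
    DifferentiableAt ℝ c t₀ ∧ ContinuousAt (deriv c) t₀ := by
  obtain ⟨a', ha', ha2⟩ := exists_between ht₀.1
  obtain ⟨b', hb2, hb'⟩ := exists_between ht₀.2
  obtain ⟨N, hN⟩ : ∃ N : ℕ, (1 / 2 : ℝ) ^ N < min h₀ (b - b') :=
    exists_pow_lt_of_lt_one (lt_min h₀p (by linarith)) (by norm_num)
  rw [lt_min_iff] at hN
  set θ := Real.sqrt (1 / 2)
  have hθ : θ ^ 2 = 1 / 2 := Real.sq_sqrt (by norm_num)
  have hθ0 : 0 ≤ θ := Real.sqrt_nonneg _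
  have hθ1 : θ < 1 := by nlinarith
  let η : ℕ → ℝ := fun n => (1 / 2 : ℝ) ^ (N + n)
  have hη : ∀ n, 0 < η n := fun n => by positivity
  have hη1 : ∀ n, η (n + 1) = η n / 2 := fun n => by simp only [η]; rw [← add_assoc, pow_succ]; ring
  have hηN : ∀ n, η n ≤ (1 / 2 : ℝ) ^ N := fun n =>
    pow_le_pow_of_le_one (by norm_num) (by norm_num) (Nat.le_add_right _ _)
  have hηθ : ∀ n, η n ≤ (θ ^ n) ^ 2 := fun n => by
    rw [← pow_mul, mul_comm, pow_mul, hθ]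
    exact pow_le_pow_of_le_one (by norm_num) (by norm_num) (Nat.le_add_left _ _)
  have hηlim : Tendsto η atTop (𝓝 0) := by
    have := (tendsto_pow_atTop_nhds_zero_of_lt_one (r := (1 / 2 : ℝ)) (by norm_num)
      (by norm_num)).comp (tendsto_add_atTop_nat N)
    refine this.congr fun n => ?_
    simp [η, add_comm]
  let q : ℕ → ℝ → E := fun n t => (η n)⁻¹ • (c (t + η n) - c t)
  have qcont : ∀ n, Continuous (q n) := fun n => by simp only [q]; fun_prop
  have hq : ∀ t ∈ Icc a' b', ∀ n, dist (q n t) (q (n + 1) t) ≤ Real.sqrt C * θ ^ n := by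
    intro t ht n
    have h1 := H (t + η (n + 1)) (η (n + 1)) (hη _) ((hηN _).trans hN.1.le)
      (by linarith [ht.1]) (by
        have := hηN n; rw [hη1]; linarith [ht.2, hN.2])
    rw [add_sub_cancel_right, add_assoc, hη1, add_halves, ← hη1] at h1
    have h2 : q n t - q (n + 1) t =
        (η n)⁻¹ • (c (t + η n) - (2 : ℝ) • c (t + η (n + 1)) + c t) := by
      simp only [q]
      rw [hη1, inv_div, div_eq_mul_inv, mul_smul, smul_comm (2 : ℝ), ← smul_sub]
      congr 1; module
    rw [dist_eq_norm, h2, norm_smul, norm_inv, Real.norm_eq_abs, abs_of_pos (hη n),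
      inv_mul_le_iff₀ (hη n)]
    refine abs_le_of_sq_le_sq' (h1.trans ?_) (by positivity) |>.2
    rw [mul_pow, mul_pow, Real.sq_sqrt hC, hη1]
    have h3 : (η n) ^ 2 * η n ≤ (η n) ^ 2 * (θ ^ n) ^ 2 := by gcongr; exact hηθ n
    have h4 : C * ((η n) ^ 2 * η n) ≤ C * ((η n) ^ 2 * (θ ^ n) ^ 2) := by gcongr
    have h5 : 0 ≤ C * ((η n) ^ 2 * η n) := by have := hη n; positivity
    nlinarith
  have hlim : ∀ t ∈ Icc a' b', ∃ p, Tendsto (fun n => q n t) atTop (𝓝 p) := fun t ht =>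
    cauchySeq_tendsto_of_complete (cauchySeq_of_le_geometric θ _ hθ1 (hq t ht))
  choose! p hp using hlim
  have hunif : TendstoUniformlyOn q p atTop (Icc a' b') := by
    rw [Metric.tendstoUniformlyOn_iff]
    intro e he
    have : Tendsto (fun n => Real.sqrt C * θ ^ n / (1 - θ)) atTop (𝓝 0) := by
      simpa using ((tendsto_pow_atTop_nhds_zero_of_lt_one hθ0 hθ1).const_mul
        (Real.sqrt C)).div_const (1 - θ)
    filter_upwards [this.eventually_lt_const he] with n hn t ht
    rw [dist_comm]
    exact (dist_le_of_le_geometric_of_tendsto θ _ hθ1 (hq t ht) (hp t ht) n).trans_lt hn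
  have pcont : ContinuousOn p (Icc a' b') :=
    hunif.continuousOn (Frequently.of_forall fun n => (qcont n).continuousOn)
  have hab : a' ≤ b' := (ha2.trans hb2).le
  have hint : ∀ t ∈ Icc a' b', ∫ r in a'..t, p r = c t - c a' := by
    intro t ht
    have hsub : uIcc a' t ⊆ Icc a' b' := by
      rw [uIcc_of_le ht.1]; exact Icc_subset_Icc_right ht.2
    have h1 : Tendsto (fun n => ∫ r in a'..t, q n r) atTop (𝓝 (∫ r in a'..t, p r)) := by
      rw [Metric.tendsto_atTop]
      intro e he
      obtain ⟨n₀, hn₀⟩ := eventually_atTop.1 ((Metric.tendstoUniformlyOn_iff.1 hunif)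
        (e / (|t - a'| + 1)) (by positivity))
      refine ⟨n₀, fun n hn => ?_⟩
      rw [dist_eq_norm, ← intervalIntegral.integral_sub ((qcont n).intervalIntegrable _ _)
        (pcont.mono hsub).intervalIntegrable]
      have h2 := intervalIntegral.norm_integral_le_of_norm_le_const (a := a') (b := t)
        (f := fun r => q n r - p r) (C := e / (|t - a'| + 1)) (fun r hr => by
          rw [← dist_eq_norm, dist_comm]
          exact (hn₀ n hn r (hsub (uIoc_subset_uIcc hr))).le)
      refine h2.trans_lt ?_
      rw [div_mul_eq_mul_div, div_lt_iff₀ (by positivity)]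
      nlinarith
    have h2 : ∀ n, ∫ r in a'..t, q n r = (η n)⁻¹ • (∫ r in t..(t + η n), c r) -
        (η n)⁻¹ • (∫ r in a'..(a' + η n), c r) := by
      intro n
      simp only [q]
      rw [intervalIntegral.integral_smul, ← smul_sub, intervalIntegral.integral_sub
        ((by fun_prop : Continuous fun r => c (r + η n)).intervalIntegrable _ _)
        (hc.intervalIntegrable _ _), intervalIntegral.integral_comp_add_right]
      congr 1
      exact intervalIntegral.integral_interval_sub_interval_comm' (hc.intervalIntegrable _ _)
        (hc.intervalIntegrable _ _) (hc.intervalIntegrable _ _)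
    have h3 : ∀ s, Tendsto (fun n => (η n)⁻¹ • (∫ r in s..(s + η n), c r)) atTop (𝓝 (c s)) := by
      intro s
      have h4 := (intervalIntegral.integral_hasDerivAt_right (hc.intervalIntegrable s s)
        (hc.stronglyMeasurableAtFilter _ _) hc.continuousAt).tendsto_slope_zero
      have h5 : Tendsto η atTop (𝓝[≠] 0) :=
        tendsto_nhdsWithin_iff.2 ⟨hηlim, Eventually.of_forall fun n => (hη n).ne'⟩
      refine (h4.comp h5).congr fun n => ?_
      simp
    refine tendsto_nhds_unique h1 ?_
    simp_rw [h2]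
    exact (h3 t).sub (h3 a')
  have hder : ∀ t ∈ Ioo a' b', HasDerivAt c (p t) t := by
    intro t ht
    have hmem : Icc a' b' ∈ 𝓝 t := Icc_mem_nhds ht.1 ht.2
    have h1 : HasDerivAt (fun t => ∫ r in a'..t, p r) (p t) t := by
      refine intervalIntegral.integral_hasDerivAt_right
        ((pcont.mono ?_).intervalIntegrable) ?_ (pcont.continuousAt hmem)
      · rw [uIcc_of_le ht.1.le]; exact Icc_subset_Icc_right ht.2.le
      · exact (pcont.mono Ioo_subset_Icc_self).stronglyMeasurableAtFilter isOpen_Ioo t ht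
    have h2 : HasDerivAt (fun t => c a' + ∫ r in a'..t, p r) (p t) t := h1.const_add _
    refine h2.congr_of_eventuallyEq ?_
    filter_upwards [hmem] with s hs
    rw [hint s hs]; abel
  have hmem : Ioo a' b' ∈ 𝓝 t₀ := isOpen_Ioo.mem_nhds ⟨ha2, hb2⟩
  refine ⟨(hder t₀ ⟨ha2, hb2⟩).differentiableAt, ?_⟩
  refine (pcont.continuousAt (Icc_mem_nhds ha2 hb2)).congr ?_
  filter_upwards [hmem] with s hs
  exact (hder s hs).deriv.symm

end SecondDifferences

lemma periodic_taylor {f : Pl → ℝ} (hf : ContDiff ℝ 2 f) (hp : ∀ k x, f (x + lat k) = f x) :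
    ∃ C, 0 ≤ C ∧ (∀ x, ‖fderiv ℝ f x‖ ≤ C) ∧
      ∀ x u, |f (x + u) - f x - fderiv ℝ f x u| ≤ C * ‖u‖ ^ 2 := by
  obtain ⟨C, hC, hCb, hCl⟩ := periodic_lipschitz (f := fderiv ℝ f)
    (hf.fderiv_right (m := 1) (by norm_num)) (fun k x => by
      rw [← fderiv_comp_add_right]; simp_rw [hp])
  refine ⟨C, hC, hCb, fun x u => ?_⟩
  have h := (convex_closedBall x ‖u‖).norm_image_sub_le_of_norm_fderiv_le' (𝕜 := ℝ) (f := f)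
    (φ := fderiv ℝ f x) (C := C * ‖u‖) (x := x) (y := x + u)
    (fun y _ => hf.differentiable two_ne_zero y) (fun y hy => ?_) (by simp) (by simp)
  · simpa [sq, mul_assoc] using h
  · refine (hCl y x).trans ?_
    rw [mem_closedBall_iff_norm] at hy
    gcongr

namespace TorusMetric
variable (M : TorusMetric)

/-- The derivative of `x ↦ g x v v` in the direction `u`. -/
def dg (x u v : Pl) : ℝ := fderiv ℝ M.cA x u * (v.1 * v.1) +
  fderiv ℝ M.cB x u * (v.1 * v.2 + v.2 * v.1) + fderiv ℝ M.cC x u * (v.2 * v.2)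

lemma exists_lag_taylor : ∃ T : ℝ, 0 < T ∧
    ∀ (x u v w : Pl) (R : ℝ), R ≤ 1 → ‖u‖ ≤ R → ‖w‖ ≤ R → ‖v‖ ≤ M.K →
      M.g (x + u) (v + w) (v + w) ≤
        M.g x v v + M.dg x u v + 2 * M.g x v w + T * R ^ 2 := by
  obtain ⟨A, hA0, hA, hA'⟩ := periodic_taylor (M.contDiff_cA (n := 2)) M.cA_per
  obtain ⟨B, hB0, hB, hB'⟩ := periodic_taylor (M.contDiff_cB (n := 2)) M.cB_per
  obtain ⟨C, hC0, hC, hC'⟩ := periodic_taylor (M.contDiff_cC (n := 2)) M.cC_per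
  have hK := M.K_pos
  set L := A + B + C + 1
  have hL : 0 < L := by positivity
  have hop : ∀ {f : Pl → ℝ} {c : ℝ} (x u : Pl), ‖fderiv ℝ f x‖ ≤ c → c ≤ L →
      |fderiv ℝ f x u| ≤ L * ‖u‖ := fun x u h hc =>
    ((fderiv ℝ _ x).le_opNorm u).trans (mul_le_mul_of_nonneg_right (h.trans hc) (norm_nonneg u))
  have lA : A ≤ L := by simp only [L]; linarith
  have lB : B ≤ L := by simp only [L]; linarith
  have lC : C ≤ L := by simp only [L]; linarith
  refine ⟨4 * L * (M.K + 1) ^ 2 + 4 * L * (2 * M.K + 1) + M.K + 4 * L, by positivity, ?_⟩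
  intro x u v w R hR1 hu hw hv
  have hR : 0 ≤ R := (norm_nonneg u).trans hu
  have hz : ‖v + w‖ ≤ M.K + 1 := (norm_add_le _ _).trans (by linarith)
  have hz2 : ‖(2 : ℝ) • v + w‖ ≤ 2 * M.K + 1 := by
    refine (norm_add_le _ _).trans ?_
    rw [norm_smul, Real.norm_eq_abs, abs_two]; linarith
  have hco : ∀ {f : Pl → ℝ} {c : ℝ}, (∀ x u, |f (x + u) - f x - fderiv ℝ f x u| ≤ c * ‖u‖ ^ 2) →
      c ≤ L → |f (x + u) - f x - fderiv ℝ f x u| ≤ L * R ^ 2 := fun h hc =>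
    (h x u).trans (by gcongr)
  have h1 := form_bound (hco hA' lA) (hco hB' lB) (hco hC' lC) (v + w) (v + w)
  have h2 := form_bound (hop x u (hA x) lA) (hop x u (hB x) lB) (hop x u (hC x) lC) w ((2:ℝ) • v + w)
  have h3 := M.abs_g_le x w w
  have h1' : 4 * (L * R ^ 2) * ‖v + w‖ * ‖v + w‖ ≤ 4 * L * (M.K + 1) ^ 2 * R ^ 2 := by
    calc _ ≤ 4 * (L * R ^ 2) * (M.K + 1) * (M.K + 1) := by gcongr
      _ = _ := by ring
  have h2' : 4 * (L * ‖u‖) * ‖w‖ * ‖(2:ℝ) • v + w‖ ≤ 4 * L * (2 * M.K + 1) * R ^ 2 := by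
    calc _ ≤ 4 * (L * R) * R * (2 * M.K + 1) := by gcongr
      _ = _ := by ring
  have h3' : M.K * ‖w‖ * ‖w‖ ≤ M.K * R ^ 2 := by
    calc _ ≤ M.K * R * R := by gcongr
      _ = _ := by ring
  have h1'' := (abs_le.1 h1).2
  have h2'' := (abs_le.1 h2).2
  have h3'' := (abs_le.1 h3).2
  have e : M.g (x + u) (v + w) (v + w) = M.g x v v + M.dg x u v + 2 * M.g x v w +
      (((M.cA (x + u) - M.cA x - fderiv ℝ M.cA x u) * ((v + w).1 * (v + w).1) +
        (M.cB (x + u) - M.cB x - fderiv ℝ M.cB x u) * ((v + w).1 * (v + w).2 + (v + w).2 * (v + w).1)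
        + (M.cC (x + u) - M.cC x - fderiv ℝ M.cC x u) * ((v + w).2 * (v + w).2)) +
      (fderiv ℝ M.cA x u * (w.1 * ((2:ℝ) • v + w).1) +
        fderiv ℝ M.cB x u * (w.1 * ((2:ℝ) • v + w).2 + w.2 * ((2:ℝ) • v + w).1) +
        fderiv ℝ M.cC x u * (w.2 * ((2:ℝ) • v + w).2)) + M.g x w w) := by
    simp [g_eq, dg]; ring
  rw [e]
  have : 0 ≤ 4 * L * R ^ 2 := by positivity
  nlinarith

/-- Constant in the second-order expansion of the energy density. -/
def T : ℝ := M.exists_lag_taylor.choose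
lemma T_pos : 0 < M.T := M.exists_lag_taylor.choose_spec.1
lemma lag_taylor {x u v w : Pl} {R : ℝ} (hR : R ≤ 1) (hu : ‖u‖ ≤ R) (hw : ‖w‖ ≤ R)
    (hv : ‖v‖ ≤ M.K) : M.g (x + u) (v + w) (v + w) ≤
      M.g x v v + M.dg x u v + 2 * M.g x v w + M.T * R ^ 2 :=
  M.exists_lag_taylor.choose_spec.2 x u v w R hR hu hw hv

lemma continuous_dg {X : Type*} [TopologicalSpace X] {f u v : X → Pl} (hf : Continuous f)
    (hu : Continuous u) (hv : Continuous v) : Continuous fun t => M.dg (f t) (u t) (v t) := by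
  have h1 := ((M.contDiff_cA (n := 1)).continuous_fderiv one_ne_zero).comp hf
  have h2 := ((M.contDiff_cB (n := 1)).continuous_fderiv one_ne_zero).comp hf
  have h3 := ((M.contDiff_cC (n := 1)).continuous_fderiv one_ne_zero).comp hf
  have h1' := h1.clm_apply hu
  have h2' := h2.clm_apply hu
  have h3' := h3.clm_apply hu
  simp only [Function.comp] at h1' h2' h3'
  unfold dg
  fun_prop

/-- Upper first-variation estimate for the distance of the endpoints of a unit speed curve. -/
lemma dist_variation_le {c φ : ℝ → Pl} (hc : ContDiff ℝ 1 c) (hφ : ContDiff ℝ 1 φ) {a b R : ℝ}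
    (hab : a ≤ b) (hR : R ≤ 1) (hs : ∀ t ∈ Icc a b, M.g (c t) (deriv c t) (deriv c t) = 1)
    (h0 : ∀ t ∈ Icc a b, ‖φ t‖ ≤ R) (h1 : ∀ t ∈ Icc a b, ‖deriv φ t‖ ≤ R) :
    M.dist (c a + φ a) (c b + φ b) ≤ (b - a) + (∫ t in a..b, (M.dg (c t) (φ t) (deriv c t) / 2 +
      M.g (c t) (deriv c t) (deriv φ t))) + M.T * R ^ 2 * (b - a) := by
  have hsum : ContDiff ℝ 1 fun t => c t + φ t := hc.add hφ
  have hd : ∀ t, deriv (fun t => c t + φ t) t = deriv c t + deriv φ t := fun t =>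
    deriv_fun_add (hc.differentiable one_ne_zero t) (hφ.differentiable one_ne_zero t)
  have cc := hc.continuous
  have cc' := hc.continuous_deriv le_rfl
  have cφ := hφ.continuous
  have cφ' := hφ.continuous_deriv le_rfl
  have i1 := M.continuous_dg cc cφ cc'
  have i2 := M.continuous_g cc cc' cφ'
  refine (dist_le_length hsum hab).trans ?_
  have hmono : M.length (fun t => c t + φ t) a b ≤ ∫ t in a..b, (1 + (M.dg (c t) (φ t) (deriv c t) / 2
      + M.g (c t) (deriv c t) (deriv φ t)) + M.T * R ^ 2) := by
    rw [length_eq]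
    refine intervalIntegral.integral_mono_on (μ := MeasureTheory.volume) hab
      ((continuous_spd hsum).intervalIntegrable _ _)
      ((by fun_prop : Continuous _).intervalIntegrable _ _) fun t ht => ?_
    have hv : ‖deriv c t‖ ≤ M.K := by
      have := M.norm_le_nrm (c t) (deriv c t)
      rwa [nrm, hs t ht, Real.sqrt_one, mul_one] at this
    have h := M.lag_taylor (x := c t) hR (h0 t ht) (h1 t ht) hv
    rw [hs t ht] at h
    have h2 := M.nrm_sq (c t + φ t) (deriv c t + deriv φ t)
    have h3 : 0 ≤ M.T * R ^ 2 := mul_nonneg M.T_pos.le (sq_nonneg R)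
    rw [spd, hd]
    nlinarith [sq_nonneg (M.nrm (c t + φ t) (deriv c t + deriv φ t) - 1)]
  refine hmono.trans (le_of_eq ?_)
  rw [intervalIntegral.integral_add ((by fun_prop : Continuous _).intervalIntegrable _ _)
    (continuous_const.intervalIntegrable _ _), intervalIntegral.integral_add
    (continuous_const.intervalIntegrable _ _) ((by fun_prop : Continuous _).intervalIntegrable _ _)]
  simp; ring

end TorusMetric

/-- A curve which is continuously differentiable near a compact interval agrees there with a
globally continuously differentiable one. -/
lemma exists_contDiff_extension {c : ℝ → Pl} {a b : ℝ} (hab : a ≤ b)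
    (h : ∀ t ∈ Icc a b, DifferentiableAt ℝ c t ∧ ContinuousAt (deriv c) t) :
    ∃ e : ℝ → Pl, ContDiff ℝ 1 e ∧ ∀ t ∈ Icc a b, e t = c t ∧ deriv e t = deriv c t := by
  set q : ℝ → Pl := fun t => deriv c (clamp a b t)
  have hq : Continuous q := continuous_iff_continuousAt.2 fun t =>
    ContinuousAt.comp (h _ (clamp_mem hab t)).2 (continuous_clamp a b).continuousAt
  set e : ℝ → Pl := fun t => c a + ∫ r in a..t, q r
  have he : ∀ t, HasDerivAt e (q t) t := fun t =>
    (intervalIntegral.integral_hasDerivAt_right (hq.intervalIntegrable _ _)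
      (hq.stronglyMeasurableAtFilter _ _) hq.continuousAt).const_add _
  have hd : deriv e = q := funext fun t => (he t).deriv
  refine ⟨e, contDiff_one_iff_deriv.2 ⟨fun t => (he t).differentiableAt, hd ▸ hq⟩, fun t ht => ?_⟩
  constructor
  · have hsub : ∀ r ∈ uIcc a t, r ∈ Icc a b := fun r hr => by
      rw [uIcc_of_le ht.1] at hr; exact ⟨hr.1, hr.2.trans ht.2⟩
    have h1 : ∫ r in a..t, q r = ∫ r in a..t, deriv c r :=
      intervalIntegral.integral_congr fun r hr => by simp only [q, clamp_eq (hsub r hr)]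
    have h2 : ∫ r in a..t, deriv c r = c t - c a :=
      intervalIntegral.integral_deriv_eq_sub (fun r hr => (h r (hsub r hr)).1)
        (ContinuousOn.intervalIntegrable fun r hr => (h r (hsub r hr)).2.continuousWithinAt)
    simp only [e, h1, h2]; abel
  · rw [hd]; simp only [q, clamp_eq ht]

namespace TorusMetric
variable {M : TorusMetric}

lemma IsSeg.continuousOn {c : ℝ → Pl} {I : Set ℝ} (h : M.IsSeg c I) : ContinuousOn c I := by
  refine LipschitzOnWith.continuousOn (K := M.K.toNNReal) (LipschitzOnWith.of_dist_le_mul ?_)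
  intro s hs t ht
  rw [Real.coe_toNNReal _ M.K_pos.le, dist_eq_norm, Real.dist_eq, ← h s hs t ht]
  exact M.norm_sub_le_dist _ _

lemma IsSeg.differentiable {c : ℝ → Pl} {a b t : ℝ} (hc : M.IsSeg c (Icc a b)) (ht : t ∈ Ioo a b) :
    DifferentiableAt ℝ c t ∧ ContinuousAt (deriv c) t := by
  have hab := ht.1.le.trans ht.2.le
  have hK := M.K_pos
  set e : ℝ → Pl := fun t => c (clamp a b t)
  have he : Continuous e := hc.continuousOn.comp_continuous (continuous_clamp a b)
    fun s => clamp_mem hab s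
  have hec : ∀ s ∈ Icc a b, e s = c s := fun s hs => by simp only [e, clamp_eq hs]
  have := differentiable_of_second_diff he (a := a) (b := b) (C := 96 * M.K ^ 6)
    (h₀ := 1 / (6 * M.K ^ 4)) (by positivity) (by positivity) (fun s h h0 hh h1 h2 => by
      rw [hec _ ⟨by linarith, h2.le⟩, hec _ ⟨by linarith, by linarith⟩,
        hec _ ⟨h1.le, by linarith⟩]
      refine M.second_diff_le h0 ?_ (hc.mono (Icc_subset_Icc h1.le h2.le))
      rw [le_div_iff₀ (by positivity)] at hh
      linarith) ht
  have hee : e =ᶠ[𝓝 t] c := by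
    filter_upwards [Icc_mem_nhds ht.1 ht.2] with s hs using hec s hs
  exact ⟨hee.differentiableAt_iff.1 this.1, this.2.congr hee.deriv⟩

lemma IsSeg.unit_speed {c : ℝ → Pl} {a b t : ℝ} (hc : M.IsSeg c (Icc a b)) (ht : t ∈ Ioo a b) :
    M.g (c t) (deriv c t) (deriv c t) = 1 := by
  have hK := M.K_pos
  have hd := (hc.differentiable ht).1.hasDerivAt
  have h1 := hd.tendsto_slope_zero
  have h2 : Tendsto (fun h : ℝ => M.nrm (c t) (h⁻¹ • (c (t + h) - c t))) (𝓝[≠] 0)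
      (𝓝 (M.nrm (c t) (deriv c t))) :=
    ((M.continuous_nrm (continuous_const (y := c t)) continuous_id).tendsto _).comp h1
  have h3 : Tendsto (fun h : ℝ => M.nrm (c t) (h⁻¹ • (c (t + h) - c t))) (𝓝[≠] 0) (𝓝 1) := by
    have hz : Tendsto (fun h : ℝ => M.K ^ 3 * |h|) (𝓝[≠] 0) (𝓝 0) := by
      have : Continuous fun h : ℝ => M.K ^ 3 * |h| := by fun_prop
      simpa using (this.tendsto 0).mono_left nhdsWithin_le_nhds
    rw [tendsto_iff_dist_tendsto_zero]
    refine squeeze_zero' (Eventually.of_forall fun _ => _root_.dist_nonneg) ?_ hz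
    have hI : Icc (a - t) (b - t) ∈ 𝓝 (0 : ℝ) :=
      Icc_mem_nhds (by linarith [ht.1]) (by linarith [ht.2])
    filter_upwards [self_mem_nhdsWithin, mem_nhdsWithin_of_mem_nhds hI] with h (h0 : h ≠ 0) hh
    have hdist := hc t ⟨ht.1.le, ht.2.le⟩ (t + h) ⟨by linarith [hh.1], by linarith [hh.2]⟩
    have h4 := M.abs_nrm_sub_dist_le (c t) (c (t + h)) (c t)
    rw [hdist, show t - (t + h) = -h by ring, abs_neg, sub_self, norm_zero, zero_add] at h4
    have h5 : 0 < |h| := abs_pos.2 h0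
    rw [nrm_smul, Real.dist_eq, abs_inv, show |h|⁻¹ * M.nrm (c t) (c (t + h) - c t) - 1 =
      |h|⁻¹ * (M.nrm (c t) (c (t + h) - c t) - |h|) by field_simp, abs_mul, abs_inv, abs_abs,
      inv_mul_le_iff₀ h5]
    linarith
  have h4 := tendsto_nhds_unique h2 h3
  rw [← nrm_sq, h4, one_pow]

/-- The Euler–Lagrange equations of a minimizing segment. -/
lemma IsSeg.euler_lagrange {c : ℝ → Pl} {a b t : ℝ} (hc : M.IsSeg c (Icc a b)) (ht : t ∈ Ioo a b)
    (w : Pl) : HasDerivAt (fun s => M.g (c s) (deriv c s) w) (M.dg (c t) w (deriv c t) / 2) t := by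
  obtain ⟨a', ha', hat⟩ := exists_between ht.1
  obtain ⟨b', htb, hb'⟩ := exists_between ht.2
  have hab : a' < b' := hat.trans htb
  have hsub : ∀ s ∈ Icc a' b', s ∈ Ioo a b := fun s hs => ⟨ha'.trans_le hs.1, hs.2.trans_lt hb'⟩
  obtain ⟨e, he, hec⟩ := exists_contDiff_extension hab.le
    (fun s hs => hc.differentiable (hsub s hs))
  have hsp : ∀ s ∈ Icc a' b', M.g (e s) (deriv e s) (deriv e s) = 1 := fun s hs => by
    rw [(hec s hs).1, (hec s hs).2]; exact hc.unit_speed (hsub s hs)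
  have ce := he.continuous
  have ce' := he.continuous_deriv le_rfl
  set A : ℝ → ℝ := fun s => M.g (e s) (deriv e s) w
  set B : ℝ → ℝ := fun s => M.dg (e s) w (deriv e s) / 2
  have cA : Continuous A := M.continuous_g ce ce' continuous_const
  have cB : Continuous B := (M.continuous_dg ce continuous_const ce').div_const 2
  have key : ∀ ψ : ℝ → ℝ, ContDiff ℝ 1 ψ → ψ a' = 0 → ψ b' = 0 →
      0 ≤ ∫ s in a'..b', (B s * ψ s + A s * deriv ψ s) := by
    intro ψ hψ h0 h1
    obtain ⟨R, hR⟩ := (isCompact_Icc (a := a') (b := b')).exists_bound_of_continuousOn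
      ((hψ.continuous.smul (continuous_const (y := w))).continuousOn)
    obtain ⟨R', hR'⟩ := (isCompact_Icc (a := a') (b := b')).exists_bound_of_continuousOn
      (((hψ.continuous_deriv le_rfl).smul (continuous_const (y := w))).continuousOn)
    set Q := max R R' + 1
    have hQ0 : 0 < Q := by
      have := (norm_nonneg _).trans (hR a' ⟨le_rfl, hab.le⟩)
      have := le_max_left R R'
      simp only [Q]; linarith
    have hlim : Tendsto (fun ε : ℝ => (∫ s in a'..b', (B s * ψ s + A s * deriv ψ s)) +
        M.T * Q ^ 2 * (b' - a') * ε) (𝓝[>] 0)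
        (𝓝 (∫ s in a'..b', (B s * ψ s + A s * deriv ψ s))) := by
      have : Continuous fun ε : ℝ => (∫ s in a'..b', (B s * ψ s + A s * deriv ψ s)) +
        M.T * Q ^ 2 * (b' - a') * ε := by fun_prop
      simpa using (this.tendsto 0).mono_left nhdsWithin_le_nhds
    refine ge_of_tendsto hlim ?_
    filter_upwards [Ioo_mem_nhdsGT (show 0 < 1 / Q by positivity)] with ε hε
    have hφ : ContDiff ℝ 1 fun s => (ε * ψ s) • w := (contDiff_const.mul hψ).smul contDiff_const
    have hφd : ∀ s, deriv (fun s => (ε * ψ s) • w) s = (ε * deriv ψ s) • w := fun s =>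
      (((hψ.differentiable one_ne_zero s).hasDerivAt.const_mul ε).smul_const w).deriv
    have h2 := M.dist_variation_le he hφ (R := ε * Q) hab.le
      (by have := hε.2; rw [lt_div_iff₀ hQ0] at this; exact this.le) hsp
      (fun s hs => by
        rw [mul_smul, norm_smul, Real.norm_eq_abs, abs_of_pos hε.1]
        have : ‖ψ s • w‖ ≤ R := hR s hs
        have := le_max_left R R'
        have := hε.1
        gcongr; simp only [Q]; linarith)
      (fun s hs => by
        rw [hφd, mul_smul, norm_smul, Real.norm_eq_abs, abs_of_pos hε.1]
        have : ‖deriv ψ s • w‖ ≤ R' := hR' s hs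
        have := le_max_right R R'
        have := hε.1
        gcongr; simp only [Q]; linarith)
    have m1 : a' ∈ Icc a' b' := ⟨le_rfl, hab.le⟩
    have m2 : b' ∈ Icc a' b' := ⟨hab.le, le_rfl⟩
    simp only [h0, h1, mul_zero, zero_smul, add_zero] at h2
    rw [(hec _ m1).1, (hec _ m2).1, hc _ ⟨ha'.le, by linarith⟩ _ ⟨by linarith, hb'.le⟩,
      abs_sub_comm, abs_of_pos (by linarith)] at h2
    have h3 : (∫ t in a'..b', (M.dg (e t) ((ε * ψ t) • w) (deriv e t) / 2 +
        M.g (e t) (deriv e t) (deriv (fun s => (ε * ψ s) • w) t))) =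
        ε * ∫ s in a'..b', (B s * ψ s + A s * deriv ψ s) := by
      rw [← intervalIntegral.integral_const_mul]
      refine intervalIntegral.integral_congr fun s _ => ?_
      simp only [hφd, A, B, g_eq, dg, map_smul, smul_eq_mul, Prod.smul_fst, Prod.smul_snd]
      ring
    rw [h3] at h2
    have h4 : 0 ≤ ε * ((∫ s in a'..b', (B s * ψ s + A s * deriv ψ s)) +
        M.T * Q ^ 2 * (b' - a') * ε) := by linarith
    exact nonneg_of_mul_nonneg_right h4 hε.1
  -- du Bois-Reymond
  set β : ℝ → ℝ := fun s => ∫ r in a'..s, B r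
  have hβ : ∀ s, HasDerivAt β (B s) s := fun s =>
    intervalIntegral.integral_hasDerivAt_right (cB.intervalIntegrable _ _)
      (cB.stronglyMeasurableAtFilter _ _) cB.continuousAt
  have cβ : Continuous β := continuous_iff_continuousAt.2 fun s => (hβ s).continuousAt
  set m : ℝ := (∫ s in a'..b', (A s - β s)) / (b' - a')
  set δ : ℝ → ℝ := fun s => m - (A s - β s)
  have cδ : Continuous δ := by fun_prop
  set ψ : ℝ → ℝ := fun s => ∫ r in a'..s, δ r
  have hψ : ∀ s, HasDerivAt ψ (δ s) s := fun s =>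
    intervalIntegral.integral_hasDerivAt_right (cδ.intervalIntegrable _ _)
      (cδ.stronglyMeasurableAtFilter _ _) cδ.continuousAt
  have hψd : deriv ψ = δ := funext fun s => (hψ s).deriv
  have hψb : ψ b' = 0 := by
    simp only [ψ, δ]
    rw [intervalIntegral.integral_sub (continuous_const.intervalIntegrable _ _)
      ((by fun_prop : Continuous fun s => A s - β s).intervalIntegrable _ _),
      intervalIntegral.integral_const, smul_eq_mul]
    simp only [m]
    rw [mul_div_cancel₀ _ (by linarith), sub_self]
  have hψa : ψ a' = 0 := intervalIntegral.integral_same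
  have cψ : Continuous ψ := continuous_iff_continuousAt.2 fun s => (hψ s).continuousAt
  have h1 := key ψ (contDiff_one_iff_deriv.2 ⟨fun s => (hψ s).differentiableAt, hψd ▸ cδ⟩) hψa hψb
  rw [hψd] at h1
  have h2 : ∫ s in a'..b', (B s * ψ s + β s * δ s) = 0 := by
    have := intervalIntegral.integral_deriv_mul_eq_sub (a := a') (b := b') (fun s _ => hβ s)
      (fun s _ => hψ s) (cB.intervalIntegrable _ _) (cδ.intervalIntegrable _ _)
    rw [hψa, hψb] at this
    simpa using this
  have h3 : ∫ s in a'..b', m * δ s = 0 := by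
    rw [intervalIntegral.integral_const_mul]; exact mul_eq_zero_of_right _ hψb
  have h4 : ∫ s in a'..b', δ s ^ 2 = -∫ s in a'..b', (B s * ψ s + A s * δ s) := by
    have : ∀ s, δ s ^ 2 = m * δ s + (B s * ψ s + β s * δ s) - (B s * ψ s + A s * δ s) := fun s => by
      simp only [δ]; ring
    simp_rw [this]
    rw [intervalIntegral.integral_sub ((by fun_prop : Continuous _).intervalIntegrable _ _)
      ((by fun_prop : Continuous _).intervalIntegrable _ _), intervalIntegral.integral_add
      ((by fun_prop : Continuous _).intervalIntegrable _ _)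
      ((by fun_prop : Continuous _).intervalIntegrable _ _), h2, h3]
    ring
  have h5 : ∀ s ∈ Icc a' b', δ s = 0 := by
    by_contra! hne
    obtain ⟨s, hs, hs0⟩ := hne
    have := intervalIntegral.integral_pos hab ((by fun_prop : Continuous fun s => δ s ^ 2).continuousOn)
      (fun s _ => sq_nonneg _) ⟨s, hs, by positivity⟩
    linarith
  have h6 : (fun s => M.g (c s) (deriv c s) w) =ᶠ[𝓝 t] fun s => m + β s := by
    filter_upwards [Icc_mem_nhds hat htb] with s hs
    have := h5 s hs
    simp only [δ, A, (hec s hs).1, (hec s hs).2] at this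
    linarith
  have h7 := ((hβ t).const_add m).congr_of_eventuallyEq h6
  have ht' : t ∈ Icc a' b' := ⟨hat.le, htb.le⟩
  simpa only [B, (hec t ht').1, (hec t ht').2] using h7

end TorusMetric

namespace TorusMetric
variable (M : TorusMetric)

/-- The momentum of a tangent vector. -/
def mom (z : Pl × Pl) : Pl := (M.g z.1 z.2 (1, 0), M.g z.1 z.2 (0, 1))

/-- The velocity of a momentum. -/
def vel (z : Pl × Pl) : Pl := ((M.cC z.1 * z.2.1 - M.cB z.1 * z.2.2) / M.dt z.1,
  (M.cA z.1 * z.2.2 - M.cB z.1 * z.2.1) / M.dt z.1)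

/-- The derivative of the momentum along a geodesic. -/
def frc (z : Pl × Pl) : Pl := (M.dg z.1 (1, 0) z.2 / 2, M.dg z.1 (0, 1) z.2 / 2)

/-- The geodesic vector field on the tangent bundle. -/
def fld (z : Pl × Pl) : Pl × Pl := (z.2, fderiv ℝ M.vel (z.1, M.mom z) (z.2, M.frc z))

lemma vel_mom (x v : Pl) : M.vel (x, M.mom (x, v)) = v := by
  have h := (M.dt_pos x).ne'
  simp only [vel, mom, g_eq]
  ext <;> simp only <;> rw [div_eq_iff h] <;> simp only [dt] <;> ring

lemma contDiff_vel : ContDiff ℝ (⊤ : ℕ∞) M.vel := by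
  have hA := M.contDiff_cA (n := ⊤)
  have hB := M.contDiff_cB (n := ⊤)
  have hC := M.contDiff_cC (n := ⊤)
  have hd := M.contDiff_dt (n := ⊤)
  unfold vel
  refine ContDiff.prodMk (ContDiff.div ?_ ?_ fun z => (M.dt_pos z.1).ne')
    (ContDiff.div ?_ ?_ fun z => (M.dt_pos z.1).ne') <;> fun_prop

lemma contDiff_mom : ContDiff ℝ (⊤ : ℕ∞) M.mom := by
  have hA := M.contDiff_cA (n := ⊤)
  have hB := M.contDiff_cB (n := ⊤)
  have hC := M.contDiff_cC (n := ⊤)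
  unfold mom
  simp only [g_eq]
  fun_prop

lemma contDiff_frc : ContDiff ℝ (⊤ : ℕ∞) M.frc := by
  have hA : ∀ u : Pl, ContDiff ℝ (⊤ : ℕ∞) fun x => fderiv ℝ M.cA x u := fun u =>
    ((M.contDiff_cA (n := ⊤)).fderiv_right (by simp)).clm_apply contDiff_const
  have hB : ∀ u : Pl, ContDiff ℝ (⊤ : ℕ∞) fun x => fderiv ℝ M.cB x u := fun u =>
    ((M.contDiff_cB (n := ⊤)).fderiv_right (by simp)).clm_apply contDiff_const
  have hC : ∀ u : Pl, ContDiff ℝ (⊤ : ℕ∞) fun x => fderiv ℝ M.cC x u := fun u =>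
    ((M.contDiff_cC (n := ⊤)).fderiv_right (by simp)).clm_apply contDiff_const
  have key : ∀ u : Pl, ContDiff ℝ (⊤ : ℕ∞) fun z : Pl × Pl => M.dg z.1 u z.2 / 2 := fun u => by
    have h1 := hA u
    have h2 := hB u
    have h3 := hC u
    unfold dg
    exact ContDiff.div_const (((((hA u).comp contDiff_fst).mul (by fun_prop)).add
      (((hB u).comp contDiff_fst).mul (by fun_prop))).add
      (((hC u).comp contDiff_fst).mul (by fun_prop))) 2
  exact (key _).prodMk (key _)

lemma contDiff_fld : ContDiff ℝ (⊤ : ℕ∞) M.fld := by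
  have h := M.contDiff_vel.fderiv_right (m := (⊤ : ℕ∞)) (by simp)
  exact contDiff_snd.prodMk ((h.comp (contDiff_fst.prodMk M.contDiff_mom)).clm_apply
    (contDiff_snd.prodMk M.contDiff_frc))

lemma fderiv_per {F : Type*} [NormedAddCommGroup F] [NormedSpace ℝ F] {f : Pl → F}
    (hp : ∀ k x, f (x + lat k) = f x) (k : ℤ × ℤ) (x : Pl) :
    fderiv ℝ f (x + lat k) = fderiv ℝ f x := by
  rw [← fderiv_comp_add_right]; simp_rw [hp]

lemma dg_per (k : ℤ × ℤ) (x u v : Pl) : M.dg (x + lat k) u v = M.dg x u v := by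
  simp only [dg, fderiv_per M.cA_per, fderiv_per M.cB_per, fderiv_per M.cC_per]

lemma fld_per (k : ℤ × ℤ) (x v : Pl) : M.fld (x + lat k, v) = M.fld (x, v) := by
  have h1 : ∀ z : Pl × Pl, M.vel (z + (lat k, 0)) = M.vel z := fun z => by
    simp [vel, cA_per, cB_per, cC_per, dt_per]
  have h2 : M.mom (x + lat k, v) = M.mom (x, v) := by simp [mom, M.periodic]
  have h3 : M.frc (x + lat k, v) = M.frc (x, v) := by simp [frc, dg_per]
  have h4 : ∀ z, fderiv ℝ M.vel (z + (lat k, 0)) = fderiv ℝ M.vel z := fun z => by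
    rw [← fderiv_comp_add_right]; simp_rw [h1]
  simp only [fld, h2, h3]
  have := h4 (x, M.mom (x, v))
  simp only [Prod.mk_add_mk, add_zero] at this
  rw [this]

lemma exists_fld_lip : ∃ C : ℝ, 1 ≤ C ∧ ∀ z w : Pl × Pl, ‖z.2‖ ≤ M.K → ‖w.2‖ ≤ M.K →
    ‖M.fld z - M.fld w‖ ≤ C * ‖z - w‖ := by
  have hf := M.contDiff_fld
  have hcf : Continuous (fderiv ℝ M.fld) := hf.continuous_fderiv (by simp)
  obtain ⟨C, hC⟩ := ((isCompact_Icc (a := (0 : Pl)) (b := 1)).prod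
    (isCompact_closedBall (0 : Pl) M.K)).exists_bound_of_continuousOn hcf.continuousOn
  refine ⟨max C 1, le_max_right _ _, fun z w hz hw => ?_⟩
  have hcv : Convex ℝ ((univ : Set Pl) ×ˢ Metric.closedBall (0 : Pl) M.K) :=
    convex_univ.prod (convex_closedBall _ _)
  refine hcv.norm_image_sub_le_of_norm_fderiv_le (𝕜 := ℝ)
    (fun y _ => hf.differentiable (by simp) y) (fun y hy => ?_)
    ⟨trivial, by simpa using hw⟩ ⟨trivial, by simpa using hz⟩
  obtain ⟨k, hk⟩ := exists_lat_near y.1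
  have h4 : ∀ (k : ℤ × ℤ) z, fderiv ℝ M.fld (z + (lat k, 0)) = fderiv ℝ M.fld z := fun k z => by
    rw [← fderiv_comp_add_right]
    congr 1; funext q
    change M.fld (q.1 + lat k, q.2 + 0) = _
    rw [add_zero, fld_per]
  rw [← h4 (-k)]
  refine (hC _ ⟨?_, by simpa using hy.2⟩).trans (le_max_left _ _)
  simpa [lat_neg, ← sub_eq_add_neg] using hk

/-- Lipschitz constant of the geodesic vector field. -/
def KF : ℝ := M.exists_fld_lip.choose
lemma one_le_KF : 1 ≤ M.KF := M.exists_fld_lip.choose_spec.1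
lemma fld_lip {z w : Pl × Pl} (hz : ‖z.2‖ ≤ M.K) (hw : ‖w.2‖ ≤ M.K) :
    ‖M.fld z - M.fld w‖ ≤ M.KF * ‖z - w‖ := M.exists_fld_lip.choose_spec.2 z w hz hw

/-- The phase curve of a curve. -/
def ph (c : ℝ → Pl) (t : ℝ) : Pl × Pl := (c t, deriv c t)

variable {M}

lemma norm_deriv_le {c : ℝ → Pl} {t : ℝ} (h : M.g (c t) (deriv c t) (deriv c t) = 1) :
    ‖deriv c t‖ ≤ M.K := by
  have := M.norm_le_nrm (c t) (deriv c t)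
  rwa [nrm, h, Real.sqrt_one, mul_one] at this

lemma IsSeg.hasDerivAt_ph {c : ℝ → Pl} {a b t : ℝ} (hc : M.IsSeg c (Icc a b)) (ht : t ∈ Ioo a b) :
    HasDerivAt (ph c) (M.fld (ph c t)) t := by
  have h0 := (hc.differentiable ht).1.hasDerivAt
  have h1 : HasDerivAt (fun s => M.mom (ph c s)) (M.frc (ph c t)) t :=
    (hc.euler_lagrange ht (1, 0)).prodMk (hc.euler_lagrange ht (0, 1))
  have h2 := ((M.contDiff_vel.differentiable (by simp) (c t, M.mom (ph c t))).hasFDerivAt).comp_hasDerivAt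
    t (h0.prodMk h1)
  have h3 : (M.vel ∘ fun s => (c s, M.mom (ph c s))) = deriv c := funext fun s => M.vel_mom _ _
  rw [h3] at h2
  exact h0.prodMk h2

/-- Curves that are minimizing on intervals of a uniform size. -/
def IsLoc (M : TorusMetric) (c : ℝ → Pl) : Prop := ∃ r > 0, ∀ t, M.IsSeg c (Icc (t - r) (t + r))

lemma IsSeg.isLoc {c : ℝ → Pl} (h : M.IsSeg c univ) : M.IsLoc c :=
  ⟨1, one_pos, fun _ => h.mono (subset_univ _)⟩

lemma IsLoc.hasDerivAt_ph {c : ℝ → Pl} (h : M.IsLoc c) (t : ℝ) :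
    HasDerivAt (ph c) (M.fld (ph c t)) t := by
  obtain ⟨r, hr, h⟩ := h
  exact (h t).hasDerivAt_ph ⟨by linarith, by linarith⟩

lemma IsLoc.unit_speed {c : ℝ → Pl} (h : M.IsLoc c) (t : ℝ) :
    M.g (c t) (deriv c t) (deriv c t) = 1 := by
  obtain ⟨r, hr, h⟩ := h
  exact (h t).unit_speed ⟨by linarith, by linarith⟩

lemma IsLoc.hasDerivAt {c : ℝ → Pl} (h : M.IsLoc c) (t : ℝ) : HasDerivAt c (deriv c t) t := by
  obtain ⟨r, hr, h⟩ := h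
  exact ((h t).differentiable ⟨by linarith, by linarith⟩).1.hasDerivAt

lemma IsLoc.contDiff {c : ℝ → Pl} (h : M.IsLoc c) : ContDiff ℝ (⊤ : ℕ∞) c := by
  have hd : deriv (ph c) = fun t => M.fld (ph c t) := funext fun t => (h.hasDerivAt_ph t).deriv
  have key : ∀ n : ℕ, ContDiff ℝ n (ph c) := by
    intro n
    induction n with
    | zero => exact contDiff_zero.2 (continuous_iff_continuousAt.2 fun t =>
        (h.hasDerivAt_ph t).continuousAt)
    | succ n ih =>
      rw [show ((n + 1 : ℕ) : WithTop ℕ∞) = (n : WithTop ℕ∞) + 1 by norm_cast,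
        contDiff_succ_iff_deriv]
      refine ⟨fun t => (h.hasDerivAt_ph t).differentiableAt, by simp, ?_⟩
      rw [hd]
      exact (M.contDiff_fld.of_le (by exact_mod_cast le_top)).comp ih
  exact contDiff_fst.comp (contDiff_infty.2 key)

lemma IsLoc.length_eq {c : ℝ → Pl} (h : M.IsLoc c) (s t : ℝ) : M.length c s t = t - s := by
  simp [TorusMetric.length, h.unit_speed]

lemma IsLoc.isGeodesic {c : ℝ → Pl} (h : M.IsLoc c) : M.IsGeodesic c := by
  refine ⟨h.contDiff, h.unit_speed, fun t => ?_⟩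
  have h' := h
  obtain ⟨r, hr, h⟩ := h
  refine ⟨r, hr, fun s₁ s₂ h1 h2 h3 => ?_⟩
  rw [h t s₁ ⟨h1, by linarith⟩ s₂ ⟨by linarith, h3⟩, h'.length_eq, abs_sub_comm,
    abs_of_nonneg (by linarith)]

lemma IsLoc.comp_add {c : ℝ → Pl} (h : M.IsLoc c) (a : ℝ) : M.IsLoc fun t => c (t + a) := by
  obtain ⟨r, hr, h⟩ := h
  exact ⟨r, hr, fun t => ((h (t + a)).comp_add a).mono fun s hs =>
    ⟨by linarith [hs.1], by linarith [hs.2]⟩⟩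

lemma IsLoc.comp_neg {c : ℝ → Pl} (h : M.IsLoc c) : M.IsLoc fun t => c (-t) := by
  obtain ⟨r, hr, h⟩ := h
  refine ⟨r, hr, fun t s hs u hu => ?_⟩
  rw [h (-t) (-s) ⟨by linarith [hs.2], by linarith [hs.1]⟩ (-u) ⟨by linarith [hu.2], by linarith [hu.1]⟩,
    abs_sub_comm]
  congr 1; ring

lemma IsLoc.add_lat {c : ℝ → Pl} (h : M.IsLoc c) (k : ℤ × ℤ) : M.IsLoc fun t => c t + lat k := by
  obtain ⟨r, hr, h⟩ := h
  exact ⟨r, hr, fun t s hs u hu => by rw [M.dist_translate]; exact h t s hs u hu⟩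

/-- Uniqueness of geodesics with given initial vector. -/
lemma IsLoc.unique {c₁ c₂ : ℝ → Pl} (h₁ : M.IsLoc c₁) (h₂ : M.IsLoc c₂) {t₀ : ℝ}
    (h0 : c₁ t₀ = c₂ t₀) (h0' : deriv c₁ t₀ = deriv c₂ t₀) : c₁ = c₂ := by
  have hl : LipschitzOnWith M.KF.toNNReal M.fld {z : Pl × Pl | ‖z.2‖ ≤ M.K} :=
    LipschitzOnWith.of_dist_le_mul fun z hz w hw => by
      rw [Real.coe_toNNReal _ (zero_le_one.trans M.one_le_KF), dist_eq_norm, dist_eq_norm]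
      exact M.fld_lip hz hw
  have := ODE_solution_unique_univ (v := fun _ => M.fld) (s := fun _ => {z | ‖z.2‖ ≤ M.K})
    (f := ph c₁) (g := ph c₂) (t₀ := t₀) (fun _ => hl)
    (fun t => ⟨h₁.hasDerivAt_ph t, norm_deriv_le (h₁.unit_speed t)⟩)
    (fun t => ⟨h₂.hasDerivAt_ph t, norm_deriv_le (h₂.unit_speed t)⟩)
    (Prod.ext h0 h0')
  exact funext fun t => congrArg Prod.fst (congrFun this t)

lemma exists_seg_unique (M : TorusMetric) : ∃ ρ : ℝ, 0 < ρ ∧ ρ ≤ 1 ∧ ∀ (c₁ c₂ : ℝ → Pl) (h : ℝ), h ≤ ρ →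
    M.IsSeg c₁ (Icc 0 h) → M.IsSeg c₂ (Icc 0 h) → c₁ 0 = c₂ 0 → c₁ h = c₂ h →
    ∀ t ∈ Icc 0 h, c₁ t = c₂ t := by
  have hF := M.one_le_KF
  have hK := M.K_pos
  refine ⟨1 / (2 * M.KF), by positivity, by
    rw [div_le_one (by positivity)]; linarith, fun c₁ c₂ h hh h1 h2 e0 e1 t ht => ?_⟩
  have hh1 : h ≤ 1 := hh.trans (by rw [div_le_one (by positivity)]; linarith)
  rw [le_div_iff₀ (by positivity)] at hh
  have hh0 : 0 ≤ h := ht.1.trans ht.2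
  rcases hh0.eq_or_lt with rfl | hpos
  · rw [Icc_self] at ht; rw [ht, e0]
  set w : ℝ → Pl := fun t => deriv c₁ t - deriv c₂ t
  have hcont : ContinuousOn (fun t => c₁ t - c₂ t) (Icc 0 h) := h1.continuousOn.sub h2.continuousOn
  have hu : ∀ s ∈ Ioo 0 h, HasDerivAt (fun t => c₁ t - c₂ t) (w s) s := fun s hs =>
    (h1.differentiable hs).1.hasDerivAt.sub (h2.differentiable hs).1.hasDerivAt
  have hw : ∀ s ∈ Ioo 0 h, HasDerivAt w ((M.fld (ph c₁ s)).2 - (M.fld (ph c₂ s)).2) s := fun s hs =>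
    ((ContinuousLinearMap.snd ℝ Pl Pl).hasFDerivAt.comp_hasDerivAt s (h1.hasDerivAt_ph hs)).sub
      ((ContinuousLinearMap.snd ℝ Pl Pl).hasFDerivAt.comp_hasDerivAt s (h2.hasDerivAt_ph hs))
  have hub : ∀ B, (∀ s ∈ Ioo 0 h, ‖w s‖ ≤ B) → ∀ s ∈ Icc 0 h, ‖c₁ s - c₂ s‖ ≤ B := by
    intro B hB s hs
    have hB0 : 0 ≤ B := (norm_nonneg _).trans (hB (h / 2) ⟨by linarith, by linarith⟩)
    rcases hs.1.eq_or_lt with rfl | hs0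
    · simpa [e0] using hB0
    have key : ∀ L : Pl →L[ℝ] ℝ, (∀ v, |L v| ≤ ‖v‖) → |L (c₁ s - c₂ s)| ≤ B := by
      intro L hL
      obtain ⟨ξ, hξ, hξ0⟩ := exists_hasDerivAt_eq_slope (fun t => L (c₁ t - c₂ t))
        (fun t => L (w t)) hs0 (L.continuous.comp_continuousOn
          (hcont.mono (Icc_subset_Icc_right hs.2)))
        (fun r hr => L.hasFDerivAt.comp_hasDerivAt r (hu r ⟨hr.1, hr.2.trans_le hs.2⟩))
      simp only [e0, sub_self, map_zero, sub_zero] at hξ0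
      rw [eq_div_iff hs0.ne'] at hξ0
      rw [← hξ0, abs_mul, abs_of_pos hs0]
      have := (hL (w ξ)).trans (hB ξ ⟨hξ.1, hξ.2.trans_le hs.2⟩)
      nlinarith [hs.2]
    exact max_le (key (ContinuousLinearMap.fst ℝ ℝ ℝ) fun v => norm_fst_le v)
      (key (ContinuousLinearMap.snd ℝ ℝ ℝ) fun v => norm_snd_le v)
  have hstep : ∀ B, (∀ s ∈ Ioo 0 h, ‖w s‖ ≤ B) → ∀ s ∈ Ioo 0 h, ‖w s‖ ≤ B / 2 := by
    intro B hB s hs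
    have hF2 : ∀ s ∈ Ioo 0 h, ‖(M.fld (ph c₁ s)).2 - (M.fld (ph c₂ s)).2‖ ≤ M.KF * B := by
      intro s hs
      refine (norm_snd_le (M.fld (ph c₁ s) - M.fld (ph c₂ s))).trans ?_
      refine (M.fld_lip (norm_deriv_le (h1.unit_speed hs)) (norm_deriv_le (h2.unit_speed hs))).trans ?_
      gcongr
      exact max_le (hub B hB s ⟨hs.1.le, hs.2.le⟩) (hB s hs)
    have key : ∀ L : Pl →L[ℝ] ℝ, (∀ v, |L v| ≤ ‖v‖) → |L (w s)| ≤ B / 2 := by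
      intro L hL
      obtain ⟨ξ, hξ, hξ0⟩ := exists_hasDerivAt_eq_zero (f := fun t => L (c₁ t - c₂ t))
        (f' := fun t => L (w t)) hpos (L.continuous.comp_continuousOn hcont) (by simp [e0, e1])
        (fun s hs => L.hasFDerivAt.comp_hasDerivAt s (hu s hs))
      have := (convex_Ioo 0 h).norm_image_sub_le_of_norm_hasDerivWithin_le
        (f := fun t => L (w t)) (C := M.KF * B)
        (fun s hs => (L.hasFDerivAt.comp_hasDerivAt s (hw s hs)).hasDerivWithinAt)
        (fun s hs => (hL _).trans (hF2 s hs)) hξ hs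
      simp only [hξ0, sub_zero, Real.norm_eq_abs] at this
      refine this.trans ?_
      have hB0 : 0 ≤ B := (norm_nonneg _).trans (hB s hs)
      have h3 : |s - ξ| ≤ h := abs_le.2 ⟨by linarith [hs.1, hξ.2], by linarith [hs.2, hξ.1]⟩
      calc M.KF * B * |s - ξ| ≤ M.KF * B * h := by gcongr
        _ ≤ B / 2 := by nlinarith
    exact max_le (key (ContinuousLinearMap.fst ℝ ℝ ℝ) fun v => norm_fst_le v)
      (key (ContinuousLinearMap.snd ℝ ℝ ℝ) fun v => norm_snd_le v)
  have hn : ∀ n : ℕ, ∀ s ∈ Ioo 0 h, ‖w s‖ ≤ 2 * M.K * (1 / 2) ^ n := by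
    intro n
    induction n with
    | zero =>
      intro s hs
      refine (norm_sub_le _ _).trans ?_
      linarith [norm_deriv_le (h1.unit_speed hs), norm_deriv_le (h2.unit_speed hs)]
    | succ n ih => intro s hs; rw [pow_succ]; linarith [hstep _ ih s hs]
  have hlim : Tendsto (fun n : ℕ => 2 * M.K * (1 / 2 : ℝ) ^ n) atTop (𝓝 0) := by
    simpa using (tendsto_pow_atTop_nhds_zero_of_lt_one (r := (1/2:ℝ)) (by norm_num)
      (by norm_num)).const_mul (2 * M.K)
  have := ge_of_tendsto' hlim fun n => hub _ (hn n) t ht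
  rw [← sub_eq_zero]
  exact norm_le_zero_iff.1 this

end TorusMetric

section Lifts

lemma exists_continuous_log {X : Type*} [TopologicalSpace X] [SimplyConnectedSpace X]
    [LocallyPathConnectedSpace X] {h : X → ℂ} (hc : Continuous h) (h0 : ∀ x, h x ≠ 0) :
    ∃ θ : X → ℂ, Continuous θ ∧ ∀ x, Complex.exp (θ x) = h x := by
  obtain ⟨a⟩ := (inferInstance : Nonempty X)
  obtain ⟨F, ⟨-, hF⟩, -⟩ := Complex.isCoveringMapOn_exp.existsUnique_continuousMap_lifts
    (⟨h, hc⟩ : C(X, ℂ)) (a₀ := a) (e₀ := Complex.log (h a)) (Complex.exp_log (h0 a))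
    (fun x => h0 x)
  exact ⟨F, F.continuous, fun x => congrFun hF x⟩

lemma eq_of_exp_eq {X : Type*} [TopologicalSpace X] [PreconnectedSpace X] {f₁ f₂ : X → ℂ}
    (h₁ : Continuous f₁) (h₂ : Continuous f₂) (he : ∀ x, Complex.exp (f₁ x) = Complex.exp (f₂ x))
    {a : X} (ha : f₁ a = f₂ a) (x : X) : f₁ x = f₂ x :=
  have hm : ∀ x, Complex.exp x ∈ ({0}ᶜ : Set ℂ) := Complex.exp_ne_zero
  congrFun (Complex.isCoveringMapOn_exp.isCoveringMap_restrictPreimage.eq_of_comp_eq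
    (g₁ := fun x => (⟨f₁ x, hm _⟩ : Complex.exp ⁻¹' {0}ᶜ)) (g₂ := fun x => ⟨f₂ x, hm _⟩)
    (by fun_prop) (by fun_prop) (funext fun x => Subtype.ext (he x)) a (Subtype.ext ha)) x
    |> Subtype.ext_iff.1

lemma sub_eq_sub_of_exp_eq {X : Type*} [TopologicalSpace X] [PreconnectedSpace X] {f₁ f₂ : X → ℂ}
    (h₁ : Continuous f₁) (h₂ : Continuous f₂) {z : ℂ}
    (he : ∀ x, Complex.exp (f₁ x) = z * Complex.exp (f₂ x)) (a x : X) :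
    f₁ x - f₁ a = f₂ x - f₂ a := by
  have hz : Complex.exp (f₁ a - f₂ a) = z := by
    rw [Complex.exp_sub, he, mul_div_assoc, div_self (Complex.exp_ne_zero _), mul_one]
  have := eq_of_exp_eq (f₂ := fun x => (f₁ a - f₂ a) + f₂ x) h₁ (by fun_prop)
    (fun x => by rw [he, Complex.exp_add, hz]) (a := a) (by ring) x
  rw [this]; ring

/-- The variation over `[0, T]` of a continuous logarithm of `h`. -/
def wnd (h : ℝ → ℂ) (T : ℝ) : ℂ :=
  open Classical in
  if H : ∃ θ : ℝ → ℂ, Continuous θ ∧ ∀ t, Complex.exp (θ t) = h t then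
    H.choose T - H.choose 0 else 0

lemma wnd_eq {h θ : ℝ → ℂ} (hθ : Continuous θ) {z : ℂ} (hz : z ≠ 0)
    (he : ∀ t, h t = z * Complex.exp (θ t)) (T : ℝ) : wnd h T = θ T - θ 0 := by
  have H : ∃ θ : ℝ → ℂ, Continuous θ ∧ ∀ t, Complex.exp (θ t) = h t :=
    ⟨fun t => Complex.log z + θ t, by fun_prop, fun t => by
      rw [Complex.exp_add, Complex.exp_log hz, he]⟩
  rw [wnd, dif_pos H]
  exact sub_eq_sub_of_exp_eq H.choose_spec.1 hθ (fun x => by rw [H.choose_spec.2, he]) _ _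

lemma wnd_homotopy {H : ℝ → ℝ → ℂ} {T : ℝ} (hc : Continuous fun p : ℝ × ℝ => H p.1 p.2)
    (h0 : ∀ s ∈ Icc (0 : ℝ) 1, ∀ t, H s t ≠ 0) (hp : ∀ s ∈ Icc (0 : ℝ) 1, H s T = H s 0) :
    wnd (H 0) T = wnd (H 1) T := by
  have hcl := continuous_clamp 0 1
  obtain ⟨Θ, hΘ, he⟩ := exists_continuous_log (X := ℝ × ℝ) (h := fun p => H (clamp 0 1 p.1) p.2)
    (hc.comp ((hcl.comp continuous_fst).prodMk continuous_snd))
    fun p => h0 _ (clamp_mem zero_le_one _) _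
  have key : ∀ s ∈ Icc (0 : ℝ) 1, wnd (H s) T = Θ (s, T) - Θ (s, 0) := fun s hs =>
    wnd_eq (θ := fun t => Θ (s, t)) (by fun_prop) one_ne_zero
      (fun t => by rw [one_mul, he, clamp_eq hs]) T
  rw [key 0 (by simp), key 1 (by simp)]
  have h1 := sub_eq_sub_of_exp_eq (f₁ := fun s => Θ (s, T)) (f₂ := fun s => Θ (s, 0)) (z := 1)
    (by fun_prop) (by fun_prop)
    (fun s => by rw [he, he, one_mul]; exact hp _ (clamp_mem zero_le_one _)) 0 1
  linear_combination -h1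

/-- The real-linear identification of the plane with `ℂ` sending `lat k` to `1`. -/
def zet (k : ℤ × ℤ) (x : Pl) : ℂ := (x.1 + x.2 * Complex.I) / (k.1 + k.2 * Complex.I)

variable {k : ℤ × ℤ}

lemma zet_den (hk : k ≠ 0) : (k.1 + k.2 * Complex.I : ℂ) ≠ 0 := by
  contrapose! hk
  simpa [Complex.ext_iff, Prod.ext_iff] using hk

lemma zet_add (x y : Pl) : zet k (x + y) = zet k x + zet k y := by
  simp [zet]; ring
lemma zet_sub (x y : Pl) : zet k (x - y) = zet k x - zet k y := by
  simp [zet]; ring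
lemma zet_smul (r : ℝ) (x : Pl) : zet k (r • x) = r * zet k x := by
  simp [zet]; ring
lemma zet_lat (hk : k ≠ 0) : zet k (lat k) = 1 := by
  simpa [zet, lat] using div_self (zet_den hk)
lemma zet_lat_zsmul (hk : k ≠ 0) (n : ℤ) : zet k (lat (n • k)) = n := by
  rw [lat_zsmul, zet_smul, zet_lat hk]; simp
lemma continuous_zet : Continuous (zet k) := by unfold zet; fun_prop

lemma zet_inj (hk : k ≠ 0) {x y : Pl} (h : zet k x = zet k y) : x = y := by
  have h := (div_left_inj' (zet_den hk)).1 h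
  simpa [Complex.ext_iff, Prod.ext_iff] using h

lemma exists_forall_le_of_periodic {f : ℝ → ℝ} (hf : Continuous f) {ℓ : ℝ} (hℓ : 0 < ℓ)
    (hp : ∀ t, f (t + ℓ) = f t) : ∃ t₀, ∀ t, f t ≤ f t₀ := by
  obtain ⟨t₀, -, h⟩ := (isCompact_Icc (a := (0 : ℝ)) (b := ℓ)).exists_isMaxOn
    (nonempty_Icc.2 hℓ.le) hf.continuousOn
  refine ⟨t₀, fun t => ?_⟩
  obtain ⟨s, hs, e⟩ := Function.Periodic.exists_mem_Ico₀ (f := f) hp hℓ t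
  rw [e]
  exact h ⟨hs.1, hs.2.le⟩

lemma mem_slitPlane_of_re {z : ℂ} (h : 0 ≤ z.re) (h0 : z ≠ 0) : z ∈ Complex.slitPlane := by
  rcases h.eq_or_lt with h | h
  · exact Or.inr fun h' => h0 (Complex.ext h.symm h')
  · exact Or.inl h

/-- A curve which is translated by a proper multiple of `k` passes through two points differing
by `k`. -/
lemma exists_square (hk : k ≠ 0) {c : ℝ → Pl} (hc : Continuous c) {ℓ : ℝ} (hℓ : 0 < ℓ) {n : ℕ}
    (hn : 2 ≤ n) (hp : ∀ t, c (t + ℓ) = c t + lat (n • k)) :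
    ∃ t τ, 0 < τ ∧ τ < ℓ ∧ c (t + τ) = c t + lat k := by
  by_contra! hne
  have hn' : (2 : ℝ) ≤ n := by exact_mod_cast hn
  have hz : ∀ t, zet k (c (t + ℓ)) = zet k (c t) + n := fun t => by
    rw [hp, zet_add, ← natCast_zsmul, zet_lat_zsmul hk]; simp
  set F : ℝ → ℝ → ℂ := fun t τ => zet k (c (t + clamp 0 ℓ τ)) - zet k (c t) - 1
  have hcl := continuous_clamp 0 ℓ
  have hzc := (continuous_zet (k := k)).comp hc
  have hF : Continuous fun p : ℝ × ℝ => F p.1 p.2 :=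
    ((hzc.comp (continuous_fst.add (hcl.comp continuous_snd))).sub
      (hzc.comp continuous_fst)).sub continuous_const
  have e0 : ∀ t, F t 0 = -1 := fun t => by simp [F, clamp_eq (left_mem_Icc.2 hℓ.le)]
  have e1 : ∀ t, F t ℓ = n - 1 := fun t => by simp [F, clamp_eq (right_mem_Icc.2 hℓ.le), hz]
  have hn1 : (n - 1 : ℂ) ≠ 0 := by
    have : ((n - 1 : ℝ) : ℂ) ≠ 0 := Complex.ofReal_ne_zero.2 (by linarith)
    simpa using this
  have h0 : ∀ p : ℝ × ℝ, F p.1 p.2 ≠ 0 := by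
    rintro ⟨t, τ⟩ h
    have hm := clamp_mem hℓ.le τ
    rcases hm.1.eq_or_lt with h1 | h1
    · simp [F, ← h1] at h
    rcases hm.2.eq_or_lt with h2 | h2
    · simp only [F, h2, hz] at h; exact hn1 (by linear_combination h)
    refine hne t _ h1 h2 (zet_inj hk ?_)
    rw [zet_add, zet_lat hk]; simp only [F] at h; linear_combination h
  obtain ⟨Θ, hΘ, he⟩ := exists_continuous_log hF h0
  have hD := fun s t => sub_eq_sub_of_exp_eq (f₁ := fun t => Θ (t, ℓ)) (f₂ := fun t => Θ (t, 0))
    (z := -(n - 1)) (by fun_prop) (by fun_prop) (fun s => by rw [he, he, e0, e1]; ring) s t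
  have key : ∀ (w : ℂ) (t : ℝ), (∀ τ, 0 ≤ (w * F t τ).re) → w ≠ 0 →
      Θ (t, ℓ) - Θ (t, 0) = Complex.log (w * (n - 1)) - Complex.log (w * -1) := by
    intro w t hre hw
    have hsl : ∀ τ, w * F t τ ∈ Complex.slitPlane := fun τ =>
      mem_slitPlane_of_re (hre τ) (mul_ne_zero hw (h0 (t, τ)))
    have h1 : Continuous (F t) := hF.comp (by fun_prop : Continuous fun τ => (t, τ))
    have := sub_eq_sub_of_exp_eq (f₁ := fun τ => Complex.log (w * F t τ))
      (f₂ := fun τ => Θ (t, τ)) (z := w)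
      (continuous_iff_continuousAt.2 fun τ => ((continuous_const.mul h1).continuousAt).clog (hsl τ))
      (by fun_prop) (fun τ => by rw [he, Complex.exp_log (Complex.slitPlane_ne_zero (hsl τ))]) 0 ℓ
    simp only [e0, e1] at this
    exact this.symm
  have him : Continuous fun t => (zet k (c t)).im := Complex.continuous_im.comp hzc
  have hper : ∀ t, (zet k (c (t + ℓ))).im = (zet k (c t)).im := fun t => by simp [hz]
  obtain ⟨t₀, ht₀⟩ := exists_forall_le_of_periodic him hℓ hper
  obtain ⟨t₁, ht₁⟩ := exists_forall_le_of_periodic him.neg hℓ (fun t => by simp [hper])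
  have ht₁' : ∀ t, (zet k (c t₁)).im ≤ (zet k (c t)).im := fun t => neg_le_neg_iff.1 (ht₁ t)
  have k0 := key Complex.I t₀ (fun τ => by
    simp only [F, Complex.mul_re, Complex.I_re, Complex.I_im, Complex.sub_im, Complex.one_im]
    linarith [ht₀ (t₀ + clamp 0 ℓ τ)]) Complex.I_ne_zero
  have k1 := key (-Complex.I) t₁ (fun τ => by
    simp only [F, Complex.mul_re, Complex.neg_re, Complex.neg_im, Complex.I_re, Complex.I_im,
      Complex.sub_im, Complex.one_im]
    linarith [ht₁' (t₁ + clamp 0 ℓ τ)]) (neg_ne_zero.2 Complex.I_ne_zero)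
  have harg : ∀ w : ℂ, Complex.arg (w * (n - 1)) = Complex.arg w := fun w => by
    have : (w * (n - 1) : ℂ) = ((n - 1 : ℝ) : ℂ) * w := by push_cast; ring
    rw [this, Complex.arg_real_mul _ (by linarith)]
  have h1 := hD t₀ t₁
  have h2 : Complex.log (Complex.I * (n - 1)) - Complex.log (Complex.I * -1) =
      Complex.log (-Complex.I * (n - 1)) - Complex.log (-Complex.I * -1) := by
    rw [← k0, ← k1]; linear_combination -h1
  have h3 := congrArg Complex.im h2
  simp only [Complex.sub_im, Complex.log_im, harg, mul_neg, mul_one, neg_neg, Complex.arg_I,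
    Complex.arg_neg_I] at h3
  linarith [Real.pi_pos]

end Lifts

section Winding

/-- The covering of the punctured plane by the plane whose deck group is generated by `lat k`. -/
def expk (k : ℤ × ℤ) (x : Pl) : ℂ := Complex.exp (2 * Real.pi * Complex.I * zet k x)

variable {k : ℤ × ℤ}

lemma continuous_expk : Continuous (expk k) := by
  have := continuous_zet (k := k)
  unfold expk; fun_prop

lemma expk_add_lat (hk : k ≠ 0) (x : Pl) (j : ℤ) : expk k (x + lat (j • k)) = expk k x := by
  rw [expk, zet_add, zet_lat_zsmul hk, mul_add, Complex.exp_add, mul_comm _ (j : ℂ),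
    Complex.exp_int_mul_two_pi_mul_I, mul_one, expk]

lemma expk_eq_iff (hk : k ≠ 0) {x y : Pl} :
    expk k x = expk k y ↔ ∃ j : ℤ, x = y + lat (j • k) := by
  constructor
  · intro h
    obtain ⟨j, hj⟩ := Complex.exp_eq_exp_iff_exists_int.1 h
    refine ⟨j, zet_inj hk ?_⟩
    rw [zet_add, zet_lat_zsmul hk]
    have : (2 * Real.pi * Complex.I : ℂ) ≠ 0 := Complex.two_pi_I_ne_zero
    apply mul_left_cancel₀ this
    rw [hj]; ring
  · rintro ⟨j, rfl⟩; exact expk_add_lat hk y j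

lemma norm_expk (x : Pl) : ‖expk k x‖ = Real.exp (-(2 * Real.pi * (zet k x).im)) := by
  rw [expk, Complex.norm_exp]; congr 1; simp

/-- The winding of the loop `P` around `z`. -/
def wind (k : ℤ × ℤ) (P : ℝ → Pl) (T : ℝ) (z : Pl) : ℂ := wnd (fun t => expk k (P t) - expk k z) T

lemma exists_wind_log {P : ℝ → Pl} (hP : Continuous P) {z : Pl}
    (h : ∀ t, expk k (P t) ≠ expk k z) :
    ∃ θ : ℝ → ℂ, Continuous θ ∧ ∀ t, Complex.exp (θ t) = expk k (P t) - expk k z :=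
  exists_continuous_log ((continuous_expk.comp hP).sub continuous_const)
    fun t => sub_ne_zero.2 (h t)

lemma wind_eq {P : ℝ → Pl} {z : Pl} {θ : ℝ → ℂ} (hθ : Continuous θ)
    (h : ∀ t, Complex.exp (θ t) = expk k (P t) - expk k z) (T : ℝ) :
    wind k P T z = θ T - θ 0 :=
  wnd_eq hθ one_ne_zero (fun t => by rw [one_mul, h]) T

lemma wind_homotopy (hk : k ≠ 0) {P : ℝ → ℝ → Pl} {z : ℝ → Pl}
    (hP : Continuous fun p : ℝ × ℝ => P p.1 p.2) (hz : Continuous z) {T : ℝ} {n : ℤ}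
    (hp : ∀ s ∈ Icc (0 : ℝ) 1, P s T = P s 0 + lat (n • k))
    (h : ∀ s ∈ Icc (0 : ℝ) 1, ∀ t, expk k (P s t) ≠ expk k (z s)) :
    wind k (P 0) T (z 0) = wind k (P 1) T (z 1) := by
  refine wnd_homotopy (H := fun s t => expk k (P s t) - expk k (z s))
    ((continuous_expk.comp hP).sub (continuous_expk.comp (hz.comp continuous_fst)))
    (fun s hs t => sub_ne_zero.2 (h s hs t)) fun s hs => ?_
  simp only [hp s hs, expk_add_lat hk]

lemma wind_comp {P : ℝ → Pl} (hP : Continuous P) {z : Pl} (h : ∀ t, expk k (P t) ≠ expk k z)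
    {φ : ℝ → ℝ} (hφ : Continuous φ) (h0 : φ 0 = 0) (T : ℝ) :
    wind k (fun t => P (φ t)) T z = wind k P (φ T) z := by
  obtain ⟨θ, hθ, he⟩ := exists_wind_log hP h
  rw [wind_eq hθ he, wind_eq (θ := fun t => θ (φ t)) (by fun_prop) (fun t => he _), h0]

lemma wind_comp_add (hk : k ≠ 0) {P : ℝ → Pl} (hP : Continuous P) {z : Pl}
    (h : ∀ t, expk k (P t) ≠ expk k z) {T : ℝ} {n : ℤ} (hp : ∀ t, P (t + T) = P t + lat (n • k))
    (a : ℝ) : wind k (fun t => P (t + a)) T z = wind k P T z := by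
  obtain ⟨θ, hθ, he⟩ := exists_wind_log hP h
  rw [wind_eq hθ he, wind_eq (θ := fun t => θ (t + a)) (by fun_prop) (fun t => he _)]
  have := sub_eq_sub_of_exp_eq (f₁ := fun t => θ (t + T)) (f₂ := θ) (z := 1) (by fun_prop) hθ
    (fun t => by rw [he, he, hp, expk_add_lat hk, one_mul]) 0 a
  simp only [zero_add] at this ⊢
  rw [add_comm T a]
  linear_combination this

lemma norm_expk_lt {x y : Pl} (h : (zet k x).im < (zet k y).im) : ‖expk k y‖ < ‖expk k x‖ := by
  rw [norm_expk, norm_expk, Real.exp_lt_exp]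
  nlinarith [Real.pi_pos]

lemma expk_ne_zero (x : Pl) : expk k x ≠ 0 := Complex.exp_ne_zero _

lemma one_sub_mem_slitPlane {a b : ℂ} (h : ‖a‖ < ‖b‖) : 1 - a / b ∈ Complex.slitPlane := by
  have hb : 0 < ‖b‖ := (norm_nonneg a).trans_lt h
  left
  have h1 : ‖a / b‖ < 1 := by rw [norm_div]; exact (div_lt_one hb).2 h
  have := (Complex.re_le_norm (a / b)).trans_lt h1
  simp only [Complex.sub_re, Complex.one_re]; linarith

lemma wind_of_lt (hk : k ≠ 0) {P : ℝ → Pl} (hP : Continuous P) {z : Pl} {T : ℝ} {n : ℤ}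
    (hp : P T = P 0 + lat (n • k)) (h : ∀ t, (zet k z).im < (zet k (P t)).im) :
    wind k P T z = 0 := by
  have hs : ∀ t, 1 - expk k (P t) / expk k z ∈ Complex.slitPlane := fun t =>
    one_sub_mem_slitPlane (norm_expk_lt (h t))
  have hc := continuous_expk (k := k) |>.comp hP
  rw [wind, wnd_eq (θ := fun t => Complex.log (1 - expk k (P t) / expk k z)) (z := -expk k z)
    (continuous_iff_continuousAt.2 fun t =>
      ((continuous_const.sub (hc.div_const _)).continuousAt).clog (hs t))
    (neg_ne_zero.2 (expk_ne_zero z)) fun t => ?_]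
  · simp only [hp, expk_add_lat hk, sub_self]
  · rw [Complex.exp_log (Complex.slitPlane_ne_zero (hs t))]
    field_simp [expk_ne_zero (k := k) z]; ring

lemma wind_of_gt (hk : k ≠ 0) {P : ℝ → Pl} (hP : Continuous P) {z : Pl} {T : ℝ} {n : ℤ}
    (hp : P T = P 0 + lat (n • k)) (h : ∀ t, (zet k (P t)).im < (zet k z).im) :
    wind k P T z = 2 * Real.pi * Complex.I * n := by
  have hs : ∀ t, 1 - expk k z / expk k (P t) ∈ Complex.slitPlane := fun t =>
    one_sub_mem_slitPlane (norm_expk_lt (h t))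
  have hc := continuous_expk (k := k) |>.comp hP
  have hz := continuous_zet (k := k) |>.comp hP
  rw [wind_eq (θ := fun t => 2 * Real.pi * Complex.I * zet k (P t) +
    Complex.log (1 - expk k z / expk k (P t))) ((continuous_const.mul hz).add
      (continuous_iff_continuousAt.2 fun t =>
      ((continuous_const.sub (continuous_const.div hc
        fun t => expk_ne_zero _)).continuousAt).clog (hs t)))
    fun t => ?_]
  · simp only [hp, expk_add_lat hk, zet_add, zet_lat_zsmul hk]; ring
  · rw [Complex.exp_add, Complex.exp_log (Complex.slitPlane_ne_zero (hs t)), ← expk]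
    field_simp [expk_ne_zero (k := k) (P t)]

/-- The increments of continuous logarithms agree along a common arc. -/
lemma log_increment_eq {f₁ f₂ : ℝ → ℂ} (h₁ : Continuous f₁) (h₂ : Continuous f₂) {φ : ℝ → ℝ}
    (hφ : Continuous φ) {a b : ℝ} (hab : a ≤ b)
    (he : ∀ t ∈ Icc a b, Complex.exp (f₁ t) = Complex.exp (f₂ (φ t))) :
    f₁ b - f₁ a = f₂ (φ b) - f₂ (φ a) := by
  have hc := continuous_clamp a b
  have := sub_eq_sub_of_exp_eq (f₁ := fun t => f₁ (clamp a b t))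
    (f₂ := fun t => f₂ (φ (clamp a b t))) (z := 1) (by fun_prop) (by fun_prop)
    (fun t => by rw [one_mul]; exact he _ (clamp_mem hab t)) a b
  simpa [clamp_eq (left_mem_Icc.2 hab), clamp_eq (right_mem_Icc.2 hab)] using this

/-- Retraction of the plane onto a square. -/
def sqr (p : Pl) (R : ℝ) (w : Pl) : Pl :=
  (clamp (p.1 - R) (p.1 + R) w.1, clamp (p.2 - R) (p.2 + R) w.2)

lemma continuous_sqr (p : Pl) (R : ℝ) : Continuous (sqr p R) := by
  unfold sqr clamp; fun_prop

lemma sqr_mem {p : Pl} {R : ℝ} (hR : 0 ≤ R) (w : Pl) : ‖sqr p R w - p‖ ≤ R := by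
  have h1 := clamp_mem (show p.1 - R ≤ p.1 + R by linarith) w.1
  have h2 := clamp_mem (show p.2 - R ≤ p.2 + R by linarith) w.2
  refine max_le ?_ ?_ <;> rw [Real.norm_eq_abs, abs_le] <;> constructor <;>
    simp only [sqr, Prod.fst_sub, Prod.snd_sub] <;> linarith [h1.1, h1.2, h2.1, h2.2]

lemma sqr_eq {p : Pl} {R : ℝ} {w : Pl} (h : ‖w - p‖ ≤ R) : sqr p R w = w := by
  have h1 := abs_le.1 ((norm_fst_le (w - p)).trans h)
  have h2 := abs_le.1 ((norm_snd_le (w - p)).trans h)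
  simp only [Prod.fst_sub, Prod.snd_sub] at h1 h2
  refine Prod.ext (clamp_eq ⟨?_, ?_⟩) (clamp_eq ⟨?_, ?_⟩) <;> linarith [h1.1, h1.2, h2.1, h2.2]

/-- A logarithm on a square avoiding the translates of `z`. -/
lemma exists_square_log (p z : Pl) {R : ℝ} (hR : 0 ≤ R)
    (h : ∀ w, ‖w - p‖ ≤ R → expk k w ≠ expk k z) :
    ∃ G : Pl → ℂ, Continuous G ∧
      ∀ w, ‖w - p‖ ≤ R → Complex.exp (G w) = expk k w - expk k z := by
  obtain ⟨G, hG, he⟩ := exists_continuous_log (X := Pl)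
    (h := fun w => expk k (sqr p R w) - expk k z)
    ((continuous_expk.comp (continuous_sqr p R)).sub continuous_const)
    fun w => sub_ne_zero.2 (h _ (sqr_mem hR w))
  exact ⟨G, hG, fun w hw => by rw [he, sqr_eq hw]⟩

end Winding

namespace TorusMetric
variable {M : TorusMetric} {k : ℤ × ℤ}

lemma Lip.of_le {P : ℝ → Pl} {ℓ : ℝ} (h : ∀ s t, s ≤ t → M.dist (P s) (P t) ≤ ℓ * (t - s)) :
    M.Lip P ℓ := by
  intro s t
  rcases le_total s t with hst | hst
  · rw [abs_of_nonpos (by linarith), neg_sub]; exact h s t hst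
  · rw [abs_of_nonneg (by linarith), M.dist_comm]; exact h t s hst

/-- Equivariant extension of an arc from `x` to `x + lat k`. -/
lemma exists_loop {T : ℝ} (hT : 0 < T) {p : ℝ → Pl}
    (hp : ∀ s ∈ Icc 0 T, ∀ t ∈ Icc 0 T, M.dist (p s) (p t) ≤ |s - t|) (hk : p T = p 0 + lat k) :
    ∃ P : ℝ → Pl, M.Lip P 1 ∧ (∀ t, P (t + T) = P t + lat k) ∧ ∀ t ∈ Icc 0 T, P t = p t := by
  set P : ℝ → Pl := fun s => p (s - ⌊s / T⌋ * T) + lat (⌊s / T⌋ • k) with hP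
  have hfl : ∀ s (j : ℤ), j * T ≤ s → s < (j + 1) * T → ⌊s / T⌋ = j := fun s j h1 h2 =>
    Int.floor_eq_iff.2 ⟨(le_div_iff₀ hT).2 h1, (div_lt_iff₀ hT).2 h2⟩
  have hcell : ∀ s (j : ℤ), j * T ≤ s → s ≤ (j + 1) * T → P s = p (s - j * T) + lat (j • k) := by
    intro s j h1 h2
    rcases h2.lt_or_eq with h2 | h2
    · simp only [hP, hfl s j h1 h2]
    · have : ⌊s / T⌋ = j + 1 := hfl s (j + 1) (by push_cast; linarith)
        (by push_cast; nlinarith)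
      simp only [hP, this]
      rw [show s - ((j + 1 : ℤ) : ℝ) * T = 0 by push_cast; linarith,
        show s - j * T = T by linarith, hk, add_smul, one_smul, lat_add]
      abel
  have hle : ∀ s, ⌊s / T⌋ * T ≤ s := fun s => (le_div_iff₀ hT).1 (Int.floor_le _)
  have hlt : ∀ s, s < (⌊s / T⌋ + 1) * T := fun s => (div_lt_iff₀ hT).1 (Int.lt_floor_add_one _)
  have hin : ∀ s t (j : ℤ), j * T ≤ s → s ≤ t → t ≤ (j + 1) * T → M.dist (P s) (P t) ≤ t - s := by
    intro s t j h1 h2 h3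
    rw [hcell s j h1 (by linarith), hcell t j (by linarith) h3, M.dist_translate]
    refine (hp _ ⟨by linarith, by linarith⟩ _ ⟨by linarith, by linarith⟩).trans ?_
    rw [abs_of_nonpos (by linarith)]; linarith
  have key : ∀ (m : ℕ) (s t : ℝ), s ≤ t → t ≤ (⌊s / T⌋ + 1 + m) * T → M.dist (P s) (P t) ≤ t - s := by
    intro m
    induction m with
    | zero => intro s t h1 h2; exact hin s t _ (hle s) h1 (by simpa using h2)
    | succ m ih =>
      intro s t h1 h2
      by_cases h3 : t ≤ (⌊s / T⌋ + 1 + m) * T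
      · exact ih s t h1 h3
      · push Not at h3
        have h4 : s ≤ (⌊s / T⌋ + 1 + m) * T := by
          have : (0 : ℝ) ≤ m * T := by positivity
          linarith [hlt s]
        have h5 := ih s _ h4 le_rfl
        have h6 := hin ((⌊s / T⌋ + 1 + m) * T) t (⌊s / T⌋ + 1 + m) (by push_cast; rfl) h3.le
          (by push_cast at h2 ⊢; linarith)
        linarith [M.dist_triangle (P s) (P ((⌊s / T⌋ + 1 + m) * T)) (P t)]
  refine ⟨P, Lip.of_le fun s t h => ?_, fun t => ?_, fun t ht => ?_⟩
  · rw [one_mul]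
    obtain ⟨m, hm⟩ := exists_nat_ge (t / T)
    have h1 := (div_le_iff₀ hT).1 hm
    by_cases h0 : 0 ≤ (⌊s / T⌋ + 1 : ℝ)
    · exact key m s t h (h1.trans (mul_le_mul_of_nonneg_right (by linarith) hT.le))
    · obtain ⟨m', hm'⟩ := exists_nat_ge (t / T - (⌊s / T⌋ + 1))
      refine key m' s t h ?_
      have := (div_le_iff₀ hT).1 (show t / T ≤ ⌊s / T⌋ + 1 + m' by linarith)
      linarith
  · have : ⌊(t + T) / T⌋ = ⌊t / T⌋ + 1 := by
      rw [add_div, div_self hT.ne', Int.floor_add_one]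
    simp only [hP, this]
    rw [show t + T - ((⌊t / T⌋ + 1 : ℤ) : ℝ) * T = t - ⌊t / T⌋ * T by push_cast; ring, add_smul,
      one_smul, lat_add]
    abel
  · rw [hcell t 0 (by simpa using ht.1) (by simpa using ht.2)]
    simp [lat_zero]

lemma abs_dist_lat_sub_le (M : TorusMetric) (k : ℤ × ℤ) (x y : Pl) :
    |M.dist x (x + lat k) - M.dist y (y + lat k)| ≤ 2 * M.dist x y := by
  have h1 := M.dist_triangle x y (x + lat k)
  have h2 := M.dist_triangle y (y + lat k) (x + lat k)
  have h3 := M.dist_triangle y x (y + lat k)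
  have h4 := M.dist_triangle x (x + lat k) (y + lat k)
  rw [M.dist_translate] at h2 h4
  rw [M.dist_comm y x] at h2 h3
  rw [abs_le]; constructor <;> linarith

lemma continuous_dist_lat (M : TorusMetric) (k : ℤ × ℤ) :
    Continuous fun x => M.dist x (x + lat k) :=
  M.continuous_dist.comp (continuous_id.prodMk (continuous_id.add continuous_const))

lemma exists_min_dist_lat (M : TorusMetric) (k : ℤ × ℤ) :
    ∃ p, ∀ x, M.dist p (p + lat k) ≤ M.dist x (x + lat k) := by
  obtain ⟨p, -, hp⟩ := (isCompact_Icc (a := (0 : Pl)) (b := 1)).exists_isMinOn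
    ⟨0, left_mem_Icc.2 zero_le_one⟩ (M.continuous_dist_lat k).continuousOn
  refine ⟨p, fun x => ?_⟩
  obtain ⟨j, hj⟩ := exists_lat_near x
  have h1 : M.dist p (p + lat k) ≤ M.dist (x - lat j) (x - lat j + lat k) := hp hj
  rwa [← M.dist_translate j (x - lat j), show x - lat j + lat k + lat j = x + lat k by abel,
    sub_add_cancel] at h1

lemma dist_lat_pos (M : TorusMetric) (hk : k ≠ 0) (x : Pl) : 0 < M.dist x (x + lat k) := by
  rcases (M.dist_nonneg x (x + lat k)).eq_or_lt with h | h
  · exfalso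
    have := M.eq_of_dist_le h.ge
    refine hk (lat_inj ?_)
    rw [lat_zero]; simpa using this.symm
  · exact h

lemma exists_loop_dist (M : TorusMetric) (hk : k ≠ 0) (x : Pl) : ∃ c : ℝ → Pl, M.Lip c 1 ∧
    (∀ t, c (t + M.dist x (x + lat k)) = c t + lat k) ∧ c 0 = x := by
  obtain ⟨σ, h0, h1, h2, h3⟩ := M.exists_seg x (x + lat k)
  obtain ⟨P, hP, hp, he⟩ := exists_loop (M.dist_lat_pos hk x) (p := σ)
    (fun s _ t _ => by simpa using h2 s t) (by rw [h0, h1])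
  exact ⟨P, hP, hp, by rw [he 0 ⟨le_rfl, M.dist_nonneg _ _⟩, h0]⟩

variable {L : ℝ}

lemma translate_iterate {c : ℝ → Pl} {T : ℝ} (h : ∀ t, c (t + T) = c t + lat k) (j : ℤ) (t : ℝ) :
    c (t + j * T) = c t + lat (j • k) := by
  induction j using Int.induction_on with
  | zero => simp [lat_zero]
  | succ i ih =>
    rw [show t + ((i + 1 : ℤ) : ℝ) * T = t + i * T + T by push_cast; ring, h, add_smul, one_smul,
      lat_add]
    push_cast at ih ⊢
    rw [ih]; abel
  | pred i ih =>
    have := h (t + ((-i - 1 : ℤ) : ℝ) * T)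
    rw [show t + ((-i - 1 : ℤ) : ℝ) * T + T = t + (-i : ℤ) * T by push_cast; ring, ih] at this
    rw [sub_smul, one_smul, lat_sub, ← add_sub_assoc, this]; abel

lemma le_dist_nsmul (hk : k ≠ 0) (hL : ∀ x, L ≤ M.dist x (x + lat k)) (n : ℕ) (x : Pl) :
    n * L ≤ M.dist x (x + lat (n • k)) := by
  induction n generalizing x with
  | zero => simpa using M.dist_nonneg _ _
  | succ n ih =>
    rcases Nat.eq_zero_or_pos n with rfl | hn
    · simpa using hL x
    have hk' : (n + 1) • k ≠ 0 := by
      rw [Ne, smul_eq_zero]; simp [hk]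
    obtain ⟨p, hp⟩ := M.exists_min_dist_lat ((n + 1) • k)
    refine le_trans ?_ (hp x)
    obtain ⟨c, h1, h2, -⟩ := M.exists_loop_dist hk' p
    obtain ⟨t, τ, h3, h4, h5⟩ := exists_square hk h1.continuous (M.dist_lat_pos hk' p)
      (by omega) h2
    set ℓ := M.dist p (p + lat ((n + 1) • k))
    have h6 := h1 t (t + τ)
    have h7 := h1 (t + τ) (t + ℓ)
    rw [h5, abs_of_nonpos (by linarith)] at h6
    rw [h2, h5, abs_of_nonpos (by linarith),
      show c t + lat ((n + 1) • k) = c t + lat k + lat (n • k) by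
        rw [add_smul, one_smul, lat_add]; abel] at h7
    push_cast
    linarith [hL (c t), ih (c t + lat k)]

lemma le_dist_zsmul (hk : k ≠ 0) (hL : ∀ x, L ≤ M.dist x (x + lat k)) (n : ℤ) (x : Pl) :
    |(n : ℝ)| * L ≤ M.dist x (x + lat (n • k)) := by
  obtain ⟨m, rfl | rfl⟩ := Int.eq_nat_or_neg n
  · simpa using le_dist_nsmul hk hL m x
  · have := le_dist_nsmul hk hL m (x + lat (-(m : ℤ) • k))
    rw [add_assoc, ← lat_add, neg_smul, natCast_zsmul, neg_add_cancel, lat_zero, add_zero,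
      M.dist_comm] at this
    simpa using this

/-- A `1`-Lipschitz loop whose period is the minimal displacement is minimal. -/
lemma isSeg_of_period (hk : k ≠ 0) (hL : ∀ x, L ≤ M.dist x (x + lat k)) (hL0 : 0 < L)
    {c : ℝ → Pl} (hc : M.Lip c 1) (hp : ∀ t, c (t + L) = c t + lat k) : M.IsSeg c univ := by
  have key : ∀ s t, s ≤ t → t - s ≤ M.dist (c s) (c t) := by
    intro s t hst
    obtain ⟨n, hn⟩ := exists_nat_ge ((t - s) / L)
    rw [div_le_iff₀ hL0] at hn
    have h1 := le_dist_nsmul hk hL n (c s)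
    have h2 := translate_iterate hp n s
    rw [natCast_zsmul] at h2
    push_cast at h2
    rw [← h2] at h1
    have h3 := hc t (s + n * L)
    rw [abs_of_nonpos (by linarith)] at h3
    linarith [M.dist_triangle (c s) (c t) (c (s + n * L))]
  intro s _ t _
  refine le_antisymm (by simpa using hc s t) ?_
  rcases le_total s t with hst | hst
  · rw [abs_of_nonpos (by linarith)]; linarith [key s t hst]
  · rw [abs_of_nonneg (by linarith), M.dist_comm]; exact key t s hst

end TorusMetric

section WindingClose
variable {k : ℤ × ℤ}

lemma wind_close (hk : k ≠ 0) {P Q : ℝ → Pl} (hP : Continuous P) (hQ : Continuous Q) {T δ : ℝ}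
    {n : ℤ} {z : Pl} (hp : P T = P 0 + lat (n • k)) (hq : Q T = Q 0 + lat (n • k))
    (hc : ∀ t, ‖Q t - P t‖ < δ) (hz : ∀ t (j : ℤ), δ ≤ ‖P t - (z + lat (j • k))‖) :
    wind k P T z = wind k Q T z := by
  have := wind_homotopy hk (P := fun s t => P t + s • (Q t - P t)) (z := fun _ => z) (T := T)
    (n := n) (by fun_prop) continuous_const
    (fun s _ => by simp only [hp, hq]; rw [add_sub_add_right_eq_sub]; abel)
    (fun s hs t he => by
      obtain ⟨j, hj⟩ := (expk_eq_iff hk).1 he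
      have h1 := hz t j
      rw [← hj, sub_add_cancel_left, norm_neg, norm_smul, Real.norm_eq_abs, abs_of_nonneg hs.1] at h1
      nlinarith [hc t, hs.2, norm_nonneg (Q t - P t)])
  simpa using this

lemma norm_le_zet (hk : k ≠ 0) (x : Pl) :
    ‖x‖ ≤ ‖(k.1 + k.2 * Complex.I : ℂ)‖ * ‖zet k x‖ := by
  rw [← norm_mul, zet, mul_div_cancel₀ _ (zet_den hk)]
  have h1 := Complex.abs_re_le_norm (x.1 + x.2 * Complex.I : ℂ)
  have h2 := Complex.abs_im_le_norm (x.1 + x.2 * Complex.I : ℂ)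
  simp only [Complex.add_re, Complex.ofReal_re, Complex.re_ofReal_mul, Complex.I_re, mul_zero,
    add_zero, Complex.add_im, Complex.ofReal_im, Complex.im_ofReal_mul, Complex.I_im, mul_one,
    zero_add] at h1 h2
  exact max_le h1 h2

lemma uniform_of_pointwise {E : Type*} [NormedAddCommGroup E] {u : ℕ → ℝ → E} {v : ℝ → E} {C : ℝ}
    (hu : ∀ n s t, ‖u n s - u n t‖ ≤ C * |s - t|) (hv : ∀ s t, ‖v s - v t‖ ≤ C * |s - t|)
    (h : ∀ t, Tendsto (fun n => u n t) Ult (𝓝 (v t))) {e : ℝ} (he : 0 < e) :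
    ∀ᶠ n in (Ult : Filter ℕ), ∀ t ∈ Icc (0 : ℝ) 1, ‖u n t - v t‖ < e := by
  obtain ⟨N, hN⟩ := exists_nat_gt (3 * |C| / e)
  have hN0 : (0 : ℝ) < N := lt_of_le_of_lt (by positivity) hN
  have hN1 : C / N < e / 3 := by
    rw [div_lt_iff₀ he] at hN
    rw [div_lt_iff₀ hN0]; nlinarith [le_abs_self C]
  have h1 : ∀ᶠ n in (Ult : Filter ℕ), ∀ i ∈ Finset.range (N + 1),
      ‖u n (i / N) - v (i / N)‖ < e / 3 := by
    rw [eventually_all_finset]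
    intro i _
    have := (tendsto_iff_norm_sub_tendsto_zero.1 (h (i / N))).eventually (gt_mem_nhds (by positivity : 0 < e / 3))
    exact this
  filter_upwards [h1] with n hn t ht
  set i := ⌊t * N⌋₊
  have h2 : (i : ℝ) ≤ t * N := Nat.floor_le (by have := ht.1; positivity)
  have h3 : t * N < i + 1 := Nat.lt_floor_add_one _
  have hi : i ∈ Finset.range (N + 1) := by
    rw [Finset.mem_range, Nat.lt_succ_iff]
    exact_mod_cast h2.trans (by nlinarith [ht.2] : t * N ≤ N)
  have h4 : |t - i / N| ≤ 1 / N := by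
    rw [abs_of_nonneg (by rw [sub_nonneg, div_le_iff₀ hN0]; exact h2), sub_le_iff_le_add, ← add_div,
      le_div_iff₀ hN0]
    linarith
  have hC : 0 ≤ C := by have := (norm_nonneg _).trans (hv 0 1); simpa using this
  have h5 : C * |t - i / N| ≤ C / N := by
    have := mul_le_mul_of_nonneg_left h4 hC
    rwa [mul_one_div] at this
  have h6 := hu n t (i / N)
  have h7 := hv (i / N) t
  rw [abs_sub_comm (i / N : ℝ)] at h7
  have h8 := hn i hi
  calc ‖u n t - v t‖ = ‖(u n t - u n (i / N)) + (u n (i / N) - v (i / N)) + (v (i / N) - v t)‖ := by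
        congr 1; abel
    _ ≤ ‖u n t - u n (i / N)‖ + ‖u n (i / N) - v (i / N)‖ + ‖v (i / N) - v t‖ := norm_add₃_le
    _ < e := by linarith

end WindingClose

namespace TorusMetric
variable {M : TorusMetric} {k : ℤ × ℤ}

/-- Loops in the class of `k` which stay at distance `ε` from `a` and separate `a` from `x`. -/
structure IsBar (M : TorusMetric) (k : ℤ × ℤ) (a : ℝ → Pl) (ε : ℝ) (x : Pl) (P : ℝ → Pl) (T : ℝ) :
    Prop where
  lip : M.Lip P 1
  pos : 0 < T
  per : ∀ t, P (t + T) = P t + lat k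
  far : ∀ t u, ε ≤ M.dist (P t) (a u)
  wd : wind k P T x ≠ wind k P T (a 0)

lemma Lip.dist_lat_le {P : ℝ → Pl} {T : ℝ} (hP : M.Lip P 1) (hT : 0 < T)
    (hp : ∀ t, P (t + T) = P t + lat k) (t : ℝ) : M.dist (P t) (P t + lat k) ≤ T := by
  have := hP t (t + T)
  rwa [hp, sub_add_cancel_left, abs_neg, abs_of_pos hT, one_mul] at this

lemma Lip.le_dist_of_period {P : ℝ → Pl} {T : ℝ} (hP : M.Lip P 1) (hT : 0 < T)
    (hp : ∀ t, P (t + T) = P t + lat k) (x : Pl) (t : ℝ) (j : ℤ) :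
    (M.dist x (x + lat k) - T) / 2 ≤ M.dist (P t) (x + lat (j • k)) := by
  have h1 := hP.dist_lat_le hT hp t
  have h2 := (abs_le.1 (M.abs_dist_lat_sub_le k (P t) (x + lat (j • k)))).1
  rw [add_right_comm x, M.dist_translate] at h2
  linarith

lemma expk_ne_of_dist (hk : k ≠ 0) {y x : Pl} (h : ∀ j : ℤ, 0 < M.dist y (x + lat (j • k))) :
    expk k y ≠ expk k x := by
  intro he
  obtain ⟨j, rfl⟩ := (expk_eq_iff hk).1 he
  exact (h j).ne' (M.dist_self _)

section
variable {a P : ℝ → Pl} {T Ta ε : ℝ} {x : Pl}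

lemma le_dist_translate (ha : ∀ t, a (t + Ta) = a t + lat k) {y : Pl}
    (h : ∀ u, ε ≤ M.dist y (a u)) (j : ℤ) (u : ℝ) : ε ≤ M.dist y (a u + lat (j • k)) := by
  rw [← translate_iterate ha]; exact h _

lemma IsBar.expk_ne (hk : k ≠ 0) (hε : 0 < ε) (ha : ∀ t, a (t + Ta) = a t + lat k)
    (h : M.IsBar k a ε x P T) (t u : ℝ) : expk k (P t) ≠ expk k (a u) :=
  expk_ne_of_dist hk fun j => hε.trans_le (le_dist_translate ha (h.far t) j u)

lemma IsBar.expk_ne' (hk : k ≠ 0) (h : M.IsBar k a ε x P T) (hT : T < M.dist x (x + lat k)) (t : ℝ) :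
    expk k (P t) ≠ expk k x :=
  expk_ne_of_dist hk fun j =>
    lt_of_lt_of_le (by linarith) (h.lip.le_dist_of_period h.pos h.per x t j)

lemma wind_path (hk : k ≠ 0) (hP : Continuous P) (hp : ∀ t, P (t + T) = P t + lat k) {z : ℝ → Pl}
    (hz : Continuous z) (h : ∀ s ∈ Icc (0 : ℝ) 1, ∀ t, z s ≠ P t) :
    wind k P T (z 0) = wind k P T (z 1) := by
  refine wind_homotopy hk (P := fun _ => P) (n := 1) (hP.comp continuous_snd) hz
    (fun s _ => by simpa using hp 0) fun s hs t he => ?_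
  obtain ⟨j, hj⟩ := (expk_eq_iff hk).1 he
  rw [← sub_eq_iff_eq_add, sub_eq_add_neg, ← lat_neg, ← neg_smul, ← translate_iterate hp] at hj
  exact h s hs _ hj.symm

lemma IsBar.wind_curve (hk : k ≠ 0) (hε : 0 < ε) (hac : Continuous a)
    (h : M.IsBar k a ε x P T) (u : ℝ) : wind k P T (a u) = wind k P T (a 0) := by
  have := wind_path hk h.lip.continuous h.per (z := fun s => a (s * u)) (by fun_prop)
    fun s _ t he => by
      have := h.far t (s * u)
      rw [he, M.dist_self] at this; linarith
  simpa using this.symm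

lemma wind_ball (hk : k ≠ 0) (hP : Continuous P) (hp : ∀ t, P (t + T) = P t + lat k) {y z : Pl}
    {r : ℝ} (hyz : M.dist y z < r) (h : ∀ t, r ≤ M.dist (P t) y) :
    wind k P T y = wind k P T z := by
  obtain ⟨σ, h0, h1, h2, h3⟩ := M.exists_seg y z
  have := wind_path hk hP hp (z := fun s => σ (s * M.dist y z)) (h2.continuous.comp (by fun_prop))
    fun s hs t he => by
      have h4 := h t
      have h5 := h2 (s * M.dist y z) 0
      rw [h0, he, sub_zero, abs_of_nonneg (mul_nonneg hs.1 (M.dist_nonneg _ _))] at h5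
      nlinarith [hs.2, M.dist_nonneg y z]
  simpa [h0, h1] using this

lemma IsBar.comp_add (hk : k ≠ 0) (hε : 0 < ε) (ha : ∀ t, a (t + Ta) = a t + lat k)
    (h : M.IsBar k a ε x P T) (hT : T < M.dist x (x + lat k)) (s : ℝ) :
    M.IsBar k a ε x (fun t => P (t + s)) T := by
  have hp : ∀ t, P (t + T) = P t + lat ((1 : ℤ) • k) := by simpa using h.per
  refine ⟨h.lip.comp_add s, h.pos, fun t => by rw [add_right_comm, h.per],
    fun t u => h.far _ u, ?_⟩
  rw [wind_comp_add hk h.lip.continuous (h.expk_ne' hk hT) hp,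
    wind_comp_add hk h.lip.continuous (fun t => h.expk_ne hk hε ha t 0) hp]
  exact h.wd

lemma IsBar.add_lat (hk : k ≠ 0) (ha : ∀ t, a (t + Ta) = a t + lat k)
    (h : M.IsBar k a ε x P T) (j : ℤ) : M.IsBar k a ε x (fun t => P t + lat (j • k)) T := by
  refine ⟨fun s t => by rw [M.dist_translate]; exact h.lip s t, h.pos,
    fun t => by rw [h.per]; abel, fun t u => ?_, ?_⟩
  · rw [← sub_add_cancel (a u) (lat (j • k)), M.dist_translate, sub_eq_add_neg, ← lat_neg,
      ← neg_smul]
    exact le_dist_translate ha (h.far t) _ _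
  · have := h.wd
    simpa only [wind, expk_add_lat hk] using this

/-- Normalized representatives. -/
lemma IsBar.exists_normalized (hk : k ≠ 0) (hε : 0 < ε) (ha : ∀ t, a (t + Ta) = a t + lat k)
    (h : M.IsBar k a ε x P T) (hT : T < M.dist x (x + lat k)) :
    ∃ Q, M.IsBar k a ε x Q T ∧ ‖Q 0‖ ≤ ‖(k.1 + k.2 * Complex.I : ℂ)‖ *
      (1 + (‖zet k x‖ + ‖zet k (a 0)‖)) := by
  set m := min (zet k x).im (zet k (a 0)).im
  set m' := max (zet k x).im (zet k (a 0)).im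
  have hg : Continuous fun t => (zet k (P t)).im :=
    Complex.continuous_im.comp (continuous_zet.comp h.lip.continuous)
  have hp : P T = P 0 + lat ((1 : ℤ) • k) := by simpa using h.per 0
  have hex : ∃ t, (zet k (P t)).im ∈ Icc m m' := by
    by_contra! hne
    have hne' : ∀ t, (zet k (P t)).im < m ∨ m' < (zet k (P t)).im := fun t => by
      by_contra! hh; exact hne t ⟨hh.1, hh.2⟩
    have hcases : (∀ t, (zet k (P t)).im < m) ∨ ∀ t, m' < (zet k (P t)).im := by
      by_contra! hh
      obtain ⟨⟨t, ht⟩, s, hs⟩ := hh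
      obtain ⟨u, hu⟩ := mem_range_of_exists_le_of_exists_ge hg
        ⟨s, (le_min (by
          rcases hne' s with h | h
          · exact (h.trans_le (min_le_left _ _)).le
          · linarith) (by
          rcases hne' s with h | h
          · exact (h.trans_le (min_le_right _ _)).le
          · linarith) : (zet k (P s)).im ≤ m)⟩ ⟨t, ht⟩
      exact hne u ⟨hu.ge, hu.le.trans (min_le_max)⟩
    apply h.wd
    rcases hcases with hc | hc
    · rw [wind_of_gt hk h.lip.continuous hp fun t => (hc t).trans_le (min_le_left _ _),
        wind_of_gt hk h.lip.continuous hp fun t => (hc t).trans_le (min_le_right _ _)]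
    · rw [wind_of_lt hk h.lip.continuous hp fun t => (le_max_left _ _).trans_lt (hc t),
        wind_of_lt hk h.lip.continuous hp fun t => (le_max_right _ _).trans_lt (hc t)]
  obtain ⟨t, ht⟩ := hex
  refine ⟨_, (h.comp_add hk hε ha hT t).add_lat hk ha (-⌊(zet k (P t)).re⌋), ?_⟩
  refine (norm_le_zet hk _).trans (mul_le_mul_of_nonneg_left ?_ (norm_nonneg _))
  simp only [zero_add]
  rw [zet_add, zet_lat_zsmul hk]
  refine (Complex.norm_le_abs_re_add_abs_im _).trans (add_le_add ?_ ?_)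
  · have h1 := Int.floor_le (zet k (P t)).re
    have h2 := Int.lt_floor_add_one (zet k (P t)).re
    rw [Complex.add_re, Complex.intCast_re, abs_le]
    push_cast
    constructor <;> linarith
  · rw [Complex.add_im, Complex.intCast_im, add_zero, abs_le]
    have h1 := abs_le.1 (Complex.abs_im_le_norm (zet k x))
    have h2 := abs_le.1 (Complex.abs_im_le_norm (zet k (a 0)))
    have h3 := norm_nonneg (zet k x)
    have h4 := norm_nonneg (zet k (a 0))
    constructor
    · refine le_trans ?_ ht.1
      refine le_min ?_ ?_ <;> linarith
    · refine ht.2.trans (max_le ?_ ?_) <;> linarith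

end
end TorusMetric

namespace TorusMetric
variable {M : TorusMetric} {k : ℤ × ℤ} {a P : ℝ → Pl} {T Ta ε L : ℝ} {x : Pl}

lemma wind_eventually_eq (hk : k ≠ 0) {Q : ℕ → ℝ → Pl} {S : ℕ → ℝ} {z : Pl} {r C : ℝ}
    (hQ : ∀ n, M.Lip (Q n) 1) (hq : ∀ n t, Q n (t + S n) = Q n t + lat k) (hS : ∀ n, |S n| ≤ C)
    (hP : M.Lip P 1) (hp : ∀ t, P (t + T) = P t + lat k) (hT : |T| ≤ C)
    (hl : ∀ t, Tendsto (fun n => Q n (t * S n)) Ult (𝓝 (P (t * T)))) (hr : 0 < r)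
    (hz : ∀ t (j : ℤ), r ≤ M.dist (P t) (z + lat (j • k)))
    (hz' : ∀ n t, expk k (Q n t) ≠ expk k z) :
    ∀ᶠ n in (Ult : Filter ℕ), wind k P T z = wind k (Q n) (S n) z := by
  have hK := M.K_pos
  have hlip : ∀ (R : ℝ → Pl) (S : ℝ), M.Lip R 1 → |S| ≤ C → ∀ s t,
      ‖R (s * S) - R (t * S)‖ ≤ M.K * C * |s - t| := fun R S hR hS s t => by
    have := hR.norm_sub_le (s * S) (t * S)
    rw [one_mul, ← sub_mul, abs_mul] at this
    refine this.trans ?_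
    rw [mul_assoc, mul_comm C]
    gcongr
  filter_upwards [uniform_of_pointwise (u := fun n t => Q n (t * S n)) (v := fun t => P (t * T))
    (fun n => hlip _ _ (hQ n) (hS n)) (hlip _ _ hP hT) hl (div_pos hr hK)] with n hn
  have e1 := wind_comp (T := 1) hP.continuous (z := z) (fun t => expk_ne_of_dist hk
    fun j => hr.trans_le (hz t j)) (φ := fun t => t * T) (by fun_prop) (zero_mul _)
  have e2 := wind_comp (T := 1) (hQ n).continuous (z := z) (hz' n) (φ := fun t => t * S n)
    (by fun_prop) (zero_mul _)
  rw [one_mul] at e1 e2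
  rw [← e1, ← e2]
  refine wind_close hk (hP.continuous.comp (by fun_prop)) ((hQ n).continuous.comp (by fun_prop))
    (δ := r / M.K) (n := 1) ?_ ?_ (fun t => ?_) fun t j => ?_
  · simpa using hp 0
  · simpa using hq n 0
  · have h1 := hn (Int.fract t) ⟨Int.fract_nonneg t, (Int.fract_lt_one t).le⟩
    have h2 : ∀ (R : ℝ → Pl) (S : ℝ), (∀ t, R (t + S) = R t + lat k) →
        R (t * S) = R (Int.fract t * S) + lat (⌊t⌋ • k) := fun R S hR => by
      rw [← translate_iterate hR, ← add_mul, Int.fract_add_floor]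
    change ‖Q n (t * S n) - P (t * T)‖ < _
    rw [h2 _ _ hp, h2 _ _ (hq n), add_sub_add_right_eq_sub]
    exact h1
  · rw [div_le_iff₀' hK]
    exact (hz _ j).trans (M.dist_le_norm_sub _ _)

lemma IsBar.exists_min (hk : k ≠ 0) (hε : 0 < ε) (ha : ∀ t, a (t + Ta) = a t + lat k)
    (hL : ∀ x, L ≤ M.dist x (x + lat k)) (hL0 : 0 < L)
    (h : M.IsBar k a ε x P T) (hT : T < M.dist x (x + lat k)) :
    ∃ P₀ T₀, M.IsBar k a ε x P₀ T₀ ∧ ∀ Q S, M.IsBar k a ε x Q S → T₀ ≤ S := by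
  have hK := M.K_pos
  set A : Set ℝ := {S | ∃ Q, M.IsBar k a ε x Q S} with hA
  have hlb : ∀ S ∈ A, L ≤ S := by
    rintro S ⟨Q, hQ⟩
    exact (hL _).trans (hQ.lip.dist_lat_le hQ.pos hQ.per 0)
  have hTA : T ∈ A := ⟨P, h⟩
  have hbd : BddBelow A := ⟨L, hlb⟩
  set T₀ := sInf A
  have hT₀ : L ≤ T₀ := le_csInf ⟨T, hTA⟩ hlb
  have hT₀T : T₀ ≤ T := csInf_le hbd hTA
  rcases hT₀T.eq_or_lt with he | hlt
  · exact ⟨P, T, h, fun Q S hQ => he ▸ csInf_le hbd ⟨Q, hQ⟩⟩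
  have hex : ∀ n : ℕ, ∃ S Q, M.IsBar k a ε x Q S ∧ S < T ∧ S < T₀ + 1 / (n + 1) ∧
      ‖Q 0‖ ≤ ‖(k.1 + k.2 * Complex.I : ℂ)‖ * (1 + (‖zet k x‖ + ‖zet k (a 0)‖)) := by
    intro n
    have h1 : (0 : ℝ) < 1 / (n + 1) := by positivity
    obtain ⟨S, ⟨Q, hQ⟩, hS⟩ := exists_lt_of_csInf_lt ⟨T, hTA⟩
      (lt_min hlt (by linarith : T₀ < T₀ + 1 / (n + 1)))
    have h2 := lt_min_iff.1 hS
    obtain ⟨Q', h3, h4⟩ := hQ.exists_normalized hk hε ha (h2.1.trans hT)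
    exact ⟨S, Q', h3, h2.1, h2.2, h4⟩
  choose S Q hQ hST hS hQ0 using hex
  set C := ‖(k.1 + k.2 * Complex.I : ℂ)‖ * (1 + (‖zet k x‖ + ‖zet k (a 0)‖))
  have hS0 : ∀ n, T₀ ≤ S n := fun n => csInf_le hbd ⟨Q n, hQ n⟩
  have hSl : Tendsto S atTop (𝓝 T₀) := by
    refine tendsto_of_tendsto_of_tendsto_of_le_of_le tendsto_const_nhds ?_ hS0 fun n => (hS n).le
    simpa using tendsto_const_nhds.add (tendsto_one_div_add_atTop_nhds_zero_nat (𝕜 := ℝ))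
  have hSu : Tendsto S Ult (𝓝 T₀) := hSl.mono_left ult_le
  obtain ⟨P₀, hP₀⟩ := exists_ulim_fun (u := Q) fun t => ⟨C + M.K * |t|, .of_forall fun n => by
    have h1 := (hQ n).lip.norm_sub_le t 0
    rw [sub_zero, one_mul] at h1
    linarith [norm_le_norm_add_norm_sub' (Q n t) (Q n 0), hQ0 n]⟩
  have hlim : ∀ (s : ℕ → ℝ) (s₀ : ℝ), Tendsto s Ult (𝓝 s₀) →
      Tendsto (fun n => Q n (s n)) Ult (𝓝 (P₀ s₀)) := by
    intro s s₀ hs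
    rw [tendsto_iff_norm_sub_tendsto_zero]
    have h1 := (tendsto_iff_norm_sub_tendsto_zero.1 hs).const_mul M.K
    have h2 := tendsto_iff_norm_sub_tendsto_zero.1 (hP₀ s₀)
    refine squeeze_zero (fun _ => norm_nonneg _) (fun n => ?_) (by simpa using h1.add h2)
    have h3 := (hQ n).lip.norm_sub_le (s n) s₀
    rw [one_mul] at h3
    exact (norm_sub_le_norm_sub_add_norm_sub _ (Q n s₀) _).trans (add_le_add_left h3 _)
  have hlip : M.Lip P₀ 1 := fun s t => le_of_tendsto (M.tendsto_dist (hP₀ s) (hP₀ t))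
    (.of_forall fun n => (hQ n).lip s t)
  have hfar : ∀ t u, ε ≤ M.dist (P₀ t) (a u) := fun t u =>
    ge_of_tendsto (M.tendsto_dist (hP₀ t) tendsto_const_nhds) (.of_forall fun n => (hQ n).far t u)
  have hper : ∀ t, P₀ (t + T₀) = P₀ t + lat k := fun t =>
    tendsto_nhds_unique (hlim (fun n => t + S n) (t + T₀) (tendsto_const_nhds.add hSu))
      (by simpa only [(hQ _).per] using (hP₀ t).add_const (lat k))
  have hT₀0 := hL0.trans_le hT₀
  have hCb : ∀ n, |S n| ≤ T := fun n => by
    rw [abs_of_pos (hQ n).pos]; exact (hST n).le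
  have hw : ∀ z r, 0 < r → (∀ t (j : ℤ), r ≤ M.dist (P₀ t) (z + lat (j • k))) →
      (∀ n t, expk k (Q n t) ≠ expk k z) →
      ∀ᶠ n in (Ult : Filter ℕ), wind k P₀ T₀ z = wind k (Q n) (S n) z := fun z r hr h1 h2 =>
    wind_eventually_eq hk (fun n => (hQ n).lip) (fun n => (hQ n).per) hCb hlip hper
      (by rw [abs_of_pos hT₀0]; exact hT₀T) (fun t => hlim _ _ (hSu.const_mul t)) hr h1 h2
  obtain ⟨n, h1, h2⟩ := ((hw x ((M.dist x (x + lat k) - T₀) / 2) (by linarith)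
    (hlip.le_dist_of_period hT₀0 hper x)
    (fun n => (hQ n).expk_ne' hk ((hST n).trans hT))).and
    (hw (a 0) ε hε (fun t j => le_dist_translate ha (hfar t) j 0)
      fun n t => (hQ n).expk_ne hk hε ha t 0)).exists
  exact ⟨P₀, T₀, ⟨hlip, hT₀0, hper, hfar, by rw [h1, h2]; exact (hQ n).wd⟩,
    fun R S' hR => csInf_le hbd ⟨R, hR⟩⟩

end TorusMetric

namespace TorusMetric
variable {M : TorusMetric} {k : ℤ × ℤ} {a P : ℝ → Pl} {T Ta ε L : ℝ} {x : Pl}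

/-- Replacing an arc of a loop by another arc with the same end points in a small square. -/
lemma wind_replace (hk : k ≠ 0) {Q : ℝ → Pl} (hP : Continuous P) (hQ : Continuous Q) {z : Pl}
    {R e τ : ℝ} (he : 0 ≤ e) (hτ : 0 ≤ τ) (hτT : τ ≤ T) (h0 : Q 0 = P 0) (hR : 0 ≤ R)
    (hPz : ∀ t, expk k (P t) ≠ expk k z) (hQz : ∀ t, expk k (Q t) ≠ expk k z)
    (hz : ∀ j : ℤ, R < ‖P 0 - (z + lat (j • k))‖) (hPR : ∀ t ∈ Icc 0 τ, ‖P t - P 0‖ ≤ R)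
    (hQR : ∀ t ∈ Icc 0 e, ‖Q t - P 0‖ ≤ R) (heq : ∀ t, e ≤ t → t ≤ T - τ + e → Q t = P (t - e + τ)) :
    wind k Q (T - τ + e) z = wind k P T z := by
  obtain ⟨θ, hθ, hθe⟩ := exists_wind_log hP hPz
  obtain ⟨η, hη, hηe⟩ := exists_wind_log hQ hQz
  obtain ⟨G, hG, hGe⟩ := exists_square_log (k := k) (P 0) z hR fun w hw he => by
    obtain ⟨j, rfl⟩ := (expk_eq_iff hk).1 he
    have := hz j
    rw [norm_sub_rev] at this
    linarith
  rw [wind_eq hθ hθe, wind_eq hη hηe]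
  have a1 : ∀ t ∈ Icc 0 τ, Complex.exp (θ t) = Complex.exp ((fun s => G (P s)) t) := fun t ht => by
    rw [hθe]; exact (hGe _ (hPR t ht)).symm
  have a2 : ∀ t ∈ Icc 0 e, Complex.exp (η t) = Complex.exp ((fun s => G (Q s)) t) := fun t ht => by
    rw [hηe]; exact (hGe _ (hQR t ht)).symm
  have e1 := log_increment_eq hθ (hG.comp hP) continuous_id hτ a1
  have e2 := log_increment_eq hη (hG.comp hQ) continuous_id he a2
  have e3 := log_increment_eq hη hθ (φ := fun t => t - e + τ) (by fun_prop)
    (by linarith : e ≤ T - τ + e) fun t ht => by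
      rw [hηe, hθe, heq t ht.1 ht.2]
  have h1 : Q e = P τ := by rw [heq e le_rfl (by linarith)]; ring_nf
  simp only [Function.comp_apply, id, h0, h1, sub_self, zero_add,
    show T - τ + e - e + τ = T by ring] at e1 e2 e3
  linear_combination e3 + e2 - e1

lemma wind_curve_eq (hk : k ≠ 0) (hε : 0 < ε) (hac : Continuous a) (hP : Continuous P)
    (hp : ∀ t, P (t + T) = P t + lat k) (hf : ∀ t u, ε ≤ M.dist (P t) (a u)) (u : ℝ) :
    wind k P T (a u) = wind k P T (a 0) := by
  have := wind_path hk hP hp (z := fun s => a (s * u)) (by fun_prop)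
    fun s _ t he => by
      have := hf t (s * u)
      rw [he, M.dist_self] at this; linarith
  simpa using this.symm

lemma exists_far_point (hk : k ≠ 0) (ha1 : M.Lip a 1) (ha : ∀ t, a (t + Ta) = a t + lat k)
    (hTa : 0 < Ta) (hL : ∀ x, L ≤ M.dist x (x + lat k)) {r : ℝ} (hr : 2 * r + Ta / 2 < L) (y : Pl) :
    ∃ w, ∀ j : ℤ, r < M.dist y (a w + lat (j • k)) := by
  by_contra! hne
  obtain ⟨i, hi⟩ := hne 0
  obtain ⟨j, hj⟩ := hne (Ta / 2)
  rw [← translate_iterate ha] at hi hj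
  rw [M.dist_comm] at hi
  have key : ∀ m : ℤ, |Ta / 2 + j * Ta - (0 + i * Ta + m * Ta)| = Ta / 2 → m = 0 := by
    intro m hm
    have h1 := le_dist_zsmul hk hL m (a (0 + i * Ta))
    rw [← translate_iterate ha] at h1
    have h2 := M.dist_triangle (a (0 + i * Ta)) y (a (0 + i * Ta + m * Ta))
    have h3 := M.dist_triangle y (a (Ta / 2 + j * Ta)) (a (0 + i * Ta + m * Ta))
    have h4 := ha1 (Ta / 2 + j * Ta) (0 + i * Ta + m * Ta)
    rw [hm] at h4
    have h5 : |(m : ℝ)| * L < 1 * L := by linarith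
    have h6 : |(m : ℝ)| < 1 := lt_of_mul_lt_mul_right h5 (by
      by_contra! hL0
      have := (M.dist_nonneg (a (0 + i * Ta)) y).trans hi
      linarith)
    have h7 : |m| < 1 := by exact_mod_cast h6
    exact abs_eq_zero.1 (by have := abs_nonneg m; omega)
  have h1 := key (j - i) (by
    push_cast
    rw [show Ta / 2 + j * Ta - (0 + i * Ta + (j - i) * Ta) = Ta / 2 by ring, abs_of_pos (half_pos hTa)])
  have h2 := key (j - i + 1) (by
    push_cast
    rw [show Ta / 2 + j * Ta - (0 + i * Ta + (j - i + 1) * Ta) = -(Ta / 2) by ring, abs_neg,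
      abs_of_pos (half_pos hTa)])
  omega

/-- The smallness conditions under which shortest barriers have no short cuts. -/
structure Small (M : TorusMetric) (L Λ l ρ : ℝ) : Prop where
  pos : 0 < ρ
  unique : ∀ (c₁ c₂ : ℝ → Pl) (h : ℝ), h ≤ ρ → M.IsSeg c₁ (Icc 0 h) → M.IsSeg c₂ (Icc 0 h) →
    c₁ 0 = c₂ 0 → c₁ h = c₂ h → ∀ t ∈ Icc 0 h, c₁ t = c₂ t
  lt_two : ρ + l < 2 * L
  gap : M.K ^ 2 * (ρ + l - L) < (Λ - l) / 2
  half : 2 * (M.K ^ 2 * (ρ + l - L)) + l / 2 < L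
  lt : l < Λ
  pos_L : 0 < L

variable {l ρ : ℝ}

lemma tendsto_of_period (hk : k ≠ 0) (hL : ∀ x, L ≤ M.dist x (x + lat k)) (hL0 : 0 < L)
    (hP : M.Lip P 1) (hT : 0 < T) (hp : ∀ t, P (t + T) = P t + lat k) :
    Tendsto P (cocompact ℝ) (cocompact Pl) := by
  have h1 : ∀ t, |t| / T * L - L - T - M.K * ‖P 0‖ ≤ M.K * ‖P t‖ := fun t => by
    have h3 := Int.floor_le (t / T)
    have h4 := Int.lt_floor_add_one (t / T)
    have h5 : |t / T| ≤ |(⌊t / T⌋ : ℝ)| + 1 := by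
      have := abs_sub_abs_le_abs_sub (t / T) ⌊t / T⌋
      rw [abs_of_nonneg (sub_nonneg.2 h3)] at this
      linarith
    rw [abs_div, abs_of_pos hT] at h5
    rw [le_div_iff₀ hT] at h3
    rw [div_lt_iff₀ hT] at h4
    have h6 := le_dist_zsmul hk hL ⌊t / T⌋ (P 0)
    rw [← translate_iterate hp, zero_add] at h6
    have h7 := hP t (⌊t / T⌋ * T)
    rw [abs_of_nonneg (by linarith)] at h7
    have h8 := M.dist_triangle (P 0) (P t) (P (⌊t / T⌋ * T))
    have h9 := M.dist_le_norm_sub (P 0) (P t)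
    have h10 := mul_le_mul_of_nonneg_left (norm_sub_le (P 0) (P t)) M.K_pos.le
    have h11 := mul_le_mul_of_nonneg_right h5 hL0.le
    linarith
  have h2 : Tendsto (fun t : ℝ => M.K * ‖P t‖) (cocompact ℝ) atTop := by
    refine tendsto_atTop_mono h1 ?_
    simp only [sub_eq_add_neg, add_assoc]
    refine tendsto_atTop_add_const_right _ _ ?_
    have := (tendsto_norm_cocompact_atTop (E := ℝ)).atTop_mul_const (div_pos hL0 hT)
    refine this.congr fun t => ?_
    rw [Real.norm_eq_abs]; ring
  exact tendsto_cocompact_of_tendsto_dist_comp_atTop (0 : Pl) (by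
    simpa only [dist_zero_right] using (tendsto_const_mul_atTop_of_pos M.K_pos).1 h2)

lemma isClosed_range_of_period (hk : k ≠ 0) (hL : ∀ x, L ≤ M.dist x (x + lat k)) (hL0 : 0 < L)
    (hP : M.Lip P 1) (hT : 0 < T) (hp : ∀ t, P (t + T) = P t + lat k) : IsClosed (range P) :=
  (isProperMap_iff_tendsto_cocompact.2
    ⟨hP.continuous, tendsto_of_period hk hL hL0 hP hT hp⟩).isClosedMap.isClosed_range

/-- The side of a barrier away from `x`. -/
def Side (k : ℤ × ℤ) (x : Pl) (P : ℝ → Pl) (T : ℝ) : Set Pl :=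
  {z | z ∈ range P ∨ wind k P T z ≠ wind k P T x}

lemma IsBar.mem_side (hk : k ≠ 0) (hε : 0 < ε) (ha1 : M.Lip a 1) (h : M.IsBar k a ε x P T) {z : Pl}
    {u : ℝ} (hz : M.dist (a u) z < ε) : z ∈ Side k x P T := by
  right
  rw [← wind_ball hk h.lip.continuous h.per hz fun t => h.far t u,
    h.wind_curve hk hε ha1.continuous]
  exact h.wd.symm

lemma IsBar.le_dist_side (hk : k ≠ 0) (h : M.IsBar k a ε x P T) {z : Pl} (hz : z ∈ Side k x P T)
    (j : ℤ) : (M.dist x (x + lat k) - T) / 2 ≤ M.dist (x + lat (j • k)) z := by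
  rcases hz with ⟨t, rfl⟩ | hz
  · rw [M.dist_comm (x + _)]; exact h.lip.le_dist_of_period h.pos h.per x t j
  · by_contra! hlt
    have h1 := wind_ball hk h.lip.continuous h.per hlt fun t =>
      h.lip.le_dist_of_period h.pos h.per x t j
    apply hz
    rw [← h1]
    simp only [wind, expk_add_lat hk]

/-- The last point of a curve segment in a closed set. -/
lemma exists_last {A : Set Pl} (hA : IsClosed A) {σ : ℝ → Pl} (hσ : Continuous σ) {a b : ℝ}
    (hne : ∃ u ∈ Icc a b, σ u ∈ A) : ∃ u ∈ Icc a b, σ u ∈ A ∧ ∀ v ∈ Ioc u b, σ v ∉ A := by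
  have hc : IsCompact (Icc a b ∩ σ ⁻¹' A) := isCompact_Icc.inter_right (hA.preimage hσ)
  obtain ⟨u, hu, hmax⟩ := hc.exists_isMaxOn (by
    obtain ⟨u, h1, h2⟩ := hne; exact ⟨u, h1, h2⟩) continuousOn_id
  refine ⟨u, hu.1, hu.2, fun v hv hA => ?_⟩
  have := hmax (⟨⟨hu.1.1.trans hv.1.le, hv.2⟩, hA⟩ : v ∈ Icc a b ∩ σ ⁻¹' A)
  exact absurd hv.1 (not_lt.2 this)

section
variable (hk : k ≠ 0) (hε : 0 < ε) (ha1 : M.Lip a 1)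
    (ha : ∀ t, a (t + Ta) = a t + lat k) (hTa : 0 < Ta) (hTal : Ta < l)
    (hL : ∀ x, L ≤ M.dist x (x + lat k)) (hs : M.Small L (M.dist x (x + lat k)) l ρ)
    (h : M.IsBar k a ε x P T) (hT : T < l) (hmin : ∀ Q S, M.IsBar k a ε x Q S → T ≤ S)

include hk hε ha1 ha hTa hTal hL hs h hT hmin

lemma IsBar.no_shortcut_zero
    {β : ℝ → Pl} {e τ : ℝ} (he : 0 < e) (heρ : e ≤ ρ) (hβ : M.IsSeg β (Icc 0 e)) (h0 : β 0 = P 0)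
    (h1 : β e = P τ) (hτ : 0 < τ) (hne : ∀ u ∈ Ioo 0 e, ∀ t, β u ≠ P t)
    (hw : ∀ u ∈ Ioo 0 e, wind k P T (β u) = wind k P T x) : False := by
  have hK := M.K_pos
  have hT0 := h.pos
  have hLT : L ≤ T := (hL _).trans (h.lip.dist_lat_le hT0 h.per 0)
  have hL0 := hs.pos_L
  have heτ : e ≤ τ := by
    have h2 := hβ 0 ⟨le_rfl, he.le⟩ e ⟨he.le, le_rfl⟩
    have h3 := h.lip 0 τ
    rw [h0, h1, zero_sub, abs_neg, abs_of_pos he] at h2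
    rw [zero_sub, abs_neg, abs_of_pos hτ] at h3
    linarith
  have hbd : (⌈τ / T⌉ : ℝ) * L ≤ e + (⌈τ / T⌉ * T - τ) := by
    have h2 := le_dist_zsmul hk hL ⌈τ / T⌉ (P 0)
    rw [← translate_iterate h.per] at h2
    have h3 := hβ 0 ⟨le_rfl, he.le⟩ e ⟨he.le, le_rfl⟩
    rw [h0, h1, zero_sub, abs_neg, abs_of_pos he] at h3
    have h4 := h.lip τ (0 + ⌈τ / T⌉ * T)
    have h5 := M.dist_triangle (P 0) (P τ) (P (0 + ⌈τ / T⌉ * T))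
    have h6 : τ ≤ ⌈τ / T⌉ * T := (div_le_iff₀ hT0).1 (Int.le_ceil _)
    rw [zero_add] at h2 h4 h5
    rw [abs_sub_comm, abs_of_nonneg (by linarith)] at h4
    nlinarith [le_abs_self (⌈τ / T⌉ : ℝ)]
  have hm : ⌈τ / T⌉ = 1 := by
    have h2 : 0 < ⌈τ / T⌉ := Int.ceil_pos.2 (div_pos hτ hT0)
    have h3 : (⌈τ / T⌉ : ℝ) * T - τ < T := by
      have := (lt_div_iff₀ hT0).1 (sub_lt_iff_lt_add.2 (Int.ceil_lt_add_one (τ / T)))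
      linarith
    have h4 : (⌈τ / T⌉ : ℝ) * L < 2 * L := by linarith [hs.lt_two]
    have h5 : (⌈τ / T⌉ : ℝ) < 2 := lt_of_mul_lt_mul_right h4 hL0.le
    have h6 : ⌈τ / T⌉ < 2 := by exact_mod_cast h5
    omega
  have hτT : τ ≤ T := by
    have := (div_le_iff₀ hT0).1 (Int.le_ceil (τ / T))
    rwa [hm, Int.cast_one, one_mul] at this
  rw [hm, Int.cast_one, one_mul, one_mul] at hbd
  rcases heτ.eq_or_lt with rfl | hlt
  · have hPs : M.IsSeg P (Icc 0 e) := IsSeg.of_le he.le (fun s _ t _ => by simpa using h.lip s t) (by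
      rw [← h0, ← h1, hβ 0 ⟨le_rfl, he.le⟩ e ⟨he.le, le_rfl⟩, zero_sub, abs_neg, abs_of_pos he, sub_zero])
    exact hne (e / 2) ⟨by linarith, by linarith⟩ _
      (hs.unique β P e heρ hβ hPs h0 h1 (e / 2) ⟨by linarith, by linarith⟩)
  set T' := T - τ + e with hT'
  have hT'0 : 0 < T' := by linarith
  set q : ℝ → Pl := fun s => if s ≤ e then β s else P (s - e + τ) with hq
  have hq1 : ∀ s, s ≤ e → q s = β s := fun s hs => if_pos hs
  have hq2 : ∀ s, e ≤ s → q s = P (s - e + τ) := fun s hs => by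
    rcases hs.eq_or_lt with rfl | hs
    · rw [hq1 _ le_rfl, h1]; ring_nf
    · exact if_neg (not_le.2 hs)
  have hqle : ∀ s ∈ Icc 0 T', ∀ t ∈ Icc 0 T', s ≤ t → M.dist (q s) (q t) ≤ t - s := by
    intro s hs t ht hst
    have hβ' : ∀ s t, 0 ≤ s → s ≤ t → t ≤ e → M.dist (q s) (q t) ≤ t - s := fun s t h1 h2 h3 => by
      rw [hq1 _ (h2.trans h3), hq1 _ h3, hβ s ⟨h1, h2.trans h3⟩ t ⟨h1.trans h2, h3⟩, abs_sub_comm,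
        abs_of_nonneg (by linarith)]
    have hP' : ∀ s t, e ≤ s → s ≤ t → M.dist (q s) (q t) ≤ t - s := fun s t h1 h2 => by
      rw [hq2 _ h1, hq2 _ (h1.trans h2)]
      refine (h.lip _ _).trans_eq ?_
      rw [abs_sub_comm, abs_of_nonneg (by linarith)]; ring
    rcases le_total t e with h1 | h1
    · exact hβ' s t hs.1 hst h1
    rcases le_total e s with h2 | h2
    · exact hP' s t h2 hst
    · linarith [M.dist_triangle (q s) (q e) (q t), hβ' s e hs.1 h2 le_rfl, hP' e t le_rfl h1]
  obtain ⟨Q, hQ1, hQp, hQq⟩ := exists_loop hT'0 (p := q) (k := k) (fun s hs t ht => by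
    rcases le_total s t with h | h
    · rw [abs_sub_comm, abs_of_nonneg (by linarith)]; exact hqle s hs t ht h
    · rw [M.dist_comm, abs_of_nonneg (by linarith)]; exact hqle t ht s hs h) (by
    rw [hq2 T' (by linarith), hq1 0 he.le, h0, ← h.per]; congr 1; rw [hT']; ring)
  have hfar : ∀ t u, ε ≤ M.dist (Q t) (a u) := by
    have h2 : ∀ t ∈ Icc 0 T', ∀ u, ε ≤ M.dist (q t) (a u) := by
      intro t ht u
      rcases le_or_gt e t with h3 | h3
      · rw [hq2 t h3]; exact h.far _ u
      rw [hq1 t h3.le]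
      rcases ht.1.eq_or_lt with rfl | h4
      · rw [h0]; exact h.far _ u
      by_contra! h5
      rw [M.dist_comm] at h5
      have h6 := wind_ball hk h.lip.continuous h.per h5 (fun t => h.far t u)
      rw [hw t ⟨h4, h3⟩, h.wind_curve hk hε ha1.continuous] at h6
      exact h.wd h6.symm
    intro t u
    have h3 := Int.floor_le (t / T')
    have h4 := Int.lt_floor_add_one (t / T')
    rw [le_div_iff₀ hT'0] at h3
    rw [div_lt_iff₀ hT'0] at h4
    have h5 : t = (t - ⌊t / T'⌋ * T') + ⌊t / T'⌋ * T' := by ring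
    have h6 : t - ⌊t / T'⌋ * T' ∈ Icc 0 T' := ⟨by linarith, by linarith⟩
    rw [h5, translate_iterate hQp, hQq _ h6, ← sub_add_cancel (a u) (lat (⌊t / T'⌋ • k)),
      M.dist_translate, sub_eq_add_neg (a u), ← lat_neg, ← neg_smul]
    exact le_dist_translate ha (h2 _ h6) _ _
  have hTT' : T' < T := by linarith
  have hκ0 : 0 ≤ M.K * (ρ + l - L) := mul_nonneg hK.le (by linarith)
  have hrep : ∀ z, (∀ t, expk k (P t) ≠ expk k z) → (∀ t, expk k (Q t) ≠ expk k z) →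
      (∀ j : ℤ, M.K ^ 2 * (ρ + l - L) < M.dist (P 0) (z + lat (j • k))) →
      wind k Q T' z = wind k P T z := fun z hz1 hz2 hz3 => by
    refine wind_replace hk h.lip.continuous hQ1.continuous he.le hτ.le hτT ?_ hκ0 hz1 hz2
      (fun j => ?_) (fun t ht => ?_) (fun t ht => ?_) fun t h1 h2 => ?_
    · rw [hQq 0 ⟨le_rfl, hT'0.le⟩, hq1 0 he.le, h0]
    · have := (hz3 j).trans_le (M.dist_le_norm_sub _ _)
      rw [pow_two, mul_assoc] at this
      exact lt_of_mul_lt_mul_left this hK.le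
    · have := h.lip.norm_sub_le t 0
      rw [sub_zero, abs_of_nonneg ht.1, one_mul] at this
      refine this.trans ?_
      gcongr; linarith [ht.2]
    · rw [hQq t ⟨ht.1, by linarith [ht.2]⟩, hq1 t ht.2, ← h0]
      refine (M.norm_sub_le_dist _ _).trans ?_
      rw [hβ t ht 0 ⟨le_rfl, he.le⟩, sub_zero, abs_of_nonneg ht.1]
      gcongr; linarith [ht.2]
    · rw [hQq t ⟨by linarith, h2⟩, hq2 t h1]
  have hTΛ : T < M.dist x (x + lat k) := hT.trans hs.lt
  have hx := hrep x (h.expk_ne' hk hTΛ) (fun t => expk_ne_of_dist hk fun j =>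
    lt_of_lt_of_le (by linarith) (hQ1.le_dist_of_period hT'0 hQp x t j)) fun j =>
      lt_of_lt_of_le (by linarith [hs.gap]) (h.lip.le_dist_of_period hT0 h.per x 0 j)
  obtain ⟨w, hw'⟩ := exists_far_point hk ha1 ha hTa hL (r := M.K ^ 2 * (ρ + l - L))
    (by linarith [hs.half]) (P 0)
  have ha' := hrep (a w) (fun t => h.expk_ne hk hε ha t w)
    (fun t => expk_ne_of_dist hk fun j => hε.trans_le (le_dist_translate ha (hfar t) j w)) hw'
  have := hmin Q T' ⟨hQ1, hT'0, hQp, hfar, by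
    rw [hx, ← wind_curve_eq hk hε ha1.continuous hQ1.continuous hQp hfar w, ha',
      h.wind_curve hk hε ha1.continuous]
    exact h.wd⟩
  linarith

lemma IsBar.no_shortcut
    {β : ℝ → Pl} {e t₁ t₂ : ℝ} (he : 0 < e) (heρ : e ≤ ρ) (hβ : M.IsSeg β (Icc 0 e))
    (h0 : β 0 = P t₁) (h1 : β e = P t₂) (hτ : t₁ < t₂) (hne : ∀ u ∈ Ioo 0 e, ∀ t, β u ≠ P t)
    (hw : ∀ u ∈ Ioo 0 e, wind k P T (β u) = wind k P T x) : False := by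
  have hp : ∀ t, P (t + T) = P t + lat ((1 : ℤ) • k) := by simpa using h.per
  refine (h.comp_add hk hε ha (hT.trans hs.lt) t₁).no_shortcut_zero hk hε ha1 ha hTa hTal hL hs hT
    hmin he heρ hβ (τ := t₂ - t₁) (by simpa using h0) (by simpa using h1) (sub_pos.2 hτ)
    (fun u hu t => hne u hu _) fun u hu => ?_
  rw [wind_comp_add hk h.lip.continuous (h.expk_ne' hk (hT.trans hs.lt)) hp,
    wind_comp_add hk h.lip.continuous (fun t he => ?_) hp]
  · exact hw u hu
  · obtain ⟨j, hj⟩ := (expk_eq_iff hk).1 he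
    rw [← sub_eq_iff_eq_add, sub_eq_add_neg, ← lat_neg, ← neg_smul, ← translate_iterate h.per] at hj
    exact hne u hu _ hj.symm

lemma IsBar.segment_subset_side
    {σ : ℝ → Pl} {e : ℝ} (heρ : e ≤ ρ) (hσl : M.Lip σ 1) (hσ : M.IsSeg σ (Icc 0 e))
    (h0 : σ 0 ∈ Side k x P T) (h1 : σ e ∈ Side k x P T) {u : ℝ} (hu : u ∈ Icc 0 e) :
    σ u ∈ Side k x P T := by
  by_contra hnot
  have hnot' : σ u ∉ range P ∧ wind k P T (σ u) = wind k P T x := by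
    constructor
    · exact fun h => hnot (Or.inl h)
    · by_contra h; exact hnot (Or.inr h)
  have hcl := isClosed_range_of_period hk hL hs.pos_L h.lip h.pos h.per
  have hcw : ∀ v w, (∀ s ∈ Icc (0 : ℝ) 1, σ (v + s * (w - v)) ∉ range P) →
      wind k P T (σ v) = wind k P T (σ w) := fun v w hvw => by
    have := wind_path hk h.lip.continuous h.per (z := fun s => σ (v + s * (w - v)))
      (hσl.continuous.comp (by fun_prop)) fun s hs t he => hvw s hs ⟨t, he.symm⟩
    simpa using this
  have hlast : ∀ τ : ℝ → Pl, Continuous τ → ∀ b, 0 ≤ b → τ 0 ∈ Side k x P T → τ b = σ u →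
      (∀ v, (∀ s ∈ Icc (0 : ℝ) 1, τ (b + s * (v - b)) ∉ range P) →
        wind k P T (τ b) = wind k P T (τ v)) →
      ∃ w ∈ Ico 0 b, τ w ∈ range P ∧ ∀ v ∈ Ioc w b, τ v ∉ range P ∧
        wind k P T (τ v) = wind k P T x := by
    intro τ hτ b hb h1 h2 h3
    obtain ⟨w, hw, hwP, hw'⟩ := exists_last hcl hτ (a := 0) (b := b) (by
      by_contra! hne
      have h4 := h3 0 fun s hs => hne _ ⟨by nlinarith [hs.1, hs.2], by nlinarith [hs.1, hs.2]⟩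
      rw [h2, hnot'.2] at h4
      rcases h1 with h1 | h1
      · exact hne 0 ⟨le_rfl, hb⟩ h1
      · exact h1 h4.symm)
    refine ⟨w, ⟨hw.1, lt_of_le_of_ne hw.2 fun hwb => hnot'.1 (by rw [← h2, ← hwb]; exact hwP)⟩, hwP,
      fun v hv => ⟨hw' v hv, ?_⟩⟩
    rw [← h3 v fun s hs => hw' _ ⟨by nlinarith [hs.1, hs.2, hv.1, hv.2], by nlinarith [hs.1, hs.2, hv.1, hv.2]⟩, h2,
      hnot'.2]
  obtain ⟨u₁, hu₁, ⟨t₁, ht₁⟩, hu₁'⟩ := hlast σ hσl.continuous u hu.1 h0 rfl fun v => hcw u v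
  obtain ⟨w, hw, ⟨t₂, ht₂⟩, hw'⟩ := hlast (fun s => σ (e - s)) (hσl.continuous.comp (by fun_prop))
    (e - u) (by linarith [hu.2]) (by simpa using h1) (by simp) fun v hv => hcw _ _ fun s hs => by
      have := hv s hs
      rwa [show e - (e - u + s * (v - (e - u))) = e - (e - u) + s * (e - v - (e - (e - u))) by ring]
        at this
  set u₂ := e - w
  have h12 : u₁ < u ∧ u < u₂ := ⟨hu₁.2, by simp only [u₂]; linarith [hw.2]⟩
  have hu₂e : u₂ ≤ e := by simp only [u₂]; linarith [hw.1]
  have hin : ∀ v ∈ Ioo u₁ u₂, σ v ∉ range P ∧ wind k P T (σ v) = wind k P T x := by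
    intro v hv
    rcases le_total v u with hvu | hvu
    · exact hu₁' v ⟨hv.1, hvu⟩
    · have := hw' (e - v) ⟨by linarith [hv.2, show u₂ = e - w from rfl], by linarith⟩
      simpa using this
  have hlen : 0 < u₂ - u₁ := by linarith
  rcases lt_trichotomy t₁ t₂ with ht | ht | ht
  · refine h.no_shortcut hk hε ha1 ha hTa hTal hL hs hT hmin (β := fun s => σ (s + u₁)) hlen
      (by linarith [hu₁.1]) ((hσ.comp_add u₁).mono fun s hs => ?_) (t₁ := t₁) (t₂ := t₂)
      (by simp [ht₁]) (by simp [ht₂]) ht (fun s hs t he => ?_) fun s hs => ?_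
    · exact ⟨by linarith [hs.1, hu₁.1], by linarith [hs.2]⟩
    · exact (hin (s + u₁) ⟨by linarith [hs.1], by linarith [hs.2]⟩).1 ⟨t, he.symm⟩
    · exact (hin (s + u₁) ⟨by linarith [hs.1], by linarith [hs.2]⟩).2
  · have h2 : σ u₁ = σ u₂ := by rw [← ht₁, ht, ht₂]
    have h3 := hσ u₁ ⟨hu₁.1, by linarith⟩ u₂ ⟨by linarith [hu₁.1], hu₂e⟩
    rw [h2, M.dist_self] at h3
    linarith [abs_eq_zero.1 h3.symm]
  · refine h.no_shortcut hk hε ha1 ha hTa hTal hL hs hT hmin (β := fun s => σ (u₂ - s)) hlen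
      (by linarith [hu₁.1]) (fun s hs t ht => ?_) (t₁ := t₂) (t₂ := t₁)
      (by simp [ht₂]) (by simp [ht₁]) ht (fun s hs t he => ?_) fun s hs => ?_
    · rw [hσ _ ⟨by linarith [hs.2, hu₁.1], by linarith [hs.1]⟩ _
        ⟨by linarith [ht.2, hu₁.1], by linarith [ht.1]⟩, abs_sub_comm]
      congr 1; ring
    · exact (hin (u₂ - s) ⟨by linarith [hs.2], by linarith [hs.1]⟩).1 ⟨t, he.symm⟩
    · exact (hin (u₂ - s) ⟨by linarith [hs.2], by linarith [hs.1]⟩).2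

end

end TorusMetric

/-- Rotation by a right angle. -/
def rot (v : Pl) : Pl := (-v.2, v.1)

/-- The Euclidean inner product. -/
def ip (v w : Pl) : ℝ := v.1 * w.1 + v.2 * w.2

lemma norm_rot (v : Pl) : ‖rot v‖ = ‖v‖ := by
  simp [rot, Prod.norm_def, max_comm]

lemma rot_sub (v w : Pl) : rot v - rot w = rot (v - w) := by
  ext <;> simp [rot]; ring

lemma continuous_rot : Continuous rot := by unfold rot; fun_prop

lemma ip_add (v w z : Pl) : ip v (w + z) = ip v w + ip v z := by simp [ip]; ring

lemma ip_smul (r : ℝ) (v w : Pl) : ip v (r • w) = r * ip v w := by simp [ip]; ring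

lemma ip_rot (v : Pl) : ip v (rot v) = 0 := by simp [ip, rot]; ring

lemma abs_ip_le (v w : Pl) : |ip v w| ≤ 2 * ‖v‖ * ‖w‖ := by
  have h1 := norm_fst_le v
  have h2 := norm_snd_le v
  have h3 := norm_fst_le w
  have h4 := norm_snd_le w
  rw [Real.norm_eq_abs] at h1 h2 h3 h4
  refine (abs_add_le _ _).trans ?_
  rw [abs_mul, abs_mul]
  have h5 := mul_le_mul h1 h3 (abs_nonneg _) (norm_nonneg _)
  have h6 := mul_le_mul h2 h4 (abs_nonneg _) (norm_nonneg _)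
  linarith

lemma norm_sq_le_ip (v : Pl) : ‖v‖ ^ 2 ≤ ip v v := by
  rw [ip, Prod.norm_def]
  rcases max_cases ‖v.1‖ ‖v.2‖ with h | h <;> rw [h.1, Real.norm_eq_abs, sq_abs] <;> nlinarith

lemma eq_smul_rot {v w : Pl} (hv : v ≠ 0) (h : ip v w = 0) : ∃ u : ℝ, w = u • rot v := by
  have h0 : ip v v ≠ 0 := by
    have := norm_sq_le_ip v
    have := norm_pos_iff.2 hv
    nlinarith
  refine ⟨(v.1 * w.2 - v.2 * w.1) / ip v v, Prod.ext ?_ ?_⟩ <;>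
    simp only [rot, Prod.smul_fst, Prod.smul_snd, smul_eq_mul] <;> rw [div_mul_eq_mul_div, eq_div_iff h0] <;>
    simp only [ip] at h ⊢
  · linear_combination v.1 * h
  · linear_combination v.2 * h

namespace TorusMetric
variable {M : TorusMetric} {k : ℤ × ℤ} {a : ℝ → Pl} {Ta L r l : ℝ}

/-- Points of a short axis at different parameters stay apart. -/
lemma le_dist_of_axis (hk : k ≠ 0) (hL : ∀ x, L ≤ M.dist x (x + lat k)) (hL0 : 0 < L)
    (ha1 : M.Lip a 1) (ha : ∀ t, a (t + Ta) = a t + lat k) (hTa : 0 < Ta)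
    (has : ∀ t, M.IsSeg a (Icc (t - r) (t + r))) {δ : ℝ} {s t : ℝ}
    (h : δ ≤ |s - t|) : min δ (min (r - (Ta - L)) (2 * L - Ta)) ≤ M.dist (a s) (a t) := by
  set m := ⌊(s - t) / Ta⌋ with hm
  set r₀ := s - t - m * Ta with hr₀
  have h1 : 0 ≤ r₀ := by
    have := Int.floor_le ((s - t) / Ta)
    rw [le_div_iff₀ hTa] at this
    linarith
  have h2 : r₀ < Ta := by
    have := Int.lt_floor_add_one ((s - t) / Ta)
    rw [div_lt_iff₀ hTa] at this
    linarith
  have h3 : |(m : ℝ)| * L ≤ M.dist (a s) (a t) + r₀ := by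
    have e1 := le_dist_zsmul hk hL m (a t)
    rw [← translate_iterate ha] at e1
    have e2 := ha1 s (t + m * Ta)
    rw [show s - (t + m * Ta) = r₀ by rw [hr₀]; ring, abs_of_nonneg h1] at e2
    linarith [M.dist_triangle (a t) (a s) (a (t + m * Ta)), M.dist_comm (a s) (a t)]
  have h4 : |(m + 1 : ℝ)| * L ≤ M.dist (a s) (a t) + (Ta - r₀) := by
    have e1 := le_dist_zsmul hk hL (m + 1) (a t)
    rw [← translate_iterate ha] at e1
    push_cast at e1
    have e2 := ha1 s (t + (m + 1) * Ta)
    rw [show s - (t + (m + 1) * Ta) = -(Ta - r₀) by rw [hr₀]; ring, abs_neg,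
      abs_of_nonneg (by linarith)] at e2
    linarith [M.dist_triangle (a t) (a s) (a (t + (m + 1) * Ta)), M.dist_comm (a s) (a t)]
  have hnear : |s - t| ≤ r → δ ≤ M.dist (a s) (a t) := fun hst => by
    have h5 := abs_le.1 hst
    rw [has t s ⟨by linarith, by linarith⟩ t ⟨by linarith [abs_nonneg (s - t)],
      by linarith [abs_nonneg (s - t)]⟩]
    exact h
  rcases lt_trichotomy m 0 with hm0 | hm0 | hm0
  · rcases (show m = -1 ∨ m ≤ -2 by omega) with hm1 | hm1
    · rw [hm1] at h3 hr₀
      push_cast at h3 hr₀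
      rw [abs_neg, abs_one, one_mul] at h3
      rcases le_or_gt (Ta - r₀) r with h5 | h5
      · exact (min_le_left _ _).trans (hnear (by
          rw [show s - t = -(Ta - r₀) by rw [hr₀]; ring, abs_neg, abs_of_nonneg (by linarith)]
          exact h5))
      · exact (min_le_right _ _).trans ((min_le_left _ _).trans (by linarith))
    · have : (m : ℝ) ≤ -2 := by exact_mod_cast hm1
      have h5 : 2 ≤ |(m : ℝ)| := by rw [abs_of_neg (by linarith)]; linarith
      exact (min_le_right _ _).trans ((min_le_right _ _).trans (by nlinarith))
  · rw [hm0] at h4 hr₀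
    simp only [Int.cast_zero, zero_add, abs_one, one_mul, zero_mul, sub_zero] at h4 hr₀
    rcases le_or_gt r₀ r with h5 | h5
    · exact (min_le_left _ _).trans (hnear (by rw [← hr₀, abs_of_nonneg h1]; exact h5))
    · exact (min_le_right _ _).trans ((min_le_left _ _).trans (by linarith))
  · have : (1 : ℝ) ≤ m := by exact_mod_cast hm0
    have h5 : 2 ≤ |(m + 1 : ℝ)| := by rw [abs_of_pos (by linarith)]; linarith
    exact (min_le_right _ _).trans ((min_le_right _ _).trans (by nlinarith))

lemma IsLoc.inv_le_norm (hl : M.IsLoc a) (t : ℝ) : 1 ≤ M.K * ‖deriv a t‖ := by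
  have := M.nrm_le_norm (a t) (deriv a t)
  rwa [nrm, hl.unit_speed, Real.sqrt_one] at this

lemma IsLoc.contDiff_deriv (hl : M.IsLoc a) : ContDiff ℝ 1 (deriv a) :=
  ((contDiff_infty_iff_deriv.1 hl.contDiff).2).of_le (by exact_mod_cast le_top)

lemma IsLoc.exists_bound (hl : M.IsLoc a) (ha : ∀ t, a (t + Ta) = a t + lat k) (hTa : 0 < Ta) :
    ∃ C, 0 < C ∧ ∀ t, ‖deriv (deriv a) t‖ ≤ C := by
  have h1 : ∀ t, deriv a (t + Ta) = deriv a t := fun t => by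
    rw [← deriv_comp_add_const, funext ha, deriv_add_const]
  have h2 : ∀ t, deriv (deriv a) (t + Ta) = deriv (deriv a) t := fun t => by
    rw [← deriv_comp_add_const, funext h1]
  obtain ⟨t₀, ht₀⟩ := exists_forall_le_of_periodic
    ((hl.contDiff_deriv.continuous_deriv le_rfl).norm) hTa (fun t => by simp only [h2])
  exact ⟨‖deriv (deriv a) t₀‖ + 1, by positivity, fun t => (ht₀ t).trans (by linarith)⟩

lemma IsLoc.norm_deriv_sub_le (hl : M.IsLoc a) {C : ℝ} (hC : ∀ t, ‖deriv (deriv a) t‖ ≤ C)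
    (s t : ℝ) : ‖deriv a s - deriv a t‖ ≤ C * |s - t| := by
  have := Convex.norm_image_sub_le_of_norm_deriv_le (f := deriv a) (s := univ) (C := C)
    (fun x _ => (hl.contDiff_deriv.differentiable one_ne_zero) x) (fun x _ => hC x) convex_univ
    (mem_univ t) (mem_univ s)
  rwa [Real.norm_eq_abs] at this

lemma IsLoc.norm_sub_sub_le (hl : M.IsLoc a) {C : ℝ} (hC0 : 0 ≤ C)
    (hC : ∀ t, ‖deriv (deriv a) t‖ ≤ C) (s t : ℝ) :
    ‖a s - a t - (s - t) • deriv a t‖ ≤ C * |s - t| ^ 2 := by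
  have hd : ∀ u, HasDerivAt (fun u => a u - u • deriv a t) (deriv a u - deriv a t) u := fun u => by
    have := (hl.hasDerivAt u).sub ((hasDerivAt_id u).smul_const (deriv a t))
    rw [one_smul] at this
    exact this
  have := Convex.norm_image_sub_le_of_norm_hasDerivWithin_le (s := uIcc t s) (C := C * |s - t|)
    (fun u _ => (hd u).hasDerivWithinAt) (fun u hu => (hl.norm_deriv_sub_le hC u t).trans
      (mul_le_mul_of_nonneg_left (abs_sub_left_of_mem_uIcc hu) hC0)) (convex_uIcc t s)
    left_mem_uIcc right_mem_uIcc
  rw [Real.norm_eq_abs, mul_assoc, ← pow_two] at this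
  rw [show a s - a t - (s - t) • deriv a t = a s - s • deriv a t - (a t - t • deriv a t) by
    rw [sub_smul]; abel]
  exact this

/-- The normal exponential map of a short axis (mixed at two foot points) is injective. -/
lemma exists_tube (hk : k ≠ 0) (hL : ∀ x, L ≤ M.dist x (x + lat k)) (hL0 : 0 < L)
    (ha1 : M.Lip a 1) (ha : ∀ t, a (t + Ta) = a t + lat k) (hTa : 0 < Ta) (hr : Ta - L < r)
    (hr0 : 0 < r) (hTa2 : Ta < 2 * L) (has : ∀ t, M.IsSeg a (Icc (t - r) (t + r))) :
    ∃ η₀, 0 < η₀ ∧ ∀ s t u₁ u₂ : ℝ, |u₁| ≤ η₀ → |u₂| ≤ η₀ → u₁ + u₂ ≠ 0 →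
      a s - a t + (u₁ • rot (deriv a s) + u₂ • rot (deriv a t)) ≠ 0 := by
  have hl : M.IsLoc a := ⟨r, hr0, has⟩
  have hK := M.K_pos
  obtain ⟨C, hC0, hC⟩ := hl.exists_bound ha hTa
  set q := 1 / (8 * M.K ^ 3 * C)
  have hq : 0 < q := by positivity
  set δ := min r q
  have hδ : 0 < δ := lt_min hr0 hq
  set m₀ := min δ (min (r - (Ta - L)) (2 * L - Ta))
  have hm₀ : 0 < m₀ := lt_min hδ (lt_min (by linarith) (by linarith))
  refine ⟨min q (m₀ / (4 * M.K ^ 2)), by positivity, fun s t u₁ u₂ h1 h2 h12 he => ?_⟩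
  have hvb : ∀ t, ‖deriv a t‖ ≤ M.K := fun t => norm_deriv_le (hl.unit_speed t)
  rcases le_or_gt δ |s - t| with hst | hst
  · have e1 := le_dist_of_axis hk hL hL0 ha1 ha hTa has hst
    have e2 := e1.trans (M.dist_le_norm_sub _ _)
    have e3 : ‖a s - a t‖ ≤ m₀ / (4 * M.K ^ 2) * M.K + m₀ / (4 * M.K ^ 2) * M.K := by
      rw [eq_neg_of_add_eq_zero_left he, norm_neg]
      refine (norm_add_le _ _).trans ?_
      rw [norm_smul, norm_smul, norm_rot, norm_rot, Real.norm_eq_abs, Real.norm_eq_abs]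
      have := h1.trans (min_le_right _ _)
      have := h2.trans (min_le_right _ _)
      gcongr <;> exact hvb _
    have e4 := e2.trans (mul_le_mul_of_nonneg_left e3 hK.le)
    have e5 : M.K * (m₀ / (4 * M.K ^ 2) * M.K + m₀ / (4 * M.K ^ 2) * M.K) = m₀ / 2 := by
      field_simp; ring
    rw [e5] at e4
    have : m₀ ≤ m₀ / 2 := e4
    linarith
  · set v := deriv a t with hv
    have hv1 := hl.inv_le_norm t
    have hv2 : 1 ≤ M.K ^ 2 * ip v v := by
      have := norm_sq_le_ip v
      nlinarith [mul_le_mul_of_nonneg_left this (sq_nonneg M.K)]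
    have hS := hl.norm_deriv_sub_le hC s t
    have hR := hl.norm_sub_sub_le hC0.le hC s t
    set h := |s - t|
    have hh : 0 ≤ h := abs_nonneg _
    set R := a s - a t - (s - t) • v
    have e1 : (s - t) • v + (R + (u₁ • rot (deriv a s - v) + (u₁ + u₂) • rot v)) = 0 := by
      rw [← he, ← rot_sub, add_smul, smul_sub]; simp only [R]; abel
    have e2 := congrArg (ip v) e1
    rw [ip_add, ip_add, ip_add, ip_smul, ip_smul, ip_smul, ip_rot, mul_zero, add_zero,
      show ip v 0 = 0 by simp [ip]] at e2
    have e3 : h * ip v v ≤ 2 * M.K * (C * h ^ 2) + q * (2 * M.K * (C * h)) := by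
      have f1 : h * ip v v = |ip v R + u₁ * ip v (rot (deriv a s - v))| := by
        rw [← abs_neg (ip v R + _), ← eq_neg_of_add_eq_zero_left e2, abs_mul,
          abs_of_nonneg ((sq_nonneg _).trans (norm_sq_le_ip v))]
      rw [f1]
      refine (abs_add_le _ _).trans (add_le_add ?_ ?_)
      · refine (abs_ip_le _ _).trans ?_
        have := hvb t
        gcongr
      · rw [abs_mul]
        have f2 := h1.trans (min_le_left _ _)
        have f3 : |ip v (rot (deriv a s - v))| ≤ 2 * M.K * (C * h) := by
          refine (abs_ip_le _ _).trans ?_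
          rw [norm_rot]
          have := hvb t
          gcongr
        gcongr
    have hhq : h ≤ q := hst.le.trans (min_le_right _ _)
    have e4 : h ≤ h * (1 / 2) := by
      have f1 : h * 1 ≤ h * (M.K ^ 2 * ip v v) := by gcongr
      have f2 : M.K ^ 2 * (h * ip v v) ≤ M.K ^ 2 * (2 * M.K * (C * (h * q)) + q * (2 * M.K * (C * h))) := by
        refine mul_le_mul_of_nonneg_left (e3.trans ?_) (by positivity)
        rw [pow_two h]
        gcongr
      have f3 : M.K ^ 2 * (2 * M.K * (C * (h * q)) + q * (2 * M.K * (C * h))) = h * (1 / 2) := by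
        simp only [q]; field_simp; ring
      linarith
    have hh0 : h = 0 := by linarith
    have hst0 : s = t := sub_eq_zero.1 (abs_eq_zero.1 hh0)
    subst hst0
    rw [sub_self, zero_add, ← add_smul, smul_eq_zero] at he
    rcases he with he | he
    · exact h12 he
    · rw [← norm_rot, he, norm_zero, mul_zero] at hv1
      linarith

end TorusMetric

namespace TorusMetric
variable {M : TorusMetric} {k : ℤ × ℤ} {a : ℝ → Pl} {Ta L r l : ℝ}

/-- The Euclidean foot point of a point off a periodic curve. -/
lemma exists_foot (hk : k ≠ 0) (hL : ∀ x, L ≤ M.dist x (x + lat k)) (hL0 : 0 < L)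
    (hl : M.IsLoc a) (ha1 : M.Lip a 1) (ha : ∀ t, a (t + Ta) = a t + lat k) (hTa : 0 < Ta) {w : Pl}
    (hw : ∀ t, a t ≠ w) : ∃ t₀ u : ℝ, u ≠ 0 ∧ w = a t₀ + u • rot (deriv a t₀) ∧
      ∀ θ : ℝ, 0 < θ → θ ≤ 1 → ∀ t, a t₀ + (θ * u) • rot (deriv a t₀) ≠ a t := by
  have hlim : Tendsto (fun t => ip (a t - w) (a t - w)) (cocompact ℝ) atTop := by
    have h1 : Tendsto (fun z : Pl => ‖z - w‖ ^ 2) (cocompact Pl) atTop :=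
      (tendsto_pow_atTop two_ne_zero).comp (by
        simpa only [dist_eq_norm] using tendsto_dist_right_cocompact_atTop w)
    exact tendsto_atTop_mono (fun t => norm_sq_le_ip _)
      (h1.comp (tendsto_of_period hk hL hL0 ha1 hTa ha))
  have hc : Continuous fun t => ip (a t - w) (a t - w) := by
    have := ha1.continuous
    unfold ip; fun_prop
  obtain ⟨t₀, ht₀⟩ := hc.exists_forall_le hlim
  have hd : HasDerivAt (fun t => ip (a t - w) (a t - w)) (2 * ip (deriv a t₀) (a t₀ - w)) t₀ := by
    have h1 := (hl.hasDerivAt t₀).sub_const w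
    have h2 := (ContinuousLinearMap.fst ℝ ℝ ℝ).hasFDerivAt.comp_hasDerivAt t₀ h1
    have h3 := (ContinuousLinearMap.snd ℝ ℝ ℝ).hasFDerivAt.comp_hasDerivAt t₀ h1
    refine ((h2.mul h2).add (h3.mul h3)).congr_deriv ?_
    simp [ip]; ring
  have h0 : ip (deriv a t₀) (a t₀ - w) = 0 := by
    have := IsLocalMin.hasDerivAt_eq_zero (Eventually.of_forall ht₀) hd
    linarith
  have hv : deriv a t₀ ≠ 0 := fun h => by
    have := hl.inv_le_norm t₀
    rw [h, norm_zero, mul_zero] at this; linarith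
  obtain ⟨u, hu⟩ := eq_smul_rot hv h0
  have hu0 : u ≠ 0 := fun h => hw t₀ (sub_eq_zero.1 (by rw [hu, h, zero_smul]))
  refine ⟨t₀, -u, neg_ne_zero.2 hu0, by rw [neg_smul, ← hu]; abel, fun θ h1 h2 t he => ?_⟩
  have h3 := ht₀ t
  have h4 : a t - w = (1 - θ) • (a t₀ - w) := by
    rw [← he, hu]
    have : a t₀ = u • rot (deriv a t₀) + w := by rw [← hu]; abel
    rw [show a t₀ + (θ * -u) • rot (deriv a t₀) - w = a t₀ - w + (θ * -u) • rot (deriv a t₀) by abel,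
      hu, smul_smul, ← add_smul]
    congr 1; ring
  have h5 : ip (a t - w) (a t - w) = (1 - θ) ^ 2 * ip (a t₀ - w) (a t₀ - w) := by
    rw [h4]; simp [ip]; ring
  have h6 : 0 < ip (a t₀ - w) (a t₀ - w) :=
    (pow_pos (norm_pos_iff.2 (sub_ne_zero.2 (hw t₀))) 2).trans_le (norm_sq_le_ip _)
  rw [h5] at h3
  nlinarith [mul_pos h6 h1]

lemma deriv_translate (ha : ∀ t, a (t + Ta) = a t + lat k) (j : ℤ) (t : ℝ) :
    deriv a (t + j * Ta) = deriv a t := by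
  rw [← deriv_comp_add_const, funext fun t => translate_iterate ha j t, deriv_add_const]

lemma IsLoc.nrm_push_le (hl : M.IsLoc a) {C : ℝ} (hC : ∀ t, ‖deriv (deriv a) t‖ ≤ C) (η s : ℝ) :
    M.nrm (a s + η • rot (deriv a s)) (deriv a s + η • rot (deriv (deriv a) s)) ≤
      1 + (M.K ^ 3 + M.K * C) * |η| := by
  have hK := M.K_pos
  have h1 := M.nrm_add_le (a s + η • rot (deriv a s)) (deriv a s) (η • rot (deriv (deriv a) s))
  have h2 := (le_abs_self _).trans (M.abs_nrm_sub_le (a s + η • rot (deriv a s)) (a s) (deriv a s))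
  have h3 := M.nrm_le_norm (a s + η • rot (deriv a s)) (η • rot (deriv (deriv a) s))
  have h4 : ‖deriv a s‖ ≤ M.K := norm_deriv_le (hl.unit_speed s)
  rw [add_sub_cancel_left, norm_smul, norm_rot, Real.norm_eq_abs, nrm, nrm, hl.unit_speed,
    Real.sqrt_one, ← nrm] at h2
  rw [norm_smul, norm_rot, Real.norm_eq_abs] at h3
  have h5 : M.K * (|η| * ‖deriv a s‖) * ‖deriv a s‖ ≤ M.K * (|η| * M.K) * M.K := by gcongr
  have h6 : M.K * (|η| * ‖deriv (deriv a) s‖) ≤ M.K * (|η| * C) := by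
    have := hC s; gcongr
  linarith

lemma exists_bar_data (hk : k ≠ 0) (hL : ∀ x, L ≤ M.dist x (x + lat k)) (hL0 : 0 < L)
    (ha1 : M.Lip a 1) (ha : ∀ t, a (t + Ta) = a t + lat k) (hTa : 0 < Ta) (hr : Ta - L < r)
    (hr0 : 0 < r) (hTa2 : Ta < 2 * L) (has : ∀ t, M.IsSeg a (Icc (t - r) (t + r))) {w : Pl}
    (hw : ∀ t, a t ≠ w) {δ : ℝ} (hδ : 0 < δ) (hTl : Ta < l) :
    ∃ ε, 0 < ε ∧ ∃ P T, M.Lip P 1 ∧ 0 < T ∧ T < l ∧ (∀ t, P (t + T) = P t + lat k) ∧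
      (∀ t u, ε ≤ M.dist (P t) (a u)) ∧ wind k P T (a 0) = wind k a Ta w ∧
      ∀ x, (∀ t (j : ℤ), δ ≤ M.dist (a t) (x + lat (j • k))) →
        wind k P T x = wind k a Ta x := by
  have hl : M.IsLoc a := ⟨r, hr0, has⟩
  have hK := M.K_pos
  have hac := ha1.continuous
  have hac' := hl.contDiff_deriv.continuous
  have hrc := continuous_rot
  obtain ⟨C, hC0, hC⟩ := hl.exists_bound ha hTa
  obtain ⟨η₀, hη₀, htube⟩ := exists_tube hk hL hL0 ha1 ha hTa hr hr0 hTa2 has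
  obtain ⟨t₀, u, hu0, hwu, hfoot⟩ := exists_foot hk hL hL0 hl ha1 ha hTa hw
  set c := M.K ^ 3 + M.K * C with hc
  have hc0 : 0 < c := by positivity
  have hTl' : 0 < l - Ta := by linarith
  set e := min η₀ (min ((l - Ta) / (2 * c * Ta)) (δ / (2 * M.K ^ 2)))
  have he : 0 < e := lt_min hη₀ (lt_min (by positivity) (by positivity))
  have hu1 : 0 < |u| := abs_pos.2 hu0
  set θ₀ := min 1 (e / |u|)
  have hθ0 : 0 < θ₀ := lt_min one_pos (by positivity)
  have hθ1 : θ₀ ≤ 1 := min_le_left _ _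
  set η := -(θ₀ * u) with hη
  have hη0 : η ≠ 0 := neg_ne_zero.2 (mul_ne_zero hθ0.ne' hu0)
  have hηe : |η| ≤ e := by
    rw [hη, abs_neg, abs_mul, abs_of_pos hθ0, ← le_div_iff₀ hu1]
    exact min_le_right _ _
  have hη1 : |η| ≤ η₀ := hηe.trans (min_le_left _ _)
  have hη2 : (1 + c * |η|) * Ta < l := by
    have := hηe.trans ((min_le_right _ _).trans (min_le_left _ _))
    rw [le_div_iff₀ (by positivity)] at this
    linarith
  have hη3 : |η| * M.K < δ / M.K := by
    have := hηe.trans ((min_le_right _ _).trans (min_le_right _ _))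
    rw [le_div_iff₀ (by positivity)] at this
    rw [lt_div_iff₀ hK]
    linarith
  set b : ℝ → Pl := fun t => a t + η • rot (deriv a t) with hb
  have hbc : Continuous b := by fun_prop
  have hbp : ∀ t, b (t + Ta) = b t + lat k := fun t => by
    have := deriv_translate ha 1 t
    rw [Int.cast_one, one_mul] at this
    simp only [hb, ha, this]; abel
  have hba : ∀ t, ‖b t - a t‖ < δ / M.K := fun t => by
    rw [hb]; simp only [add_sub_cancel_left]
    rw [norm_smul, norm_rot, Real.norm_eq_abs]
    refine lt_of_le_of_lt ?_ hη3
    have := norm_deriv_le (hl.unit_speed t)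
    gcongr
  have hab : ∀ t u, b t ≠ a u := fun t s h => by
    refine htube t s η 0 hη1 (by rw [abs_zero]; exact hη₀.le) (by simpa using hη0) ?_
    rw [zero_smul, add_zero, ← h]; simp only [hb]; abel
  obtain ⟨δ₀, hδ₀, hdis⟩ := Disjoint.exists_thickenings
    (s := b '' Icc 0 Ta) (t := range a) (by
      rw [Set.disjoint_left]
      rintro _ ⟨t, -, rfl⟩ ⟨u, h⟩
      exact hab t u h.symm)
    (isCompact_Icc.image hbc) (isClosed_range_of_period hk hL hL0 ha1 hTa ha)
  have hfar0 : ∀ t ∈ Icc 0 Ta, ∀ u, δ₀ / M.K ≤ M.dist (b t) (a u) := fun t ht u => by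
    rw [div_le_iff₀' hK]
    refine le_trans ?_ (M.norm_sub_le_dist _ _)
    by_contra! hlt
    have hmem : a u ∈ Metric.thickening δ₀ (range a) :=
      Metric.self_subset_thickening hδ₀ _ (mem_range_self u)
    refine Set.disjoint_left.1 hdis ?_ hmem
    rw [Metric.mem_thickening_iff]
    exact ⟨b t, mem_image_of_mem _ ht, by rwa [_root_.dist_comm, dist_eq_norm]⟩
  have hfar : ∀ t u, δ₀ / M.K ≤ M.dist (b t) (a u) := fun t u => by
    obtain ⟨j, hj⟩ := existsUnique_add_zsmul_mem_Ico hTa t 0 |>.exists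
    rw [zero_add, zsmul_eq_mul] at hj
    have h1 := le_dist_translate ha (hfar0 _ (Ico_subset_Icc_self hj)) (-j) (u + j * Ta)
    have h2 := le_dist_translate ha (hfar0 _ (Ico_subset_Icc_self hj)) j u
    rwa [translate_iterate hbp, M.dist_translate] at h2
  have hε : 0 < δ₀ / M.K := by positivity
  have hw1 : wind k a Ta (a t₀ + (θ₀ * u) • rot (deriv a t₀)) = wind k a Ta w := by
    have := wind_path (T := Ta) hk hac ha
      (z := fun s => a t₀ + ((θ₀ + s * (1 - θ₀)) * u) • rot (deriv a t₀)) (by fun_prop)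
      (fun s hs t => hfoot _ (by nlinarith [hs.1]) (by nlinarith [hs.2]) t)
    simpa [← hwu] using this
  have hw2 : wind k b Ta (a t₀) = wind k a Ta w := by
    have := wind_homotopy (k := k) (T := Ta) (n := 1) hk
      (P := fun s t => a t + ((1 - s) * η) • rot (deriv a t))
      (z := fun s => a t₀ - (s * η) • rot (deriv a t₀)) (by fun_prop) (by fun_prop)
      (fun s _ => by
        have h1 := deriv_translate ha 1 0
        have h2 := ha 0
        rw [Int.cast_one, one_mul, zero_add] at h1
        rw [zero_add] at h2
        rw [h1, h2, one_smul]; abel)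
      (fun s hs t he => by
        obtain ⟨j, hj⟩ := (expk_eq_iff hk).1 he
        have hs0 : |1 - s| ≤ 1 := by rw [abs_le]; constructor <;> linarith [hs.1, hs.2]
        have hs1 : |s| ≤ 1 := by rw [abs_le]; constructor <;> linarith [hs.1, hs.2]
        refine htube t (t₀ + j * Ta) ((1 - s) * η) (s * η) ?_ ?_ ?_ ?_
        · rw [abs_mul]; exact (mul_le_of_le_one_left (abs_nonneg _) hs0).trans hη1
        · rw [abs_mul]; exact (mul_le_of_le_one_left (abs_nonneg _) hs1).trans hη1
        · rw [← add_mul, sub_add_cancel, one_mul]; exact hη0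
        · rw [deriv_translate ha, translate_iterate ha]
          rw [← sub_eq_zero] at hj
          rw [← hj]; abel)
    simp only [sub_zero, one_mul, zero_mul, zero_smul, sub_self, add_zero] at this
    rw [hη, neg_smul, sub_neg_eq_add, hw1] at this
    exact this
  set S := 1 + c * |η| with hS
  have hS0 : 0 < S := by positivity
  have hP0 : ∀ {z : Pl}, (∀ t, expk k (b t) ≠ expk k z) →
      wind k (fun t => b (t / S)) (Ta * S) z = wind k b Ta z := fun {z} h => by
    have := wind_comp (k := k) hbc h (φ := fun t => t / S) (by fun_prop) (zero_div _) (Ta * S)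
    rwa [mul_div_cancel_right₀ _ hS0.ne'] at this
  refine ⟨δ₀ / M.K, hε, fun t => b (t / S), Ta * S, ?_, by positivity, by linarith, fun t => ?_,
    fun t u => hfar _ _, ?_, fun x hx => ?_⟩
  · have hr1 : ContDiff ℝ 1 fun t => rot (deriv a t) :=
      (hl.contDiff_deriv.snd.neg).prodMk hl.contDiff_deriv.fst
    have hb1 : ContDiff ℝ 1 b :=
      (hl.contDiff.of_le (by exact_mod_cast le_top)).add (hr1.const_smul η)
    have hspd : ∀ t, M.spd b t ≤ S := fun t => by
      refine le_trans (le_of_eq ?_) (hl.nrm_push_le hC η t)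
      have h1 := ((hl.contDiff_deriv.differentiable one_ne_zero) t).hasDerivAt
      have h2 := (ContinuousLinearMap.fst ℝ ℝ ℝ).hasFDerivAt.comp_hasDerivAt t h1
      have h3 := (ContinuousLinearMap.snd ℝ ℝ ℝ).hasFDerivAt.comp_hasDerivAt t h1
      have h4 : HasDerivAt b (deriv a t + η • rot (deriv (deriv a) t)) t :=
        (hl.hasDerivAt t).add ((h3.neg.prodMk h2).const_smul η)
      rw [spd, h4.deriv, nrm]
    refine Lip.of_le fun s t hst => ?_
    have hst' : s / S ≤ t / S := by gcongr
    refine (dist_le_length hb1 hst').trans ?_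
    rw [length_eq]
    have := intervalIntegral.integral_mono_on (μ := MeasureTheory.volume) hst'
      ((continuous_spd hb1).intervalIntegrable _ _)
      ((continuous_const (y := S)).intervalIntegrable _ _) (fun x _ => hspd x)
    refine this.trans (le_of_eq ?_)
    rw [intervalIntegral.integral_const, smul_eq_mul]
    field_simp
  · simp only [add_div, mul_div_cancel_right₀ _ hS0.ne', hbp]
  · rw [hP0 fun t => expk_ne_of_dist hk fun j => hε.trans_le
      (le_dist_translate ha (hfar t) j 0), ← wind_curve_eq hk hε hac hbc hbp hfar t₀, hw2]
  · have hx' : ∀ t (j : ℤ), δ / M.K ≤ ‖a t - (x + lat (j • k))‖ := fun t j => by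
      rw [div_le_iff₀' hK]
      exact (hx t j).trans (M.dist_le_norm_sub _ _)
    rw [hP0 fun t he => ?_]
    · have h1 := ha 0
      have h2 := hbp 0
      rw [zero_add] at h1 h2
      exact (wind_close (n := 1) hk hac hbc (by rwa [one_smul]) (by rwa [one_smul]) hba hx').symm
    · obtain ⟨j, hj⟩ := (expk_eq_iff hk).1 he
      have h1 := hx' t j
      rw [← hj, norm_sub_rev] at h1
      exact absurd (hba t) (not_lt.2 h1)

/-- Near a short axis there are short curves separating it from any point `x` through which all
loops are long. -/
lemma exists_bar (hk : k ≠ 0) (hL : ∀ x, L ≤ M.dist x (x + lat k)) (hL0 : 0 < L)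
    (ha1 : M.Lip a 1) (ha : ∀ t, a (t + Ta) = a t + lat k) (hTa : 0 < Ta) (hr : Ta - L < r)
    (hr0 : 0 < r) (hTa2 : Ta < 2 * L) (has : ∀ t, M.IsSeg a (Icc (t - r) (t + r))) {Λ : ℝ}
    (hTl : Ta < l) (hlΛ : l < Λ) :
    ∃ ε, 0 < ε ∧ ∀ x, Λ ≤ M.dist x (x + lat k) → ∃ P T, M.IsBar k a ε x P T ∧ T < l := by
  have hac := ha1.continuous
  have hcz := continuous_zet (k := k)
  have hper : ∀ t, zet k (a (t + Ta)) = zet k (a t) + 1 := fun t => by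
    rw [ha, zet_add, zet_lat hk]
  obtain ⟨t₁, ht₁⟩ := exists_forall_le_of_periodic (f := fun t => (zet k (a t)).im) (by fun_prop)
    hTa (fun t => by rw [hper]; simp)
  obtain ⟨t₂, ht₂⟩ := exists_forall_le_of_periodic (f := fun t => -(zet k (a t)).im) (by fun_prop)
    hTa (fun t => by rw [hper]; simp)
  have hrot : zet k (rot (lat k)) = Complex.I := by
    have := zet_den hk
    rw [zet, div_eq_iff this]
    simp only [rot, lat]
    push_cast
    linear_combination -(k.2 : ℂ) * Complex.I_sq
  have hrim : ∀ r : ℝ, (zet k (r • rot (lat k))).im = r := fun r => by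
    rw [zet_smul, hrot]; simp
  set r₁ := (zet k (a t₁)).im + 1
  set r₂ := (zet k (a t₂)).im - 1
  have hp : a Ta = a 0 + lat ((1 : ℤ) • k) := by
    have := ha 0
    rwa [zero_add, ← one_smul ℤ k] at this
  have hw1 : wind k a Ta (r₁ • rot (lat k)) = 2 * Real.pi * Complex.I * (1 : ℤ) :=
    wind_of_gt hk hac hp fun t => by rw [hrim]; have := ht₁ t; simp only [r₁]; linarith
  have hw2 : wind k a Ta (r₂ • rot (lat k)) = 0 :=
    wind_of_lt hk hac hp fun t => by rw [hrim]; have := ht₂ t; simp only [r₂]; linarith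
  have hδ : 0 < (Λ - Ta) / 2 := by linarith
  obtain ⟨ε₁, hε₁, P₁, T₁, h11, h12, h13, h14, h15, h16, h17⟩ := exists_bar_data (w := r₁ • rot (lat k))
    hk hL hL0 ha1 ha hTa hr hr0 hTa2 has (fun t h => by
      have h1 := congrArg (fun z => (zet k z).im) h
      have h2 := ht₁ t
      simp only [hrim, r₁] at h1 h2; linarith) hδ hTl
  obtain ⟨ε₂, hε₂, P₂, T₂, h21, h22, h23, h24, h25, h26, h27⟩ := exists_bar_data (w := r₂ • rot (lat k))
    hk hL hL0 ha1 ha hTa hr hr0 hTa2 has (fun t h => by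
      have h1 := congrArg (fun z => (zet k z).im) h
      have h2 := ht₂ t
      simp only [hrim, r₂] at h1 h2; linarith) hδ hTl
  refine ⟨min ε₁ ε₂, lt_min hε₁ hε₂, fun x hx => ?_⟩
  have hxa : ∀ t (j : ℤ), (Λ - Ta) / 2 ≤ M.dist (a t) (x + lat (j • k)) := fun t j =>
    le_trans (by linarith) (ha1.le_dist_of_period hTa ha x t j)
  by_cases h0 : wind k a Ta x = 0
  · refine ⟨P₁, T₁, ⟨h11, h12, h14, fun t u => (min_le_left _ _).trans (h15 t u), ?_⟩, h13⟩
    rw [h17 x hxa, h0, h16, hw1]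
    simp [Real.pi_ne_zero]
  · refine ⟨P₂, T₂, ⟨h21, h22, h24, fun t u => (min_le_right _ _).trans (h25 t u), ?_⟩, h23⟩
    rwa [h27 x hxa, h26, hw2]

end TorusMetric

namespace TorusMetric
section Reduce
variable {M : TorusMetric} {k : ℤ × ℤ} {c : ℝ → Pl}

/-- Two unit vectors with vanishing cross determinant agree up to sign. -/
lemma eq_or_eq_neg_of_crossDet {x v w : Pl} (hv : M.g x v v = 1) (hw : M.g x w w = 1)
    (h : crossDet v w = 0) : v = w ∨ v = -w := by
  have hw0 : w ≠ 0 := fun h0 => by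
    rw [h0] at hw
    have := M.g_smul_self x 0 0
    rw [zero_smul] at this
    rw [this] at hw; norm_num at hw
  have hl : ip w w ≠ 0 := by
    have := norm_sq_le_ip w
    have := norm_pos_iff.2 hw0
    nlinarith
  have hvw : v = (ip w v / ip w w) • w := by
    refine Prod.ext ?_ ?_ <;> simp only [Prod.smul_fst, Prod.smul_snd, smul_eq_mul] <;>
      rw [div_mul_eq_mul_div, eq_div_iff hl] <;> simp only [ip, crossDet] at h ⊢
    · linear_combination w.2 * h
    · linear_combination -w.1 * h
  have h1 := M.g_smul_self x w (ip w v / ip w w)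
  rw [← hvw, hv, hw, mul_one] at h1
  rcases (by simpa using h1.symm : ip w v / ip w w = 1 ∨ ip w v / ip w w = -1) with h2 | h2
  · left; rw [hvw, h2, one_smul]
  · right; rw [hvw, h2, neg_smul, one_smul]

/-- If axes never cross their translates, an axis of a power of `τ_k` is an axis of `τ_k`. -/
lemma axis_reduce (H : ∀ c, IsAxis M c → ∀ k : ℤ × ℤ, k ≠ 0 →
      transInter c (transl k c) Set.univ Set.univ = ∅) (hk : k ≠ 0) (hl : M.IsLoc c) {ℓ : ℝ}
    (hℓ : 0 < ℓ) {n : ℕ} (hn : 0 < n) (hp : ∀ t, c (t + ℓ) = c t + lat (n • k)) :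
    ∀ t, c (t + ℓ / n) = c t + lat k := by
  rcases Nat.lt_or_ge n 2 with hn1 | hn2
  · obtain rfl : n = 1 := by omega
    simpa using hp
  have hc : Continuous c := hl.contDiff.continuous
  have hcz := continuous_zet (k := k)
  obtain ⟨t, τ, hτ, hτℓ, ht⟩ := exists_square hk hc hℓ hn2 hp
  have hax : IsAxis M c := ⟨n • k, hl.isGeodesic, smul_ne_zero hn.ne' hk, ℓ, hp⟩
  have hcr : crossDet (deriv c (t + τ)) (deriv c t) = 0 := by
    by_contra h0
    have : c (t + τ) ∈ transInter c (transl k c) univ univ :=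
      ⟨t + τ, mem_univ _, t, mem_univ _, rfl, ht.symm, by
        have : deriv (transl k c) t = deriv c t := deriv_add_const ..
        rwa [this]⟩
    rw [H c hax k hk] at this
    exact this
  have hu : M.g (c t) (deriv c (t + τ)) (deriv c (t + τ)) = 1 := by
    have := hl.unit_speed (t + τ)
    rwa [ht, M.periodic] at this
  have hshift : ∀ s, deriv (fun s => c s + lat k) s = deriv c s := fun s => deriv_add_const ..
  rcases eq_or_eq_neg_of_crossDet hu (hl.unit_speed t) hcr with h1 | h1
  · have h2 : (fun s => c (s + τ)) = fun s => c s + lat k :=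
      (hl.comp_add τ).unique (hl.add_lat k) (t₀ := t) ht (by
        rw [deriv_comp_add_const, h1, hshift])
    have h3 : ∀ s, c (s + τ) = c s + lat k := congrFun h2
    have h4 : ∀ s, c (s + (ℓ - n * τ)) = c s := fun s => by
      have h5 := translate_iterate h3 n (s + (ℓ - n * τ))
      rw [show s + (ℓ - n * τ) + ((n : ℤ) : ℝ) * τ = s + ℓ by push_cast; ring, hp,
        natCast_zsmul] at h5
      exact (add_right_cancel h5).symm
    have h5 : ℓ - n * τ = 0 := by
      by_contra h0
      obtain ⟨t₀, ht₀⟩ := exists_forall_le_of_periodic (f := fun t => (zet k (c t)).re)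
        (by fun_prop) (abs_pos.2 h0) (fun s => by
          rcases abs_choice (ℓ - n * τ) with h | h <;> rw [h]
          · rw [h4]
          · have := h4 (s + -(ℓ - n * τ))
            rw [neg_add_cancel_right] at this
            rw [← this])
      have := ht₀ (t₀ + τ)
      simp only [h3, zet_add, zet_lat hk, Complex.add_re, Complex.one_re] at this
      linarith
    have h6 : ℓ / n = τ := by
      rw [div_eq_iff (by positivity)]; linarith
    rwa [h6]
  · exfalso
    have h2 : (fun s => c (t + τ + s)) = fun s => c (t - s) + lat k := by
      have e1 : M.IsLoc fun s => c (t + τ + s) := by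
        simpa only [add_comm] using hl.comp_add (t + τ)
      have e2 : M.IsLoc fun s => c (t - s) := by
        have := (hl.comp_add t).comp_neg
        simpa only [neg_add_eq_sub] using this
      refine e1.unique (e2.add_lat k) (t₀ := 0) (by simpa using ht) ?_
      rw [deriv_comp_const_add, deriv_add_const, deriv_comp_const_sub, add_zero, sub_zero, h1]
    have h3 := congrFun h2 (-τ / 2)
    change c (t + τ + -τ / 2) = c (t - -τ / 2) + lat k at h3
    rw [show t + τ + -τ / 2 = t - -τ / 2 by ring] at h3
    have h4 : lat k = lat 0 := by rw [lat_zero]; exact left_eq_add.1 h3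
    exact hk (lat_inj h4)

end Reduce

section Mid
variable (M : TorusMetric)

/-- Minimal segments of length at most `ρ` are determined by their end points. -/
def SegUnique (ρ : ℝ) : Prop := ∀ (c₁ c₂ : ℝ → Pl) (h : ℝ), h ≤ ρ →
  M.IsSeg c₁ (Icc 0 h) → M.IsSeg c₂ (Icc 0 h) → c₁ 0 = c₂ 0 → c₁ h = c₂ h →
  ∀ t ∈ Icc 0 h, c₁ t = c₂ t

/-- A chosen minimal segment between two points. -/
def seg (p q : Pl) : ℝ → Pl := (M.exists_seg p q).choose

lemma seg_zero (p q : Pl) : M.seg p q 0 = p := (M.exists_seg p q).choose_spec.1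
lemma seg_dist (p q : Pl) : M.seg p q (M.dist p q) = q := (M.exists_seg p q).choose_spec.2.1
lemma seg_lip (p q : Pl) : M.Lip (M.seg p q) 1 := (M.exists_seg p q).choose_spec.2.2.1
lemma seg_isSeg (p q : Pl) : M.IsSeg (M.seg p q) (Icc 0 (M.dist p q)) :=
  (M.exists_seg p q).choose_spec.2.2.2

/-- The midpoint of the chosen minimal segment. -/
def mid (p q : Pl) : Pl := M.seg p q (M.dist p q / 2)

lemma dist_mid_left (p q : Pl) : M.dist p (M.mid p q) = M.dist p q / 2 := by
  have h := M.dist_nonneg p q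
  have := M.seg_isSeg p q 0 ⟨le_rfl, h⟩ (M.dist p q / 2) ⟨by linarith, by linarith⟩
  rwa [seg_zero, zero_sub, abs_neg, abs_of_nonneg (by linarith)] at this

lemma dist_mid_right (p q : Pl) : M.dist (M.mid p q) q = M.dist p q / 2 := by
  have h := M.dist_nonneg p q
  have := M.seg_isSeg p q (M.dist p q / 2) ⟨by linarith, by linarith⟩ (M.dist p q) ⟨h, le_rfl⟩
  rw [seg_dist, abs_sub_comm, abs_of_nonneg (by linarith)] at this
  rw [mid, this]; ring

variable {M}

lemma dist_le_concat {c : ℝ → Pl} {a b e : ℝ}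
    (h1 : ∀ s ∈ Icc a b, ∀ t ∈ Icc a b, M.dist (c s) (c t) ≤ |s - t|)
    (h2 : ∀ s ∈ Icc b e, ∀ t ∈ Icc b e, M.dist (c s) (c t) ≤ |s - t|) (hab : a ≤ b) (hbe : b ≤ e) :
    ∀ s ∈ Icc a e, ∀ t ∈ Icc a e, M.dist (c s) (c t) ≤ |s - t| := by
  have key : ∀ s ∈ Icc a e, ∀ t ∈ Icc a e, s ≤ t → M.dist (c s) (c t) ≤ |s - t| := by
    intro s hs t ht hst
    rcases le_total t b with h | h
    · exact h1 s ⟨hs.1, hst.trans h⟩ t ⟨ht.1, h⟩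
    rcases le_total b s with h' | h'
    · exact h2 s ⟨h', hs.2⟩ t ⟨h, ht.2⟩
    have h3 := h1 s ⟨hs.1, h'⟩ b ⟨hab, le_rfl⟩
    have h4 := h2 b ⟨le_rfl, hbe⟩ t ⟨h, ht.2⟩
    have h5 := M.dist_triangle (c s) (c b) (c t)
    rw [abs_sub_comm, abs_of_nonneg (by linarith)] at h3 h4 ⊢
    linarith
  intro s hs t ht
  rcases le_total s t with h | h
  · exact key s hs t ht h
  · rw [M.dist_comm, abs_sub_comm]; exact key t ht s hs h

variable {ρ : ℝ}

lemma SegUnique.eq_mid (hU : M.SegUnique ρ) {p q z : Pl} (hd : M.dist p q ≤ ρ)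
    (h1 : M.dist p z ≤ M.dist p q / 2) (h2 : M.dist z q ≤ M.dist p q / 2) : z = M.mid p q := by
  set D := M.dist p q
  have hD : 0 ≤ D := M.dist_nonneg p q
  have h3 : D ≤ _ := M.dist_triangle p z q
  have h1' : M.dist p z = D / 2 := by linarith
  have h2' : M.dist z q = D / 2 := by linarith
  set c : ℝ → Pl := fun t => if t ≤ D / 2 then M.seg p z t else M.seg z q (t - D / 2) with hc
  have hc1 : ∀ t ∈ Icc 0 (D / 2), c t = M.seg p z t := fun t ht => if_pos ht.2
  have hc2 : ∀ t ∈ Icc (D / 2) D, c t = M.seg z q (t - D / 2) := fun t ht => by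
    rcases eq_or_lt_of_le ht.1 with h | h
    · rw [← h, hc1 _ ⟨by linarith, le_rfl⟩, sub_self, seg_zero, ← h1', seg_dist]
    · exact if_neg (not_le.2 h)
  have hcs : M.IsSeg c (Icc 0 D) := by
    refine IsSeg.of_le hD (dist_le_concat (b := D / 2) ?_ ?_ (by linarith) (by linarith)) ?_
    · intro s hs t ht
      rw [hc1 s hs, hc1 t ht]
      simpa using M.seg_lip p z s t
    · intro s hs t ht
      rw [hc2 s hs, hc2 t ht]
      simpa using M.seg_lip z q (s - D / 2) (t - D / 2)
    · rw [hc1 0 ⟨le_rfl, by linarith⟩, hc2 D ⟨by linarith, le_rfl⟩, seg_zero,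
        show D - D / 2 = M.dist z q by linarith, seg_dist, sub_zero]
  have := hU c (M.seg p q) D hd hcs (M.seg_isSeg p q)
    (by rw [hc1 0 ⟨le_rfl, by linarith⟩, seg_zero, seg_zero])
    (by rw [hc2 D ⟨by linarith, le_rfl⟩, show D - D / 2 = M.dist z q by linarith, seg_dist, seg_dist])
    (D / 2) ⟨by linarith, by linarith⟩
  rw [mid, ← this, hc1 _ ⟨by linarith, le_rfl⟩, ← h1', seg_dist]

lemma SegUnique.mid_add_lat (hU : M.SegUnique ρ) {p q : Pl} (hd : M.dist p q ≤ ρ) (j : ℤ × ℤ) :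
    M.mid (p + lat j) (q + lat j) = M.mid p q + lat j := by
  refine (hU.eq_mid (by rwa [M.dist_translate]) ?_ ?_).symm <;> simp only [M.dist_translate]
  · rw [dist_mid_left]
  · rw [dist_mid_right]

lemma SegUnique.seg_add_lat (hU : M.SegUnique ρ) {p q : Pl} (hd : M.dist p q ≤ ρ) (j : ℤ × ℤ)
    {t : ℝ} (ht : t ∈ Icc 0 (M.dist p q)) :
    M.seg (p + lat j) (q + lat j) t = M.seg p q t + lat j := by
  refine hU _ (fun t => M.seg p q t + lat j) (M.dist p q) hd ?_ ?_ ?_ ?_ t ht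
  · have := M.seg_isSeg (p + lat j) (q + lat j)
    rwa [M.dist_translate] at this
  · exact fun s hs t ht => by rw [M.dist_translate]; exact M.seg_isSeg p q s hs t ht
  · simp only [seg_zero]
  · have := M.seg_dist (p + lat j) (q + lat j)
    rw [M.dist_translate] at this
    rw [this, seg_dist]

lemma SegUnique.mid_tendsto (hU : M.SegUnique ρ) {ι : Type*} {l : Filter ι} {p q : ι → Pl} {p₀ q₀ : Pl}
    (hp : Tendsto p l (𝓝 p₀)) (hq : Tendsto q l (𝓝 q₀)) (hd : M.dist p₀ q₀ ≤ ρ) :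
    Tendsto (fun i => M.mid (p i) (q i)) l (𝓝 (M.mid p₀ q₀)) := by
  rw [tendsto_iff_ultrafilter]
  intro g hg
  replace hp := hp.mono_left hg
  replace hq := hq.mono_left hg
  have hpq := M.tendsto_dist hp hq
  obtain ⟨z, hz⟩ := exists_ulim (U := g) (u := fun i => M.mid (p i) (q i))
    (C := ‖p₀‖ + 1 + M.K * ((M.dist p₀ q₀ + 1) / 2)) (by
      filter_upwards [hp.norm.eventually_le_const (lt_add_one _), hpq.eventually_le_const (lt_add_one _)]
        with i h1 h2
      have h3 := M.norm_sub_le_dist (M.mid (p i) (q i)) (p i)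
      rw [M.dist_comm, dist_mid_left] at h3
      have h4 := norm_le_norm_add_norm_sub' (M.mid (p i) (q i)) (p i)
      have h5 : M.K * (M.dist (p i) (q i) / 2) ≤ M.K * ((M.dist p₀ q₀ + 1) / 2) := by
        have := M.K_pos
        gcongr
      linarith)
  have h1 := M.tendsto_dist hp hz
  have h2 := M.tendsto_dist hz hq
  simp only [dist_mid_left, dist_mid_right] at h1 h2
  have e1 := tendsto_nhds_unique h1 (hpq.div_const 2)
  have e2 := tendsto_nhds_unique h2 (hpq.div_const 2)
  rwa [hU.eq_mid hd e1.le e2.le] at hz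

end Mid

section Curve
variable {M : TorusMetric} {ρ e : ℝ} {y : ℤ → Pl}

/-- The curve through the vertices of an equilateral polygon. -/
def pcurve (M : TorusMetric) (y : ℤ → Pl) (e : ℝ) (t : ℝ) : Pl :=
  M.seg (y ⌊t / e⌋) (y (⌊t / e⌋ + 1)) (t - ⌊t / e⌋ * e)

lemma pcurve_eq (he : 0 < e) (hy : ∀ i, M.dist (y i) (y (i + 1)) = e) (i : ℤ) {t : ℝ}
    (ht : t ∈ Icc (i * e) ((i + 1) * e)) : M.pcurve y e t = M.seg (y i) (y (i + 1)) (t - i * e) := by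
  rcases eq_or_lt_of_le ht.2 with h | h
  · have h1 : ⌊t / e⌋ = i + 1 := by
      rw [h, mul_div_cancel_right₀ _ he.ne']
      exact_mod_cast Int.floor_intCast (i + 1)
    rw [pcurve, h1, h]
    push_cast
    rw [sub_self, seg_zero, show ((i : ℝ) + 1) * e - i * e = e by ring]
    have h2 := M.seg_dist (y i) (y (i + 1))
    rw [hy] at h2
    exact h2.symm
  · have h1 : ⌊t / e⌋ = i := by
      rw [Int.floor_eq_iff, le_div_iff₀ he, div_lt_iff₀ he]
      exact ⟨ht.1, h⟩
    rw [pcurve, h1]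

lemma pcurve_vertex (he : 0 < e) (hy : ∀ i, M.dist (y i) (y (i + 1)) = e) (i : ℤ) :
    M.pcurve y e (i * e) = y i := by
  rw [pcurve_eq he hy i ⟨le_rfl, by nlinarith⟩, sub_self, seg_zero]

lemma pcurve_mid (he : 0 < e) (hy : ∀ i, M.dist (y i) (y (i + 1)) = e) (i : ℤ) :
    M.pcurve y e (i * e + e / 2) = M.mid (y i) (y (i + 1)) := by
  rw [pcurve_eq he hy i ⟨by linarith, by nlinarith⟩, add_sub_cancel_left, mid, hy]

lemma pcurve_lip (he : 0 < e) (hy : ∀ i, M.dist (y i) (y (i + 1)) = e) :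
    M.Lip (M.pcurve y e) 1 := by
  have key : ∀ (n : ℕ) (i : ℤ), ∀ s ∈ Icc (i * e) ((i + n) * e), ∀ t ∈ Icc (i * e) ((i + n) * e),
      M.dist (M.pcurve y e s) (M.pcurve y e t) ≤ |s - t| := by
    intro n i
    induction n with
    | zero =>
      intro s hs t ht
      simp only [Nat.cast_zero, add_zero, Icc_self, mem_singleton_iff] at hs ht
      rw [hs, ht, M.dist_self, sub_self, abs_zero]
    | succ n ih =>
      refine dist_le_concat ih ?_ (by nlinarith [Nat.cast_nonneg (α := ℝ) n])
        (by push_cast; nlinarith)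
      intro s hs t ht
      have e1 : (i : ℝ) + n = ((i + n : ℤ) : ℝ) := by push_cast; ring
      have e2 : (i : ℝ) + (n + 1 : ℕ) = ((i + n : ℤ) : ℝ) + 1 := by push_cast; ring
      rw [e1, e2] at hs ht
      rw [pcurve_eq he hy _ hs, pcurve_eq he hy _ ht]
      simpa using M.seg_lip (y (i + n)) (y (i + n + 1)) (s - (i + n : ℤ) * e) (t - (i + n : ℤ) * e)
  refine Lip.of_le fun s t hst => ?_
  rw [one_mul]
  have h1 : (⌊s / e⌋ : ℝ) * e ≤ s := by rw [← le_div_iff₀ he]; exact Int.floor_le _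
  obtain ⟨n, hn⟩ := exists_nat_ge (t / e - ⌊s / e⌋)
  have h2 : t ≤ (⌊s / e⌋ + n) * e := by rw [← div_le_iff₀ he]; linarith
  have := key n ⌊s / e⌋ s ⟨h1, hst.trans h2⟩ t ⟨h1.trans hst, h2⟩
  rwa [abs_sub_comm, abs_of_nonneg (by linarith)] at this

lemma pcurve_isSeg (he : 0 < e) (hy : ∀ i, M.dist (y i) (y (i + 1)) = e)
    (hm : ∀ i, M.dist (M.mid (y i) (y (i + 1))) (M.mid (y (i + 1)) (y (i + 1 + 1))) = e) (t : ℝ) :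
    M.IsSeg (M.pcurve y e) (Icc (t - e / 4) (t + e / 4)) := by
  have hlip : ∀ s t, M.dist (M.pcurve y e s) (M.pcurve y e t) ≤ |s - t| := fun s t => by
    simpa using pcurve_lip he hy s t
  have h1 : ∀ i : ℤ, M.IsSeg (M.pcurve y e) (Icc (i * e) ((i + 1) * e)) := fun i => by
    refine IsSeg.of_le (by nlinarith) (fun s _ t _ => hlip s t) ?_
    have := pcurve_vertex he hy (i + 1)
    push_cast at this
    rw [pcurve_vertex he hy, this, hy]; linarith
  have h2 : ∀ i : ℤ, M.IsSeg (M.pcurve y e) (Icc (i * e + e / 2) ((i + 1) * e + e / 2)) := fun i => by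
    refine IsSeg.of_le (by nlinarith) (fun s _ t _ => hlip s t) ?_
    have := pcurve_mid he hy (i + 1)
    push_cast at this
    rw [pcurve_mid he hy, this, hm]; linarith
  set i := ⌊(t - e / 4) / e⌋
  have h3 : i * e ≤ t - e / 4 := by rw [← le_div_iff₀ he]; exact Int.floor_le _
  have h4 : t - e / 4 < (i + 1) * e := by rw [← div_lt_iff₀ he]; exact Int.lt_floor_add_one _
  rcases le_total (t - e / 4) (i * e + e / 2) with h | h
  · exact (h1 i).mono (Icc_subset_Icc h3 (by linarith))
  · exact (h2 i).mono (Icc_subset_Icc h (by linarith))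

lemma pcurve_per (hU : M.SegUnique ρ) (he : 0 < e) (heρ : e ≤ ρ)
    (hy : ∀ i, M.dist (y i) (y (i + 1)) = e) {N : ℕ} {j : ℤ × ℤ} (hp : ∀ i, y (i + N) = y i + lat j)
    (t : ℝ) : M.pcurve y e (t + N * e) = M.pcurve y e t + lat j := by
  have h1 : ⌊(t + N * e) / e⌋ = ⌊t / e⌋ + N := by
    rw [add_div, mul_div_cancel_right₀ _ he.ne']; exact Int.floor_add_natCast _ _
  have h2 : (⌊t / e⌋ : ℝ) * e ≤ t := by rw [← le_div_iff₀ he]; exact Int.floor_le _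
  have h3 : t < (⌊t / e⌋ + 1) * e := by rw [← div_lt_iff₀ he]; exact Int.lt_floor_add_one _
  rw [pcurve, h1, show ⌊t / e⌋ + (N : ℤ) + 1 = ⌊t / e⌋ + 1 + N by ring, hp, hp,
    show t + N * e - ((⌊t / e⌋ + N : ℤ) : ℝ) * e = t - ⌊t / e⌋ * e by push_cast; ring]
  exact hU.seg_add_lat (by rwa [hy]) j (by rw [hy]; constructor <;> linarith)

end Curve
end TorusMetric

namespace TorusMetric
variable {M : TorusMetric} {ρ : ℝ} {j : ℤ × ℤ} {N : ℕ} {y : ℤ → Pl}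

/-- A periodic polygon with short edges. -/
structure IsPoly (M : TorusMetric) (j : ℤ × ℤ) (N : ℕ) (ρ : ℝ) (y : ℤ → Pl) : Prop where
  per : ∀ i, y (i + N) = y i + lat j
  edge : ∀ i, M.dist (y i) (y (i + 1)) ≤ ρ

/-- Replacing a polygon by the polygon of the midpoints of its edges. -/
def step (M : TorusMetric) (y : ℤ → Pl) (i : ℤ) : Pl := M.mid (y i) (y (i + 1))

/-- The length of one period of a polygon. -/
def plen (M : TorusMetric) (N : ℕ) (y : ℤ → Pl) : ℝ :=
  ∑ i ∈ Finset.range N, M.dist (y i) (y (i + 1))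

/-- The energy of one period of a polygon. -/
def pen (M : TorusMetric) (N : ℕ) (y : ℤ → Pl) : ℝ :=
  ∑ i ∈ Finset.range N, M.dist (y i) (y (i + 1)) ^ 2

lemma dist_step_le (y : ℤ → Pl) (i : ℤ) : M.dist (M.step y i) (M.step y (i + 1)) ≤
    (M.dist (y i) (y (i + 1)) + M.dist (y (i + 1)) (y (i + 1 + 1))) / 2 := by
  have := M.dist_triangle (M.step y i) (y (i + 1)) (M.step y (i + 1))
  rw [step, step, dist_mid_right, dist_mid_left] at this
  rw [step, step]; linarith

lemma IsPoly.step (hU : M.SegUnique ρ) (h : M.IsPoly j N ρ y) : M.IsPoly j N ρ (M.step y) where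
  per i := by
    rw [TorusMetric.step, TorusMetric.step, show i + N + 1 = i + 1 + N by ring, h.per, h.per,
      hU.mid_add_lat (h.edge i)]
  edge i := by
    have := M.dist_step_le y i
    have := h.edge i
    have := h.edge (i + 1)
    linarith

lemma IsPoly.iterate (hU : M.SegUnique ρ) (h : M.IsPoly j N ρ y) (m : ℕ) :
    M.IsPoly j N ρ (M.step^[m] y) := by
  induction m with
  | zero => exact h
  | succ m ih => rw [Function.iterate_succ_apply']; exact ih.step hU

lemma IsPoly.dist_per (h : M.IsPoly j N ρ y) :
    Function.Periodic (fun i => M.dist (y i) (y (i + 1))) (N : ℤ) := fun i => by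
  simp only
  rw [show i + N + 1 = i + 1 + N by ring, h.per, h.per, M.dist_translate]

lemma IsPoly.sum_shift {f : ℤ → ℝ} (hf : Function.Periodic f (N : ℤ)) :
    ∑ i ∈ Finset.range N, f (i + 1) = ∑ i ∈ Finset.range N, f i := by
  have h1 := Finset.sum_range_succ (fun i : ℕ => f i) N
  have h2 := Finset.sum_range_succ' (fun i : ℕ => f i) N
  have h3 := hf 0
  rw [zero_add] at h3
  push_cast at h1 h2
  linarith

lemma IsPoly.plen_step_le (h : M.IsPoly j N ρ y) : M.plen N (M.step y) ≤ M.plen N y := by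
  have h1 := IsPoly.sum_shift h.dist_per
  have h2 : M.plen N (M.step y) ≤ ∑ i ∈ Finset.range N,
      (M.dist (y i) (y (i + 1)) + M.dist (y (i + 1)) (y (i + 1 + 1))) / 2 :=
    Finset.sum_le_sum fun i _ => M.dist_step_le y i
  rw [← Finset.sum_div, Finset.sum_add_distrib, h1] at h2
  rw [plen] at h2
  rw [plen, plen]
  linarith

lemma IsPoly.pen_term (y : ℤ → Pl) (i : ℤ) :
    (M.dist (y i) (y (i + 1)) - M.dist (y (i + 1)) (y (i + 1 + 1))) ^ 2 / 4 ≤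
    (M.dist (y i) (y (i + 1)) ^ 2 + M.dist (y (i + 1)) (y (i + 1 + 1)) ^ 2) / 2 -
      M.dist (M.step y i) (M.step y (i + 1)) ^ 2 := by
  have := M.dist_step_le y i
  have := M.dist_nonneg (M.step y i) (M.step y (i + 1))
  nlinarith

lemma IsPoly.pen_sub (h : M.IsPoly j N ρ y) : M.pen N y - M.pen N (M.step y) =
    ∑ i ∈ Finset.range N, ((M.dist (y i) (y (i + 1)) ^ 2 +
      M.dist (y (i + 1)) (y (i + 1 + 1)) ^ 2) / 2 - M.dist (M.step y i) (M.step y (i + 1)) ^ 2) := by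
  have h1 := IsPoly.sum_shift (N := N) (f := fun i => M.dist (y i) (y (i + 1)) ^ 2)
    (fun i => congrArg (· ^ 2) (h.dist_per i))
  rw [Finset.sum_sub_distrib, ← Finset.sum_div, Finset.sum_add_distrib]
  rw [pen, pen, h1]; ring

lemma IsPoly.pen_step_le (h : M.IsPoly j N ρ y) : M.pen N (M.step y) ≤ M.pen N y := by
  have h1 := h.pen_sub
  have : 0 ≤ M.pen N y - M.pen N (M.step y) := by
    rw [h1]
    exact Finset.sum_nonneg fun i _ => (by positivity : (0 : ℝ) ≤ _).trans (IsPoly.pen_term y i)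
  linarith

lemma IsPoly.forall_of_range (hN : 0 < N) {p : ℤ → Prop} (hp : Function.Periodic p (N : ℤ))
    (h : ∀ i < N, p (i : ℕ)) (i : ℤ) : p i := by
  have hN' : (0 : ℤ) < N := by exact_mod_cast hN
  have h1 := (hp.int_mul (i / N)) (i % N)
  have h2 : i % N + (i / N) * N = i := by
    rw [mul_comm]; exact Int.emod_add_mul_ediv i N
  simp only [Int.cast_id] at h1
  rw [h2] at h1
  rw [h1]
  obtain ⟨m, hm⟩ := Int.eq_ofNat_of_zero_le (Int.emod_nonneg i hN'.ne')
  rw [hm]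
  apply h
  have := Int.emod_lt_of_pos i hN'
  rw [hm] at this
  exact_mod_cast this

lemma IsPoly.equilateral (hU : M.SegUnique ρ) (hN : 0 < N) (h : M.IsPoly j N ρ y)
    (he : M.pen N (M.step y) = M.pen N y) : ∃ e, (∀ i, M.dist (y i) (y (i + 1)) = e) ∧
      ∀ i, M.dist (M.step y i) (M.step y (i + 1)) = e := by
  have h1 := h.pen_sub
  rw [he, sub_self] at h1
  have h2 := (Finset.sum_eq_zero_iff_of_nonneg fun (i : ℕ) _ =>
    (by positivity : (0 : ℝ) ≤ _).trans (IsPoly.pen_term (M := M) y i)).1 h1.symm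
  have h3 : ∀ i < N, M.dist (y (i : ℕ)) (y (i + 1)) = M.dist (y (i + 1)) (y (i + 1 + 1)) ∧
      M.dist (M.step y i) (M.step y (i + 1)) = M.dist (y i) (y (i + 1)) := by
    intro i hi
    have h4 := h2 i (Finset.mem_range.2 hi)
    have h5 := IsPoly.pen_term (M := M) y i
    rw [h4] at h5
    have h6 : M.dist (y i) (y (i + 1)) = M.dist (y (i + 1)) (y (i + 1 + 1)) := by
      nlinarith
    refine ⟨h6, ?_⟩
    rw [← h6] at h4
    have h7 := M.dist_nonneg (M.step y i) (M.step y (i + 1))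
    have h8 := M.dist_nonneg (y i) (y (i + 1))
    rw [← sq_eq_sq₀ h7 h8]; linarith
  have hp1 := h.dist_per
  have hp2 := (h.step hU).dist_per
  have h4 := IsPoly.forall_of_range hN (p := fun i => M.dist (y i) (y (i + 1)) =
      M.dist (y (i + 1)) (y (i + 1 + 1)) ∧
      M.dist (M.step y i) (M.step y (i + 1)) = M.dist (y i) (y (i + 1))) (fun i => by
        have e1 := hp1 i
        have e2 := hp1 (i + 1)
        have e3 := hp2 i
        simp only at e1 e2 e3
        rw [show i + 1 + (N : ℤ) = i + N + 1 by ring] at e2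
        simp only
        rw [e1, e2, e3]) h3
  have h5 : ∀ i : ℤ, M.dist (y i) (y (i + 1)) = M.dist (y 0) (y (0 + 1)) := fun i => by
    induction i using Int.induction_on with
    | zero => rfl
    | succ i ih => rw [← ih]; exact (h4 i).1.symm
    | pred i ih =>
      rw [← ih]
      have := (h4 (-i - 1)).1
      rw [sub_add_cancel] at this ⊢
      exact this
  exact ⟨_, h5, fun i => (h4 i).2.trans (h5 i)⟩

lemma IsPoly.dist_le_nat (h : M.IsPoly j N ρ y) (i : ℤ) (n : ℕ) : M.dist (y i) (y (i + n)) ≤ n * ρ := by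
  induction n with
  | zero => simp [M.dist_self]
  | succ n ih =>
    have h1 := M.dist_triangle (y i) (y (i + n)) (y (i + n + 1))
    have h2 := h.edge (i + n)
    push_cast
    rw [← add_assoc]
    linarith

lemma IsPoly.dist_zero_le (h : M.IsPoly j N ρ y) (i : ℤ) : M.dist (y 0) (y i) ≤ i.natAbs * ρ := by
  rcases Int.natAbs_eq i with hi | hi
  · have := h.dist_le_nat 0 i.natAbs
    rwa [zero_add, ← hi] at this
  · have := h.dist_le_nat i i.natAbs
    rwa [show i + (i.natAbs : ℤ) = 0 by omega, M.dist_comm] at this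

lemma dist_le_plen (N : ℕ) (y : ℤ → Pl) : M.dist (y 0) (y N) ≤ M.plen N y := by
  induction N with
  | zero => simp [plen, M.dist_self]
  | succ n ih =>
    have := M.dist_triangle (y 0) (y n) (y (n + 1))
    rw [plen, Finset.sum_range_succ, ← plen]
    push_cast
    linarith

lemma SegUnique.step_tendsto (hU : M.SegUnique ρ) {ι : Type*} {l : Filter ι} {y : ι → ℤ → Pl}
    {z : ℤ → Pl} (hz : M.IsPoly j N ρ z) (h : ∀ i, Tendsto (fun s => y s i) l (𝓝 (z i))) (i : ℤ) :
    Tendsto (fun s => M.step (y s) i) l (𝓝 (M.step z i)) :=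
  hU.mid_tendsto (h i) (h (i + 1)) (hz.edge i)

lemma SegUnique.iterate_tendsto (hU : M.SegUnique ρ) {ι : Type*} {l : Filter ι} {y : ι → ℤ → Pl}
    {z : ℤ → Pl} (hz : M.IsPoly j N ρ z) (h : ∀ i, Tendsto (fun s => y s i) l (𝓝 (z i))) (m : ℕ) :
    ∀ i, Tendsto (fun s => M.step^[m] (y s) i) l (𝓝 (M.step^[m] z i)) := by
  induction m with
  | zero => exact h
  | succ m ih =>
    intro i
    simp only [Function.iterate_succ_apply']
    exact hU.step_tendsto (hz.iterate hU m) ih i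

lemma IsPoly.pen_tendsto {ι : Type*} {l : Filter ι} {y : ι → ℤ → Pl} {z : ℤ → Pl}
    (h : ∀ i, Tendsto (fun s => y s i) l (𝓝 (z i))) :
    Tendsto (fun s => M.pen N (y s)) l (𝓝 (M.pen N z)) :=
  tendsto_finsetSum _ fun i _ => (M.tendsto_dist (h i) (h (i + 1))).pow 2

lemma IsPoly.plen_tendsto {ι : Type*} {l : Filter ι} {y : ι → ℤ → Pl} {z : ℤ → Pl}
    (h : ∀ i, Tendsto (fun s => y s i) l (𝓝 (z i))) :
    Tendsto (fun s => M.plen N (y s)) l (𝓝 (M.plen N z)) :=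
  tendsto_finsetSum _ fun i _ => M.tendsto_dist (h i) (h (i + 1))

lemma pen_sub_lat (y : ℤ → Pl) (k : ℤ × ℤ) : M.pen N (fun i => y i - lat k) = M.pen N y := by
  simp only [pen, sub_eq_add_neg, ← lat_neg, M.dist_translate]

lemma plen_sub_lat (y : ℤ → Pl) (k : ℤ × ℤ) : M.plen N (fun i => y i - lat k) = M.plen N y := by
  simp only [plen, sub_eq_add_neg, ← lat_neg, M.dist_translate]

lemma IsPoly.step_sub_lat (hU : M.SegUnique ρ) (h : M.IsPoly j N ρ y) (k : ℤ × ℤ) :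
    M.step (fun i => y i - lat k) = fun i => M.step y i - lat k := by
  funext i
  simp only [TorusMetric.step, sub_eq_add_neg, ← lat_neg, hU.mid_add_lat (h.edge i)]

/-- Iterated midpoint polygons converge, up to translations, to an equilateral closed polygon. -/
lemma IsPoly.exists_limit (hU : M.SegUnique ρ) (hN : 0 < N) (hy : M.IsPoly j N ρ y) :
    ∃ (z : ℤ → Pl) (k : ℕ → ℤ × ℤ) (e : ℝ),
      (∀ i, Tendsto (fun m => M.step^[m] y i - lat (k m)) Ult (𝓝 (z i))) ∧ M.IsPoly j N ρ z ∧
      (∀ i, M.dist (z i) (z (i + 1)) = e) ∧ (∀ i, M.dist (M.step z i) (M.step z (i + 1)) = e) ∧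
      N * e ≤ M.plen N y := by
  choose k hk using fun m => exists_lat_near (M.step^[m] y 0)
  have hit := hy.iterate hU
  have hex : ∀ i, ∃ z, Tendsto (fun m => M.step^[m] y i - lat (k m)) Ult (𝓝 z) := fun i => by
    refine exists_ulim (C := 1 + M.K * (i.natAbs * ρ)) (Eventually.of_forall fun m => ?_)
    have h1 := norm_le_of_mem_Icc (hk m)
    have h2 := (M.norm_sub_le_dist (M.step^[m] y i) (M.step^[m] y 0)).trans
      (mul_le_mul_of_nonneg_left ((M.dist_comm _ _).trans_le ((hit m).dist_zero_le i)) M.K_pos.le)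
    have h3 := norm_add_le (M.step^[m] y 0 - lat (k m)) (M.step^[m] y i - M.step^[m] y 0)
    rw [show M.step^[m] y 0 - lat (k m) + (M.step^[m] y i - M.step^[m] y 0) =
      M.step^[m] y i - lat (k m) by abel] at h3
    linarith
  choose z hz using hex
  have hzp : M.IsPoly j N ρ z := by
    refine ⟨fun i => tendsto_nhds_unique (hz (i + N)) ?_, fun i => ?_⟩
    · refine ((hz i).add_const (lat j)).congr fun m => ?_
      rw [(hit m).per]; abel
    · refine le_of_tendsto (M.tendsto_dist (hz i) (hz (i + 1))) (Eventually.of_forall fun m => ?_)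
      simp only [sub_eq_add_neg, ← lat_neg, M.dist_translate]
      exact (hit m).edge i
  have hanti : Antitone fun m => M.pen N (M.step^[m] y) := antitone_nat_of_succ_le fun m => by
    rw [Function.iterate_succ_apply']; exact (hit m).pen_step_le
  have hlen : Antitone fun m => M.plen N (M.step^[m] y) := antitone_nat_of_succ_le fun m => by
    rw [Function.iterate_succ_apply']; exact (hit m).plen_step_le
  have hlim := tendsto_atTop_ciInf hanti ⟨0, by
    rintro _ ⟨m, rfl⟩
    exact Finset.sum_nonneg fun i _ => sq_nonneg _⟩
  have hsub : ∀ m, M.IsPoly j N ρ fun i => M.step^[m] y i - lat (k m) := fun m => by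
    refine ⟨fun i => ?_, fun i => ?_⟩
    · rw [(hit m).per]; abel
    · simp only [sub_eq_add_neg, ← lat_neg, M.dist_translate]
      exact (hit m).edge i
  have e1 : M.pen N z = _ := tendsto_nhds_unique
    ((IsPoly.pen_tendsto hz).congr fun m => pen_sub_lat _ _) (hlim.mono_left ult_le)
  have e2 : M.pen N (M.step z) = _ := tendsto_nhds_unique
    ((IsPoly.pen_tendsto (hU.step_tendsto hzp hz)).congr fun m => by
      rw [(hit m).step_sub_lat hU, pen_sub_lat]
      simp only [Function.comp_apply, Function.iterate_succ_apply'])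
    ((hlim.comp (tendsto_add_atTop_nat 1)).mono_left ult_le)
  obtain ⟨e, he1, he2⟩ := hzp.equilateral hU hN (e2.trans e1.symm)
  refine ⟨z, k, e, hz, hzp, he1, he2, ?_⟩
  have h3 : M.plen N z = N * e := by simp [plen, he1]
  rw [← h3]
  refine le_of_tendsto (IsPoly.plen_tendsto hz) (Eventually.of_forall fun m => ?_)
  rw [plen_sub_lat]
  exact hlen (Nat.zero_le m)

end TorusMetric

/-- The piecewise affine curve through the first `N + 1` vertices of a polygon. -/
def pline (y : ℤ → Pl) (N : ℕ) (t : ℝ) : Pl :=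
  y 0 + ∑ i ∈ Finset.range N, clamp 0 1 (t - i) • (y (i + 1) - y i)

lemma continuous_pline (y : ℤ → Pl) (N : ℕ) : Continuous (pline y N) :=
  continuous_const.add (continuous_finsetSum _ fun _ _ =>
    ((continuous_clamp 0 1).comp (continuous_id.sub continuous_const)).smul continuous_const)

lemma pline_of_ge (y : ℤ → Pl) (N : ℕ) {t : ℝ} (ht : N ≤ t) : pline y N t = y N := by
  have h : ∀ i ∈ Finset.range N, clamp 0 1 (t - i) • (y ((i : ℕ) + 1) - y i) =
      y ((i + 1 : ℕ) : ℤ) - y (i : ℕ) := fun i hi => by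
    have h1 : (i : ℝ) + 1 ≤ N := by exact_mod_cast Finset.mem_range.1 hi
    rw [clamp, min_eq_left (by linarith), max_eq_right zero_le_one, one_smul]
    push_cast; rfl
  rw [pline, Finset.sum_congr rfl h, Finset.sum_range_sub (fun i : ℕ => y i)]
  simp

lemma pline_zero (y : ℤ → Pl) (N : ℕ) : pline y N 0 = y 0 := by
  rw [pline, Finset.sum_eq_zero, add_zero]
  intro i _
  rw [clamp, max_eq_left, zero_smul]
  exact (min_le_right _ _).trans (by simp)

lemma exists_pline_eq {N : ℕ} (hN : 0 < N) (t : ℝ) :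
    ∃ i < N, ∃ θ ∈ Icc (0 : ℝ) 1, ∀ y : ℤ → Pl, pline y N t = y i + θ • (y (i + 1) - y i) := by
  have key : ∀ n : ℕ, ∃ i ≤ n - 1, ∃ θ ∈ Icc (0 : ℝ) 1, ∀ y : ℤ → Pl,
      pline y n t = y i + θ • (y (i + 1) - y i) := by
    intro n
    induction n with
    | zero => exact ⟨0, le_rfl, 0, by simp, fun y => by simp [pline]⟩
    | succ n ih =>
      rcases le_total (n : ℝ) t with h | h
      · refine ⟨n, by omega, clamp 0 1 (t - n), clamp_mem zero_le_one _, fun y => ?_⟩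
        rw [← pline_of_ge y n h, pline, Finset.sum_range_succ, ← add_assoc, ← pline,
          pline_of_ge y n h]
      · obtain ⟨i, hi, θ, hθ, hy⟩ := ih
        refine ⟨i, by omega, θ, hθ, fun y => ?_⟩
        rw [← hy, pline, Finset.sum_range_succ, ← add_assoc, ← pline, clamp,
          max_eq_left ((min_le_right _ _).trans (by linarith)), zero_smul, add_zero]
  obtain ⟨i, hi, h⟩ := key N
  exact ⟨i, by omega, h⟩

namespace TorusMetric
variable {M : TorusMetric} {k : ℤ × ℤ} {ρ L l δ : ℝ} {n N : ℕ} {y y' : ℤ → Pl} {x : Pl}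

lemma wind_pline_eq (hk : k ≠ 0) (hN : 0 < N) (hy : M.IsPoly (n • k) N ρ y)
    (hy' : M.IsPoly (n • k) N ρ y') (hδ : 2 * M.K ^ 2 * ρ ≤ δ)
    (hx : ∀ (i : ℤ) (m : ℤ), δ ≤ M.dist (x + lat (m • k)) (y i))
    (hc : ∀ i : ℕ, i ≤ N → M.dist (y' i) (y i) < ρ) :
    wind k (pline y N) N x = wind k (pline y' N) N x := by
  have hK := M.K_pos
  have hend : ∀ z, M.IsPoly (n • k) N ρ z → pline z N N = pline z N 0 + lat ((n : ℤ) • k) := by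
    intro z hz
    have := hz.per 0
    rw [pline_of_ge z N le_rfl, pline_zero, natCast_zsmul, ← this, zero_add]
  refine wind_close hk (continuous_pline y N) (continuous_pline y' N) (δ := M.K * ρ) (hend y hy)
    (hend y' hy') (fun t => ?_) fun t m => ?_
  · obtain ⟨i, hi, θ, hθ, h⟩ := exists_pline_eq hN t
    rw [h, h]
    have h1 : ∀ i : ℕ, i ≤ N → ‖y' i - y i‖ < M.K * ρ := fun i hi =>
      (M.norm_sub_le_dist _ _).trans_lt (mul_lt_mul_of_pos_left (hc i hi) hK)
    have h2 := h1 i hi.le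
    have h3 := h1 (i + 1) hi
    push_cast at h3
    have e : y' i + θ • (y' (i + 1) - y' i) - (y i + θ • (y (i + 1) - y i)) =
      (1 - θ) • (y' i - y i) + θ • (y' (i + 1) - y (i + 1)) := by module
    rw [e]
    refine (norm_add_le _ _).trans_lt ?_
    rw [norm_smul, norm_smul, Real.norm_of_nonneg hθ.1, Real.norm_of_nonneg (sub_nonneg.2 hθ.2)]
    have h4 := mul_le_mul_of_nonneg_left (le_max_left ‖y' i - y i‖ ‖y' (i + 1) - y (i + 1)‖)
      (sub_nonneg.2 hθ.2)
    have h5 := mul_le_mul_of_nonneg_left (le_max_right ‖y' i - y i‖ ‖y' (i + 1) - y (i + 1)‖) hθ.1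
    have h6 := max_lt h2 h3
    linarith
  · obtain ⟨i, hi, θ, hθ, h⟩ := exists_pline_eq hN t
    rw [h]
    have h1 : ‖y (i + 1) - y i‖ ≤ M.K * ρ := (M.norm_sub_le_dist _ _).trans
      (mul_le_mul_of_nonneg_left ((M.dist_comm _ _).trans_le (hy.edge i)) hK.le)
    have h2 : ‖θ • (y (i + 1) - y i)‖ ≤ M.K * ρ := by
      rw [norm_smul, Real.norm_of_nonneg hθ.1]
      nlinarith [hθ.1, hθ.2, norm_nonneg (y (i + 1) - y i)]
    have h3 : 2 * M.K * ρ ≤ ‖y i - (x + lat (m • k))‖ := by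
      have h4 := hx i m
      rw [M.dist_comm] at h4
      have h5 := M.dist_le_norm_sub (y i) (x + lat (m • k))
      have h6 : M.K * (2 * M.K * ρ) ≤ M.K * ‖y i - (x + lat (m • k))‖ := by nlinarith
      exact le_of_mul_le_mul_left h6 hK
    have h4 := norm_sub_le (y i + θ • (y (i + 1) - y i) - (x + lat (m • k)))
      (θ • (y (i + 1) - y i))
    rw [show y i + θ • (y (i + 1) - y i) - (x + lat (m • k)) - θ • (y (i + 1) - y i) =
      y i - (x + lat (m • k)) by abel] at h4
    linarith

lemma exists_trap (H : ∀ c, IsAxis M c → ∀ k : ℤ × ℤ, k ≠ 0 →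
      transInter c (transl k c) Set.univ Set.univ = ∅) (hk : k ≠ 0)
    (hL : ∀ x, L ≤ M.dist x (x + lat k)) (hs : M.Small L (M.dist x (x + lat k)) l ρ)
    (hn : 0 < n) (hN : 0 < N) (hy : M.IsPoly (n • k) N ρ y) (hlen : M.plen N y < n * l)
    (hlN : l - L ≤ n * L / N / 4) :
    ∃ (m₀ : ℕ) (V : Set Pl) (ε : ℝ), 0 < ε ∧
      (∀ (i : ℤ) w, M.dist w (M.step^[m₀] y i) < ε → w ∈ V) ∧
      (∀ p ∈ V, ∀ q ∈ V, M.dist p q ≤ ρ → M.mid p q ∈ V) ∧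
      ∀ p ∈ V, ∀ j : ℤ, (M.dist x (x + lat k) - l) / 2 ≤ M.dist (x + lat (j • k)) p := by
  have hU : M.SegUnique ρ := hs.unique
  have hL0 := hs.pos_L
  have hN' : (0 : ℝ) < N := by exact_mod_cast hN
  have hn' : (0 : ℝ) < n := by exact_mod_cast hn
  obtain ⟨z, κ, e, hz, hzp, he1, he2, hle⟩ := hy.exists_limit hU hN
  have hne : n * L ≤ N * e := by
    have h1 := le_dist_nsmul hk hL n (z 0)
    have h2 := dist_le_plen (M := M) N z
    have h3 := hzp.per 0
    rw [zero_add] at h3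
    have h4 : M.plen N z = N * e := by simp [plen, he1]
    rw [h3] at h2
    linarith
  have heq : n * L / N ≤ e := by rw [div_le_iff₀ hN']; linarith
  have he0 : 0 < e := lt_of_lt_of_le (by positivity) heq
  have heρ : e ≤ ρ := by rw [← he1 0]; exact hzp.edge 0
  set a := M.pcurve z e with hadef
  have ha1 : M.Lip a 1 := pcurve_lip he0 he1
  have has : ∀ t, M.IsSeg a (Icc (t - e / 4) (t + e / 4)) := pcurve_isSeg he0 he1 he2
  have hal : M.IsLoc a := ⟨e / 4, by positivity, has⟩
  have hap : ∀ t, a (t + N * e) = a t + lat (n • k) := pcurve_per hU he0 heρ he1 hzp.per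
  have hav : ∀ i : ℤ, a (i * e) = z i := pcurve_vertex he0 he1
  set Ta := N * e / n with hTa
  have hTa0 : 0 < Ta := by positivity
  have ha := axis_reduce H hk hal (by positivity : 0 < N * e) hn hap
  have hTal : Ta < l := by rw [hTa, div_lt_iff₀ hn']; linarith
  have hrest := hs.lt_two
  have hρ0 := hs.pos
  obtain ⟨ε, hε, hbar⟩ := exists_bar hk hL hL0 ha1 ha hTa0 (r := e / 4) (by linarith)
    (by positivity) (by linarith) has hTal hs.lt
  have hev : ∀ᶠ m in (Ult : Filter ℕ), ∀ i ∈ Finset.range N,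
      M.dist (M.step^[m] y (i : ℕ) - lat (κ m)) (z i) < ε / 2 := by
    rw [eventually_all_finset]
    intro i _
    have := M.tendsto_dist (hz i) (tendsto_const_nhds (x := z i))
    rw [M.dist_self] at this
    exact this.eventually_lt_const (by positivity)
  obtain ⟨m, hm⟩ := hev.exists
  have hmp := hy.iterate hU m
  have hm' := IsPoly.forall_of_range hN
    (p := fun i => M.dist (M.step^[m] y i - lat (κ m)) (z i) < ε / 2) (fun i => by
      simp only
      rw [hmp.per, hzp.per, add_sub_right_comm, M.dist_translate])
    fun i hi => hm i (Finset.mem_range.2 hi)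
  set x' := x - lat (κ m) with hx'
  have hdx : M.dist x' (x' + lat k) = M.dist x (x + lat k) := by
    have := M.dist_translate (-κ m) x (x + lat k)
    rwa [lat_neg, ← sub_eq_add_neg, ← sub_eq_add_neg, add_sub_right_comm] at this
  obtain ⟨P₁, T₁, hP₁, hT₁⟩ := hbar x' hdx.ge
  obtain ⟨P, T, hP, hmin⟩ := hP₁.exists_min hk hε ha hL hL0 (hT₁.trans (hs.lt.trans_eq hdx.symm))
  have hTl : T < l := (hmin _ _ hP₁).trans_lt hT₁
  have hs' := hs
  rw [← hdx] at hs'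
  refine ⟨m, {w | w - lat (κ m) ∈ Side k x' P T}, ε / 2, by positivity, fun i w hw => ?_, ?_, ?_⟩
  · refine hP.mem_side hk hε ha1 (u := i * e) ?_
    rw [hav]
    have h1 := hm' i
    have h2 := M.dist_triangle (z i) (M.step^[m] y i - lat (κ m)) (w - lat (κ m))
    have h3 := M.dist_translate (-κ m) w (M.step^[m] y i)
    rw [lat_neg, ← sub_eq_add_neg, ← sub_eq_add_neg, M.dist_comm] at h3
    rw [M.dist_comm] at h1
    linarith
  · intro p hp q hq hpq
    have h1 := hU.mid_add_lat hpq (-κ m)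
    rw [lat_neg, ← sub_eq_add_neg, ← sub_eq_add_neg, ← sub_eq_add_neg] at h1
    have hpq' : M.dist (p - lat (κ m)) (q - lat (κ m)) = M.dist p q := by
      have h3 := M.dist_translate (-κ m) p q
      rwa [lat_neg, ← sub_eq_add_neg, ← sub_eq_add_neg] at h3
    change M.mid p q - lat (κ m) ∈ Side k x' P T
    rw [← h1]
    have hd0 := M.dist_nonneg (p - lat (κ m)) (q - lat (κ m))
    refine hP.segment_subset_side hk hε ha1 ha hTa0 hTal hL hs' hTl hmin (hpq'.trans_le hpq)
      (M.seg_lip _ _) (M.seg_isSeg _ _) ?_ ?_ ⟨by linarith, by linarith⟩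
    · rw [seg_zero]; exact hp
    · rw [seg_dist]; exact hq
  · intro p hp j
    have h1 := hP.le_dist_side hk hp j
    have h3 := M.dist_translate (-κ m) (x + lat (j • k)) p
    rw [lat_neg, ← sub_eq_add_neg, ← sub_eq_add_neg, add_sub_right_comm] at h3
    rw [h3, hdx] at h1
    linarith

variable (H : ∀ c, IsAxis M c → ∀ k : ℤ × ℤ, k ≠ 0 →
      transInter c (transl k c) Set.univ Set.univ = ∅) (hk : k ≠ 0)
    (hL : ∀ x, L ≤ M.dist x (x + lat k)) (hs : M.Small L (M.dist x (x + lat k)) l ρ)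
    (hn : 0 < n) (hN : 0 < N) {γ : ℝ → ℤ → Pl} (hγ : ∀ i, Continuous fun s => γ s i)
    (hy : ∀ s, M.IsPoly (n • k) N ρ (γ s)) (hlen : ∀ s, M.plen N (γ s) < n * l)
    (hlN : l - L ≤ n * L / N / 4) (hδ : 2 * M.K ^ 2 * ρ ≤ (M.dist x (x + lat k) - l) / 2)

include H hk hL hs hn hN hγ hy hlen hlN hδ

/-- The winding numbers of iterated midpoint polygons stabilize locally uniformly. -/
lemma eventually_wind_eq (s₀ : ℝ) :
    ∃ m₀ : ℕ, ∀ᶠ s in 𝓝 s₀, ∀ m ≥ m₀, wind k (pline (M.step^[m] (γ s)) N) N x =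
      wind k (pline (M.step^[m₀] (γ s₀)) N) N x := by
  have hU : M.SegUnique ρ := hs.unique
  obtain ⟨m₀, V, ε, hε, hV1, hV2, hV3⟩ := exists_trap H hk hL hs hn hN (hy s₀) (hlen s₀) hlN
  refine ⟨m₀, ?_⟩
  have ht := hU.iterate_tendsto (hy s₀) (fun i => (hγ i).tendsto s₀) m₀
  have hev : ∀ᶠ s in 𝓝 s₀, ∀ i ∈ Finset.range (N + 1),
      M.dist (M.step^[m₀] (γ s) (i : ℕ)) (M.step^[m₀] (γ s₀) i) < min ε ρ := by
    rw [eventually_all_finset]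
    intro i _
    have := M.tendsto_dist (ht i) (tendsto_const_nhds (x := M.step^[m₀] (γ s₀) i))
    rw [M.dist_self] at this
    exact this.eventually_lt_const (lt_min hε hs.pos)
  filter_upwards [hev] with s hs1
  have hp₀ := (hy s₀).iterate hU m₀
  have hmem₀ : ∀ i, M.step^[m₀] (γ s₀) i ∈ V := fun i => hV1 i _ (by rwa [M.dist_self])
  have hclose : ∀ i : ℕ, i ≤ N → M.dist (M.step^[m₀] (γ s) i) (M.step^[m₀] (γ s₀) i) < min ε ρ :=
    fun i hi => hs1 i (Finset.mem_range.2 (by omega))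
  have hclose' := IsPoly.forall_of_range hN
    (p := fun i => M.dist (M.step^[m₀] (γ s) i) (M.step^[m₀] (γ s₀) i) < min ε ρ) (fun i => by
      simp only
      rw [hp₀.per, ((hy s).iterate hU m₀).per, M.dist_translate])
    fun i hi => hclose i hi.le
  have hmem : ∀ m ≥ m₀, ∀ i, M.step^[m] (γ s) i ∈ V := by
    intro m hm
    induction m, hm using Nat.le_induction with
    | base => exact fun i => hV1 i _ ((hclose' i).trans_le (min_le_left _ _))
    | succ m hm ih =>
      intro i
      rw [Function.iterate_succ_apply']
      exact hV2 _ (ih i) _ (ih (i + 1)) (((hy s).iterate hU m).edge i)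
  have hdist : ∀ m ≥ m₀, ∀ (i j : ℤ), (M.dist x (x + lat k) - l) / 2 ≤
      M.dist (x + lat (j • k)) (M.step^[m] (γ s) i) := fun m hm i j => hV3 _ (hmem m hm i) j
  intro m hm
  induction m, hm using Nat.le_induction with
  | base =>
    exact (wind_pline_eq hk hN hp₀ ((hy s).iterate hU m₀) hδ
      (fun i j => hV3 _ (hmem₀ i) j) fun i hi => (hclose i hi).trans_le (min_le_right _ _)).symm
  | succ m hm ih =>
    rw [← ih]
    refine (wind_pline_eq hk hN ((hy s).iterate hU m) ((hy s).iterate hU (m + 1)) hδ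
      (hdist m hm) fun i hi => ?_).symm
    rw [Function.iterate_succ_apply', step, M.dist_comm, dist_mid_left]
    have := ((hy s).iterate hU m).edge i
    have := hs.pos
    linarith

/-- The limiting winding number is constant along a continuous family of polygons. -/
lemma exists_wind_limit (s₁ s₂ : ℝ) : ∃ m, wind k (pline (M.step^[m] (γ s₁)) N) N x =
      wind k (pline (M.step^[m] (γ s₂)) N) N x := by
  choose m₀ hm using eventually_wind_eq H hk hL hs hn hN hγ hy hlen hlN hδ
  set f : ℝ → ℂ := fun s => wind k (pline (M.step^[m₀ s] (γ s)) N) N x with hf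
  have hlc : IsLocallyConstant f := by
    rw [IsLocallyConstant.iff_eventually_eq]
    intro s₀
    filter_upwards [hm s₀] with s h1
    have h2 := (hm s).self_of_nhds (max (m₀ s) (m₀ s₀)) (le_max_left _ _)
    have h3 := h1 (max (m₀ s) (m₀ s₀)) (le_max_right _ _)
    exact h2.symm.trans h3
  have h1 : f s₁ = f s₂ := hlc.apply_eq_of_preconnectedSpace s₁ s₂
  refine ⟨max (m₀ s₁) (m₀ s₂), ?_⟩
  rw [(hm s₁).self_of_nhds _ (le_max_left _ _), (hm s₂).self_of_nhds _ (le_max_right _ _)]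
  exact h1

end TorusMetric

section Height
variable {k : ℤ × ℤ}

lemma zet_im_lat (hk : k ≠ 0) (m : ℤ) : (zet k (lat (m • (-k.2, k.1)))).im = m := by
  have h : zet k (lat (-k.2, k.1)) = Complex.I := by
    rw [zet, div_eq_iff (zet_den hk)]
    simp only [lat]
    push_cast
    linear_combination (-(k.2 : ℂ)) * Complex.I_mul_I
  rw [lat_zsmul, zet_smul, h]
  simp

lemma pline_im_mem {N : ℕ} (hN : 0 < N) {y : ℤ → Pl} {s : Set ℝ} (hs : Convex ℝ s)
    (h : ∀ i, (zet k (y i)).im ∈ s) (t : ℝ) : (zet k (pline y N t)).im ∈ s := by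
  obtain ⟨i, _, θ, hθ, hy⟩ := exists_pline_eq hN t
  simpa [hy, zet_add, zet_smul, zet_sub] using hs.add_smul_sub_mem (h i) (h (i + 1)) hθ

end Height

lemma clamp_mono (a b : ℝ) : Monotone (clamp a b) := fun _ _ h =>
  max_le_max le_rfl (min_le_min le_rfl h)

lemma sum_abs_clamp_le {h s a b : ℝ} (hh : 0 ≤ h) (hab : a ≤ b) (m : ℕ) :
    ∑ i ∈ Finset.range (2 * m), |clamp a b (s - |((i + 1 : ℕ) : ℝ) - m| * h) -
      clamp a b (s - |(i : ℝ) - m| * h)| ≤ 2 * (b - a) := by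
  rw [two_mul m, Finset.sum_range_add]
  have e1 : ∀ i ∈ Finset.range m, |clamp a b (s - |((i + 1 : ℕ) : ℝ) - m| * h) -
      clamp a b (s - |(i : ℝ) - m| * h)| = clamp a b (s - |((i + 1 : ℕ) : ℝ) - m| * h) -
      clamp a b (s - |(i : ℝ) - m| * h) := fun i hi => by
    have h1 : ((i + 1 : ℕ) : ℝ) ≤ m := Nat.cast_le.2 (Finset.mem_range.1 hi)
    rw [abs_of_nonneg]
    refine sub_nonneg.2 (clamp_mono a b ?_)
    push_cast at h1 ⊢
    rw [abs_of_nonpos (by linarith), abs_of_nonpos (by linarith)]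
    nlinarith
  have e2 : ∀ i ∈ Finset.range m, |clamp a b (s - |((m + i + 1 : ℕ) : ℝ) - m| * h) -
      clamp a b (s - |((m + i : ℕ) : ℝ) - m| * h)| =
      clamp a b (s - |((m + i : ℕ) : ℝ) - m| * h) -
      clamp a b (s - |((m + (i + 1) : ℕ) : ℝ) - m| * h) := fun i _ => by
    rw [abs_sub_comm, ← add_assoc, abs_of_nonneg]
    refine sub_nonneg.2 (clamp_mono a b ?_)
    have := Nat.cast_nonneg (α := ℝ) i
    push_cast
    rw [abs_of_nonneg (by linarith), abs_of_nonneg (by linarith)]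
    nlinarith
  rw [Finset.sum_congr rfl e1, Finset.sum_congr rfl e2,
    Finset.sum_range_sub (fun i : ℕ => clamp a b (s - |(i : ℝ) - m| * h)),
    Finset.sum_range_sub' (fun i : ℕ => clamp a b (s - |((m + i : ℕ) : ℝ) - m| * h))]
  have hm := fun t => clamp_mem hab t
  have h1 := hm (s - |(m : ℝ) - m| * h)
  have h2 := hm (s - |((0 : ℕ) : ℝ) - m| * h)
  have h3 := hm (s - |((m + 0 : ℕ) : ℝ) - m| * h)
  have h4 := hm (s - |((m + m : ℕ) : ℝ) - m| * h)
  linarith [h1.1, h1.2, h2.1, h2.2, h3.1, h3.2, h4.1, h4.2]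

namespace TorusMetric
variable {M : TorusMetric} {k : ℤ × ℤ} {c : ℝ → Pl} {L h ρ : ℝ} {v : Pl}

lemma dist_push_le (hh : 0 ≤ h) {p p' : Pl} (hp : M.dist p p' ≤ h) {s s' : ℝ} (hs : |s - s'| = h)
    {j : ℤ × ℤ} : M.dist (p + clamp 0 1 s • lat j) (p' + clamp 0 1 s' • lat j) ≤
      h + (M.K ^ 2 + M.K * ‖lat j‖) * |clamp (-h) (1 + h) s' - clamp (-h) (1 + h) s| := by
  have hK := M.K_pos
  have hC : 0 ≤ M.K ^ 2 + M.K * ‖lat j‖ := by positivity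
  have habs := abs_le.1 hs.le
  by_cases h0 : s ≤ 0 ∧ s' ≤ 0
  · rw [clamp, max_eq_left ((min_le_right _ _).trans h0.1), clamp,
      max_eq_left ((min_le_right _ _).trans h0.2), zero_smul, add_zero, add_zero]
    exact hp.trans (le_add_of_nonneg_right (by positivity))
  by_cases h1 : 1 ≤ s ∧ 1 ≤ s'
  · rw [clamp, min_eq_left h1.1, clamp, min_eq_left h1.2, max_eq_right zero_le_one, one_smul,
      M.dist_translate]
    exact hp.trans (le_add_of_nonneg_right (by positivity))
  have h2 : s ∈ Icc (-h) (1 + h) ∧ s' ∈ Icc (-h) (1 + h) := by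
    simp only [mem_Icc]
    rw [not_and_or, not_le, not_le] at h0 h1
    refine ⟨⟨?_, ?_⟩, ⟨?_, ?_⟩⟩ <;> rcases h0 with h0 | h0 <;> rcases h1 with h1 | h1 <;> linarith
  rw [clamp_eq h2.1, clamp_eq h2.2, abs_sub_comm, hs]
  refine (M.dist_le_norm_sub _ _).trans ?_
  have h3 : ‖p + clamp 0 1 s • lat j - (p' + clamp 0 1 s' • lat j)‖ ≤ M.K * h + h * ‖lat j‖ := by
    rw [show p + clamp 0 1 s • lat j - (p' + clamp 0 1 s' • lat j) =
      (p - p') + (clamp 0 1 s - clamp 0 1 s') • lat j by module]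
    refine (norm_add_le _ _).trans (add_le_add ((M.norm_sub_le_dist _ _).trans (by gcongr)) ?_)
    rw [norm_smul, ← hs]
    gcongr
    exact clamp_lip ..
  nlinarith [mul_le_mul_of_nonneg_left h3 hK.le]

/-- A family of polygons sweeping from a curve to a translate. -/
def sweep (c : ℝ → Pl) (v : Pl) (h : ℝ) (m : ℕ) (s : ℝ) (i : ℤ) : Pl :=
  c (i * h) + clamp 0 1 (s - |((i % (2 * m : ℕ) : ℤ) : ℝ) - m| * h) • v

lemma abs_sweep_sub (hh : 0 ≤ h) {m : ℕ} (hm : 0 < m) (s : ℝ) (i : ℤ) :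
    |s - |((i % (2 * m : ℕ) : ℤ) : ℝ) - m| * h - (s - |(((i + 1) % (2 * m : ℕ) : ℤ) : ℝ) - m| * h)| = h := by
  have h0 : (0 : ℤ) < (2 * m : ℕ) := by exact_mod_cast (by omega : 0 < 2 * m)
  set r := i % (2 * m : ℕ) with hr
  have h1 := Int.emod_nonneg i h0.ne'
  have h2 := Int.emod_lt_of_pos i h0
  rw [← hr] at h1 h2
  have h3 : (i + 1) % (2 * m : ℕ) = if r + 1 = (2 * m : ℕ) then 0 else r + 1 := by
    rw [← Int.emod_add_emod, ← hr]
    split_ifs with h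
    · rw [h, Int.emod_self]
    · exact Int.emod_eq_of_lt (by omega) (by omega)
  rw [h3]
  rcases lt_or_ge r m with h4 | h4
  · have h5 : (r : ℝ) + 1 ≤ m := by exact_mod_cast h4
    rw [if_neg (by push_cast; omega), abs_of_nonpos (a := (r : ℝ) - m) (by linarith)]
    push_cast
    rw [abs_of_nonpos (a := (r : ℝ) + 1 - m) (by linarith), abs_of_nonpos (by nlinarith)]
    ring
  · have h5 : (m : ℝ) ≤ r := by exact_mod_cast h4
    rw [abs_of_nonneg (a := (r : ℝ) - m) (by linarith)]
    split_ifs with h6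
    · have h7 : (r : ℝ) + 1 = 2 * m := by exact_mod_cast h6
      rw [Int.cast_zero, zero_sub, abs_neg, abs_of_nonneg (a := (m : ℝ)) (Nat.cast_nonneg m),
        show s - (r - m) * h - (s - m * h) = h by linear_combination h * h7.symm, abs_of_nonneg hh]
    · push_cast
      rw [abs_of_nonneg (a := (r : ℝ) + 1 - m) (by linarith), abs_of_nonneg (by nlinarith)]
      ring

lemma dist_sweep_le (hc : M.Lip c 1) (hh : 0 ≤ h) {m : ℕ} (hm : 0 < m) (j : ℤ × ℤ) (s : ℝ) (i : ℤ) :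
    M.dist (sweep c (lat j) h m s i) (sweep c (lat j) h m s (i + 1)) ≤
      h + (M.K ^ 2 + M.K * ‖lat j‖) *
        |clamp (-h) (1 + h) (s - |(((i + 1) % (2 * m : ℕ) : ℤ) : ℝ) - m| * h) -
        clamp (-h) (1 + h) (s - |((i % (2 * m : ℕ) : ℤ) : ℝ) - m| * h)| := by
  refine dist_push_le hh ?_ (abs_sweep_sub hh hm s i)
  have := hc (i * h) ((i + 1 : ℤ) * h)
  push_cast at this ⊢
  rwa [one_mul, show i * h - (i + 1) * h = -h by ring, abs_neg, abs_of_nonneg hh] at this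

lemma sweep_isPoly (hc : M.Lip c 1) (hh : 0 ≤ h) {m n q : ℕ} (hm : 0 < m) (hL : 2 * q * h = L)
    (hmq : m = n * q) (hp : ∀ t, c (t + L) = c t + lat k) {j : ℤ × ℤ}
    (hρ : h + (M.K ^ 2 + M.K * ‖lat j‖) * h ≤ ρ) (s : ℝ) :
    M.IsPoly (n • k) (2 * m) ρ (sweep c (lat j) h m s) where
  per i := by
    rw [sweep, Int.add_emod_right, sweep, show ((i + (2 * m : ℕ) : ℤ) : ℝ) * h = i * h + (n : ℤ) * L by
      push_cast; rw [hmq, ← hL]; push_cast; ring, translate_iterate hp, natCast_zsmul]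
    abel
  edge i := by
    have hK := M.K_pos
    refine (dist_sweep_le hc hh hm j s i).trans (le_trans ?_ hρ)
    gcongr
    refine (clamp_lip ..).trans ?_
    rw [abs_sub_comm]
    exact (abs_sweep_sub hh hm s i).le

lemma sweep_plen_le (hc : M.Lip c 1) (hh : 0 ≤ h) {m : ℕ} (hm : 0 < m) (j : ℤ × ℤ) (s : ℝ) :
    M.plen (2 * m) (sweep c (lat j) h m s) ≤
      2 * m * h + (M.K ^ 2 + M.K * ‖lat j‖) * (2 * (1 + 2 * h)) := by
  have hK := M.K_pos
  refine (Finset.sum_le_sum fun (i : ℕ) _ => dist_sweep_le hc hh hm j s i).trans ?_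
  rw [Finset.sum_add_distrib, ← Finset.mul_sum, Finset.sum_const, Finset.card_range, nsmul_eq_mul]
  push_cast
  gcongr
  have h1 := sum_abs_clamp_le (s := s) hh (by linarith : -h ≤ 1 + h) m
  rw [show 2 * (1 + h - -h) = 2 * (1 + 2 * h) by ring] at h1
  refine le_trans (Finset.sum_congr rfl fun i hi => ?_).le h1
  have hi' := Finset.mem_range.1 hi
  have e1 : ((i : ℤ) % (2 * (m : ℤ))) = i := Int.emod_eq_of_lt (by positivity) (by exact_mod_cast hi')
  rw [e1]
  rcases Nat.lt_or_ge (i + 1) (2 * m) with h2 | h2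
  · have e2 : (((i : ℤ) + 1) % (2 * (m : ℤ))) = i + 1 :=
      Int.emod_eq_of_lt (by positivity) (by exact_mod_cast h2)
    rw [e2]; push_cast; rfl
  · have e2 : i + 1 = 2 * m := by omega
    have e3 : (((i : ℤ) + 1) % (2 * (m : ℤ))) = 0 := by
      rw [show (i : ℤ) + 1 = 2 * m by exact_mod_cast e2, Int.emod_self]
    rw [e3, e2]
    have e4 : |((0 : ℤ) : ℝ) - m| = |((2 * m : ℕ) : ℝ) - m| := by
      rw [Int.cast_zero, zero_sub, abs_neg]; congr 1; push_cast; ring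
    rw [e4]
    push_cast
    rfl

lemma iterate_step_line (hU : M.SegUnique ρ) (hc : M.IsSeg c univ) (hh : 0 ≤ h) (hρ : h ≤ ρ)
    (j : ℤ × ℤ) (m : ℕ) : M.step^[m] (fun i => c (i * h) + lat j) =
      fun i : ℤ => c ((i + m / 2) * h) + lat j := by
  induction m with
  | zero => simp
  | succ m ih =>
    rw [Function.iterate_succ_apply', ih]
    funext i
    have hd : ∀ s t : ℝ, M.dist (c s + lat j) (c t + lat j) = |s - t| := fun s t => by
      rw [M.dist_translate, hc s (mem_univ _) t (mem_univ _)]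
    have h1 : |((i : ℝ) + m / 2) * h - (((i + 1 : ℤ) : ℝ) + m / 2) * h| = h := by
      push_cast
      rw [show ((i : ℝ) + m / 2) * h - (i + 1 + m / 2) * h = -h by ring, abs_neg, abs_of_nonneg hh]
    refine (hU.eq_mid (by rw [hd, h1]; exact hρ) ?_ ?_).symm <;> rw [hd, hd, h1] <;> push_cast
    · rw [show ((i : ℝ) + m / 2) * h - (i + (m + 1) / 2) * h = -(h / 2) by ring, abs_neg,
        abs_of_nonneg (by linarith)]
    · rw [show ((i : ℝ) + (m + 1) / 2) * h - (i + 1 + m / 2) * h = -(h / 2) by ring, abs_neg,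
        abs_of_nonneg (by linarith)]

/-- If axes never cross their translates, the displacement of every translation is constant. -/
theorem dist_lat_const (H : ∀ c, IsAxis M c → ∀ k : ℤ × ℤ, k ≠ 0 →
      transInter c (transl k c) Set.univ Set.univ = ∅) (hk : k ≠ 0) :
    ∃ L, ∀ x, M.dist x (x + lat k) = L := by
  obtain ⟨p, hp⟩ := exists_min_dist_lat M k
  set L := M.dist p (p + lat k) with hLdef
  refine ⟨L, ?_⟩
  by_contra! hne
  obtain ⟨x₀, hx₀⟩ := hne
  have hL0 : 0 < L := dist_lat_pos M hk p
  obtain ⟨c, hc1, hcp, -⟩ := exists_loop_dist M hk p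
  have hcs := isSeg_of_period hk hp hL0 hc1 hcp
  have hcc : Continuous c := hc1.continuous
  have hfp : ∀ t, (zet k (c (t + L))).im = (zet k (c t)).im := fun t => by
    rw [hcp, zet_add, zet_lat hk]; simp
  have hz := continuous_zet (k := k)
  obtain ⟨t₁, ht₁⟩ := exists_forall_le_of_periodic (f := fun t => (zet k (c t)).im)
    (by fun_prop) hL0 hfp
  obtain ⟨t₂, ht₂⟩ := exists_forall_le_of_periodic (f := fun t => -(zet k (c t)).im)
    (by fun_prop) hL0 fun t => by rw [hfp]
  obtain ⟨m₁, hm₁⟩ := exists_int_gt ((zet k (c t₁)).im - (zet k x₀).im)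
  set x := x₀ + lat (m₁ • (-k.2, k.1)) with hx
  have hxim : (zet k x).im = (zet k x₀).im + m₁ := by
    rw [hx, zet_add, Complex.add_im, zet_im_lat hk]
  obtain ⟨m₂, hm₂⟩ := exists_int_gt ((zet k x).im - (zet k (c t₂)).im)
  set j : ℤ × ℤ := m₂ • (-k.2, k.1) with hj
  have hbelow : ∀ t, (zet k (c t)).im < (zet k x).im := fun t => by
    have := ht₁ t
    rw [hxim]; linarith
  have habove : ∀ t, (zet k x).im < (zet k (c t + lat j)).im := fun t => by
    have h1 := ht₂ t
    have h2 : (zet k (c t + lat j)).im = (zet k (c t)).im + m₂ := by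
      rw [zet_add, Complex.add_im, hj, zet_im_lat hk]
    rw [h2]; linarith
  have hLx : L < M.dist x (x + lat k) := by
    have : M.dist x (x + lat k) = M.dist x₀ (x₀ + lat k) := by
      rw [hx, add_right_comm, M.dist_translate]
    rw [this]
    exact lt_of_le_of_ne (hp x₀) hx₀.symm
  clear_value x
  set Λ := M.dist x (x + lat k) with hΛ
  have hK1 := M.one_le_K
  have hK := M.K_pos
  obtain ⟨ρ₀, hρ₀, -, hU₀⟩ := M.exists_seg_unique
  set η := min L (Λ - L) / (8 * M.K ^ 2) with hη
  have hη0 : 0 < η := div_pos (lt_min hL0 (by linarith)) (by positivity)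
  have hηK : M.K ^ 2 * η = min L (Λ - L) / 8 := by rw [hη]; field_simp
  have hmin1 := min_le_left L (Λ - L)
  have hmin2 := min_le_right L (Λ - L)
  have hηη : η ≤ M.K ^ 2 * η := by
    have : 1 ≤ M.K ^ 2 := one_le_pow₀ hK1
    nlinarith
  set ρ := min ρ₀ (η / 2) with hρ
  have hρ0 : 0 < ρ := lt_min hρ₀ (by positivity)
  have hρη : ρ ≤ η / 2 := min_le_right _ _
  set C := M.K ^ 2 + M.K * ‖lat j‖ with hC
  have hC0 : 0 < C := by positivity
  obtain ⟨q, hq⟩ := exists_nat_gt (max (L / 2) (L * (1 + C) / (2 * ρ)))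
  have hq0 : (0 : ℝ) < q := lt_of_le_of_lt (by positivity) ((le_max_left _ _).trans_lt hq)
  set h := L / (2 * q) with hh
  have hh0 : 0 < h := by positivity
  have hqL : 2 * q * h = L := by rw [hh]; field_simp
  have hhρ : h + C * h ≤ ρ := by
    have h1 := (le_max_right _ _).trans_lt hq
    rw [div_lt_iff₀ (by positivity)] at h1
    rw [show h + C * h = L * (1 + C) / (2 * q) by rw [hh]; ring, div_le_iff₀ (by positivity)]
    linarith
  have hh1 : h ≤ 1 := by
    have h1 := (le_max_left _ _).trans_lt hq
    rw [hh, div_le_one (by positivity)]; linarith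
  have hhρ' : h ≤ ρ := by nlinarith
  set Δ := min (η / 2) (h / 4) with hΔ
  have hΔ0 : 0 < Δ := by positivity
  have hΔ1 : Δ ≤ η / 2 := min_le_left _ _
  have hΔ2 : Δ ≤ h / 4 := min_le_right _ _
  have hU : M.SegUnique ρ := fun c₁ c₂ h hle => hU₀ c₁ c₂ h (hle.trans (min_le_left _ _))
  have hgap : M.K ^ 2 * (ρ + (L + Δ) - L) ≤ M.K ^ 2 * η := by gcongr; linarith
  have hs : M.Small L Λ (L + Δ) ρ := ⟨hρ0, hU, by linarith, by linarith, by linarith, by linarith, hL0⟩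
  obtain ⟨n, hn⟩ := exists_nat_gt (C * 6 / Δ)
  have hn0 : (0 : ℝ) < n := lt_of_le_of_lt (by positivity) hn
  have hn0' : 0 < n := by exact_mod_cast hn0
  have hq0' : 0 < q := by exact_mod_cast hq0
  have hm0 : 0 < n * q := by positivity
  obtain ⟨m, hw⟩ := exists_wind_limit (n := n) (N := 2 * (n * q)) H hk hp hs hn0' (by positivity)
    (γ := sweep c (lat j) h (n * q)) (fun i => by
      have := continuous_clamp 0 1
      unfold sweep
      fun_prop)
    (sweep_isPoly hc1 hh0.le hm0 hqL rfl hcp hhρ) (fun s => by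
      refine (sweep_plen_le hc1 hh0.le hm0 j s).trans_lt ?_
      rw [div_lt_iff₀ hΔ0] at hn
      have : C * (2 * (1 + 2 * h)) ≤ C * 6 := by gcongr; linarith
      push_cast
      rw [show 2 * ((n : ℝ) * q) * h = n * (2 * q * h) by ring, hqL]
      linarith) (by
      have : (n : ℝ) * L / (2 * (n * q) : ℕ) / 4 = h / 4 := by
        push_cast
        rw [hh]; field_simp
      rw [this]; linarith) (by
      have : M.K ^ 2 * ρ ≤ M.K ^ 2 * (η / 2) := by gcongr
      linarith) 0 (1 + n * q * h)
  have hr : ∀ i : ℤ, |((i % (2 * (n * q) : ℕ) : ℤ) : ℝ) - (n * q : ℕ)| ≤ n * q := fun i => by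
    have h0 : (0 : ℤ) < (2 * (n * q) : ℕ) := by exact_mod_cast (by positivity : 0 < 2 * (n * q))
    have h1 : (0 : ℝ) ≤ (i % (2 * (n * q) : ℕ) : ℤ) := by exact_mod_cast Int.emod_nonneg i h0.ne'
    have h2 : ((i % (2 * (n * q) : ℕ) : ℤ) : ℝ) ≤ (2 * (n * q) : ℕ) := by
      exact_mod_cast (Int.emod_lt_of_pos i h0).le
    push_cast at h1 h2 ⊢
    rw [abs_le]; constructor <;> linarith
  have e0 : sweep c (lat j) h (n * q) 0 = fun i : ℤ => c (i * h) + lat 0 := by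
    funext i
    rw [sweep, clamp, max_eq_left, zero_smul, lat_zero]
    refine (min_le_right _ _).trans ?_
    have := abs_nonneg (((i % (2 * (n * q) : ℕ) : ℤ) : ℝ) - (n * q : ℕ))
    nlinarith
  have e1 : sweep c (lat j) h (n * q) (1 + n * q * h) = fun i : ℤ => c (i * h) + lat j := by
    funext i
    have := hr i
    rw [sweep, clamp, min_eq_left, max_eq_right zero_le_one, one_smul]
    nlinarith
  rw [e0, e1, iterate_step_line hU hcs hh0.le hhρ', iterate_step_line hU hcs hh0.le hhρ'] at hw
  have hpp : ∀ v : Pl, pline (fun i : ℤ => c ((i + m / 2) * h) + v) (2 * (n * q)) (2 * (n * q) : ℕ) =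
      pline (fun i : ℤ => c ((i + m / 2) * h) + v) (2 * (n * q)) 0 + lat ((n : ℤ) • k) := fun v => by
    rw [pline_of_ge _ _ le_rfl, pline_zero]
    have : ((((2 * (n * q) : ℕ) : ℤ) : ℝ) + m / 2) * h = ((0 : ℤ) + m / 2) * h + (n : ℤ) * L := by
      rw [← hqL]; push_cast; ring
    change c _ + v = c _ + v + _
    rw [this, translate_iterate hcp, add_right_comm]
  have hN0 : 0 < 2 * (n * q) := by positivity
  rw [wind_of_gt hk (continuous_pline _ _) (hpp _) (pline_im_mem hN0 (convex_Iio _) fun i => by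
      rw [lat_zero, add_zero]; exact hbelow _),
    wind_of_lt hk (continuous_pline _ _) (hpp _) (pline_im_mem hN0 (convex_Ioi _) fun i => habove _)] at hw
  have : (n : ℂ) = 0 := by simpa [Real.pi_ne_zero] using hw
  exact hn0'.ne' (by exact_mod_cast this)

end TorusMetric

/-- The integral of a function over the unit square. -/
def avg (f : Pl → ℝ) : ℝ := ∫ y in (0 : ℝ)..1, ∫ x in (0 : ℝ)..1, f (x, y)

section Avg
variable {f f' : Pl → ℝ}

lemma continuous_avg_inner (hf : Continuous f) : Continuous fun y => ∫ x in (0 : ℝ)..1, f (x, y) :=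
  intervalIntegral.continuous_parametric_intervalIntegral_of_continuous' (by fun_prop) 0 1

lemma avg_add (hf : Continuous f) (hf' : Continuous f') : avg (fun x => f x + f' x) = avg f + avg f' := by
  unfold avg
  rw [← intervalIntegral.integral_add ((continuous_avg_inner hf).intervalIntegrable 0 1)
    ((continuous_avg_inner hf').intervalIntegrable 0 1)]
  congr 1
  funext y
  exact intervalIntegral.integral_add (Continuous.intervalIntegrable (by fun_prop) 0 1)
    (Continuous.intervalIntegrable (by fun_prop) 0 1)

lemma avg_const_mul (r : ℝ) : avg (fun x => r * f x) = r * avg f := by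
  simp [avg]

lemma avg_const (r : ℝ) : avg (fun _ => r) = r := by simp [avg]

lemma avg_sub (hf : Continuous f) (hf' : Continuous f') : avg (fun x => f x - f' x) = avg f - avg f' := by
  have h := avg_add hf (f' := fun x => (-1) * f' x) (by fun_prop)
  rw [avg_const_mul] at h
  simpa only [sub_eq_add_neg, neg_one_mul] using h

lemma avg_mono (hf : Continuous f) (hf' : Continuous f') (h : ∀ x, f x ≤ f' x) : avg f ≤ avg f' :=
  intervalIntegral.integral_mono zero_le_one ((continuous_avg_inner hf).intervalIntegrable 0 1)
    ((continuous_avg_inner hf').intervalIntegrable 0 1) fun y =>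
    intervalIntegral.integral_mono zero_le_one (Continuous.intervalIntegrable (by fun_prop) 0 1)
      (Continuous.intervalIntegrable (by fun_prop) 0 1) fun x => h (x, y)

lemma avg_sum {ι : Type*} (s : Finset ι) {F : ι → Pl → ℝ} (hF : ∀ i, Continuous (F i)) :
    avg (fun x => ∑ i ∈ s, F i x) = ∑ i ∈ s, avg (F i) := by
  classical
  induction s using Finset.induction_on with
  | empty => simp [avg]
  | insert a s ha ih =>
    simp only [Finset.sum_insert ha]
    rw [avg_add (hF a) (continuous_finsetSum _ fun i _ => hF i), ih]

lemma avg_translate (hp : ∀ x (k : ℤ × ℤ), f (x + lat k) = f x) (v : Pl) :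
    avg (fun x => f (x + v)) = avg f := by
  have h1 : ∀ y, (∫ x in (0 : ℝ)..1, f (x + v.1, y)) = ∫ x in (0 : ℝ)..1, f (x, y) := fun y => by
    have hper : Function.Periodic (fun x => f (x, y)) 1 := fun x => by
      have := hp (x, y) (1, 0)
      simpa [lat] using this
    rw [intervalIntegral.integral_comp_add_right (fun x => f (x, y)) v.1, zero_add, add_comm (1 : ℝ),
      hper.intervalIntegral_add_eq v.1 0, zero_add]
  have hper : Function.Periodic (fun y => ∫ x in (0 : ℝ)..1, f (x, y)) 1 := fun y => by
    refine intervalIntegral.integral_congr fun x _ => ?_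
    have := hp (x, y) (0, 1)
    simpa [lat] using this
  calc avg (fun x => f (x + v)) = ∫ y in (0 : ℝ)..1, ∫ x in (0 : ℝ)..1, f (x + v.1, y + v.2) := rfl
    _ = ∫ y in (0 : ℝ)..1, ∫ x in (0 : ℝ)..1, f (x, y + v.2) := by simp only [h1]
    _ = avg f := by
      rw [intervalIntegral.integral_comp_add_right (fun y => ∫ x in (0 : ℝ)..1, f (x, y)) v.2,
        zero_add, add_comm (1 : ℝ), hper.intervalIntegral_add_eq v.2 0, zero_add]
      rfl

lemma eq_zero_of_avg (hf : Continuous f) (hp : ∀ x (k : ℤ × ℤ), f (x + lat k) = f x)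
    (h0 : ∀ x, 0 ≤ f x) (ha : avg f ≤ 0) (x : Pl) : f x = 0 := by
  by_contra hx
  obtain ⟨k, hk⟩ := exists_lat_near x
  set z := x - lat k with hz
  have hz0 : 0 < f z := by
    rw [← hp z k, hz, sub_add_cancel]
    exact lt_of_le_of_ne (h0 x) (Ne.symm hx)
  refine absurd ha (not_le.2 ?_)
  refine intervalIntegral.integral_pos zero_lt_one (continuous_avg_inner hf).continuousOn
    (fun y _ => intervalIntegral.integral_nonneg zero_le_one fun x _ => h0 _)
    ⟨z.2, ⟨hk.1.2, hk.2.2⟩, ?_⟩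
  exact intervalIntegral.integral_pos zero_lt_one (Continuous.continuousOn (by fun_prop))
    (fun y _ => h0 _) ⟨z.1, ⟨hk.1.1, hk.2.1⟩, hz0⟩

lemma avg_pos (hf : Continuous f) (hp : ∀ x (k : ℤ × ℤ), f (x + lat k) = f x)
    (h0 : ∀ x, 0 < f x) : 0 < avg f := by
  by_contra! h
  exact (h0 0).ne' (eq_zero_of_avg hf hp (fun x => (h0 x).le) h 0)

lemma avg_tendsto (hf : Continuous f) {F : ℕ → Pl → ℝ} (hF : ∀ n, Continuous (F n)) {e : ℕ → ℝ}
    (he : Tendsto e atTop (𝓝 0)) (h : ∀ n x, |F n x - f x| ≤ e n) :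
    Tendsto (fun n => avg (F n)) atTop (𝓝 (avg f)) := by
  refine tendsto_iff_dist_tendsto_zero.2 (squeeze_zero (fun _ => _root_.dist_nonneg) (fun n => ?_) he)
  rw [Real.dist_eq, ← avg_sub (hF n) hf, abs_le]
  have h1 := avg_mono (f := fun _ => -e n) (f' := fun x => F n x - f x) continuous_const
    ((hF n).sub hf) fun x => (abs_le.1 (h n x)).1
  have h2 := avg_mono (f := fun x => F n x - f x) (f' := fun _ => e n)
    ((hF n).sub hf) continuous_const fun x => (abs_le.1 (h n x)).2
  rw [avg_const] at h1 h2
  exact ⟨h1, h2⟩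

/-- Summation by parts for central differences of periodic functions. -/
lemma avg_diff_mul (hf : Continuous f) (hf' : Continuous f')
    (hp : ∀ x (k : ℤ × ℤ), f (x + lat k) = f x) (hp' : ∀ x (k : ℤ × ℤ), f' (x + lat k) = f' x) (v w : Pl) :
    avg (fun x => (f (x + v) - f (x - v)) * (f' (x + w) - f' (x - w))) =
      avg (fun x => (f (x + w) - f (x - w)) * (f' (x + v) - f' (x - v))) := by
  have key : ∀ p q : Pl, avg (fun x => f (x + p) * f' (x + q)) = avg (fun x => f (x - q) * f' (x - p)) := by
    intro p q
    rw [← avg_translate (f := fun x => f (x + p) * f' (x + q)) (v := -q - p) fun x k => by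
      rw [add_right_comm x (lat k) p, add_right_comm x (lat k) q, hp, hp']]
    congr 1
    funext x
    congr 2 <;> abel
  have exp : ∀ p q : Pl, avg (fun x => (f (x + p) - f (x - p)) * (f' (x + q) - f' (x - q))) =
      avg (fun x => f (x + p) * f' (x + q)) - avg (fun x => f (x + p) * f' (x + -q)) -
      avg (fun x => f (x + -p) * f' (x + q)) + avg (fun x => f (x + -p) * f' (x + -q)) := by
    intro p q
    rw [← avg_sub (by fun_prop) (by fun_prop), ← avg_sub (by fun_prop) (by fun_prop),
      ← avg_add (by fun_prop) (by fun_prop)]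
    congr 1
    funext x
    rw [← sub_eq_add_neg x p, ← sub_eq_add_neg x q]
    ring
  rw [exp, exp, key v w, key v (-w), key (-v) w, key (-v) (-w)]
  simp only [sub_neg_eq_add, ← sub_eq_add_neg]
  ring

end Avg

lemma eq_of_abs_sub_le_sq {a b C r : ℝ} (hr : 0 < r)
    (h : ∀ t, 0 < t → t ≤ r → |t * a - t * b| ≤ C * t ^ 2) : a = b := by
  refine eq_of_abs_sub_le_all fun ε hε => ?_
  set t := min r (ε / (|C| + 1)) with ht
  have hC := abs_nonneg C
  have ht0 : 0 < t := lt_min hr (by positivity)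
  have h1 := h t ht0 (min_le_left _ _)
  have h2 : t * (|C| + 1) ≤ ε := by
    rw [← le_div_iff₀ (by positivity)]; exact min_le_right _ _
  rw [← mul_sub, abs_mul, abs_of_pos ht0] at h1
  have h3 := le_abs_self C
  have : t * |a - b| ≤ t * (t * (|C| + 1)) := by nlinarith [mul_nonneg ht0.le ht0.le]
  exact (le_of_mul_le_mul_left this ht0).trans h2

namespace TorusMetric
variable (M : TorusMetric)

lemma g_add_left (x v v' w : Pl) : M.g x (v + v') w = M.g x v w + M.g x v' w := (M.linear x w).map_add v v'

lemma g_smul_left (x v w : Pl) (r : ℝ) : M.g x (r • v) w = r * M.g x v w := (M.linear x w).map_smul r v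

lemma g_add_right (x v w w' : Pl) : M.g x v (w + w') = M.g x v w + M.g x v w' := by
  rw [M.symm, g_add_left, M.symm, M.symm x w']

lemma g_smul_right (x v w : Pl) (r : ℝ) : M.g x v (r • w) = r * M.g x v w := by
  rw [M.symm, g_smul_left, M.symm]

lemma g_neg_left (x v w : Pl) : M.g x (-v) w = -M.g x v w := by
  rw [← neg_one_smul ℝ v, g_smul_left, neg_one_mul]

lemma g_neg_right (x v w : Pl) : M.g x v (-w) = -M.g x v w := by
  rw [M.symm, g_neg_left, M.symm]

lemma g_sub_left (x v v' w : Pl) : M.g x (v - v') w = M.g x v w - M.g x v' w := by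
  rw [sub_eq_add_neg, g_add_left, g_neg_left, sub_eq_add_neg]

/-- The linear form `g x v`. -/
def gL (x v : Pl) : Pl →L[ℝ] ℝ :=
  LinearMap.toContinuousLinearMap (IsLinearMap.mk' (fun w => M.g x v w)
    ⟨fun w w' => M.g_add_right x v w w', fun r w => M.g_smul_right x v w r⟩)

lemma gL_apply (x v w : Pl) : M.gL x v w = M.g x v w := rfl

/-- The components of the linear form `g x v`. -/
def cov (x v : Pl) : Pl := (M.g x v (1, 0), M.g x v (0, 1))

lemma crossDet_cov (x v w : Pl) : crossDet (M.cov x v) (M.cov x w) = M.dt x * crossDet v w := by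
  simp only [crossDet, cov, M.g_eq, dt]; ring

lemma eq_of_g_eq {x v w : Pl} (h : ∀ u, M.g x v u = M.g x w u) : v = w := by
  by_contra hne
  have := M.posdef x (v - w) (sub_ne_zero.2 hne)
  rw [g_sub_left, h, sub_self] at this
  exact lt_irrefl _ this

lemma eq_of_taylor {f : Pl → ℝ} {x v w : Pl} {C : ℝ}
    (hv : ∀ u, ‖u‖ ≤ 1 → |f u - M.g x v u| ≤ C * ‖u‖ ^ 2)
    (hw : ∀ u, ‖u‖ ≤ 1 → |f u - M.g x w u| ≤ C * ‖u‖ ^ 2) : v = w := by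
  refine M.eq_of_g_eq (x := x) fun u => ?_
  refine eq_of_abs_sub_le_sq (r := 1 / (‖u‖ + 1)) (C := 2 * C * ‖u‖ ^ 2) (by positivity)
    fun t ht ht1 => ?_
  have hu : ‖t • u‖ ≤ 1 := by
    rw [norm_smul, Real.norm_of_nonneg ht.le]
    rw [le_div_iff₀ (by positivity)] at ht1
    nlinarith [norm_nonneg u]
  have h1 := abs_le.1 (hv _ hu)
  have h2 := abs_le.1 (hw _ hu)
  rw [g_smul_right, norm_smul, Real.norm_of_nonneg ht.le, mul_pow] at h1 h2
  rw [abs_le]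
  constructor <;> nlinarith

lemma hasFDerivAt_of_taylor {B : Pl → ℝ} {x v : Pl} {C : ℝ}
    (h : ∀ u, ‖u‖ ≤ 1 → |B (x + u) - B x - M.g x v u| ≤ C * ‖u‖ ^ 2) :
    HasFDerivAt B (M.gL x v) x := by
  rw [hasFDerivAt_iff_isLittleO_nhds_zero]
  refine Asymptotics.IsBigO.trans_isLittleO (g := fun u : Pl => ‖u‖ ^ 2) ?_ ?_
  · refine Asymptotics.IsBigO.of_bound C ?_
    filter_upwards [Metric.ball_mem_nhds (0 : Pl) one_pos] with u hu
    rw [Real.norm_eq_abs, gL_apply, Real.norm_of_nonneg (by positivity)]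
    exact h u (by simpa using (mem_ball_zero_iff.1 hu).le)
  · have := Asymptotics.isLittleO_norm_pow_id (E' := Pl) one_lt_two
    exact this

/-- Functions with unit gradient that are uniformly approximated to second order by their
differentials and that are additively equivariant under translations. -/
structure IsBus (B : Pl → ℝ) (v : Pl → Pl) (h : Pl) : Prop where
  unit : ∀ x, M.g x (v x) (v x) = 1
  taylor : ∀ x u, ‖u‖ ≤ 1 → |B (x + u) - B x - M.g x (v x) u| ≤ M.T * ‖u‖ ^ 2
  shift : ∀ x j, B (x + lat j) = B x + ip h (lat j)

variable {M} {B B' : Pl → ℝ} {v v' : Pl → Pl} {h h' : Pl}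

namespace IsBus

lemma neg (hB : M.IsBus B v h) : M.IsBus (fun x => -B x) (fun x => -v x) (-h) where
  unit x := by rw [g_neg_left, g_neg_right, neg_neg, hB.unit]
  taylor x u hu := by
    rw [g_neg_left, ← abs_neg]
    convert hB.taylor x u hu using 2
    ring
  shift x j := by
    rw [hB.shift]
    simp only [ip, Prod.fst_neg, Prod.snd_neg]
    ring

lemma hasFDerivAt (hB : M.IsBus B v h) (x : Pl) : HasFDerivAt B (M.gL x (v x)) x :=
  M.hasFDerivAt_of_taylor (hB.taylor x)

lemma continuous (hB : M.IsBus B v h) : Continuous B :=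
  continuous_iff_continuousAt.2 fun x => (hB.hasFDerivAt x).continuousAt

lemma nrm_eq (hB : M.IsBus B v h) (x : Pl) : M.nrm x (v x) = 1 := by
  rw [nrm, hB.unit, Real.sqrt_one]

lemma abs_g_le (hB : M.IsBus B v h) (x w : Pl) : |M.g x (v x) w| ≤ M.K * ‖w‖ := by
  refine (M.g_le_nrm x (v x) w).trans ?_
  rw [hB.nrm_eq, one_mul]
  exact M.nrm_le_norm x w

lemma v_add_lat (hB : M.IsBus B v h) (x : Pl) (k : ℤ × ℤ) : v (x + lat k) = v x := by
  refine M.eq_of_taylor (f := fun u => B (x + u) - B x) (x := x) (C := M.T) (fun u hu => ?_)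
    (hB.taylor x)
  have := hB.taylor (x + lat k) u hu
  rwa [add_right_comm, hB.shift, hB.shift, M.periodic, add_sub_add_right_eq_sub] at this

lemma abs_g_sub_le (hB : M.IsBus B v h) {x u : Pl} (hu : ‖u‖ ≤ 1 / 2) (w : Pl) :
    |M.g (x + u) (v (x + u)) w - M.g x (v x) w| ≤ 6 * M.T * ‖u‖ * ‖w‖ := by
  rcases eq_or_ne u 0 with rfl | hu0
  · simp
  rcases eq_or_ne w 0 with rfl | hw0
  · have : ∀ y z, M.g y z 0 = 0 := fun y z => by simpa using M.g_smul_right y z 0 0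
    simp [this]
  have hu1 : 0 < ‖u‖ := norm_pos_iff.2 hu0
  have hw1 : 0 < ‖w‖ := norm_pos_iff.2 hw0
  set r := ‖u‖ / ‖w‖ with hr
  have hr0 : 0 < r := by positivity
  have hn : ‖r • w‖ = ‖u‖ := by
    rw [norm_smul, Real.norm_of_nonneg hr0.le, hr]; field_simp
  have h1 := abs_le.1 (hB.taylor x (u + r • w) ((norm_add_le _ _).trans (by rw [hn]; linarith)))
  have h2 := abs_le.1 (hB.taylor x u (by linarith))
  have h3 := abs_le.1 (hB.taylor (x + u) (r • w) (by rw [hn]; linarith))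
  have h4 : ‖u + r • w‖ ^ 2 ≤ (2 * ‖u‖) ^ 2 :=
    pow_le_pow_left₀ (norm_nonneg _) ((norm_add_le _ _).trans (by rw [hn]; linarith)) 2
  rw [g_add_right, ← add_assoc] at h1
  rw [hn] at h3
  rw [g_smul_right] at h1 h3
  have hT := M.T_pos
  have h5 : |r * (M.g (x + u) (v (x + u)) w - M.g x (v x) w)| ≤ 6 * M.T * ‖u‖ ^ 2 := by
    rw [abs_le]
    constructor <;> nlinarith
  rw [abs_mul, abs_of_pos hr0] at h5
  refine le_of_mul_le_mul_left (h5.trans_eq ?_) hr0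
  rw [hr]; field_simp

lemma continuous_g (hB : M.IsBus B v h) (w : Pl) : Continuous fun x => M.g x (v x) w := by
  refine continuous_iff_continuousAt.2 fun x => ?_
  refine tendsto_iff_dist_tendsto_zero.2 (squeeze_zero' (g := fun y => 6 * M.T * ‖y - x‖ * ‖w‖)
    (Eventually.of_forall fun _ => _root_.dist_nonneg) ?_ ?_)
  · filter_upwards [Metric.ball_mem_nhds x (by norm_num : (0 : ℝ) < 1 / 2)] with y hy
    have := hB.abs_g_sub_le (x := x) (u := y - x) (by
      rw [← dist_eq_norm]; exact (Metric.mem_ball.1 hy).le) w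
    rwa [add_sub_cancel] at this
  · have : Continuous fun y => 6 * M.T * ‖y - x‖ * ‖w‖ := by fun_prop
    simpa using this.tendsto x

lemma continuous_wedge (hB : M.IsBus B v h) (hB' : M.IsBus B' v' h') :
    Continuous fun x => M.dt x * crossDet (v x) (v' x) := by
  have : (fun x => M.dt x * crossDet (v x) (v' x)) = fun x => M.g x (v x) (1, 0) * M.g x (v' x) (0, 1) -
      M.g x (v x) (0, 1) * M.g x (v' x) (1, 0) := funext fun x => (M.crossDet_cov x _ _).symm
  rw [this]
  exact ((hB.continuous_g _).mul (hB'.continuous_g _)).sub ((hB.continuous_g _).mul (hB'.continuous_g _))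

lemma wedge_add_lat (hB : M.IsBus B v h) (hB' : M.IsBus B' v' h') (x : Pl) (k : ℤ × ℤ) :
    M.dt (x + lat k) * crossDet (v (x + lat k)) (v' (x + lat k)) = M.dt x * crossDet (v x) (v' x) := by
  rw [hB.v_add_lat, hB'.v_add_lat, M.dt_per]

lemma wedge_sq_le (hB : M.IsBus B v h) (hB' : M.IsBus B' v' h') (x : Pl) :
    (M.dt x * crossDet (v x) (v' x)) ^ 2 ≤ M.dt x := by
  have h1 := M.g_lagrange x (v x) (v' x)
  rw [hB.unit, hB'.unit] at h1
  have h2 := M.dt_pos x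
  rw [crossDet]
  nlinarith [sq_nonneg (M.g x (v x) (v' x))]

lemma wedge_le (hB : M.IsBus B v h) (hB' : M.IsBus B' v' h') (x : Pl) :
    M.dt x * crossDet (v x) (v' x) ≤ √(M.dt x) :=
  Real.le_sqrt_of_sq_le (hB.wedge_sq_le hB' x)

lemma avg_cross_diff (hB : M.IsBus B v h) (hB' : M.IsBus B' v' h') (p q : Pl) :
    avg (fun x => (B (x + p) - B (x - p)) * (B' (x + q) - B' (x - q)) -
      (B (x + q) - B (x - q)) * (B' (x + p) - B' (x - p))) =
      4 * (ip h p * ip h' q - ip h q * ip h' p) := by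
  have hc := hB.continuous
  have hc' := hB'.continuous
  have hip : ∀ z : Pl, Continuous fun x => ip z x := fun z => by unfold ip; fun_prop
  set u := fun x => B x - ip h x with hu
  set u' := fun x => B' x - ip h' x with hu'
  have huc : Continuous u := hc.sub (hip h)
  have huc' : Continuous u' := hc'.sub (hip h')
  have hup : ∀ x (k : ℤ × ℤ), u (x + lat k) = u x := fun x k => by
    simp only [hu, hB.shift, ip_add]; ring
  have hup' : ∀ x (k : ℤ × ℤ), u' (x + lat k) = u' x := fun x k => by
    simp only [hu', hB'.shift, ip_add]; ring
  have hz : ∀ {f : Pl → ℝ}, Continuous f → (∀ x (k : ℤ × ℤ), f (x + lat k) = f x) → ∀ w : Pl,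
      avg (fun x => f (x + w) - f (x - w)) = 0 := fun {f} hf hp w => by
    rw [avg_sub (by fun_prop) (by fun_prop), avg_translate hp]
    simp only [sub_eq_add_neg]
    rw [avg_translate hp, add_neg_cancel]
  have hd : ∀ x w : Pl, B (x + w) - B (x - w) = (u (x + w) - u (x - w)) + 2 * ip h w := fun x w => by
    simp only [hu, ip, Prod.fst_add, Prod.snd_add, Prod.fst_sub, Prod.snd_sub]; ring
  have hd' : ∀ x w : Pl, B' (x + w) - B' (x - w) = (u' (x + w) - u' (x - w)) + 2 * ip h' w := fun x w => by
    simp only [hu', ip, Prod.fst_add, Prod.snd_add, Prod.fst_sub, Prod.snd_sub]; ring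
  clear_value u u'
  have he : (fun x => (B (x + p) - B (x - p)) * (B' (x + q) - B' (x - q)) -
      (B (x + q) - B (x - q)) * (B' (x + p) - B' (x - p))) = fun x =>
      (((u (x + p) - u (x - p)) * (u' (x + q) - u' (x - q)) -
        (u (x + q) - u (x - q)) * (u' (x + p) - u' (x - p))) +
      (2 * ip h' q * (u (x + p) - u (x - p)) + 2 * ip h p * (u' (x + q) - u' (x - q)))) -
      ((2 * ip h' p * (u (x + q) - u (x - q)) + 2 * ip h q * (u' (x + p) - u' (x - p))) -
      4 * (ip h p * ip h' q - ip h q * ip h' p)) := by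
    funext x
    rw [hd, hd, hd', hd']; ring
  rw [he, avg_sub (by fun_prop) (by fun_prop), avg_add (by fun_prop) (by fun_prop),
    avg_sub (by fun_prop) (by fun_prop), avg_add (by fun_prop) (by fun_prop),
    avg_sub (by fun_prop) (by fun_prop), avg_add (by fun_prop) (by fun_prop), avg_const,
    avg_const_mul, avg_const_mul, avg_const_mul, avg_const_mul, hz huc hup, hz huc' hup', hz huc hup,
    hz huc' hup', avg_diff_mul huc huc' hup hup' p q]
  ring

lemma abs_diff_le (hB : M.IsBus B v h) {w : Pl} {δ : ℝ} (hδ : 0 < δ) (hδ1 : δ ≤ 1) (hw : ‖w‖ ≤ 1) (x : Pl) :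
    |(B (x + δ • w) - B (x - δ • w)) / (2 * δ) - M.g x (v x) w| ≤ M.T * δ := by
  have hn : ‖δ • w‖ ≤ δ := by
    rw [norm_smul, Real.norm_of_nonneg hδ.le]; nlinarith
  have hT := M.T_pos
  have hs : M.T * ‖δ • w‖ ^ 2 ≤ M.T * δ ^ 2 := by gcongr
  have h1 := abs_le.1 (hB.taylor x (δ • w) (hn.trans hδ1))
  have h2 := abs_le.1 (hB.taylor x (-(δ • w)) (by rw [norm_neg]; exact hn.trans hδ1))
  rw [norm_neg, g_neg_right, ← sub_eq_add_neg x] at h2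
  rw [g_smul_right] at h1 h2
  rw [div_sub' (by positivity), abs_div, abs_of_pos (a := 2 * δ) (by positivity),
    div_le_iff₀ (by positivity), abs_le]
  constructor <;> nlinarith

theorem avg_wedge (hB : M.IsBus B v h) (hB' : M.IsBus B' v' h') :
    avg (fun x => M.dt x * crossDet (v x) (v' x)) = crossDet h h' := by
  have hT := M.T_pos
  have hK := M.K_pos
  have hc := hB.continuous
  have hc' := hB'.continuous
  set δ : ℕ → ℝ := fun n => 1 / ((n : ℝ) + 1) with hδ
  have hδ0 : ∀ n, 0 < δ n := fun n => by simp only [hδ]; positivity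
  have hδ1 : ∀ n, δ n ≤ 1 := fun n => by
    simp only [hδ]; rw [div_le_one (by positivity)]; linarith [Nat.cast_nonneg (α := ℝ) n]
  have hlim : Tendsto δ atTop (𝓝 0) := tendsto_one_div_add_atTop_nhds_zero_nat
  set D : (Pl → ℝ) → ℕ → Pl → Pl → ℝ := fun b n w x =>
    (b (x + δ n • w) - b (x - δ n • w)) / (2 * δ n) with hD
  have e1 : ‖((1, 0) : Pl)‖ ≤ 1 := by simp [Prod.norm_def]
  have e2 : ‖((0, 1) : Pl)‖ ≤ 1 := by simp [Prod.norm_def]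
  have hav : ∀ n, avg (fun x => D B n (1, 0) x * D B' n (0, 1) x - D B n (0, 1) x * D B' n (1, 0) x) =
      crossDet h h' := fun n => by
    have h1 := hB.avg_cross_diff hB' (δ n • (1, 0)) (δ n • (0, 1))
    have h2 : (fun x => D B n (1, 0) x * D B' n (0, 1) x - D B n (0, 1) x * D B' n (1, 0) x) = fun x =>
        (1 / (4 * δ n ^ 2)) * ((B (x + δ n • (1, 0)) - B (x - δ n • (1, 0))) *
          (B' (x + δ n • (0, 1)) - B' (x - δ n • (0, 1))) -
        (B (x + δ n • (0, 1)) - B (x - δ n • (0, 1))) *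
          (B' (x + δ n • (1, 0)) - B' (x - δ n • (1, 0)))) := by
      funext x
      simp only [hD]
      have := (hδ0 n).ne'
      field_simp
      ring
    rw [h2, avg_const_mul, h1]
    have := (hδ0 n).ne'
    simp only [ip, crossDet, Prod.smul_fst, Prod.smul_snd, smul_eq_mul]
    field_simp
    ring
  have ht := avg_tendsto (f := fun x => M.dt x * crossDet (v x) (v' x)) (hB.continuous_wedge hB')
    (F := fun n x => D B n (1, 0) x * D B' n (0, 1) x - D B n (0, 1) x * D B' n (1, 0) x)
    (fun n => by simp only [hD]; fun_prop) (e := fun n => (2 * (2 * M.K + M.T) * M.T) * δ n) (by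
      simpa using hlim.const_mul (2 * (2 * M.K + M.T) * M.T)) fun n x => by
    have a1 := hB.abs_diff_le (hδ0 n) (hδ1 n) e1 x
    have a2 := hB.abs_diff_le (hδ0 n) (hδ1 n) e2 x
    have a3 := hB'.abs_diff_le (hδ0 n) (hδ1 n) e1 x
    have a4 := hB'.abs_diff_le (hδ0 n) (hδ1 n) e2 x
    have b1 := (hB.abs_g_le x (1, 0)).trans (mul_le_of_le_one_right hK.le e1)
    have b2 := (hB.abs_g_le x (0, 1)).trans (mul_le_of_le_one_right hK.le e2)
    have b3 := (hB'.abs_g_le x (1, 0)).trans (mul_le_of_le_one_right hK.le e1)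
    have b4 := (hB'.abs_g_le x (0, 1)).trans (mul_le_of_le_one_right hK.le e2)
    have key : ∀ {a b a' b' : ℝ}, |a - a'| ≤ M.T * δ n → |b - b'| ≤ M.T * δ n → |a'| ≤ M.K →
        |b'| ≤ M.K → |a * b - a' * b'| ≤ (2 * M.K + M.T) * M.T * δ n := fun {a b a' b'} ha hb ha' hb' => by
      have hTδ : M.T * δ n ≤ M.T := mul_le_of_le_one_right hT.le (hδ1 n)
      have h0 : 0 < M.T * δ n := mul_pos hT (hδ0 n)
      calc |a * b - a' * b'| = |(a - a') * (b - b') + (a - a') * b' + a' * (b - b')| := by ring_nf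
        _ ≤ |a - a'| * |b - b'| + |a - a'| * |b'| + |a'| * |b - b'| := by
          rw [← abs_mul, ← abs_mul, ← abs_mul]; exact abs_add_three _ _ _
        _ ≤ (M.T * δ n) * M.T + (M.T * δ n) * M.K + M.K * (M.T * δ n) := by
          gcongr
          exact hb.trans hTδ
        _ = _ := by ring
    rw [← crossDet_cov]
    simp only [crossDet, cov]
    calc _ = |(D B n (1, 0) x * D B' n (0, 1) x - M.g x (v x) (1, 0) * M.g x (v' x) (0, 1)) -
        (D B n (0, 1) x * D B' n (1, 0) x - M.g x (v x) (0, 1) * M.g x (v' x) (1, 0))| := by ring_nf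
      _ ≤ _ := abs_sub _ _
      _ ≤ (2 * M.K + M.T) * M.T * δ n + (2 * M.K + M.T) * M.T * δ n :=
        add_le_add (key a1 a4 b1 b4) (key a2 a3 b2 b3)
      _ = _ := by ring
  simp only [hav] at ht
  exact tendsto_nhds_unique ht tendsto_const_nhds

end IsBus
end TorusMetric

namespace TorusMetric
variable (M : TorusMetric)

/-- The displacement of the translation `τ_k` at the origin. -/
def nm (k : ℤ × ℤ) : ℝ := M.dist 0 (lat k)

/-- A minimal geodesic that is translated by `τ_k` by the length `M.nm k`. -/
structure IsLine (k : ℤ × ℤ) (c : ℝ → Pl) : Prop where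
  seg : M.IsSeg c univ
  per : ∀ t, c (t + M.nm k) = c t + lat k

variable {M} {k : ℤ × ℤ} {c : ℝ → Pl}

lemma IsLine.add_lat (hc : M.IsLine k c) (j : ℤ × ℤ) : M.IsLine k fun t => c t + lat j where
  seg s hs t ht := by rw [M.dist_translate]; exact hc.seg s hs t ht
  per t := by rw [hc.per, add_right_comm]

lemma IsSeg.comp_neg (hc : M.IsSeg c univ) : M.IsSeg (fun t => c (-t)) univ := fun s _ t _ => by
  rw [hc _ (mem_univ _) _ (mem_univ _), neg_sub_neg, abs_sub_comm]

lemma deriv_add_lat (c : ℝ → Pl) (j : ℤ × ℤ) (t : ℝ) : deriv (fun s => c s + lat j) t = deriv c t :=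
  deriv_add_const ..

lemma dist_cone_le (hc : M.IsSeg c univ) {u : Pl} (hu : ‖u‖ ≤ 1) :
    M.dist (c 0 + u) (c 1) ≤ 1 - M.g (c 0) (deriv c 0) u + M.T * ‖u‖ ^ 2 := by
  have hl := hc.isLoc
  have hc1 : ContDiff ℝ 1 c := hl.contDiff.of_le (by exact_mod_cast le_top)
  have hcc := hc1.continuous
  have hcd : Continuous (deriv c) := hc1.continuous_deriv le_rfl
  have hφd : ∀ t, HasDerivAt (fun t : ℝ => (1 - t) • u) (-u) t := fun t => by
    simpa using ((hasDerivAt_id t).const_sub 1).smul_const u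
  have hφ : ContDiff ℝ 1 fun t : ℝ => (1 - t) • u := (contDiff_const.sub contDiff_id).smul contDiff_const
  have hv := M.dist_variation_le hc1 hφ zero_le_one hu (fun t _ => hl.unit_speed t) (fun t ht => by
      rw [norm_smul, Real.norm_of_nonneg (by linarith [ht.2])]
      nlinarith [ht.1, norm_nonneg u]) (fun t _ => by rw [(hφd t).deriv, norm_neg])
  have hF : ∀ t, HasDerivAt (fun t => (1 - t) * M.g (c t) (deriv c t) u)
      ((-1) * M.g (c t) (deriv c t) u + (1 - t) * (M.dg (c t) u (deriv c t) / 2)) t := fun t => by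
    have h1 := (hc.mono (subset_univ (Icc (t - 1) (t + 1)))).euler_lagrange (t := t)
      ⟨by linarith, by linarith⟩ u
    exact ((hasDerivAt_id t).const_sub 1).mul h1
  have hint : (∫ t in (0 : ℝ)..1, (M.dg (c t) ((1 - t) • u) (deriv c t) / 2 +
      M.g (c t) (deriv c t) (deriv (fun t : ℝ => (1 - t) • u) t))) = -M.g (c 0) (deriv c 0) u := by
    have h2 : ∀ t, M.dg (c t) ((1 - t) • u) (deriv c t) / 2 +
        M.g (c t) (deriv c t) (deriv (fun t : ℝ => (1 - t) • u) t) =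
        (-1) * M.g (c t) (deriv c t) u + (1 - t) * (M.dg (c t) u (deriv c t) / 2) := fun t => by
      rw [(hφd t).deriv, g_neg_right]
      simp only [dg, map_smul, smul_eq_mul]
      ring
    simp only [h2]
    rw [intervalIntegral.integral_eq_sub_of_hasDerivAt (fun t _ => hF t)]
    · ring
    · refine Continuous.intervalIntegrable ?_ _ _
      have h3 := M.continuous_g hcc hcd (continuous_const (y := u))
      have h4 := M.continuous_dg hcc (continuous_const (y := u)) hcd
      fun_prop
  rw [hint] at hv
  simp only [sub_zero, sub_self, one_smul, zero_smul, add_zero, mul_one] at hv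
  linarith

section Displacement
variable (hM : ∀ k x, M.dist x (x + lat k) = M.nm k)
include hM

lemma nm_pos (hk : k ≠ 0) : 0 < M.nm k := by
  rw [← hM k 0]; exact dist_lat_pos M hk 0

lemma exists_isLine (hk : k ≠ 0) (x : Pl) : ∃ c, M.IsLine k c ∧ c 0 = x := by
  obtain ⟨c, hc, hp, h0⟩ := exists_loop_dist M hk x
  rw [hM] at hp
  exact ⟨c, ⟨isSeg_of_period hk (fun x => (hM k x).ge) (nm_pos hM hk) hc hp, hp⟩, h0⟩

/-- The Busemann function of the translation `τ_k`. -/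
lemma exists_busemann (hk : k ≠ 0) : ∃ B : Pl → ℝ, (∀ x y, B x - B y ≤ M.dist x y) ∧
    ∀ x, B (x + lat k) = B x + M.nm k := by
  set b : ℕ → Pl → ℝ := fun n x => n * M.nm k - M.dist x (lat (n • k)) with hb
  have hmono : ∀ x, Monotone fun n => b n x := fun x => monotone_nat_of_le_succ fun n => by
    have h1 := M.dist_triangle x (lat (n • k)) (lat (n • k) + lat k)
    rw [hM] at h1
    simp only [hb, succ_nsmul, lat_add]
    push_cast
    linarith
  have hbdd : ∀ x, BddAbove (range fun n => b n x) := fun x => ⟨M.dist 0 x, by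
    rintro _ ⟨n, rfl⟩
    have h1 := le_dist_nsmul hk (fun x => (hM k x).ge) n 0
    have h2 := M.dist_triangle 0 x (0 + lat (n • k))
    rw [zero_add] at h1 h2
    simp only [hb]
    linarith⟩
  have hlim : ∀ x, Tendsto (fun n => b n x) atTop (𝓝 (⨆ n, b n x)) := fun x =>
    tendsto_atTop_ciSup (hmono x) (hbdd x)
  refine ⟨fun x => ⨆ n, b n x, fun x y => ?_, fun x => ?_⟩
  · refine le_of_tendsto ((hlim x).sub (hlim y)) (Eventually.of_forall fun n => ?_)
    have := M.dist_triangle y x (lat (n • k))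
    rw [M.dist_comm y x] at this
    simp only [hb]
    linarith
  · refine tendsto_nhds_unique ((tendsto_add_atTop_iff_nat 1).2 (hlim (x + lat k))) ?_
    refine ((hlim x).add_const (M.nm k)).congr fun n => ?_
    simp only [hb, succ_nsmul, lat_add]
    rw [M.dist_translate]
    push_cast
    ring

end Displacement

section Busemann
variable {B : Pl → ℝ}

lemma busemann_nsmul (hB : ∀ x, B (x + lat k) = B x + M.nm k) (n : ℕ) (x : Pl) :
    B (x + lat (n • k)) = B x + n * M.nm k := by
  induction n with
  | zero => simp [lat_zero]
  | succ n ih =>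
    rw [succ_nsmul, lat_add, ← add_assoc, hB, ih]
    push_cast; ring

lemma busemann_line (hN : 0 < M.nm k) (hB1 : ∀ x y, B x - B y ≤ M.dist x y)
    (hB : ∀ x, B (x + lat k) = B x + M.nm k) (hc : M.IsLine k c) {s t : ℝ} (hst : s ≤ t) :
    B (c t) = B (c s) + (t - s) := by
  obtain ⟨n, hn⟩ := exists_nat_ge ((t - s) / M.nm k)
  rw [div_le_iff₀ hN] at hn
  have h1 := translate_iterate hc.per n s
  have h2 := busemann_nsmul hB n (c s)
  rw [natCast_zsmul] at h1
  push_cast at h1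
  rw [← h1] at h2
  have h3 := hB1 (c (s + n * M.nm k)) (c t)
  have h4 := hB1 (c t) (c s)
  rw [hc.seg _ (mem_univ _) _ (mem_univ _)] at h3 h4
  rw [abs_of_nonneg (by linarith)] at h3 h4
  linarith

lemma busemann_taylor (hN : 0 < M.nm k) (hB1 : ∀ x y, B x - B y ≤ M.dist x y)
    (hB : ∀ x, B (x + lat k) = B x + M.nm k) (hc : M.IsLine k c) {u : Pl} (hu : ‖u‖ ≤ 1) :
    |B (c 0 + u) - B (c 0) - M.g (c 0) (deriv c 0) u| ≤ M.T * ‖u‖ ^ 2 := by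
  have h1 := busemann_line hN hB1 hB hc zero_le_one
  have h2 := busemann_line hN hB1 hB hc (by norm_num : (-1 : ℝ) ≤ 0)
  have h3 := dist_cone_le hc.seg hu
  have h4 := dist_cone_le hc.seg.comp_neg hu
  rw [deriv_comp_neg (f := c)] at h4
  simp only [neg_zero, g_neg_left] at h4
  have h5 := hB1 (c 1) (c 0 + u)
  have h6 := hB1 (c 0 + u) (c (-1))
  rw [M.dist_comm] at h5
  rw [abs_le]
  constructor <;> linarith

end Busemann

variable (M) in
/-- Busemann functions of a translation `τ_k`. -/
structure IsBusOf (k : ℤ × ℤ) (B : Pl → ℝ) (v : Pl → Pl) (h : Pl) : Prop extends M.IsBus B v h where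
  nm_eq : ip h (lat k) = M.nm k
  line : ∀ x, ∃ c, M.IsLine k c ∧ c 0 = x ∧ deriv c 0 = v x

lemma nm_neg (k : ℤ × ℤ) : M.nm (-k) = M.nm k := by
  have := M.dist_translate k 0 (lat (-k))
  rw [zero_add, lat_neg, neg_add_cancel, M.dist_comm] at this
  rw [nm, nm, this, lat_neg]

lemma IsBusOf.neg {B : Pl → ℝ} {v : Pl → Pl} {h : Pl} (hB : M.IsBusOf k B v h) :
    M.IsBusOf (-k) (fun x => -B x) (fun x => -v x) (-h) where
  toIsBus := hB.toIsBus.neg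
  nm_eq := by
    rw [nm_neg, ← hB.nm_eq, lat_neg]
    simp only [ip, Prod.fst_neg, Prod.snd_neg]
    ring
  line x := by
    obtain ⟨c, hc, h0, h1⟩ := hB.line x
    refine ⟨fun t => c (-t), ⟨hc.seg.comp_neg, fun t => ?_⟩, by simpa using h0, ?_⟩
    · have := hc.per (-(t + M.nm (-k)))
      rw [nm_neg, neg_add_rev, neg_add_cancel_comm] at this
      rw [this, nm_neg, neg_add_rev, lat_neg, add_neg_cancel_right]
    · rw [deriv_comp_neg (f := c), neg_zero, h1]

lemma exists_isBusOf (hM : ∀ k x, M.dist x (x + lat k) = M.nm k) (hk : k ≠ 0) :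
    ∃ B v h, M.IsBusOf k B v h := by
  have hN := nm_pos hM hk
  obtain ⟨B, hB1, hB⟩ := exists_busemann hM hk
  choose c hc hc0 using exists_isLine hM hk
  set v : Pl → Pl := fun x => deriv (c x) 0 with hv
  have ht : ∀ x u, ‖u‖ ≤ 1 → |B (x + u) - B x - M.g x (v x) u| ≤ M.T * ‖u‖ ^ 2 := fun x u hu => by
    have := busemann_taylor hN hB1 hB (hc x) hu
    rwa [hc0] at this
  have hper : ∀ x j, v (x + lat j) = v x := fun x j => by
    refine M.eq_of_taylor (f := fun u => B (x + lat j + u) - B (x + lat j)) (ht (x + lat j)) fun u hu => ?_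
    have := busemann_taylor hN hB1 hB ((hc x).add_lat j) hu
    rwa [hc0, deriv_add_lat] at this
  have hj : ∀ j x, B (x + lat j) - B x = B (0 + lat j) - B 0 := fun j x => by
    have hd : ∀ y, HasFDerivAt (fun y => B (y + lat j) - B y) (0 : Pl →L[ℝ] ℝ) y := fun y => by
      have h1 := (M.hasFDerivAt_of_taylor (ht (y + lat j))).comp y ((hasFDerivAt_id y).add_const (lat j))
      have h2 := h1.sub (M.hasFDerivAt_of_taylor (ht y))
      have e : M.gL (y + lat j) (v (y + lat j)) ∘SL ContinuousLinearMap.id ℝ Pl - M.gL y (v y) = 0 := by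
        refine ContinuousLinearMap.ext fun w => ?_
        simp [gL_apply, hper, M.periodic]
      rw [e] at h2
      exact h2
    exact is_const_of_fderiv_eq_zero (fun y => (hd y).differentiableAt) (fun y => (hd y).fderiv) x 0
  set H : ℤ × ℤ →+ ℝ := AddMonoidHom.mk' (fun j => B (0 + lat j) - B 0) (fun i j => by
    have := hj j (0 + lat i)
    rw [lat_add, ← add_assoc, ← this]; ring) with hH
  have hHj : ∀ j x, B (x + lat j) = B x + H j := fun j x => by
    have := hj j x
    rw [hH, AddMonoidHom.mk'_apply, ← this]; ring
  have hHl : ∀ j, H j = ip (H (1, 0), H (0, 1)) (lat j) := fun j => by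
    have h1 : j = j.1 • (1, 0) + j.2 • (0, 1) := by ext <;> simp
    conv_lhs => rw [h1]
    rw [map_add, map_zsmul, map_zsmul]
    simp [ip, lat, mul_comm]
  refine ⟨B, v, (H (1, 0), H (0, 1)), ⟨⟨fun x => ?_, ht, fun x j => by rw [← hHl, hHj]⟩, ?_,
    fun x => ⟨c x, hc x, hc0 x, rfl⟩⟩⟩
  · have := (hc x).seg.isLoc.unit_speed 0
    rwa [hc0] at this
  · have h1 := hB 0
    rw [hHj] at h1
    rw [← hHl]
    linarith

end TorusMetric

lemma crossDet_le_norm (v w : Pl) : |crossDet v w| ≤ 2 * ‖v‖ * ‖w‖ := by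
  have h : crossDet v w = ip (rot v) w := by simp only [crossDet, ip, rot]; ring
  rw [h, ← norm_rot v]
  exact abs_ip_le _ _

namespace TorusMetric
variable {M : TorusMetric} {k l : ℤ × ℤ}

lemma sub_le_dist_of_hasFDerivAt {B : Pl → ℝ} {v : Pl → Pl} (hB : ∀ x, HasFDerivAt B (M.gL x (v x)) x)
    (hv : ∀ x, M.nrm x (v x) ≤ 1) (x y : Pl) : B y - B x ≤ M.dist x y := by
  refine le_csInf (M.lengths_nonempty x y) ?_
  rintro _ ⟨c, hc, rfl, rfl, rfl⟩
  have hs : Continuous (M.spd c) := M.continuous_spd hc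
  have hd : ∀ t, HasDerivAt (fun t => M.length c 0 t - B (c t))
      (M.spd c t - M.g (c t) (v (c t)) (deriv c t)) t := fun t => by
    refine HasDerivAt.sub ?_ ((hB (c t)).comp_hasDerivAt t
      ((hc.differentiable one_ne_zero) t).hasDerivAt)
    exact intervalIntegral.integral_hasDerivAt_right (hs.intervalIntegrable _ _)
      (hs.stronglyMeasurableAtFilter _ _) hs.continuousAt
  have hmono : Monotone fun t => M.length c 0 t - B (c t) :=
    monotone_of_deriv_nonneg (fun t => (hd t).differentiableAt) fun t => by
      rw [(hd t).deriv]
      have h1 := le_of_abs_le (M.g_le_nrm (c t) (v (c t)) (deriv c t))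
      have h2 := mul_le_mul_of_nonneg_right (hv (c t)) (M.nrm_nonneg (c t) (deriv c t))
      have h3 : M.spd c t = M.nrm (c t) (deriv c t) := rfl
      linarith
  have := hmono zero_le_one
  simp only [M.length_eq, intervalIntegral.integral_same] at this ⊢
  linarith

lemma IsBus.sub_le_dist {B : Pl → ℝ} {v : Pl → Pl} {h : Pl} (hB : M.IsBus B v h) (x y : Pl) :
    B y - B x ≤ M.dist x y :=
  sub_le_dist_of_hasFDerivAt hB.hasFDerivAt (fun x => (hB.nrm_eq x).le) x y

lemma IsBus.ip_le {B : Pl → ℝ} {v : Pl → Pl} {h : Pl} (hB : M.IsBus B v h) (j : ℤ × ℤ) :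
    ip h (lat j) ≤ M.nm j := by
  have h1 := hB.sub_le_dist 0 (0 + lat j)
  rw [hB.shift, zero_add] at h1
  rw [nm]; linarith

lemma nm_le_norm (k : ℤ × ℤ) : M.nm k ≤ M.K * ‖lat k‖ := by
  have := M.dist_le_norm_sub 0 (lat k)
  rwa [zero_sub, norm_neg] at this

lemma norm_le_nm (k : ℤ × ℤ) : ‖lat k‖ ≤ M.K * M.nm k := by
  have := M.norm_sub_le_dist 0 (lat k)
  rwa [zero_sub, norm_neg] at this

/-- The average of the Riemannian area density. -/
def area (M : TorusMetric) : ℝ := avg fun x => √(M.dt x)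

variable {B B' : Pl → ℝ} {v v' : Pl → Pl} {h h' : Pl}

lemma continuous_sqrt_dt : Continuous fun x => √(M.dt x) :=
  (M.contDiff_dt (n := 0)).continuous.sqrt

lemma area_pos : 0 < M.area :=
  avg_pos continuous_sqrt_dt (fun x k => by rw [M.dt_per]) fun x => Real.sqrt_pos.2 (M.dt_pos x)

lemma IsBus.crossDet_le (hB : M.IsBus B v h) (hB' : M.IsBus B' v' h') : crossDet h h' ≤ M.area := by
  rw [← hB.avg_wedge hB', area]
  exact avg_mono (hB.continuous_wedge hB') continuous_sqrt_dt (hB.wedge_le hB')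

lemma IsBus.abs_crossDet_le (hB : M.IsBus B v h) (hB' : M.IsBus B' v' h') :
    |crossDet h h'| ≤ M.area := by
  rw [abs_le]
  have h1 := hB.neg.crossDet_le hB'
  have h2 : crossDet (-h) h' = -crossDet h h' := by
    simp only [crossDet, Prod.fst_neg, Prod.snd_neg]; ring
  exact ⟨by linarith, hB.crossDet_le hB'⟩

lemma crossDet_lat_mul (h h' : Pl) (k l : ℤ × ℤ) : crossDet h h' * crossDet (lat k) (lat l) =
    ip h (lat k) * ip h' (lat l) - ip h (lat l) * ip h' (lat k) := by
  simp only [crossDet, ip]; ring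

lemma ne_of_crossDet_ne (hM : ∀ k x, M.dist x (x + lat k) = M.nm k) (hl : l ≠ 0)
    (hB : M.IsBusOf k B v h) (hB' : M.IsBusOf l B' v' h')
    (hkl : crossDet (lat k) (lat l) ≠ 0) (x : Pl) : v x ≠ v' x := fun hv => by
  obtain ⟨c, hc, h0, hd⟩ := hB.line x
  obtain ⟨c', hc', h0', hd'⟩ := hB'.line x
  obtain rfl : c = c' := hc.seg.isLoc.unique hc'.seg.isLoc (h0.trans h0'.symm) (by rw [hd, hd', hv])
  have hN := nm_pos hM hl
  have hK := M.K_pos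
  set D := |crossDet (lat k) (lat l)| with hD
  have hD0 : 0 < D := abs_pos.2 hkl
  obtain ⟨n, hn⟩ := exists_nat_gt (2 * (M.K * M.nm l) * ‖lat l‖ / D)
  rw [div_lt_iff₀ hD0] at hn
  set m : ℤ := ⌊n * M.nm k / M.nm l⌋ with hm
  have hm1 : (m : ℝ) * M.nm l ≤ n * M.nm k := by
    rw [← le_div_iff₀ hN]; exact Int.floor_le _
  have hm2 : n * M.nm k < (m + 1 : ℝ) * M.nm l := by
    rw [← div_lt_iff₀ hN]; exact Int.lt_floor_add_one _
  have h1 := translate_iterate hc.per n 0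
  have h2 := translate_iterate hc'.per m 0
  rw [zero_add] at h1 h2
  have h3 := M.norm_sub_le_dist (c ((n : ℤ) * M.nm k)) (c (m * M.nm l))
  rw [hc.seg _ (mem_univ _) _ (mem_univ _), h1, h2, add_sub_add_left_eq_sub, Int.cast_natCast,
    abs_of_nonneg (by linarith)] at h3
  have h4 := crossDet_le_norm (lat ((n : ℤ) • k) - lat (m • l)) (lat l)
  have h5 : crossDet (lat ((n : ℤ) • k) - lat (m • l)) (lat l) = n * crossDet (lat k) (lat l) := by
    simp only [crossDet, lat, Prod.smul_fst, Prod.smul_snd, smul_eq_mul, Prod.fst_sub, Prod.snd_sub]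
    push_cast
    ring
  rw [h5, abs_mul, Nat.abs_cast] at h4
  have h6 : M.K * (n * M.nm k - m * M.nm l) ≤ M.K * M.nm l :=
    mul_le_mul_of_nonneg_left (by linarith) hK.le
  have h7 := mul_le_mul_of_nonneg_right (h3.trans h6) (norm_nonneg (lat l))
  linarith

lemma ne_zero_of_crossDet (hkl : crossDet (lat k) (lat l) ≠ 0) : k ≠ 0 ∧ l ≠ 0 := by
  constructor <;> rintro rfl <;> simp [crossDet, lat] at hkl

lemma crossDet_pos (hM : ∀ k x, M.dist x (x + lat k) = M.nm k)
    (hB : M.IsBusOf k B v h) (hB' : M.IsBusOf l B' v' h')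
    (hkl : 0 < crossDet (lat k) (lat l)) (x : Pl) : 0 < crossDet (v x) (v' x) := by
  obtain ⟨hk, hl⟩ := ne_zero_of_crossDet hkl.ne'
  have hne : ∀ y, M.dt y * crossDet (v y) (v' y) ≠ 0 := fun y h0 => by
    rcases mul_eq_zero.1 h0 with h1 | h1
    · exact (M.dt_pos y).ne' h1
    rcases eq_or_eq_neg_of_crossDet (hB.unit y) (hB'.unit y) h1 with h2 | h2
    · exact ne_of_crossDet_ne hM hl hB hB' hkl.ne' y h2
    · refine ne_of_crossDet_ne hM (neg_ne_zero.2 hl) hB hB'.neg ?_ y h2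
      have : crossDet (lat k) (lat (-l)) = -crossDet (lat k) (lat l) := by
        rw [lat_neg]; simp only [crossDet, Prod.fst_neg, Prod.snd_neg]; ring
      rw [this]
      exact neg_ne_zero.2 hkl.ne'
  have hc := hB.continuous_wedge hB'.toIsBus
  suffices 0 < M.dt x * crossDet (v x) (v' x) from pos_of_mul_pos_right this (M.dt_pos x).le
  by_contra! hx
  have hneg : ∀ y, 0 < -(M.dt y * crossDet (v y) (v' y)) := fun y => by
    by_contra! hy
    obtain ⟨z, -, hz⟩ := isPreconnected_univ.intermediate_value (mem_univ x) (mem_univ y)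
      hc.continuousOn ⟨hx, by linarith⟩
    exact hne z hz
  have h1 := avg_pos (f := fun y => -(M.dt y * crossDet (v y) (v' y))) hc.neg
    (fun y k => by rw [hB.wedge_add_lat hB'.toIsBus]) hneg
  have h2 : avg (fun y => -(M.dt y * crossDet (v y) (v' y))) = -crossDet h h' := by
    rw [← hB.avg_wedge hB'.toIsBus]
    have := avg_const_mul (f := fun y => M.dt y * crossDet (v y) (v' y)) (-1)
    simpa only [neg_one_mul] using this
  rw [h2] at h1
  have h3 := crossDet_lat_mul h h' k l
  have h4 := hB.ip_le l
  have h5 := hB'.ip_le k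
  have h6 := hB.neg.toIsBus.ip_le l
  have h7 := hB'.neg.toIsBus.ip_le k
  have hneg : ∀ a b : Pl, ip (-a) b = -ip a b := fun a b => by
    simp only [ip, Prod.fst_neg, Prod.snd_neg]; ring
  rw [hneg] at h6 h7
  rw [hB.nm_eq, hB'.nm_eq] at h3
  have h8 : |ip h (lat l) * ip h' (lat k)| ≤ M.nm l * M.nm k := by
    rw [abs_mul]
    exact mul_le_mul (abs_le.2 ⟨by linarith, h4⟩) (abs_le.2 ⟨by linarith, h5⟩) (abs_nonneg _)
      (nm_pos hM hl).le
  have h9 := le_of_abs_le h8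
  nlinarith

lemma one_le_norm_lat (hk : k ≠ 0) : 1 ≤ ‖lat k‖ := by
  have : k.1 ≠ 0 ∨ k.2 ≠ 0 := by
    by_contra! h0
    exact hk (Prod.ext h0.1 h0.2)
  rcases this with h3 | h3
  · refine le_trans ?_ (norm_fst_le (lat k))
    rw [Real.norm_eq_abs]
    change (1 : ℝ) ≤ |((k.1 : ℤ) : ℝ)|
    exact_mod_cast Int.one_le_abs h3
  · refine le_trans ?_ (norm_snd_le (lat k))
    rw [Real.norm_eq_abs]
    change (1 : ℝ) ≤ |((k.2 : ℤ) : ℝ)|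
    exact_mod_cast Int.one_le_abs h3

/-- Two consecutive directions of large size have almost additive displacements. -/
lemma saving_le (hM : ∀ k x, M.dist x (x + lat k) = M.nm k)
    (hB : M.IsBusOf k B v h) (hB' : M.IsBusOf l B' v' h')
    (hkl : |crossDet (lat k) (lat l)| = 1) (h1 : 0 ≤ k.1 * l.1) (h2 : 0 ≤ k.2 * l.2)
    (hk : M.K ^ 2 * (1 + M.area) < ‖lat k‖) : M.nm k + M.nm l - M.nm (k + l) ≤ M.area / M.nm k := by
  obtain ⟨hk0, hl0⟩ := ne_zero_of_crossDet (k := k) (l := l) fun h0 => by simp [h0] at hkl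
  have hA := area_pos (M := M)
  have ha := nm_pos hM hk0
  have hb := nm_pos hM hl0
  have hK := M.one_le_K
  set a := M.nm k
  set b := M.nm l
  set p := ip h (lat l) with hp
  set q := ip h' (lat k) with hq
  have hdet : a * b - p * q ≤ M.area := by
    have := crossDet_lat_mul h h' k l
    rw [hB.nm_eq, hB'.nm_eq] at this
    rw [← this]
    refine (le_abs_self _).trans ?_
    rw [abs_mul, hkl, mul_one]
    exact hB.abs_crossDet_le hB'.toIsBus
  have hpb : p ≤ b := hB.ip_le l
  have hqa : q ≤ a := hB'.ip_le k
  have hk1 : M.K * (1 + M.area) < a := by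
    have := norm_le_nm (M := M) k
    have h3 : M.K * (M.K * (1 + M.area)) < M.K * a := by
      calc _ = M.K ^ 2 * (1 + M.area) := by ring
        _ < _ := hk.trans_le this
    exact lt_of_mul_lt_mul_left h3 M.K_pos.le
  have hb1 : 1 ≤ M.K * b := (one_le_norm_lat hl0).trans (norm_le_nm (M := M) l)
  have hab : M.area < a * b := by nlinarith
  have hq0 : 0 < q := by
    have hbasis : ∀ w : ℤ × ℤ, ‖lat w‖ ≤ 1 → |ip h' (lat w)| ≤ M.K := fun w hw => by
      have h3 := (hB'.ip_le w).trans (nm_le_norm w)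
      have h4 := (hB'.ip_le (-w)).trans (nm_le_norm (-w))
      rw [lat_neg, norm_neg] at h4
      have h5 : ip h' (-lat w) = -ip h' (lat w) := by
        simp only [ip, Prod.fst_neg, Prod.snd_neg]; ring
      rw [h5] at h4
      have h6 : M.K * ‖lat w‖ ≤ M.K := by nlinarith [M.K_pos]
      exact abs_le.2 ⟨by linarith, by linarith⟩
    have hbq : ip h' (lat l) = b := hB'.nm_eq
    have key : ∀ s t e : ℝ, 0 ≤ s * t → ‖lat k‖ = |s| → t * q = s * b + e → |e| ≤ M.K → 0 < q := by
      intro s t e hst hs he heK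
      by_contra! hq0
      have h3 : s * (s * b + e) ≤ 0 := by
        rw [← he]; nlinarith
      have h4 : |s| * |e| ≤ |s| * M.K := mul_le_mul_of_nonneg_left heK (abs_nonneg s)
      have h5 : -(s * e) ≤ |s| * |e| := by rw [← abs_mul]; exact neg_le_abs _
      have h6 : s * s = |s| * |s| := (abs_mul_abs_self s).symm
      rw [← hs] at h4 h5 h6
      have h7 : M.K ^ 2 < ‖lat k‖ := by nlinarith [M.K_pos]
      have h8 : 0 < ‖lat k‖ := lt_trans (by positivity) h7
      have h9 : M.K * (s * s * b) ≤ M.K * (‖lat k‖ * M.K) := mul_le_mul_of_nonneg_left (by linarith) M.K_pos.le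
      have h10 : ‖lat k‖ * ‖lat k‖ ≤ M.K * (s * s * b) := by
        rw [h6]; nlinarith [mul_nonneg h8.le h8.le]
      nlinarith
    have hdt : |(k.1 * l.2 - k.2 * l.1 : ℝ)| = 1 := hkl
    rcases le_total |(k.2 : ℝ)| |(k.1 : ℝ)| with h3 | h3
    · refine key k.1 l.1 (-((k.1 * l.2 - k.2 * l.1 : ℝ) * ip h' (lat (0, 1)))) (by exact_mod_cast h1) (max_eq_left h3) ?_ ?_
      · rw [← hbq, hq]
        simp only [ip, lat]
        push_cast; ring
      · rw [abs_neg, abs_mul, hdt, one_mul]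
        exact hbasis _ (by simp [lat, Prod.norm_def])
    · refine key k.2 l.2 ((k.1 * l.2 - k.2 * l.1 : ℝ) * ip h' (lat (1, 0))) (by exact_mod_cast h2) (max_eq_right h3) ?_ ?_
      · rw [← hbq, hq]
        simp only [ip, lat]
        push_cast; ring
      · rw [abs_mul, hdt, one_mul]
        exact hbasis _ (by simp [lat, Prod.norm_def])
  have hp0 : 0 < p := by
    by_contra! h0
    nlinarith
  have h3 : a + p ≤ M.nm (k + l) := by
    have := hB.ip_le (k + l)
    rw [lat_add, ip_add, hB.nm_eq] at this
    exact this
  have h4 : b - p ≤ M.area / a := by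
    rw [le_div_iff₀ ha]; nlinarith
  linarith

/-- If the displacements of `k` and `l` are almost additive, the directions of the minimal axes
almost agree. -/
lemma corner_cut (hM : ∀ k x, M.dist x (x + lat k) = M.nm k)
    (hB : M.IsBusOf k B v h) (hB' : M.IsBusOf l B' v' h') {s : ℝ} (hs : 0 < s) (hk : s ≤ M.nm k)
    (hl : 1 ≤ M.nm l) (hsK : M.K * s ≤ 1) (hσ : M.nm k + M.nm l - M.nm (k + l) ≤ s ^ 2) (x : Pl) :
    M.g x (v x - v' x) (v x - v' x) ≤ 4 * (1 + 2 * M.T * M.K ^ 2 + 2 * M.K ^ 3) * s := by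
  have hK := M.K_pos
  have hT := M.T_pos
  obtain ⟨c, hc, h0, hd⟩ := hB.line x
  obtain ⟨c', hc', h0', hd'⟩ := hB'.line x
  set u := c (-s) - x with hu
  have hus : M.dist x (c (-s)) = s := by
    rw [← h0, hc.seg _ (mem_univ _) _ (mem_univ _), zero_sub, neg_neg, abs_of_pos hs]
  have hun : ‖u‖ ≤ M.K * s := by
    have := M.norm_sub_le_dist x (c (-s))
    rwa [hus, norm_sub_rev] at this
  have hxu : x + u = c (-s) := by rw [hu]; abel
  have hu1 : ‖u‖ ≤ 1 := hun.trans hsK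
  have hu2 : M.T * ‖u‖ ^ 2 ≤ M.T * M.K ^ 2 * s ^ 2 := by
    have := mul_le_mul_of_nonneg_left (pow_le_pow_left₀ (norm_nonneg u) hun 2) hT.le
    linarith [mul_pow M.K s 2]
  have h1 := hB.taylor x u hu1
  have h2 : B (x + u) = B x - s := by
    have hper : ∀ t, B (c (t + M.nm k)) = B (c t) + M.nm k := fun t => by
      rw [hc.per, hB.shift, hB.nm_eq]
    have e1 := hB.sub_le_dist (c (-s)) (c 0)
    have e2 := hB.sub_le_dist (c 0) (c (-s + M.nm k))
    rw [hc.seg _ (mem_univ _) _ (mem_univ _)] at e1 e2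
    rw [hper, zero_sub, abs_neg, abs_of_nonneg (by linarith)] at e2
    rw [sub_zero, abs_neg, abs_of_pos hs] at e1
    rw [hxu, ← h0]
    linarith
  have h3 : M.g x (v x) u ≤ -s + M.T * M.K ^ 2 * s ^ 2 := by
    have := neg_le_of_abs_le h1
    linarith
  have h4 : M.g x (v' x) u ≤ -s + s ^ 2 + M.T * M.K ^ 2 * s ^ 2 := by
    have e1 := dist_cone_le hc'.seg hu1
    rw [h0', hd', hxu] at e1
    have e2 := M.dist_triangle (c (-s)) (c' 1) (c' (M.nm l))
    rw [hc'.seg _ (mem_univ _) _ (mem_univ _), abs_sub_comm, abs_of_nonneg (by linarith)] at e2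
    have e3 := M.dist_triangle (c (-M.nm k)) (c (-s)) (c' (M.nm l))
    rw [hc.seg _ (mem_univ _) _ (mem_univ _), abs_sub_comm, abs_of_nonneg (by linarith)] at e3
    have e4 : c' (M.nm l) = c (-M.nm k) + lat (k + l) := by
      have f1 := hc'.per 0
      have f2 := hc.per (-M.nm k)
      rw [zero_add, h0'] at f1
      rw [neg_add_cancel, h0] at f2
      rw [f1, f2, lat_add, add_assoc]
    rw [e4, hM, ← e4] at e3
    linarith
  have h5 : M.nrm x u ≤ s + M.K ^ 3 * s ^ 2 := by
    have := le_of_abs_le (M.abs_nrm_sub_dist_le x (c (-s)) x)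
    rw [sub_self, norm_zero, zero_add, hus] at this
    linarith
  set w := M.nrm x (v x + v' x) with hw
  have h6 : 2 * s - (1 + 2 * M.T * M.K ^ 2) * s ^ 2 ≤ w * M.nrm x u := by
    have e1 := le_of_abs_le (M.g_le_nrm x (v x + v' x) (-u))
    have e2 : M.nrm x (-u) = M.nrm x u := by
      rw [← neg_one_smul ℝ u, M.nrm_smul]; simp
    rw [g_neg_right, g_add_left, e2] at e1
    linarith
  have hw0 : 0 ≤ w := M.nrm_nonneg _ _
  have hw2 : w ≤ 2 := by
    have := M.nrm_add_le x (v x) (v' x)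
    rw [hB.nrm_eq, hB'.nrm_eq] at this
    linarith
  have h7 : 2 * s - (1 + 2 * M.T * M.K ^ 2 + 2 * M.K ^ 3) * s ^ 2 ≤ w * s := by
    have e1 := mul_le_mul_of_nonneg_left h5 hw0
    have e2 : w * (M.K ^ 3 * s ^ 2) ≤ 2 * (M.K ^ 3 * s ^ 2) :=
      mul_le_mul_of_nonneg_right hw2 (by positivity)
    linarith
  have h8 : 2 - (1 + 2 * M.T * M.K ^ 2 + 2 * M.K ^ 3) * s ≤ w := by
    refine le_of_mul_le_mul_right ?_ hs
    linarith
  have h9 : M.g x (v x - v' x) (v x - v' x) = 4 - w ^ 2 := by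
    rw [hw, M.nrm_sq]
    simp only [sub_eq_add_neg, g_add_left, g_add_right, g_neg_left, g_neg_right, hB.unit, hB'.unit]
    ring
  rw [h9]
  nlinarith

end TorusMetric

/-- Iterated mediants: chains of lattice vectors from `(1, 0)` to `(-1, 0)` through the upper half
plane whose consecutive members form bases, one of them long. -/
lemma exists_mediant_chain (r : ℕ) : ∃ (m : ℕ) (s : ℕ → ℤ × ℤ), 0 < m ∧ s 0 = (1, 0) ∧ s m = (-1, 0) ∧
    (∀ i < m, (s i).1 * (s (i + 1)).2 - (s i).2 * (s (i + 1)).1 = 1 ∧ 0 ≤ (s i).1 * (s (i + 1)).1 ∧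
      0 ≤ (s i).2 * (s (i + 1)).2 ∧ ((r : ℤ) + 1 ≤ |(s i).1| + |(s i).2| ∨
        (r : ℤ) + 1 ≤ |(s (i + 1)).1| + |(s (i + 1)).2|)) ∧ ∀ i ≤ m, 0 ≤ (s i).2 := by
  have hsize : ∀ k l : ℤ × ℤ, k.1 * l.2 - k.2 * l.1 = 1 → 1 ≤ |k.1| + |k.2| ∧ 1 ≤ |l.1| + |l.2| := by
    intro k l h
    constructor
    · by_contra! h0
      have h1 : k.1 = 0 := abs_nonpos_iff.1 (by linarith [abs_nonneg k.2])
      have h2 : k.2 = 0 := abs_nonpos_iff.1 (by linarith [abs_nonneg k.1])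
      simp [h1, h2] at h
    · by_contra! h0
      have h1 : l.1 = 0 := abs_nonpos_iff.1 (by linarith [abs_nonneg l.2])
      have h2 : l.2 = 0 := abs_nonpos_iff.1 (by linarith [abs_nonneg l.1])
      simp [h1, h2] at h
  have habs : ∀ a b : ℤ, 0 ≤ a * b → |a + b| = |a| + |b| := fun a b h =>
    abs_add_eq_add_abs_iff a b |>.2 (mul_nonneg_iff.1 h)
  induction r with
  | zero =>
    refine ⟨2, fun n => if n = 0 then (1, 0) else if n = 1 then (0, 1) else (-1, 0), by norm_num,
      by simp, by simp, fun i hi => ?_, fun i hi => ?_⟩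
    · interval_cases i <;> simp
    · interval_cases i <;> simp
  | succ r ih =>
    obtain ⟨m, s, hm, h0, h1, h2, h3⟩ := ih
    refine ⟨2 * m, fun n => if n % 2 = 0 then s (n / 2) else s (n / 2) + s (n / 2 + 1), by omega,
      by simpa using h0, by simpa using h1, fun i hi => ?_, fun i hi => ?_⟩
    · obtain ⟨hd, ha, hb, hr⟩ := h2 (i / 2) (by omega)
      obtain ⟨hk, hl⟩ := hsize _ _ hd
      rcases Nat.mod_two_eq_zero_or_one i with he | he
      · have e1 : (i + 1) % 2 = 1 := by omega
        have e2 : (i + 1) / 2 = i / 2 := by omega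
        simp only [he, e1, e2, if_true, one_ne_zero, if_false, Prod.fst_add, Prod.snd_add]
        refine ⟨by linarith, by nlinarith [mul_self_nonneg (s (i / 2)).1],
          by nlinarith [mul_self_nonneg (s (i / 2)).2], Or.inr ?_⟩
        rw [habs _ _ ha, habs _ _ hb]
        push_cast
        rcases hr with hr | hr <;> linarith
      · have e1 : (i + 1) % 2 = 0 := by omega
        have e2 : (i + 1) / 2 = i / 2 + 1 := by omega
        simp only [he, e1, e2, if_true, one_ne_zero, if_false, Prod.fst_add, Prod.snd_add]
        refine ⟨by linarith, by nlinarith [mul_self_nonneg (s (i / 2 + 1)).1],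
          by nlinarith [mul_self_nonneg (s (i / 2 + 1)).2], Or.inl ?_⟩
        rw [habs _ _ ha, habs _ _ hb]
        push_cast
        rcases hr with hr | hr <;> linarith
    · rcases Nat.mod_two_eq_zero_or_one i with he | he
      · simpa only [he, if_true] using h3 (i / 2) (by omega)
      · simp only [he, one_ne_zero, if_false, Prod.snd_add]
        exact add_nonneg (h3 _ (by omega)) (h3 _ (by omega))

/-- The sum of the sines of the small positive turning angles of a half turn is almost `π`. -/
lemma half_turn_le {m : ℕ} {u : ℕ → ℂ} {δ : ℝ} (hδ : δ < 1) (hu : ∀ i ≤ m, ‖u i‖ = 1)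
    (hum : u m = -u 0) (him : ∀ i < m, 0 < ((starRingEnd ℂ) (u i) * u (i + 1)).im)
    (hre : ∀ i < m, 1 - δ ≤ ((starRingEnd ℂ) (u i) * u (i + 1)).re) :
    (1 - δ) * Real.pi ≤ ∑ i ∈ Finset.range m, ((starRingEnd ℂ) (u i) * u (i + 1)).im := by
  set z : ℕ → ℂ := fun i => (starRingEnd ℂ) (u i) * u (i + 1) with hz
  set θ : ℕ → ℝ := fun i => Complex.arg (z i) with hθ
  have hzn : ∀ i < m, ‖z i‖ = 1 := fun i hi => by
    rw [hz]; simp only [norm_mul, RCLike.norm_conj]; rw [hu i hi.le, hu _ hi, one_mul]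
  have hexp : ∀ i < m, Complex.exp (θ i * Complex.I) = z i := fun i hi => by
    have := Complex.norm_mul_exp_arg_mul_I (z i)
    rwa [hzn i hi, Complex.ofReal_one, one_mul] at this
  have hsin : ∀ i < m, Real.sin (θ i) = (z i).im := fun i hi => by
    rw [← hexp i hi, Complex.exp_ofReal_mul_I_im]
  have hcos : ∀ i < m, Real.cos (θ i) = (z i).re := fun i hi => by
    rw [← hexp i hi, Complex.exp_ofReal_mul_I_re]
  have hθ0 : ∀ i < m, 0 ≤ θ i := fun i hi => Complex.arg_nonneg_iff.2 (him i hi).le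
  have hprod : ∀ n ≤ m, Complex.exp ((∑ i ∈ Finset.range n, θ i : ℝ) * Complex.I) =
      (starRingEnd ℂ) (u 0) * u n := by
    intro n
    induction n with
    | zero => intro _; simp [← Complex.normSq_eq_conj_mul_self, Complex.normSq_eq_norm_sq, hu 0 (Nat.zero_le m)]
    | succ n ih =>
      intro hn
      have h1 : u n * (starRingEnd ℂ) (u n) = 1 := by
        rw [Complex.mul_conj, Complex.normSq_eq_norm_sq, hu n (by omega)]; norm_num
      rw [Finset.sum_range_succ, Complex.ofReal_add, add_mul, Complex.exp_add, ih (by omega),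
        hexp n (by omega)]
      calc _ = (starRingEnd ℂ) (u 0) * (u n * (starRingEnd ℂ) (u n)) * u (n + 1) := by rw [hz]; ring
        _ = _ := by rw [h1, mul_one]
  set S := ∑ i ∈ Finset.range m, θ i with hS
  have hS0 : 0 ≤ S := Finset.sum_nonneg fun i hi => hθ0 i (Finset.mem_range.1 hi)
  have hSpi : Real.pi ≤ S := by
    have h1 := hprod m le_rfl
    have h2 : (starRingEnd ℂ) (u 0) * u 0 = 1 := by
      rw [← Complex.normSq_eq_conj_mul_self, Complex.normSq_eq_norm_sq, hu 0 (Nat.zero_le m)]; norm_num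
    rw [hum, mul_neg, h2] at h1
    have h3 : Real.cos S = -1 := by
      rw [← Complex.exp_ofReal_mul_I_re, h1]; simp
    by_contra! h4
    have h5 := Real.cos_lt_cos_of_nonneg_of_le_pi hS0 le_rfl h4
    rw [h3, Real.cos_pi] at h5
    exact lt_irrefl _ h5
  calc (1 - δ) * Real.pi ≤ (1 - δ) * S := mul_le_mul_of_nonneg_left hSpi (by linarith)
    _ = ∑ i ∈ Finset.range m, (1 - δ) * θ i := by rw [hS, Finset.mul_sum]
    _ ≤ _ := Finset.sum_le_sum fun i hi => by
      have hi := Finset.mem_range.1 hi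
      have h1 : 0 < Real.cos (θ i) := by rw [hcos i hi]; linarith [hre i hi]
      have h2 : θ i < Real.pi / 2 := by
        by_contra! h2
        exact h1.not_ge (Real.cos_nonpos_of_pi_div_two_le_of_le h2
          (by linarith [Complex.arg_le_pi (z i), Real.pi_pos]))
      have h3 := Real.le_tan (hθ0 i hi) h2
      rw [Real.tan_eq_sin_div_cos, le_div_iff₀ h1] at h3
      have h4 := mul_le_mul_of_nonneg_right (hre i hi) (hθ0 i hi)
      rw [← hsin i hi]
      rw [← hcos i hi] at h4
      linarith

namespace TorusMetric
variable (M : TorusMetric)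

/-- An orthonormal coordinate of tangent vectors at `x`. -/
def frame (x v : Pl) : ℂ :=
  ⟨(M.cA x * v.1 + M.cB x * v.2) / √(M.cA x), √(M.dt x) / √(M.cA x) * v.2⟩

lemma frame_re (x v w : Pl) : ((starRingEnd ℂ) (M.frame x v) * M.frame x w).re = M.g x v w := by
  have h0 := M.cA_pos x
  have h1 : √(M.cA x) ^ 2 = M.cA x := Real.sq_sqrt h0.le
  have h2 : √(M.dt x) ^ 2 = M.dt x := Real.sq_sqrt (M.dt_pos x).le
  have h3 : √(M.cA x) ≠ 0 := (Real.sqrt_pos.2 h0).ne'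
  simp only [frame, Complex.mul_re, Complex.conj_re, Complex.conj_im, M.g_eq]
  field_simp
  rw [h2, h1, dt]
  ring

lemma frame_im (x v w : Pl) :
    ((starRingEnd ℂ) (M.frame x v) * M.frame x w).im = √(M.dt x) * crossDet v w := by
  have h0 := M.cA_pos x
  have h1 : √(M.cA x) ^ 2 = M.cA x := Real.sq_sqrt h0.le
  have h3 : √(M.cA x) ≠ 0 := (Real.sqrt_pos.2 h0).ne'
  simp only [frame, Complex.mul_im, Complex.conj_re, Complex.conj_im, crossDet]
  field_simp
  rw [h1]
  ring

lemma frame_neg (x v : Pl) : M.frame x (-v) = -M.frame x v := by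
  apply Complex.ext <;> simp only [frame, Complex.neg_re, Complex.neg_im, Prod.fst_neg, Prod.snd_neg] <;> ring

lemma norm_frame {x v : Pl} (hv : M.g x v v = 1) : ‖M.frame x v‖ = 1 := by
  have h1 := M.frame_re x v v
  rw [← Complex.normSq_eq_conj_mul_self, Complex.ofReal_re, Complex.normSq_eq_norm_sq, hv] at h1
  exact (pow_eq_one_iff_of_nonneg (norm_nonneg _) two_ne_zero).1 h1

variable {M} {k l : ℤ × ℤ}

variable {B B' : Pl → ℝ} {v v' : Pl → Pl} {h h' : Pl}

lemma exists_close_of_large (hM : ∀ k x, M.dist x (x + lat k) = M.nm k) {s : ℝ} (hs : 0 < s)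
    (hsK : M.K * s ≤ 1) : ∃ R : ℝ, ∀ (k l : ℤ × ℤ) (B B' : Pl → ℝ) (v v' : Pl → Pl) (h h' : Pl),
      M.IsBusOf k B v h → M.IsBusOf l B' v' h' → |crossDet (lat k) (lat l)| = 1 →
      0 ≤ k.1 * l.1 → 0 ≤ k.2 * l.2 → R ≤ ‖lat k‖ ∨ R ≤ ‖lat l‖ → ∀ x,
      M.g x (v x - v' x) (v x - v' x) ≤ 4 * (1 + 2 * M.T * M.K ^ 2 + 2 * M.K ^ 3) * s := by
  have hK := M.K_pos
  have hA := area_pos (M := M)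
  have hlow : ∀ {k : ℤ × ℤ}, k ≠ 0 → s ≤ M.nm k := fun {k} hk => by
    have h1 := (one_le_norm_lat hk).trans (norm_le_nm (M := M) k)
    exact le_of_mul_le_mul_left (hsK.trans h1) hK
  set R := M.K ^ 2 * (1 + M.area) + 1 + M.K * (M.area / s ^ 2) + M.K with hR
  have hRp : 0 ≤ M.K * (M.area / s ^ 2) := by positivity
  have hRq : 0 ≤ M.K ^ 2 * (1 + M.area) := by positivity
  have hbig : ∀ {k : ℤ × ℤ}, R ≤ ‖lat k‖ → M.K ^ 2 * (1 + M.area) < ‖lat k‖ ∧ 1 ≤ M.nm k ∧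
      M.area / M.nm k ≤ s ^ 2 := fun {k} hk => by
    have h1 := hk.trans (norm_le_nm (M := M) k)
    have h2 : 1 ≤ M.nm k := le_of_mul_le_mul_left (by linarith) hK
    have h3 : M.area / s ^ 2 ≤ M.nm k := le_of_mul_le_mul_left (by linarith) hK
    refine ⟨by linarith, h2, ?_⟩
    rw [div_le_iff₀ (by linarith)]
    rwa [div_le_iff₀' (by positivity)] at h3
  refine ⟨R, fun k l B B' v v' h h' hB hB' hd h1 h2 hor x => ?_⟩
  obtain ⟨hk0, hl0⟩ := ne_zero_of_crossDet (k := k) (l := l) fun h0 => by simp [h0] at hd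
  rcases hor with hor | hor
  · obtain ⟨e1, e2, e3⟩ := hbig hor
    have e4 := saving_le hM hB hB' hd h1 h2 e1
    have := corner_cut hM hB'.neg hB.neg hs (by rw [nm_neg]; exact hlow hl0) (by rw [nm_neg]; exact e2) hsK
      (by rw [← neg_add, nm_neg, nm_neg, nm_neg, add_comm l k]; linarith) x
    have e5 : -v' x - -v x = v x - v' x := by abel
    rwa [e5] at this
  · obtain ⟨e1, e2, e3⟩ := hbig hor
    have e4 := saving_le hM hB' hB (by
      rw [← hd, ← abs_neg]; congr 1; simp only [crossDet]; ring) (by linarith) (by linarith) e1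
    exact corner_cut hM hB hB' hs (hlow hk0) e2 hsK (by rw [add_comm k l]; linarith) x

/-- A half turn of Busemann classes sweeping out almost `π` times the area. -/
lemma exists_half_turn (hM : ∀ k x, M.dist x (x + lat k) = M.nm k) {δ : ℝ} (hδ : 0 < δ) (hδ1 : δ < 1) :
    ∃ (m : ℕ) (H : ℕ → Pl), 0 < (H 0).1 ∧ H m = -H 0 ∧ (∀ i < m, (H (i + 1)).1 ≤ (H i).1) ∧
      (∀ i ≤ m, ∃ B v, M.IsBus B v (H i)) ∧
      (1 - δ) * Real.pi * M.area ≤ ∑ i ∈ Finset.range m, crossDet (H i) (H (i + 1)) := by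
  have hK := M.K_pos
  have hT := M.T_pos
  set C := 4 * (1 + 2 * M.T * M.K ^ 2 + 2 * M.K ^ 3) with hC
  have hC0 : 0 < C := by positivity
  set s := min (1 / M.K) (2 * δ / C) with hs
  have hs0 : 0 < s := by positivity
  have hsK : M.K * s ≤ 1 := by
    rw [← le_div_iff₀' hK]; exact min_le_left _ _
  have hsC : C * s ≤ 2 * δ := by
    rw [← le_div_iff₀' hC0]; exact min_le_right _ _
  obtain ⟨R, hR⟩ := exists_close_of_large hM hs0 hsK
  obtain ⟨r, hr⟩ := exists_nat_ge (2 * R)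
  obtain ⟨m, k, hm, hk0, hkm, hk, hk2⟩ := exists_mediant_chain r
  have hdet : ∀ i < m, crossDet (lat (k i)) (lat (k (i + 1))) = 1 := fun i hi => by
    have := (hk i hi).1
    simp only [crossDet, lat]
    exact_mod_cast this
  have hkne : ∀ i < m, k i ≠ 0 := fun i hi =>
    (ne_zero_of_crossDet (l := k (i + 1)) (by rw [hdet i hi]; exact one_ne_zero)).1
  have hex : ∀ i, ∃ b : (Pl → ℝ) × (Pl → Pl) × Pl, i < m → M.IsBusOf (k i) b.1 b.2.1 b.2.2 := fun i => by
    by_cases hi : i < m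
    · obtain ⟨B, v, h, hB⟩ := exists_isBusOf hM (hkne i hi)
      exact ⟨(B, v, h), fun _ => hB⟩
    · exact ⟨(fun _ => 0, fun _ => 0, 0), fun h => absurd h hi⟩
  choose b₀ hb₀ using hex
  set b : ℕ → (Pl → ℝ) × (Pl → Pl) × Pl := fun i => if i < m then b₀ i else
    (fun x => -(b₀ 0).1 x, fun x => -(b₀ 0).2.1 x, -(b₀ 0).2.2) with hb
  have hbm : b m = (fun x => -(b₀ 0).1 x, fun x => -(b₀ 0).2.1 x, -(b₀ 0).2.2) := by simp [hb]
  have hb0 : b 0 = b₀ 0 := by simp [hb, hm]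
  have hbus : ∀ i ≤ m, M.IsBusOf (k i) (b i).1 (b i).2.1 (b i).2.2 := fun i hi => by
    rcases hi.lt_or_eq with h1 | h1
    · have : b i = b₀ i := by simp [hb, h1]
      rw [this]; exact hb₀ i h1
    · subst h1
      rw [hbm]
      have h2 : k i = -(k 0) := by rw [hkm, hk0]; rfl
      rw [h2]
      exact (hb₀ 0 hm).neg
  have hpos : ∀ i < m, ∀ x, 0 < crossDet ((b i).2.1 x) ((b (i + 1)).2.1 x) := fun i hi x =>
    crossDet_pos hM (hbus i hi.le) (hbus (i + 1) hi) (by rw [hdet i hi]; exact one_pos) x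
  have hsz : ∀ {k : ℤ × ℤ}, (r : ℤ) + 1 ≤ |k.1| + |k.2| → R ≤ ‖lat k‖ := fun {k} h1 => by
    have h2 := norm_fst_le (lat k)
    have h3 := norm_snd_le (lat k)
    simp only [Real.norm_eq_abs, lat] at h2 h3
    have h4 : (r : ℝ) + 1 ≤ |(k.1 : ℝ)| + |(k.2 : ℝ)| := by exact_mod_cast h1
    have h5 : ‖lat k‖ = ‖((k.1 : ℝ), (k.2 : ℝ))‖ := rfl
    linarith
  have hclose : ∀ i < m, ∀ x, 1 - δ ≤ M.g x ((b i).2.1 x) ((b (i + 1)).2.1 x) := fun i hi x => by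
    obtain ⟨-, e1, e2, e3⟩ := hk i hi
    have e4 := hR _ _ _ _ _ _ _ _ (hbus i hi.le) (hbus (i + 1) hi) (by rw [hdet i hi, abs_one]) e1 e2
      (e3.imp hsz hsz) x
    have e5 : M.g x ((b i).2.1 x - (b (i + 1)).2.1 x) ((b i).2.1 x - (b (i + 1)).2.1 x) =
        2 - 2 * M.g x ((b i).2.1 x) ((b (i + 1)).2.1 x) := by
      simp only [sub_eq_add_neg, g_add_left, g_add_right, g_neg_left, g_neg_right,
        (hbus i hi.le).unit, (hbus (i + 1) hi).unit, M.symm x ((b (i + 1)).2.1 x) ((b i).2.1 x)]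
      ring
    rw [e5] at e4
    linarith
  have hsum : ∀ x, (1 - δ) * Real.pi ≤
      ∑ i ∈ Finset.range m, √(M.dt x) * crossDet ((b i).2.1 x) ((b (i + 1)).2.1 x) := fun x => by
    have := half_turn_le (u := fun i => M.frame x ((b i).2.1 x)) hδ1
      (fun i hi => M.norm_frame ((hbus i hi).unit x)) (by rw [hbm, hb0, M.frame_neg])
      (fun i hi => by
        rw [frame_im]; exact mul_pos (Real.sqrt_pos.2 (M.dt_pos x)) (hpos i hi x))
      (fun i hi => by rw [frame_re]; exact hclose i hi x)
    simpa only [frame_im] using this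
  refine ⟨m, fun i => (b i).2.2, ?_, by simp only [hbm, hb0], fun i hi => ?_,
    fun i hi => ⟨_, _, (hbus i hi).toIsBus⟩, ?_⟩
  · have h1 := (hbus 0 hm.le).nm_eq
    have h2 := nm_pos hM (hkne 0 hm)
    rw [← h1, hk0] at h2
    simpa [ip, lat] using h2
  · have h1 := hbus i hi.le
    have h2 := hbus (i + 1) hi
    have e1 := h1.ip_le (k (i + 1))
    have e2 := h2.ip_le (k i)
    rw [← h2.nm_eq] at e1
    rw [← h1.nm_eq] at e2
    have e3 : (0 : ℝ) ≤ (k i).2 := by exact_mod_cast hk2 i hi.le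
    have e4 : (0 : ℝ) ≤ (k (i + 1)).2 := by exact_mod_cast hk2 (i + 1) hi
    have e5 := mul_nonneg e3 (sub_nonneg.2 e1)
    have e6 := mul_nonneg e4 (sub_nonneg.2 e2)
    have e7 := hdet i hi
    simp only [crossDet, lat, ip] at e5 e6 e7
    have e8 : (b i).2.2.1 - (b (i + 1)).2.2.1 = ((b i).2.2.1 - (b (i + 1)).2.2.1) *
      ((k i).1 * (k (i + 1)).2 - (k i).2 * (k (i + 1)).1 : ℝ) := by rw [e7, mul_one]
    linarith
  · have h1 : ∀ i < m, crossDet (b i).2.2 (b (i + 1)).2.2 =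
        avg fun x => M.dt x * crossDet ((b i).2.1 x) ((b (i + 1)).2.1 x) := fun i hi =>
      ((hbus i hi.le).avg_wedge (hbus (i + 1) hi).toIsBus).symm
    have hcont : ∀ i < m, Continuous fun x => M.dt x * crossDet ((b i).2.1 x) ((b (i + 1)).2.1 x) :=
      fun i hi => (hbus i hi.le).continuous_wedge (hbus (i + 1) hi).toIsBus
    set F : ℕ → Pl → ℝ := fun i x => if i < m then M.dt x * crossDet ((b i).2.1 x) ((b (i + 1)).2.1 x) else 0
      with hF
    have hFc : ∀ i, Continuous (F i) := fun i => by
      by_cases hi : i < m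
      · simpa only [hF, hi, if_true] using hcont i hi
      · simpa only [hF, hi, if_false] using continuous_const
    have h2 : ∑ i ∈ Finset.range m, crossDet (b i).2.2 (b (i + 1)).2.2 =
        avg fun x => ∑ i ∈ Finset.range m, F i x := by
      rw [avg_sum _ hFc]
      refine Finset.sum_congr rfl fun i hi => ?_
      simp only [hF, Finset.mem_range.1 hi, if_true]
      exact h1 i (Finset.mem_range.1 hi)
    change _ ≤ ∑ i ∈ Finset.range m, crossDet (b i).2.2 (b (i + 1)).2.2
    rw [h2, area, ← avg_const_mul]
    refine avg_mono (continuous_const.mul continuous_sqrt_dt) (continuous_finsetSum _ fun i _ => hFc i) fun x => ?_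
    have h3 := mul_le_mul_of_nonneg_left (hsum x) (Real.sqrt_nonneg (M.dt x))
    rw [Finset.mul_sum] at h3
    calc _ = √(M.dt x) * ((1 - δ) * Real.pi) := by ring
      _ ≤ _ := h3
      _ = _ := Finset.sum_congr rfl fun i hi => by
        simp only [hF, Finset.mem_range.1 hi, if_true]
        rw [← mul_assoc, Real.mul_self_sqrt (M.dt_pos x).le]

end TorusMetric

section
open MeasureTheory (volume IntegrableOn)
open Real (sin cos)

lemma integrableOn_of_continuousOn_Ioo {f : ℝ → ℝ} {a b C : ℝ} (hf : ContinuousOn f (Ioo a b))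
    (hC : ∀ x ∈ Ioo a b, |f x| ≤ C) : IntegrableOn f (Icc a b) := by
  rw [integrableOn_Icc_iff_integrableOn_Ioo]
  exact (MeasureTheory.integrableOn_const (C := C) (by simp)).mono'
    (hf.aestronglyMeasurable measurableSet_Ioo)
    ((MeasureTheory.ae_restrict_mem measurableSet_Ioo).mono fun x hx => hC x hx)

lemma le_integral_of_chord {f : ℝ → ℝ} {a b y z : ℝ} (hab : a ≤ b)
    (hf : IntervalIntegrable f volume a b)
    (h : ∀ t ∈ Icc (0 : ℝ) 1, (1 - t) * y + t * z ≤ f ((1 - t) * a + t * b)) :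
    (b - a) * (y + z) / 2 ≤ ∫ x in a..b, f x := by
  rcases hab.eq_or_lt with rfl | hlt
  · simp
  have hba : 0 < b - a := sub_pos.2 hlt
  set e : ℝ → ℝ := fun x => y + (x - a) * ((z - y) / (b - a)) with he
  have hd : ∀ x ∈ uIcc a b, HasDerivAt (fun x => y * x + (x - a) ^ 2 / 2 * ((z - y) / (b - a))) (e x) x :=
    fun x _ => by
      have h1 := ((hasDerivAt_id x).const_mul y).add
        (((((hasDerivAt_id x).sub_const a).pow 2).div_const 2).mul_const ((z - y) / (b - a)))
      refine h1.congr_deriv ?_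
      simp [he]
  have hec : Continuous e := by fun_prop
  have h1 : ∫ x in a..b, e x = (b - a) * (y + z) / 2 := by
    rw [intervalIntegral.integral_eq_sub_of_hasDerivAt hd (hec.intervalIntegrable _ _)]
    field_simp
    ring
  rw [← h1]
  refine intervalIntegral.integral_mono_on (μ := volume) hab (hec.intervalIntegrable _ _) hf
    fun x hx => ?_
  have h2 := h ((x - a) / (b - a)) ⟨div_nonneg (by linarith [hx.1]) hba.le,
    (div_le_one hba).2 (by linarith [hx.2])⟩
  have h3 : (1 - (x - a) / (b - a)) * a + (x - a) / (b - a) * b = x := by field_simp; ring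
  rw [h3] at h2
  refine le_trans (le_of_eq ?_) h2
  rw [he]; field_simp; ring

/-- A profile over `[-X, X]` whose points span only small areas with the origin encloses at most
half of the area of the corresponding ellipse. -/
lemma integral_profile_le {f : ℝ → ℝ} {X A C : ℝ} (hX : 0 < X) (hf : ContinuousOn f (Ioo (-X) X))
    (hC : ∀ x ∈ Icc (-X) X, |f x| ≤ C)
    (h : ∀ x ∈ Icc 0 X, ∀ x' ∈ Icc (-X) 0, x * f x' - x' * f x ≤ A) :
    ∫ x in (-X)..X, f x ≤ Real.pi / 2 * A := by
  have hpi : 0 < Real.pi / 2 := by positivity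
  have hint : IntegrableOn f (Icc (-X) X) :=
    integrableOn_of_continuousOn_Ioo hf fun x hx => hC x (Ioo_subset_Icc_self hx)
  have hs : ∀ φ ∈ Ioo 0 (Real.pi / 2), 0 < sin φ ∧ sin φ < 1 ∧ 0 < cos φ ∧ cos φ < 1 :=
    fun φ hφ => by
      have h1 := Real.sin_pos_of_pos_of_lt_pi hφ.1 (by linarith [hφ.2])
      have h2 := Real.cos_pos_of_mem_Ioo (x := φ) ⟨by linarith [hφ.1], hφ.2⟩
      have h3 := Real.sin_sq_add_cos_sq φ
      exact ⟨h1, by nlinarith, h2, by nlinarith⟩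
  have hsub : ∀ (p p' : ℝ → ℝ), Continuous p → Continuous p' → (∀ t, HasDerivAt p (p' t) t) →
      (∀ t ∈ Ioo 0 (Real.pi / 2), p t ∈ Ioo (-X) X) → (∀ t ∈ Icc 0 (Real.pi / 2), p t ∈ Icc (-X) X) →
      (∀ t, |p' t| ≤ X) →
      IntegrableOn (fun t => f (p t) * p' t) (Icc 0 (Real.pi / 2)) ∧
      (∫ t in (0 : ℝ)..(Real.pi / 2), f (p t) * p' t) = ∫ x in (p 0)..(p (Real.pi / 2)), f x := by
    intro p p' hp hp' hd h1 h2 h3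
    have hi : IntegrableOn (fun t => f (p t) * p' t) (Icc 0 (Real.pi / 2)) := by
      refine integrableOn_of_continuousOn_Ioo (C := C * X)
        ((hf.comp hp.continuousOn h1).mul hp'.continuousOn) fun t ht => ?_
      rw [abs_mul]
      have := hC _ (h2 t (Ioo_subset_Icc_self ht))
      exact mul_le_mul this (h3 t) (abs_nonneg _) ((abs_nonneg _).trans this)
    refine ⟨hi, ?_⟩
    refine intervalIntegral.integral_comp_mul_deriv''' (f := p) (f' := p') (g := f) hp.continuousOn
      (fun t _ => (hd t).hasDerivWithinAt) (hf.mono ?_) (hint.mono_set ?_) ?_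
    · rw [min_eq_left hpi.le, max_eq_right hpi.le]
      rintro _ ⟨t, ht, rfl⟩
      exact h1 t ht
    · rw [uIcc_of_le hpi.le]
      rintro _ ⟨t, ht, rfl⟩
      exact h2 t ht
    · rw [uIcc_of_le hpi.le]
      exact hi
  have hmem : ∀ {r : ℝ}, |r| ≤ 1 → X * r ∈ Icc (-X) X := fun {r} hr => by
    obtain ⟨h1, h2⟩ := abs_le.1 hr
    exact ⟨by nlinarith, by nlinarith⟩
  have hX' : ∀ {r : ℝ}, |r| ≤ 1 → |X * r| ≤ X := fun {r} hr => abs_le.2 (hmem hr)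
  obtain ⟨i1, e1⟩ := hsub (fun t => X * -sin t) (fun t => X * -cos t) (by fun_prop) (by fun_prop)
    (fun t => ((Real.hasDerivAt_sin t).neg).const_mul X)
    (fun t ht => by obtain ⟨h1, h2, -, -⟩ := hs t ht; exact ⟨by nlinarith, by nlinarith⟩)
    (fun t _ => hmem (by rw [abs_neg]; exact Real.abs_sin_le_one t))
    (fun t => hX' (by rw [abs_neg]; exact Real.abs_cos_le_one t))
  obtain ⟨i2, e2⟩ := hsub (fun t => X * cos t) (fun t => X * -sin t) (by fun_prop) (by fun_prop)
    (fun t => (Real.hasDerivAt_cos t).const_mul X)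
    (fun t ht => by obtain ⟨-, -, h1, h2⟩ := hs t ht; exact ⟨by nlinarith, by nlinarith⟩)
    (fun t _ => hmem (Real.abs_cos_le_one t))
    (fun t => hX' (by rw [abs_neg]; exact Real.abs_sin_le_one t))
  simp only [Real.sin_zero, Real.cos_zero, Real.sin_pi_div_two, Real.cos_pi_div_two, neg_zero, mul_zero,
    mul_one, mul_neg] at e1 e2
  simp only [mul_neg] at i1 i2
  have hfi : ∀ a b, a ∈ Icc (-X) X → b ∈ Icc (-X) X → IntervalIntegrable f volume a b :=
    fun a b ha hb => (hint.mono_set (uIcc_subset_Icc ha hb)).intervalIntegrable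
  have m0 : (0 : ℝ) ∈ Icc (-X) X := ⟨by linarith, hX.le⟩
  have m1 : -X ∈ Icc (-X) X := ⟨le_rfl, by linarith⟩
  have m2 : X ∈ Icc (-X) X := ⟨by linarith, le_rfl⟩
  rw [← intervalIntegral.integral_add_adjacent_intervals (hfi _ _ m1 m0) (hfi _ _ m0 m2),
    intervalIntegral.integral_symm 0 (-X), intervalIntegral.integral_symm X 0, ← e1, ← e2,
    ← intervalIntegral.integral_neg, ← intervalIntegral.integral_neg]
  rw [← uIcc_of_le hpi.le] at i1 i2
  have j1 : IntervalIntegrable (fun t => - -(f (-(X * sin t)) * (X * cos t)))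
      volume 0 (Real.pi / 2) := i1.intervalIntegrable.neg
  have j2 : IntervalIntegrable (fun t => -(-(f (X * cos t) * (X * sin t))))
      volume 0 (Real.pi / 2) := i2.intervalIntegrable.neg
  rw [← intervalIntegral.integral_add j1 j2]
  have h3 : (∫ _ in (0 : ℝ)..(Real.pi / 2), A) = Real.pi / 2 * A := by
    rw [intervalIntegral.integral_const, sub_zero, smul_eq_mul]
  rw [← h3]
  refine intervalIntegral.integral_mono_on (μ := volume) hpi.le (j1.add j2)
    intervalIntegrable_const fun t ht => ?_
  have c1 : 0 ≤ cos t := Real.cos_nonneg_of_mem_Icc ⟨by linarith [ht.1], ht.2⟩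
  have c2 : 0 ≤ sin t := Real.sin_nonneg_of_nonneg_of_le_pi ht.1 (by linarith [ht.2])
  have c3 := Real.cos_le_one t
  have c4 := Real.sin_le_one t
  have := h (X * cos t) ⟨by positivity, by nlinarith⟩ (-(X * sin t)) ⟨by nlinarith, by nlinarith [mul_nonneg hX.le c2]⟩
  refine le_trans (le_of_eq ?_) this
  ring

lemma crossDet_hull_le {S : Set Pl} {A : ℝ} (h : ∀ p ∈ S, ∀ q ∈ S, crossDet p q ≤ A) {p q : Pl}
    (hp : p ∈ convexHull ℝ S) (hq : q ∈ convexHull ℝ S) : crossDet p q ≤ A := by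
  have h1 : ∀ q ∈ S, convexHull ℝ S ⊆ {p | crossDet p q ≤ A} := fun q hq =>
    convexHull_min (fun p hp => h p hp q hq) (convex_halfSpace_le
      ⟨fun a b => by simp only [crossDet, Prod.fst_add, Prod.snd_add]; ring,
        fun r a => by simp only [crossDet, Prod.smul_fst, Prod.smul_snd, smul_eq_mul]; ring⟩ A)
  have h2 : convexHull ℝ S ⊆ {q | crossDet p q ≤ A} :=
    convexHull_min (fun q hq => h1 q hq hp) (convex_halfSpace_le
      ⟨fun a b => by simp only [crossDet, Prod.fst_add, Prod.snd_add]; ring,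
        fun r a => by simp only [crossDet, Prod.smul_fst, Prod.smul_snd, smul_eq_mul]; ring⟩ A)
  exact h2 hq

lemma sum_crossDet_le_of_horizontal {m : ℕ} {z : ℕ → Pl} {A X : ℝ} (hX : 0 < X) (h0 : z 0 = (X, 0))
    (hm : z m = (-X, 0)) (hz : ∀ i < m, (z (i + 1)).1 ≤ (z i).1)
    (h : ∀ i ≤ m, ∀ j ≤ m, crossDet (z i) (z j) ≤ A) :
    ∑ i ∈ Finset.range m, crossDet (z i) (z (i + 1)) ≤ Real.pi * A := by
  set S := convexHull ℝ (z '' Iic m) with hS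
  have hzS : ∀ i ≤ m, z i ∈ S := fun i hi => subset_convexHull ℝ _ ⟨i, hi, rfl⟩
  have hconv : Convex ℝ S := convex_convexHull ℝ _
  have hcomp : IsCompact S := ((finite_Iic m).image z).isCompact_convexHull ℝ
  have hA : ∀ p ∈ S, ∀ q ∈ S, crossDet p q ≤ A := fun p hp q hq =>
    crossDet_hull_le (by rintro _ ⟨i, hi, rfl⟩ _ ⟨j, hj, rfl⟩; exact h i hi j hj) hp hq
  set f : ℝ → ℝ := fun x => sSup (Prod.snd '' (S ∩ {p | p.1 = x})) with hf
  have hax : ∀ x, IsCompact (Prod.snd '' (S ∩ {p : Pl | p.1 = x})) := fun x =>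
    (hcomp.inter_right (isClosed_eq continuous_fst continuous_const)).image continuous_snd
  have hle : ∀ x y, (x, y) ∈ S → y ≤ f x := fun x y hxy => le_csSup (hax x).bddAbove ⟨(x, y), ⟨hxy, rfl⟩, rfl⟩
  have hzero : ∀ x ∈ Icc (-X) X, (x, (0 : ℝ)) ∈ S := fun x hx => by
    have h1 := hzS 0 (Nat.zero_le m)
    have h2 := hzS m le_rfl
    rw [h0] at h1
    rw [hm] at h2
    have h3 := hconv h1 h2 (a := (X + x) / (2 * X)) (b := (X - x) / (2 * X))
      (div_nonneg (by linarith [hx.1]) (by linarith)) (div_nonneg (by linarith [hx.2]) (by linarith))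
      (by field_simp; ring)
    convert h3 using 1
    ext
    · simp only [Prod.fst_add, Prod.smul_fst, smul_eq_mul]; field_simp; ring
    · simp
  have hmem : ∀ x ∈ Icc (-X) X, (x, f x) ∈ S := fun x hx => by
    obtain ⟨p, ⟨hp, hp1⟩, hp2⟩ := (hax x).sSup_mem ⟨0, (x, 0), ⟨hzero x hx, rfl⟩, rfl⟩
    have : p = (x, f x) := Prod.ext hp1 hp2
    rwa [← this]
  have hconc : ConcaveOn ℝ (Icc (-X) X) f := ⟨convex_Icc _ _, fun x hx y hy a b ha hb hab =>
    hle _ _ (hconv (hmem x hx) (hmem y hy) ha hb hab)⟩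
  have hcont : ContinuousOn f (Ioo (-X) X) := by
    have := hconc.continuousOn_interior
    rwa [interior_Icc] at this
  have hC : ∀ x ∈ Icc (-X) X, |f x| ≤ A / X := fun x hx => by
    have h1 := hle x 0 (hzero x hx)
    have h2 := hA _ (hzS 0 (Nat.zero_le m)) _ (hmem x hx)
    rw [abs_of_nonneg h1, le_div_iff₀ hX]
    rw [h0] at h2
    simp only [crossDet] at h2
    linarith
  have hx : ∀ i ≤ m, (z i).1 ∈ Icc (-X) X := by
    have hup : ∀ i ≤ m, (z i).1 ≤ X := fun i => by
      induction i with
      | zero => intro _; rw [h0]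
      | succ i ih => exact fun hi => (hz i hi).trans (ih (by omega))
    have hdn : ∀ j ≤ m, -X ≤ (z (m - j)).1 := fun j => by
      induction j with
      | zero => intro _; rw [Nat.sub_zero, hm]
      | succ j ih =>
        intro hj
        refine (ih (by omega)).trans ?_
        have := hz (m - (j + 1)) (by omega)
        rwa [show m - (j + 1) + 1 = m - j by omega] at this
    intro i hi
    have := hdn (m - i) (by omega)
    rw [Nat.sub_sub_self hi] at this
    exact ⟨this, hup i hi⟩
  have hint : IntegrableOn f (Icc (-X) X) :=
    integrableOn_of_continuousOn_Ioo hcont fun x hx => hC x (Ioo_subset_Icc_self hx)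
  have hfi : ∀ a b, a ∈ Icc (-X) X → b ∈ Icc (-X) X → IntervalIntegrable f volume a b :=
    fun a b ha hb => (hint.mono_set (uIcc_subset_Icc ha hb)).intervalIntegrable
  have htotal := integral_profile_le hX hcont hC (A := A) fun x hx x' hx' => by
    have := hA _ (hmem x ⟨by linarith [hx.1], hx.2⟩) _ (hmem x' ⟨hx'.1, by linarith [hx'.2]⟩)
    simp only [crossDet] at this
    linarith
  have hpiece : ∀ i < m, ((z i).1 - (z (i + 1)).1) * ((z i).2 + (z (i + 1)).2) / 2 ≤
      -∫ x in (z i).1..(z (i + 1)).1, f x := fun i hi => by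
    rw [← intervalIntegral.integral_symm, add_comm (z i).2]
    refine le_integral_of_chord (hz i hi) (hfi _ _ (hx _ hi) (hx _ hi.le)) fun t ht => ?_
    exact hle _ _ (hconv (hzS (i + 1) hi) (hzS i hi.le) (a := 1 - t) (b := t) (by linarith [ht.2]) ht.1
      (by ring))
  have hsum := intervalIntegral.sum_integral_adjacent_intervals (f := f)
    (μ := volume) (a := fun i => (z i).1) (n := m)
    fun i hi => hfi _ _ (hx _ hi.le) (hx _ hi)
  have htel : ∑ i ∈ Finset.range m, ((z (i + 1)).1 * (z (i + 1)).2 - (z i).1 * (z i).2) = 0 := by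
    rw [Finset.sum_range_sub (fun i => (z i).1 * (z i).2), h0, hm]; simp
  have h1 : ∀ i, crossDet (z i) (z (i + 1)) = 2 * (((z i).1 - (z (i + 1)).1) * ((z i).2 + (z (i + 1)).2) / 2) +
      ((z (i + 1)).1 * (z (i + 1)).2 - (z i).1 * (z i).2) := fun i => by
    simp only [crossDet]; ring
  simp only [h1]
  rw [Finset.sum_add_distrib, htel, add_zero, ← Finset.mul_sum]
  have h2 := Finset.sum_le_sum fun i hi => hpiece i (Finset.mem_range.1 hi)
  rw [Finset.sum_neg_distrib, hsum, h0, hm, ← intervalIntegral.integral_symm] at h2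
  linarith

/-- A form of Sas's inequality. -/
lemma sum_crossDet_le {m : ℕ} {z : ℕ → Pl} {A : ℝ} (h0 : 0 < (z 0).1) (hm : z m = -z 0)
    (hz : ∀ i < m, (z (i + 1)).1 ≤ (z i).1) (h : ∀ i ≤ m, ∀ j ≤ m, crossDet (z i) (z j) ≤ A) :
    ∑ i ∈ Finset.range m, crossDet (z i) (z (i + 1)) ≤ Real.pi * A := by
  set c := (z 0).2 / (z 0).1 with hc
  have hc' : c * (z 0).1 = (z 0).2 := div_mul_cancel₀ _ h0.ne'
  have hcr : ∀ i j, crossDet ((z i).1, (z i).2 - c * (z i).1) ((z j).1, (z j).2 - c * (z j).1) =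
      crossDet (z i) (z j) := fun i j => by simp only [crossDet]; ring
  have := sum_crossDet_le_of_horizontal (z := fun i => ((z i).1, (z i).2 - c * (z i).1)) (m := m) (A := A) h0
    (by simp only [hc', sub_self]) (by
      simp only [hm, Prod.fst_neg, Prod.snd_neg, mul_neg, hc', sub_self]) hz
    fun i hi j hj => by rw [hcr]; exact h i hi j hj
  simpa only [hcr] using this

namespace TorusMetric
variable {M : TorusMetric}

lemma exists_large_wedge (hM : ∀ k x, M.dist x (x + lat k) = M.nm k) {ε : ℝ} (hε : 0 < ε) (hε1 : ε < 1) :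
    ∃ B v h B' v' h', M.IsBus B v h ∧ M.IsBus B' v' h' ∧ (1 - ε) * M.area ≤ crossDet h h' := by
  obtain ⟨m, H, h0, hm, hmono, hbus, hsum⟩ := exists_half_turn hM (half_pos hε) (by linarith)
  by_contra! hcon
  have h1 := sum_crossDet_le h0 hm hmono (A := (1 - ε) * M.area) fun i hi j hj => by
    obtain ⟨B, v, hB⟩ := hbus i hi
    obtain ⟨B', v', hB'⟩ := hbus j hj
    exact (hcon _ _ _ _ _ _ hB hB').le
  have h2 := mul_pos Real.pi_pos (area_pos (M := M))
  nlinarith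

end TorusMetric
end

/-- The point of the complex plane with given real coordinates. -/
def toC (p : Pl) : ℂ := ⟨p.1, p.2⟩

lemma norm_toC (p : Pl) : ‖toC p‖ = norm2 p := by
  rw [Complex.norm_def, Complex.normSq_apply, norm2, sq, sq]
  rfl

lemma toC_sub (p q : Pl) : toC (p - q) = toC p - toC q := rfl

lemma toC_injective : Function.Injective toC := fun p q h => by
  rw [toC, toC, Complex.mk.injEq] at h
  exact Prod.ext h.1 h.2

lemma norm_sub_eq_of_local {γ : ℝ → ℂ} {a b ρ : ℝ} (hab : a ≤ b) (hρ : 0 < ρ)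
    (h : ∀ s ∈ Icc a b, ∀ t ∈ Icc a b, s ≤ t → t - s ≤ ρ → ‖γ t - γ s‖ = t - s) :
    ‖γ b - γ a‖ = b - a := by
  obtain ⟨N, hN⟩ := exists_nat_gt (2 * (b - a) / ρ)
  have hba := sub_nonneg.2 hab
  have hN0 : (0 : ℝ) < N := lt_of_le_of_lt (by positivity) hN
  set s := (b - a) / N with hs
  have hs0 : 0 ≤ s := by positivity
  have hNs : N * s = b - a := by rw [hs]; field_simp
  have hsρ : 2 * s ≤ ρ := by
    rw [div_lt_iff₀ hρ] at hN
    rw [hs, ← mul_div_assoc, div_le_iff₀ hN0]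
    linarith
  have hmem : ∀ i ≤ N, a + i * s ∈ Icc a b := fun i hi => by
    have h1 : (i : ℝ) ≤ N := by exact_mod_cast hi
    have h2 : (0 : ℝ) ≤ i := i.cast_nonneg
    exact ⟨by nlinarith, by nlinarith⟩
  set δ : ℕ → ℂ := fun i => γ (a + (i + 1 : ℕ) * s) - γ (a + i * s) with hδ
  have hn : ∀ i < N, ‖δ i‖ = s := fun i hi => by
    rw [hδ, h _ (hmem i hi.le) _ (hmem (i + 1) hi) (by push_cast; linarith) (by push_cast; linarith)]
    push_cast; ring
  have hstep : ∀ i, i + 1 < N → δ i = δ (i + 1) := fun i hi => by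
    refine eq_of_norm_eq_of_norm_add_eq (by rw [hn i (by omega), hn _ hi]) ?_
    rw [hn i (by omega), hn _ hi, hδ, sub_add_sub_cancel',
      h _ (hmem i (by omega)) _ (hmem (i + 2) (by omega)) (by push_cast; linarith) (by push_cast; linarith)]
    push_cast; ring
  have hall : ∀ i < N, δ i = δ 0 := fun i => by
    induction i with
    | zero => intro _; rfl
    | succ i ih => intro hi; rw [← hstep i hi, ih (by omega)]
  have hsum : ∀ i ≤ N, γ (a + i * s) - γ a = i * δ 0 := fun i => by
    induction i with
    | zero => intro _; simp
    | succ i ih =>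
      intro hi
      have h1 : γ (a + (i + 1 : ℕ) * s) - γ (a + i * s) = δ 0 := hall i hi
      rw [← sub_add_sub_cancel _ (γ (a + i * s)), h1, ih (by omega)]
      push_cast
      ring
  have h1 := hsum N le_rfl
  rw [hNs, add_sub_cancel] at h1
  rw [h1, norm_mul, hn 0 (by exact_mod_cast hN0), Complex.norm_natCast, hNs]

lemma exists_forall_add_of_isometry {γ : ℝ → ℂ} (h : Isometry γ) :
    ∃ e : ℂ, ∀ s r, γ (s + r) = γ s + r * e := by
  refine ⟨h.affineIsometryOfStrictConvexSpace.linearIsometry 1, fun s r => ?_⟩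
  have h1 := h.affineIsometryOfStrictConvexSpace.map_vadd s r
  have h2 := h.affineIsometryOfStrictConvexSpace.linearIsometry.map_smul r 1
  simp only [vadd_eq_add, Isometry.coe_affineIsometryOfStrictConvexSpace, smul_eq_mul, mul_one] at h1 h2
  rw [add_comm s, h1, h2, add_comm, Complex.real_smul]

namespace TorusMetric
variable {M : TorusMetric} {B B' : Pl → ℝ} {v v' : Pl → Pl} {h h' : Pl}

lemma IsBus.norm_le (hB : M.IsBus B v h) : ‖h‖ ≤ M.nm (1, 0) + M.nm (0, 1) := by
  have h1 := hB.ip_le (1, 0)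
  have h2 := hB.ip_le (0, 1)
  have h3 := hB.neg.ip_le (1, 0)
  have h4 := hB.neg.ip_le (0, 1)
  have n1 : 0 ≤ M.nm (1, 0) := M.dist_nonneg _ _
  have n2 : 0 ≤ M.nm (0, 1) := M.dist_nonneg _ _
  simp [ip, lat] at h1 h2 h3 h4
  rw [Prod.norm_def, Real.norm_eq_abs, Real.norm_eq_abs]
  exact max_le (abs_le.2 ⟨by linarith, by linarith⟩) (abs_le.2 ⟨by linarith, by linarith⟩)

lemma exists_isBus_ulim {B : ℕ → Pl → ℝ} {v : ℕ → Pl → Pl} {h : ℕ → Pl}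
    (hB : ∀ n, M.IsBus (B n) (v n) (h n)) :
    ∃ B' v' h', M.IsBus B' v' h' ∧ Tendsto h Ult (𝓝 h') := by
  obtain ⟨b, hb⟩ := exists_ulim_fun (u := fun n x => B n x - B n 0) fun x => ⟨M.dist 0 x,
    .of_forall fun n => abs_le.2 ⟨by linarith [(hB n).sub_le_dist x 0, M.dist_comm 0 x],
      (hB n).sub_le_dist 0 x⟩⟩
  obtain ⟨w, hw⟩ := exists_ulim_fun (u := v) fun x => ⟨M.K, .of_forall fun n => by
    simpa [(hB n).nrm_eq] using M.norm_le_nrm x (v n x)⟩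
  obtain ⟨p, hp⟩ := exists_ulim (U := Ult) (u := h) (.of_forall fun n => (hB n).norm_le)
  have hg : ∀ x u, Tendsto (fun n => M.g x (v n x) u) Ult (𝓝 (M.g x (w x) u)) := fun x u =>
    ((M.continuous_g continuous_const continuous_id continuous_const).tendsto (w x)).comp (hw x)
  refine ⟨b, w, p, ⟨fun x => ?_, fun x u hu => ?_, fun x j => ?_⟩, hp⟩
  · refine tendsto_nhds_unique ?_ (tendsto_const_nhds (x := (1 : ℝ)) (f := (Ult : Filter ℕ)))
    refine (((M.continuous_g continuous_const continuous_id continuous_id).tendsto (w x)).comp (hw x)).congr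
      fun n => (hB n).unit x
  · refine le_of_tendsto (((hb (x + u)).sub (hb x)).sub (hg x u)).abs (.of_forall fun n => ?_)
    simpa using (hB n).taylor x u hu
  · have h1 : Tendsto (fun n => ip (h n) (lat j)) Ult (𝓝 (ip p (lat j))) := by
      have hc : Continuous fun q : Pl => ip q (lat j) := by unfold ip; fun_prop
      exact (hc.tendsto p).comp hp
    refine tendsto_nhds_unique (hb (x + lat j)) (((hb x).add h1).congr fun n => ?_)
    rw [(hB n).shift]
    ring

lemma exists_orthogonal_isBus (hM : ∀ k x, M.dist x (x + lat k) = M.nm k) :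
    ∃ B v h B' v' h', M.IsBus B v h ∧ M.IsBus B' v' h' ∧ ∀ x, M.g x (v x) (v' x) = 0 := by
  have he : ∀ n : ℕ, 0 < 1 / ((n : ℝ) + 2) ∧ 1 / ((n : ℝ) + 2) < 1 := fun n =>
    ⟨by positivity, (div_lt_one (by positivity)).2 (by linarith [n.cast_nonneg (α := ℝ)])⟩
  choose B v h B' v' h' hB hB' hA using fun n => exists_large_wedge hM (he n).1 (he n).2
  obtain ⟨b, w, p, hb, hp⟩ := exists_isBus_ulim hB
  obtain ⟨b', w', p', hb', hp'⟩ := exists_isBus_ulim hB'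
  refine ⟨b, w, p, b', w', p', hb, hb', fun x => ?_⟩
  have hA' : M.area ≤ crossDet p p' := by
    have hc : Continuous fun q : Pl × Pl => crossDet q.1 q.2 := by unfold crossDet; fun_prop
    have h1 : Tendsto (fun n => crossDet (h n) (h' n)) Ult (𝓝 (crossDet p p')) :=
      (hc.tendsto (p, p')).comp (hp.prodMk_nhds hp')
    have h2 : Tendsto (fun n : ℕ => (1 - 1 / ((n : ℝ) + 2)) * M.area) Ult (𝓝 ((1 - 0) * M.area)) := by
      refine (tendsto_const_nhds.sub (Tendsto.mono_left ?_ ult_le)).mul_const _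
      have := (tendsto_one_div_add_atTop_nhds_zero_nat (𝕜 := ℝ)).comp (tendsto_add_atTop_nat 1)
      refine this.congr fun n => ?_
      simp only [Function.comp, Nat.cast_add, Nat.cast_one]
      ring
    simpa using le_of_tendsto_of_tendsto' h2 h1 hA
  have hz := eq_zero_of_avg (f := fun x => √(M.dt x) - M.dt x * crossDet (w x) (w' x))
    (continuous_sqrt_dt.sub (hb.continuous_wedge hb'))
    (fun x k => by rw [M.dt_per, hb.v_add_lat, hb'.v_add_lat])
    (fun x => sub_nonneg.2 (hb.wedge_le hb' x))
    (by rw [avg_sub continuous_sqrt_dt (hb.continuous_wedge hb'), hb.avg_wedge hb']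
        exact sub_nonpos.2 hA') x
  have h1 := M.g_lagrange x (w x) (w' x)
  rw [hb.unit, hb'.unit] at h1
  have h2 : M.dt x * (M.dt x * crossDet (w x) (w' x) ^ 2) = M.dt x * 1 := by
    have := Real.sq_sqrt (M.dt_pos x).le
    rw [sub_eq_zero.1 hz] at this
    linarith
  have h3 := mul_left_cancel₀ (M.dt_pos x).ne' h2
  rw [crossDet] at h3
  have : M.g x (w x) (w' x) ^ 2 = 0 := by linarith
  exact pow_eq_zero_iff (two_ne_zero) |>.1 this

section

variable (hB : M.IsBus B v h) (hB' : M.IsBus B' v' h') (ho : ∀ x, M.g x (v x) (v' x) = 0)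

include hB hB' ho

lemma g_comb (x w u : Pl) : M.g x (w.1 • v x + w.2 • v' x) (u.1 • v x + u.2 • v' x) = ip w u := by
  simp only [g_add_left, g_add_right, g_smul_left, g_smul_right, hB.unit, hB'.unit, ho, M.symm x (v' x) (v x), ip]
  ring

lemma nrm_comb (x : Pl) {w : Pl} (hw : ip w w = 1) : M.nrm x (w.1 • v x + w.2 • v' x) = 1 := by
  rw [nrm, g_comb hB hB' ho, hw, Real.sqrt_one]

lemma g_self_eq (x u : Pl) : M.g x u u = M.g x (v x) u ^ 2 + M.g x (v' x) u ^ 2 := by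
  have h1 := M.g_lagrange x (v x) (v' x)
  rw [hB.unit, hB'.unit, ho] at h1
  have hD : crossDet (v x) (v' x) ≠ 0 := fun hD => by
    rw [crossDet] at hD
    rw [hD] at h1
    norm_num at h1
  obtain ⟨p, rfl⟩ : ∃ p : Pl, u = p.1 • v x + p.2 • v' x := by
    refine ⟨(crossDet u (v' x) / crossDet (v x) (v' x), crossDet (v x) u / crossDet (v x) (v' x)), ?_⟩
    ext <;> simp only [Prod.fst_add, Prod.snd_add, Prod.smul_fst, Prod.smul_snd, smul_eq_mul] <;>
      field_simp <;> simp only [crossDet] <;> ring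
  have h2 := g_comb hB hB' ho x (1, 0) p
  have h3 := g_comb hB hB' ho x (0, 1) p
  simp only [one_smul, zero_smul, add_zero, zero_add] at h2 h3
  rw [g_comb hB hB' ho, h2, h3]
  simp only [ip]
  ring

lemma comb_sub_le_dist {w : Pl} (hw : ip w w = 1) (x y : Pl) :
    w.1 * (B y - B x) + w.2 * (B' y - B' x) ≤ M.dist x y := by
  have := sub_le_dist_of_hasFDerivAt (M := M) (B := fun z => w.1 * B z + w.2 * B' z)
    (v := fun z => w.1 • v z + w.2 • v' z) (fun z => ?_) (fun z => (nrm_comb hB hB' ho z hw).le) x y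
  · linarith
  · refine (((hB.hasFDerivAt z).const_mul w.1).add ((hB'.hasFDerivAt z).const_mul w.2)).congr_fderiv ?_
    ext <;> simp [gL_apply, g_add_left, g_smul_left]

lemma exists_gain_step : ∃ C, 0 ≤ C ∧ ∀ w, ip w w = 1 → ∀ y s, 0 ≤ s → s * M.K ≤ 1 →
    ∃ z, M.dist y z ≤ s + C * s ^ 2 ∧
      s - C * s ^ 2 ≤ w.1 * (B z - B y) + w.2 * (B' z - B' y) := by
  have hK := M.K_pos
  have hT := M.T_pos
  refine ⟨2 * M.T * M.K ^ 2 + M.K ^ 7, by positivity, fun w hw y s hs hsK => ?_⟩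
  set e := w.1 • v y + w.2 • v' y with he
  have hn : M.nrm y (s • e) = s := by rw [nrm_smul, nrm_comb hB hB' ho y hw, abs_of_nonneg hs, mul_one]
  have hne : ‖s • e‖ ≤ M.K * s := by simpa [hn] using M.norm_le_nrm y (s • e)
  have hn1 : ‖s • e‖ ≤ 1 := by linarith
  have hsq : ‖s • e‖ ^ 2 ≤ M.K ^ 2 * s ^ 2 := by
    rw [← mul_pow]; exact pow_le_pow_left₀ (norm_nonneg _) hne 2
  refine ⟨y + s • e, ?_, ?_⟩
  · have h1 := abs_le.1 (M.abs_nrm_sub_dist_le y (y + s • e) y)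
    have h2 := M.dist_le_norm_sub y (y + s • e)
    rw [sub_add_cancel_left, norm_neg] at h2
    simp only [add_sub_cancel_left, hn, sub_self, norm_zero, zero_add] at h1
    have h3 : M.dist y (y + s • e) ≤ M.K ^ 2 * s := by nlinarith
    have h4 : M.dist y (y + s • e) ^ 2 ≤ (M.K ^ 2 * s) ^ 2 := pow_le_pow_left₀ (M.dist_nonneg _ _) h3 2
    have h5 := mul_le_mul_of_nonneg_left h4 (pow_nonneg hK.le 3)
    have h6 : 0 ≤ 2 * M.T * M.K ^ 2 * s ^ 2 := by positivity
    nlinarith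
  · have h1 := abs_le.1 (hB.taylor y _ hn1)
    have h2 := abs_le.1 (hB'.taylor y _ hn1)
    have h3 := g_comb hB hB' ho y (1, 0) w
    have h4 := g_comb hB hB' ho y (0, 1) w
    simp only [one_smul, zero_smul, add_zero, zero_add, ← he] at h3 h4
    rw [g_smul_right, h3] at h1
    rw [g_smul_right, h4] at h2
    simp only [ip, one_mul, zero_mul, add_zero, zero_add] at h1 h2 hw
    have w1 : |w.1| ≤ 1 := abs_le_of_sq_le_sq (by nlinarith [sq_nonneg w.2]) zero_le_one
    have w2 : |w.2| ≤ 1 := abs_le_of_sq_le_sq (by nlinarith [sq_nonneg w.1]) zero_le_one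
    have k1 : |w.1 * (B (y + s • e) - B y - s * w.1)| ≤ 1 * (M.T * ‖s • e‖ ^ 2) := by
      rw [abs_mul]; exact mul_le_mul w1 (abs_le.2 h1) (abs_nonneg _) zero_le_one
    have k2 : |w.2 * (B' (y + s • e) - B' y - s * w.2)| ≤ 1 * (M.T * ‖s • e‖ ^ 2) := by
      rw [abs_mul]; exact mul_le_mul w2 (abs_le.2 h2) (abs_nonneg _) zero_le_one
    have k3 := (abs_le.1 k1).1
    have k4 := (abs_le.1 k2).1
    have k5 := mul_le_mul_of_nonneg_left hsq hT.le
    have k6 : 0 ≤ M.K ^ 7 * s ^ 2 := by positivity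
    have k7 : s * (w.1 * w.1 + w.2 * w.2) = s := by rw [hw, mul_one]
    nlinarith

lemma exists_gain {w : Pl} (hw : ip w w = 1) (x : Pl) {R : ℝ} (hR : 0 ≤ R) :
    ∃ y, M.dist x y ≤ R ∧ R ≤ w.1 * (B y - B x) + w.2 * (B' y - B' x) := by
  obtain ⟨C, hC, hstep⟩ := exists_gain_step hB hB' ho
  have hiter : ∀ s, 0 ≤ s → s * M.K ≤ 1 → ∀ m : ℕ, ∃ z, M.dist x z ≤ m * (s + C * s ^ 2) ∧
      m * (s - C * s ^ 2) ≤ w.1 * (B z - B x) + w.2 * (B' z - B' x) := by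
    intro s hs hsK m
    induction m with
    | zero => exact ⟨x, by simp [M.dist_self], by simp⟩
    | succ m ih =>
      obtain ⟨z, h1, h2⟩ := ih
      obtain ⟨z', h3, h4⟩ := hstep w hw z s hs hsK
      refine ⟨z', ?_, ?_⟩
      · push_cast; linarith [M.dist_triangle x z z']
      · push_cast; linarith
  have hsmall : ∀ᶠ n : ℕ in (Ult : Filter ℕ), R / (n + 1) * M.K ≤ 1 := by
    refine ult_le ?_
    filter_upwards [eventually_ge_atTop ⌈R * M.K⌉₊] with n hn
    have : R * M.K ≤ n := (Nat.le_ceil _).trans (by exact_mod_cast hn)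
    rw [div_mul_eq_mul_div, div_le_one (by positivity)]
    linarith
  have hex : ∀ n : ℕ, ∃ z, R / (n + 1) * M.K ≤ 1 → M.dist x z ≤ R + C * R ^ 2 * (1 / (n + 1)) ∧
      R - C * R ^ 2 * (1 / (n + 1)) ≤ w.1 * (B z - B x) + w.2 * (B' z - B' x) := fun n => by
    by_cases hn : R / (n + 1) * M.K ≤ 1
    · have hp : (0 : ℝ) < n + 1 := by positivity
      obtain ⟨z, h1, h2⟩ := hiter (R / (n + 1)) (by positivity) hn (n + 1)
      push_cast at h1 h2
      refine ⟨z, fun _ => ⟨h1.trans_eq ?_, Eq.trans_le ?_ h2⟩⟩ <;> field_simp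
    · exact ⟨x, fun h => absurd h hn⟩
  choose z hz using hex
  have hb : ∀ᶠ n in (Ult : Filter ℕ), ‖z n - x‖ ≤ M.K * (R + C * R ^ 2) := by
    filter_upwards [hsmall] with n hn
    rw [norm_sub_rev]
    refine (M.norm_sub_le_dist _ _).trans (mul_le_mul_of_nonneg_left ((hz n hn).1.trans ?_) M.K_pos.le)
    have h1 : 1 / ((n : ℝ) + 1) ≤ 1 := (div_le_one (by positivity)).2 (by linarith [n.cast_nonneg (α := ℝ)])
    nlinarith [mul_nonneg hC (sq_nonneg R)]
  obtain ⟨u, hu⟩ := exists_ulim hb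
  have hy : Tendsto z Ult (𝓝 (u + x)) := (hu.add_const x).congr fun n => by simp
  have h0 : Tendsto (fun n : ℕ => C * R ^ 2 * (1 / ((n : ℝ) + 1))) Ult (𝓝 0) := by
    simpa using (tendsto_one_div_add_atTop_nhds_zero_nat (𝕜 := ℝ)).mono_left ult_le |>.const_mul (C * R ^ 2)
  have h1 : Tendsto (fun n : ℕ => R + C * R ^ 2 * (1 / ((n : ℝ) + 1))) Ult (𝓝 R) := by
    simpa using h0.const_add R
  have h2 : Tendsto (fun n : ℕ => R - C * R ^ 2 * (1 / ((n : ℝ) + 1))) Ult (𝓝 R) := by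
    simpa using h0.const_sub R
  refine ⟨u + x, le_of_tendsto_of_tendsto (M.tendsto_dist tendsto_const_nhds hy) h1 ?_,
    le_of_tendsto_of_tendsto h2 (((((hB.continuous.tendsto _).comp hy).sub_const (B x)).const_mul w.1).add
        ((((hB'.continuous.tendsto _).comp hy).sub_const (B' x)).const_mul w.2)) ?_⟩
  · filter_upwards [hsmall] with n hn using (hz n hn).1
  · filter_upwards [hsmall] with n hn using (hz n hn).2

lemma norm2_sub_le_dist (x y : Pl) : norm2 (B y - B x, B' y - B' x) ≤ M.dist x y := by
  set n := norm2 (B y - B x, B' y - B' x) with hn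
  have hsq : n ^ 2 = (B y - B x) ^ 2 + (B' y - B' x) ^ 2 := Real.sq_sqrt (by positivity)
  have hn0 : 0 ≤ n := Real.sqrt_nonneg _
  rcases hn0.eq_or_lt with h0 | h0
  · rw [← h0]; exact M.dist_nonneg _ _
  have := comb_sub_le_dist hB hB' ho (w := ((B y - B x) / n, (B' y - B' x) / n))
    (by simp only [ip]; field_simp; linarith) x y
  refine le_trans (le_of_eq ?_) this
  simp only
  field_simp
  linarith

lemma exists_preimage (x w : Pl) : ∃ y, (B y, B' y) = w ∧ M.dist x y ≤ norm2 (w - (B x, B' x)) := by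
  set p := w - (B x, B' x) with hp
  set n := norm2 p with hn
  have hsq : n ^ 2 = p.1 ^ 2 + p.2 ^ 2 := Real.sq_sqrt (by positivity)
  have hn0 : 0 ≤ n := Real.sqrt_nonneg _
  rcases hn0.eq_or_lt with h0 | h0
  · refine ⟨x, ?_, by rw [M.dist_self]; exact h0.le⟩
    rw [← h0] at hsq
    have h1 : p.1 = 0 := by nlinarith [sq_nonneg p.1, sq_nonneg p.2]
    have h2 : p.2 = 0 := by nlinarith [sq_nonneg p.1, sq_nonneg p.2]
    exact (sub_eq_zero.1 (Prod.ext h1 h2 : p = 0)).symm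
  obtain ⟨y, h1, h2⟩ := exists_gain hB hB' ho (w := (p.1 / n, p.2 / n))
    (by simp only [ip]; field_simp; linarith) x h0.le
  have h3 := (norm2_sub_le_dist hB hB' ho x y).trans h1
  have h4 : (B y - B x) ^ 2 + (B' y - B' x) ^ 2 ≤ n ^ 2 := by
    rw [norm2] at h3
    exact (Real.sqrt_le_left h0.le).1 h3
  have h5 : n ^ 2 ≤ p.1 * (B y - B x) + p.2 * (B' y - B' x) := by
    have := mul_le_mul_of_nonneg_left h2 h0.le
    refine (le_of_eq (sq n)).trans (this.trans_eq ?_)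
    simp only
    field_simp
  have h6 : (B y - B x - p.1) ^ 2 + (B' y - B' x - p.2) ^ 2 ≤ 0 := by nlinarith
  have h7 : B y - B x - p.1 = 0 := by nlinarith [sq_nonneg (B y - B x - p.1), sq_nonneg (B' y - B' x - p.2)]
  have h8 : B' y - B' x - p.2 = 0 := by nlinarith [sq_nonneg (B y - B x - p.1), sq_nonneg (B' y - B' x - p.2)]
  refine ⟨y, Prod.ext ?_ ?_, h1⟩
  · have : p.1 = w.1 - B x := rfl
    simp only
    linarith
  · have : p.2 = w.2 - B' x := rfl
    simp only
    linarith

lemma exists_locally_injective :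
    ∃ r > 0, ∀ x y, M.dist x y ≤ r → B x = B y → B' x = B' y → x = y := by
  have hK := M.K_pos
  have hT := M.T_pos
  refine ⟨1 / (M.K * (1 + 2 * M.K * M.T)), by positivity, fun x y hxy h1 h2 => ?_⟩
  by_contra hne
  set u := y - x with hu
  have hux : x + u = y := by rw [hu]; abel
  have hu0 : 0 < ‖u‖ := norm_pos_iff.2 (sub_ne_zero.2 (Ne.symm hne))
  have hu1 : ‖u‖ ≤ 1 / (1 + 2 * M.K * M.T) := by
    have h3 := M.norm_sub_le_dist x y
    rw [norm_sub_rev] at h3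
    refine h3.trans ((mul_le_mul_of_nonneg_left hxy hK.le).trans_eq ?_)
    field_simp
  rw [le_div_iff₀ (by positivity)] at hu1
  have hu2 : ‖u‖ ≤ 1 := by nlinarith [mul_pos (mul_pos hK hT) hu0]
  have h3 := hB.taylor x u hu2
  have h4 := hB'.taylor x u hu2
  rw [hux, h1, sub_self, zero_sub, abs_neg] at h3
  rw [hux, h2, sub_self, zero_sub, abs_neg] at h4
  have h5 := pow_le_pow_left₀ (abs_nonneg _) h3 2
  have h6 := pow_le_pow_left₀ (abs_nonneg _) h4 2
  rw [sq_abs] at h5 h6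
  have h7 := pow_le_pow_left₀ (norm_nonneg u) (M.norm_le_nrm x u) 2
  rw [mul_pow, M.nrm_sq, g_self_eq hB hB' ho] at h7
  have h8 : ‖u‖ ^ 2 ≤ (2 * M.K * M.T * ‖u‖) ^ 2 / 2 * ‖u‖ ^ 2 := by
    have := mul_le_mul_of_nonneg_left (add_le_add h5 h6) (sq_nonneg M.K)
    refine h7.trans (this.trans_eq ?_)
    ring
  have h9 : 2 * M.K * M.T * ‖u‖ ≤ 1 := by nlinarith
  have h10 : (2 * M.K * M.T * ‖u‖) ^ 2 ≤ 1 := pow_le_one₀ (by positivity) h9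
  nlinarith [pow_pos hu0 2]

lemma dist_eq_norm2 (x y : Pl) : M.dist x y = norm2 ((B x, B' x) - (B y, B' y)) := by
  obtain ⟨r, hr, hinj⟩ := exists_locally_injective hB hB' ho
  have hloc : ∀ x y, M.dist x y ≤ r / 2 → norm2 ((B y, B' y) - (B x, B' x)) = M.dist x y := fun x y hxy => by
    refine le_antisymm (norm2_sub_le_dist hB hB' ho x y) ?_
    obtain ⟨z, h1, h2⟩ := exists_preimage hB hB' ho x (B y, B' y)
    have h3 := h2.trans (norm2_sub_le_dist hB hB' ho x y)
    have h4 : z = y := hinj z y (by linarith [M.dist_triangle z x y, M.dist_comm x z])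
      (congrArg Prod.fst h1) (congrArg Prod.snd h1)
    rwa [h4] at h2
  obtain ⟨σ, h0, h1, -, hσ⟩ := M.exists_seg y x
  have := norm_sub_eq_of_local (γ := fun t => toC (B (σ t), B' (σ t))) (M.dist_nonneg y x) (half_pos hr)
    fun s hs t ht hst hr => by
      have h2 : M.dist (σ s) (σ t) = t - s := by rw [hσ s hs t ht, abs_sub_comm, abs_of_nonneg (sub_nonneg.2 hst)]
      rw [← toC_sub, norm_toC, hloc _ _ (h2.trans_le hr), h2]
  rw [← toC_sub, norm_toC, h0, h1, sub_zero] at this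
  rw [this, M.dist_comm]

end

theorem isFlat_of_dist_lat (hM : ∀ k x, M.dist x (x + lat k) = M.nm k) : IsFlat M := by
  obtain ⟨B, v, h, B', v', h', hB, hB', ho⟩ := exists_orthogonal_isBus hM
  have hd := dist_eq_norm2 hB hB' ho
  refine ⟨Equiv.ofBijective (fun x => (B x, B' x)) ⟨fun x y hxy => M.eq_of_dist_le ?_, fun w => ?_⟩, hd⟩
  · rw [hd, sub_eq_zero.2 hxy]
    simp [norm2]
  · obtain ⟨y, hy, -⟩ := exists_preimage hB hB' ho 0 w
    exact ⟨y, hy⟩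

lemma IsGeodesic.isometry {F : Pl → Pl} (hF : ∀ x y, M.dist x y = norm2 (F x - F y)) {c : ℝ → Pl}
    (hc : M.IsGeodesic c) : Isometry fun t => toC (F (c t)) := by
  obtain ⟨-, hu, hmin⟩ := hc
  choose ε hε hmin using hmin
  have key : ∀ a b, a ≤ b → ‖toC (F (c b)) - toC (F (c a))‖ = b - a := fun a b hab => by
    obtain ⟨δ, hδ, hδb⟩ := lebesgue_number_lemma_of_metric (c := fun t => Metric.ball t (ε t))
      (isCompact_Icc (a := a) (b := b)) (fun t => Metric.isOpen_ball)
      fun t _ => mem_iUnion.2 ⟨t, Metric.mem_ball_self (hε t)⟩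
    refine norm_sub_eq_of_local (γ := fun t => toC (F (c t))) hab (half_pos hδ) fun s hs t _ hst hts => ?_
    obtain ⟨i, hi⟩ := hδb s hs
    have h1 := hi (Metric.mem_ball_self hδ)
    have h2 := hi (show t ∈ Metric.ball s δ by
      rw [Metric.mem_ball, Real.dist_eq, abs_of_nonneg (sub_nonneg.2 hst)]; linarith)
    rw [Metric.mem_ball, Real.dist_eq, abs_lt] at h1 h2
    rw [← toC_sub, norm_toC, ← hF, M.dist_comm, hmin i s t (by linarith) hst (by linarith), length]
    simp [hu]
  refine Isometry.of_dist_eq fun s t => ?_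
  rw [Real.dist_eq, _root_.dist_eq_norm]
  rcases le_total s t with h | h
  · rw [norm_sub_rev, key s t h, abs_sub_comm, abs_of_nonneg (sub_nonneg.2 h)]
  · rw [key t s h, abs_of_nonneg (sub_nonneg.2 h)]

theorem transInter_eq_empty_of_isFlat (hM : IsFlat M) {c : ℝ → Pl} (hc : IsAxis M c) (k : ℤ × ℤ) :
    transInter c (transl k c) univ univ = ∅ := by
  obtain ⟨F, hF⟩ := hM
  obtain ⟨j, hgeo, hj, ℓ, hℓ⟩ := hc
  have i1 := hgeo.isometry hF
  have i2 : Isometry fun t => toC (F (transl k c t)) := Isometry.of_dist_eq fun s t => by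
    rw [← i1.dist_eq, _root_.dist_eq_norm, _root_.dist_eq_norm, ← toC_sub, ← toC_sub, norm_toC, norm_toC,
      ← hF, ← hF]
    exact M.dist_translate k _ _
  obtain ⟨e, he⟩ := exists_forall_add_of_isometry i1
  obtain ⟨e', he'⟩ := exists_forall_add_of_isometry i2
  rw [eq_empty_iff_forall_notMem]
  rintro x ⟨s, -, t, -, h1, h2, h3⟩
  have hst : c s = transl k c t := h1.trans h2.symm
  have hℓ0 : ℓ ≠ 0 := by
    rintro rfl
    have := hℓ 0
    rw [add_zero, left_eq_add, ← lat_zero] at this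
    exact hj (lat_inj this)
  have hee : e = e' := by
    have h4 := he s ℓ
    have h5 := he' t ℓ
    have h6 : c (s + ℓ) = transl k c (t + ℓ) := by
      rw [hℓ, hst]
      simp only [transl, hℓ]
      exact add_right_comm _ _ _
    simp only [h6, hst] at h4
    rw [h5] at h4
    exact (mul_left_cancel₀ (Complex.ofReal_ne_zero.2 hℓ0) (add_left_cancel h4)).symm
  have heq : (fun r => c (s + r)) = fun r => transl k c (t + r) := by
    funext r
    refine F.injective (toC_injective ?_)
    have h4 := he s r
    have h5 := he' t r
    rw [h4, h5, hst, hee]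
  have hder := congrArg (fun f => deriv f 0) heq
  simp only [deriv_comp_const_add, add_zero] at hder
  rw [hder, crossDet] at h3
  exact h3 (by ring)

end TorusMetric

/-- **Theorem IV.** A Riemannian metric `g` on `T²` is flat if and only if no axis
`c : ℝ → ℝ²` on the universal covering intersects any of its translates `τ c`
(`τ` a nontrivial translation element) transversally. -/
theorem stmt3 (M : TorusMetric) :
    IsFlat M ↔ ∀ c, IsAxis M c → ∀ k : ℤ × ℤ, k ≠ 0 →
      transInter c (transl k c) Set.univ Set.univ = ∅ := by
  refine ⟨fun hM c hc k _ => TorusMetric.transInter_eq_empty_of_isFlat hM hc k, fun H =>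
    TorusMetric.isFlat_of_dist_lat fun k x => ?_⟩
  rcases eq_or_ne k 0 with rfl | hk
  · rw [TorusMetric.nm, lat_zero, add_zero, M.dist_self, M.dist_self]
  · obtain ⟨L, hL⟩ := TorusMetric.dist_lat_const H hk
    rw [hL, TorusMetric.nm, ← hL 0, zero_add]
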